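/- Let h : (M, q) → (M', q') be a C¹-smooth CR diffeomorphism between real analytic hypersurfaces in ℂⁿ, with M minimal in the sense of Tumanov at q, and suppose the morphism of k-jets of Segre varieties of M' is of locally constant maximal rank near (q', q̄'). Choose coordinates (w', v', z') ∈ ℂ^{n−1−κ'} × ℂ^{κ'} × ℂ vanishing at q' in which M' is given by z̄' = Θ'(w̄', w', z') with Θ' independent of (v', v̄'), and split h = (g, l, f) accordingly, setting h̲ := (g, f). Then the components of h̲ = (g, f) extend holomorphically at q. -/

import Mathlib

/-!
Common definitions: CR geometry of real analytic hypersurfaces in `ℂⁿ`,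
following J. Merker, "On envelopes of holomorphy of domains with Levi-flat
hats and the reflection principle".

We model `ℂⁿ` with `n = m + 1` as `CS m := (Fin m → ℂ) × ℂ`, with coordinates
`t = (w, z)`; the sup-norm balls of this product are polydiscs.
-/

noncomputable section

open Complex Topology Filter Metric Set

abbrev CS (m : ℕ) : Type := (Fin m → ℂ) × ℂ

section Basic

variable {E F : Type*} [NormedAddCommGroup E] [NormedSpace ℂ E]
  [NormedAddCommGroup F] [NormedSpace ℂ F]

/-- `v` is a real tangent vector to the set `M` at `q`: every real-differentiable
function vanishing on `M` near `q` has differential annihilating `v`. -/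
def TangentAt (M : Set E) (q v : E) : Prop :=
  ∀ ρ : E → ℝ, DifferentiableAt ℝ ρ q → (∀ᶠ z in 𝓝 q, z ∈ M → ρ z = 0) →
    fderiv ℝ ρ q v = 0

/-- `v` is a complex tangent vector to `M` at `q` (i.e. `v ∈ T^c_q M`). -/
def ComplexTangentAt (M : Set E) (q v : E) : Prop :=
  TangentAt M q v ∧ TangentAt M q (Complex.I • v)

/-- `M` is a real analytic real hypersurface: near each of its points it is the
zero set of a real analytic real-valued function with nonvanishing differential. -/
def IsRealAnalyticHypersurface (M : Set E) : Prop :=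
  M.Nonempty ∧ ∀ p ∈ M, ∃ (U : Set E) (ρ : E → ℝ), IsOpen U ∧ p ∈ U ∧
    AnalyticOnNhd ℝ ρ U ∧ fderiv ℝ ρ p ≠ 0 ∧ M ∩ U = {z ∈ U | ρ z = 0}

/-- A set `N ⊆ E` is generic in `E`: `T_q N + i T_q N = E` at each `q ∈ N`. -/
def IsGenericSet (N : Set E) : Prop :=
  ∀ q ∈ N, ∀ v : E, ∃ a b : E, TangentAt N q a ∧ TangentAt N q b ∧
    v = a + Complex.I • b

/-- The antiholomorphic part `∂̄f(q)(v)` of the real differential of `f` at `q`. -/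
def antiCDeriv (f : E → ℂ) (q v : E) : ℂ :=
  (fderiv ℝ f q v + Complex.I * fderiv ℝ f q (Complex.I • v)) / 2

/-- `f` is a CR function of class `C^k` on the hypersurface `M`: locally it has
`C^k` extensions whose antiholomorphic differential annihilates the complex
tangent spaces of `M`. -/
def IsCRFunctionOn (k : ℕ∞) (M : Set E) (f : E → ℂ) : Prop :=
  ∀ p ∈ M, ∃ (U : Set E) (g : E → ℂ), IsOpen U ∧ p ∈ U ∧
    ContDiffOn ℝ k g U ∧ (∀ z ∈ M ∩ U, g z = f z) ∧
    ∀ q ∈ M ∩ U, ∀ v : E, ComplexTangentAt M q v → antiCDeriv g q v = 0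

/-- `h` is a CR mapping of class `C^k` from `M` to `M'`. -/
def IsCRMapOn (k : ℕ∞) (M : Set E) (M' : Set F) (h : E → F) : Prop :=
  Set.MapsTo h M M' ∧ ∀ ℓ : F →L[ℂ] ℂ, IsCRFunctionOn k M fun z => ℓ (h z)

/-- `h` is a CR diffeomorphism of class `C^k` from `M` onto `M'`. -/
def IsCRDiffeoOn (k : ℕ∞) (M : Set E) (M' : Set F) (h : E → F) : Prop :=
  IsCRMapOn k M M' h ∧ Set.BijOn h M M' ∧
    ∃ g : F → E, IsCRMapOn k M' M g ∧ ∀ z ∈ M, g (h z) = z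

/-- `f` is a CR function of class `C^{1,α}` on `M`. -/
def IsCRFunctionC1HolderOn (α : NNReal) (M : Set E) (f : E → ℂ) : Prop :=
  ∀ p ∈ M, ∃ (U : Set E) (g : E → ℂ), IsOpen U ∧ p ∈ U ∧
    ContDiffOn ℝ 1 g U ∧
    (∃ C : NNReal, HolderOnWith C α (fderivWithin ℝ g U) U) ∧
    (∀ z ∈ M ∩ U, g z = f z) ∧
    ∀ q ∈ M ∩ U, ∀ v : E, ComplexTangentAt M q v → antiCDeriv g q v = 0

/-- `h` is a CR mapping of class `C^{1,α}` from `M` to `M'`. -/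
def IsCRMapC1HolderOn (α : NNReal) (M : Set E) (M' : Set F) (h : E → F) : Prop :=
  Set.MapsTo h M M' ∧ ∀ ℓ : F →L[ℂ] ℂ, IsCRFunctionC1HolderOn α M fun z => ℓ (h z)

/-- `h` is a CR diffeomorphism of class `C^{1,α}` from `M` onto `M'`. -/
def IsCRDiffeoC1HolderOn (α : NNReal) (M : Set E) (M' : Set F) (h : E → F) : Prop :=
  IsCRMapC1HolderOn α M M' h ∧ Set.BijOn h M M' ∧
    ∃ g : F → E, IsCRMapC1HolderOn α M' M g ∧ ∀ z ∈ M, g (h z) = z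

/-- There is a germ of a (possibly singular) complex hypersurface through `q`
contained in `M`. -/
def HasComplexHypersurfaceGermIn (M : Set E) (q : E) : Prop :=
  ∃ (U : Set E) (f : E → ℂ), IsOpen U ∧ q ∈ U ∧ DifferentiableOn ℂ f U ∧
    f q = 0 ∧ ¬ (∀ᶠ z in 𝓝 q, f z = 0) ∧ {z ∈ U | f z = 0} ⊆ M

/-- `M` is minimal in the sense of Tumanov at `q`: no germ of a complex
hypersurface through `q` is contained in `M`. -/
def MinimalAt (M : Set E) (q : E) : Prop := ¬ HasComplexHypersurfaceGermIn M q

/-- `M` is holomorphically nondegenerate: there is no holomorphic vector field,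
defined and not identically zero near some point of `M`, tangent to `M`. -/
def HolomorphicallyNondegenerate (M : Set E) : Prop :=
  ¬ ∃ (U : Set E) (X : E → E) (q : E), IsOpen U ∧ q ∈ M ∩ U ∧
      DifferentiableOn ℂ X U ∧ ¬ (∀ᶠ z in 𝓝 q, X z = 0) ∧
      ∀ z ∈ M ∩ U, ComplexTangentAt M z (X z)

/-- There exist `d` holomorphic vector fields tangent to `M`, defined near some
point of `M` and linearly independent at that (generic) point. -/
def HolDegDegreeGE (M : Set E) (d : ℕ) : Prop :=
  ∃ (U : Set E) (X : Fin d → E → E) (q : E), IsOpen U ∧ q ∈ M ∩ U ∧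
    (∀ i, DifferentiableOn ℂ (X i) U) ∧
    (∀ i, ∀ z ∈ M ∩ U, ComplexTangentAt M z (X i z)) ∧
    LinearIndependent ℂ fun i => X i q

/-- The holomorphic degeneracy degree of `M` equals `κ`. -/
def HolDegDegree (M : Set E) (κ : ℕ) : Prop :=
  HolDegDegreeGE M κ ∧ ¬ HolDegDegreeGE M (κ + 1)

/-- Near `b`, the set `A` is a complex submanifold of complex codimension `c`. -/
def IsComplexSubmanifoldAt (A : Set E) (b : E) (c : ℕ) : Prop :=
  ∃ (W : Set E) (f : E → Fin c → ℂ), IsOpen W ∧ b ∈ W ∧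
    DifferentiableOn ℂ f W ∧ A ∩ W = {z ∈ W | f z = 0} ∧
    Function.Surjective ⇑(fderiv ℂ f b)

/-- `A` is a closed complex analytic subset of the open set `Ω`. -/
def IsAnalyticSubsetOf (Ω A : Set E) : Prop :=
  A ⊆ Ω ∧ closure A ∩ Ω ⊆ A ∧
    ∀ a ∈ Ω, ∃ (W : Set E) (N : ℕ) (f : E → Fin N → ℂ), IsOpen W ∧ a ∈ W ∧
      W ⊆ Ω ∧ DifferentiableOn ℂ f W ∧ A ∩ W = {z ∈ W | f z = 0}

/-- `A` is a complex analytic subset of `Ω` of pure complex codimension `c`: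
its regular points are dense in it, and they all have codimension `c`. -/
def IsPureCodimAnalyticSubsetOf (Ω A : Set E) (c : ℕ) : Prop :=
  IsAnalyticSubsetOf Ω A ∧
  (∀ a ∈ A, ∀ V ∈ 𝓝 a, ∃ b ∈ A ∩ V, IsComplexSubmanifoldAt A b c) ∧
  (∀ b ∈ A, ∀ c' : ℕ, IsComplexSubmanifoldAt A b c' → c' = c)

/-- `S` is a `C^∞`-smooth real hypersurface of the open set `Ω`. -/
def IsSmoothHypersurfaceIn (Ω S : Set E) : Prop :=
  S ⊆ Ω ∧ ∀ q ∈ S, ∃ (U : Set E) (ρ : E → ℝ), IsOpen U ∧ q ∈ U ∧ U ⊆ Ω ∧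
    ContDiffOn ℝ (⊤ : ℕ∞) ρ U ∧ (∀ z ∈ U, fderiv ℝ ρ z ≠ 0) ∧
    S ∩ U = {z ∈ U | ρ z = 0}

/-- A smooth real hypersurface is Levi-flat iff it is foliated by complex
hypersurfaces, i.e. through each of its points there passes a germ of a
complex hypersurface contained in it. -/
def IsLeviFlat (S : Set E) : Prop :=
  ∀ q ∈ S, HasComplexHypersurfaceGermIn S q

/-- `f` is of class `C^{1,β}` on `s`. -/
def IsC1HolderOn {X Y : Type*} [NormedAddCommGroup X] [NormedSpace ℝ X]
    [NormedAddCommGroup Y] [NormedSpace ℝ Y] (β : NNReal) (f : X → Y)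
    (s : Set X) : Prop :=
  ContDiffOn ℝ 1 f s ∧ ∃ C : NNReal, HolderOnWith C β (fderivWithin ℝ f s) s

/-- A continuous CR function on a smooth hypersurface `S`: continuous on `S`
and locally a uniform limit on `S` of holomorphic functions
(Baouendi–Trèves characterization). -/
def ContinuousCRFunctionOn (S : Set E) (ψ : E → ℂ) : Prop :=
  ContinuousOn ψ S ∧ ∀ p ∈ S, ∃ U : Set E, IsOpen U ∧ p ∈ U ∧
    ∃ Fs : ℕ → E → ℂ, (∀ k, DifferentiableOn ℂ (Fs k) U) ∧
      TendstoUniformlyOn (fun k => Fs k) ψ atTop (S ∩ U)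

end Basic

section Series

variable {m : ℕ}

/-- Total degree of a multiindex `β ∈ ℕ^m`. -/
def mdeg (β : Fin m → ℕ) : ℕ := ∑ i, β i

/-- Monomial `w^β`. -/
def mpow (w : Fin m → ℂ) (β : Fin m → ℕ) : ℂ := ∏ i, w i ^ β i

/-- Componentwise conjugation of `w ∈ ℂ^m`. -/
def conjW (w : Fin m → ℂ) : Fin m → ℂ := fun i => starRingEnd ℂ (w i)

/-- Componentwise conjugation on `ℂ^{m+1}`. -/
def conjCS (t : CS m) : CS m := (conjW t.1, starRingEnd ℂ t.2)

/-- The series `Θ(ζ, t) = Σ_β ζ^β Θ_β(t)`. -/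
def ThetaSum (Θ : (Fin m → ℕ) → CS m → ℂ) (ζ : Fin m → ℂ) (t : CS m) : ℂ :=
  ∑' β : Fin m → ℕ, mpow ζ β * Θ β t

/-- The conjugate series `Θ̄(w, τ) = Σ_β w^β conj(Θ_β(τ̄))`. -/
def ThetaBar (Θ : (Fin m → ℕ) → CS m → ℂ) (w : Fin m → ℂ) (τ : CS m) : ℂ :=
  ∑' β : Fin m → ℕ, mpow w β * starRingEnd ℂ (Θ β (conjCS τ))

/-- Defining data for a hypersurface through `0`: a family of coefficient
functions `Θ_β`, a radius `r` and a constant `C`. -/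
structure DefData (m : ℕ) where
  Θ : (Fin m → ℕ) → CS m → ℂ
  r : ℝ
  C : ℝ

/-- `d` is a normally convergent complex defining series for `M` near the
origin, i.e. in suitable holomorphic coordinates vanishing at the reference
point, `M = {(w, z) : z̄ = Θ(w̄, (w, z)) = Σ_β w̄^β Θ_β(w, z)}`, where the
coefficients are holomorphic on the polydisc of radius `2r` and satisfy the
normal-convergence Cauchy estimates `|Θ_β| ≤ C / (2r)^{|β|}` there, and the
series vanishes at the origin. -/
def DefData.IsDefiningSeriesOf (d : DefData m) (M : Set (CS m)) : Prop :=
  0 < d.r ∧ 0 < d.C ∧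
  (∀ β, DifferentiableOn ℂ (d.Θ β) (ball (0 : CS m) (2 * d.r))) ∧
  (∀ β, ∀ t ∈ ball (0 : CS m) (2 * d.r), ‖d.Θ β t‖ ≤ d.C / (2 * d.r) ^ mdeg β) ∧
  d.Θ 0 0 = 0 ∧
  ∀ t ∈ ball (0 : CS m) d.r,
    (t ∈ M ↔ starRingEnd ℂ t.2 = ThetaSum d.Θ (conjW t.1) t)

/-- The Segre variety `S_{q̄}` of a point `q`, inside the polydisc of radius
`r`: `S_{q̄} = {(w, z) : z = Σ_β w^β conj(Θ_β(q))}`. -/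
def segreVariety (Θ : (Fin m → ℕ) → CS m → ℂ) (r : ℝ) (q : CS m) : Set (CS m) :=
  {t ∈ ball (0 : CS m) r |
    t.2 = ∑' β : Fin m → ℕ, mpow t.1 β * starRingEnd ℂ (Θ β q)}

/-- The reflection function `R'_h(t, ν̄') = μ̄' - Σ_β λ̄'^β Θ'_β(h(t))` extends
holomorphically to a neighborhood of `(p, p̄')` in `ℂⁿ × ℂⁿ`. -/
def ReflectionExtendsAt (Θ : (Fin m → ℕ) → CS m → ℂ) (h : CS m → CS m)
    (M : Set (CS m)) (p p' : CS m) : Prop :=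
  ∃ r > (0 : ℝ), ∃ R : CS m × CS m → ℂ,
    DifferentiableOn ℂ R (ball p r ×ˢ ball (conjCS p') r) ∧
    ∀ t ∈ M ∩ ball p r, ∀ ν ∈ ball (conjCS p') r,
      R (t, ν) = ν.2 - ∑' β : Fin m → ℕ, mpow ν.1 β * Θ β (h t)

/-- All the components `Θ_β ∘ h` of the reflection function extend
holomorphically to a common neighborhood of `q`, with uniform Cauchy
estimates `|Θ_β(h(t))| < C^{|β|+1}`; i.e. the reflection function is real
analytic at `q`. -/
def ReflectionAnalyticAt (Θ : (Fin m → ℕ) → CS m → ℂ) (h : CS m → CS m)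
    (M : Set (CS m)) (q : CS m) : Prop :=
  ∃ r C : ℝ, 0 < r ∧ 0 < C ∧ ∃ φ : (Fin m → ℕ) → CS m → ℂ,
    (∀ β, DifferentiableOn ℂ (φ β) (ball q r)) ∧
    (∀ β, ∀ t ∈ M ∩ ball q r, φ β t = Θ β (h t)) ∧
    ∀ β, ∀ t ∈ ball q r, ‖φ β t‖ < C ^ (mdeg β + 1)

end Series

section Jets

variable {m : ℕ}

/-- Partial derivative in the direction of the `i`-th `w`-coordinate. -/
def pderivW (i : Fin m) (f : CS m → ℂ) : CS m → ℂ :=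
  fun t => fderiv ℂ f t (Pi.single i 1, 0)

def pderivList : List (Fin m) → (CS m → ℂ) → CS m → ℂ
  | [], f => f
  | i :: L, f => pderivW i (pderivList L f)

def indexList (β : Fin m → ℕ) : List (Fin m) :=
  (List.finRange m).flatMap fun i => List.replicate (β i) i

/-- The iterated partial derivative `∂_w^β f`. -/
def pderivMulti (β : Fin m → ℕ) (f : CS m → ℂ) : CS m → ℂ :=
  pderivList (indexList β) f

/-- The morphism of `k`-jets of Segre varieties
`φ'_k : (t', τ') ↦ (t', (∂^β_{w'}[z' − Θ̄'(w', τ')](t'))_{|β| ≤ k})`, written in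
the holomorphic parametrization `(t, ζ) ↦ (t, (ζ, Θ(ζ, t)))` of the extrinsic
complexification `M^c`. -/
def segreJetMap (Θ : (Fin m → ℕ) → CS m → ℂ) (k : ℕ) :
    CS m × (Fin m → ℂ) → CS m × ((Fin m → Fin (k + 1)) → ℂ) :=
  fun p =>
    (p.1, fun β =>
      if mdeg (fun i => (β i : ℕ)) ≤ k then
        pderivMulti (fun i => (β i : ℕ))
          (fun s => s.2 - ThetaBar Θ s.1 (p.2, ThetaSum Θ p.2 p.1)) p.1
      else 0)

/-- The rank of the differential of a map at a point. -/
def mapRankAt {X Y : Type*} [NormedAddCommGroup X] [NormedSpace ℂ X]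
    [NormedAddCommGroup Y] [NormedSpace ℂ Y] (f : X → Y) (p : X) : ℕ :=
  Module.finrank ℂ (LinearMap.range (fderiv ℂ f p).toLinearMap)

/-- Parameter domain for the complexification. -/
def segreDomain (m : ℕ) (r : ℝ) : Set (CS m × (Fin m → ℂ)) :=
  {p | ‖p.1‖ < r ∧ ‖p.2‖ < r}

/-- The morphism of `k`-jets of Segre varieties has generic rank `ρ`. -/
def SegreGenericRank (Θ : (Fin m → ℕ) → CS m → ℂ) (r : ℝ) (k ρ : ℕ) : Prop :=
  (∀ p ∈ segreDomain m r, mapRankAt (segreJetMap Θ k) p ≤ ρ) ∧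
  ∃ p ∈ segreDomain m r, mapRankAt (segreJetMap Θ k) p = ρ

/-- The `k`-jet morphism has locally constant rank `ρ` in a neighborhood of the
point of the complexification corresponding to `(q, q̄)`. -/
def SegreConstRankNear (Θ : (Fin m → ℕ) → CS m → ℂ) (k ρ : ℕ) (q : CS m) : Prop :=
  ∀ᶠ p in 𝓝 (q, conjW q.1), mapRankAt (segreJetMap Θ k) p = ρ

/-- Normal form of a defining series with respect to the splitting
`t' = (w', v', z') ∈ ℂ^a × ℂ^{m-a} × ℂ`: the series involves no `v̄'` and its
coefficients are independent of `v'`. -/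
def NormalFormSeries (a : ℕ) (Θ : (Fin m → ℕ) → CS m → ℂ) : Prop :=
  (∀ β : Fin m → ℕ, (∃ i : Fin m, a ≤ (i : ℕ) ∧ β i ≠ 0) → Θ β = 0) ∧
  ∀ β, ∀ s t : CS m, (∀ i : Fin m, (i : ℕ) < a → s.1 i = t.1 i) → s.2 = t.2 →
    Θ β s = Θ β t

def extendIdx (m a : ℕ) (β : Fin a → ℕ) : Fin m → ℕ :=
  fun i => if h : (i : ℕ) < a then β ⟨i, h⟩ else 0

def embedCS (m a : ℕ) (t : CS a) : CS m :=
  ((fun i => if h : (i : ℕ) < a then t.1 ⟨i, h⟩ else 0), t.2)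

/-- The defining series of the reduced hypersurface `M̲' ⊆ ℂ^{a+1}` underlying
a series in normal form. -/
def reducedSeries (m a : ℕ) (Θ : (Fin m → ℕ) → CS m → ℂ) :
    (Fin a → ℕ) → CS a → ℂ :=
  fun β t => Θ (extendIdx m a β) (embedCS m a t)

end Jets

section Tools
variable {E F : Type*} [NormedAddCommGroup E] [NormedSpace ℂ E]
  [NormedAddCommGroup F] [NormedSpace ℂ F]

/-- Cauchy estimate in several variables. -/
theorem cauchy_fderiv_bound {f : E → F} {x : E} {R C : ℝ} (hR : 0 < R)
    (hf : DifferentiableOn ℂ f (ball x R)) (hC : ∀ y ∈ ball x R, ‖f y‖ ≤ C) :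
    ‖fderiv ℂ f x‖ ≤ 2 * C / R := by
  have hC0 : 0 ≤ C := (norm_nonneg _).trans (hC x (mem_ball_self hR))
  refine ContinuousLinearMap.opNorm_le_bound _ (by positivity) fun v => ?_
  by_cases hv : v = 0
  · simp [hv]
  have hvn : 0 < ‖v‖ := norm_pos_iff.mpr hv
  set ρ : ℝ := R / (2 * ‖v‖) with hρ
  have hρ0 : 0 < ρ := by positivity
  have hρv : ρ * ‖v‖ = R / 2 := by rw [hρ]; field_simp
  have hmem : ∀ ζ ∈ closedBall (0:ℂ) ρ, x + ζ • v ∈ ball x R := by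
    intro ζ hζ
    rw [mem_closedBall_zero_iff] at hζ
    rw [mem_ball_iff_norm, add_sub_cancel_left, norm_smul]
    calc ‖ζ‖ * ‖v‖ ≤ ρ * ‖v‖ := by gcongr
      _ < R := by rw [hρv]; linarith
  have hdg : DifferentiableOn ℂ (fun ζ : ℂ => f (x + ζ • v)) (closedBall 0 ρ) := by
    refine hf.comp (t := ball x R) ?_ hmem
    fun_prop
  have h1 : HasDerivAt (fun ζ : ℂ => f (x + ζ • v)) (fderiv ℂ f x v) 0 := by
    have hx : HasFDerivAt f (fderiv ℂ f x) (x + (0:ℂ) • v) := by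
      simpa using ((hf x (mem_ball_self hR)).differentiableAt
        (isOpen_ball.mem_nhds (mem_ball_self hR))).hasFDerivAt
    have h2 : HasDerivAt (fun ζ : ℂ => x + ζ • v) v 0 := by
      simpa using ((hasDerivAt_id (0:ℂ)).smul_const v).const_add x
    exact hx.comp_hasDerivAt (0:ℂ) h2
  have h3 := Complex.norm_deriv_le_of_forall_mem_sphere_norm_le (C := C) hρ0
    (hdg.diffContOnCl_ball (Subset.refl _))
    (fun z hz => hC _ (hmem z (sphere_subset_closedBall hz)))
  rw [h1.deriv] at h3
  refine h3.trans (le_of_eq ?_)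
  rw [hρ]; field_simp

/-- Weierstrass: locally uniform limits of holomorphic functions are holomorphic. -/
theorem weierstrass_ball [CompleteSpace F] {f : ℕ → E → F} {g : E → F} {x : E} {R : ℝ} (hR : 0 < R)
    (hf : ∀ n, DifferentiableOn ℂ (f n) (ball x R))
    (hg : TendstoUniformlyOn f g atTop (ball x R)) : DifferentiableAt ℂ g x := by
  have hsub : ∀ y ∈ ball x (R/2), ball y (R/2) ⊆ ball x R := by
    intro y hy
    apply ball_subset_ball'
    rw [mem_ball] at hy; linarith
  have hcau : UniformCauchySeqOn (fun n => fderiv ℂ (f n)) atTop (ball x (R/2)) := by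
    rw [Metric.uniformCauchySeqOn_iff]
    intro ε hε
    have h1 := Metric.uniformCauchySeqOn_iff.mp hg.uniformCauchySeqOn (ε * R / 8) (by positivity)
    obtain ⟨N, hN⟩ := h1
    refine ⟨N, fun a ha b hb y hy => ?_⟩
    have hda : ∀ n, DifferentiableAt ℂ (f n) y := fun n =>
      (hf n).differentiableAt (isOpen_ball.mem_nhds (ball_subset_ball (by linarith) hy))
    rw [dist_eq_norm, ← fderiv_sub (hda a) (hda b)]
    have := cauchy_fderiv_bound (f := f a - f b) (x := y) (R := R/2) (C := ε * R / 8) (by positivity)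
      (((hf a).sub (hf b)).mono (hsub y hy)) (fun z hz => by
        have := hN a ha b hb z (hsub y hy hz)
        rw [dist_eq_norm] at this
        exact this.le)
    refine lt_of_le_of_lt this ?_
    rw [div_lt_iff₀ (by positivity)]
    nlinarith [mul_pos hε hR]
  have hlim : ∀ y ∈ ball x (R/2), ∃ L, Tendsto (fun n => fderiv ℂ (f n) y) atTop (𝓝 L) := by
    intro y hy
    exact cauchySeq_tendsto_of_complete (hcau.cauchySeq hy)
  choose! L hL using hlim
  have hu := hcau.tendstoUniformlyOn_of_tendsto hL
  have hx : x ∈ ball x (R/2) := mem_ball_self (by positivity)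
  refine (hasFDerivAt_of_tendstoUniformlyOn (𝕜 := ℂ) (f := f) isOpen_ball hu (fun n y hy => ?_)
    (fun y hy => ?_) hx).differentiableAt
  · exact ((hf n).differentiableAt (isOpen_ball.mem_nhds
      (ball_subset_ball (by linarith) hy))).hasFDerivAt
  · exact hg.tendsto_at (ball_subset_ball (by linarith) hy)

/-- fderiv of a holomorphic function is locally Lipschitz. -/
theorem fderiv_lipschitz_of_hol {f : E → F} {x : E} {R C : ℝ} (hR : 0 < R)
    (hf : DifferentiableOn ℂ f (ball x R)) (hC : ∀ y ∈ ball x R, ‖f y‖ ≤ C) :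
    ∀ y ∈ ball x (R/4), ∀ z ∈ ball x (R/4),
      ‖fderiv ℂ f z - fderiv ℂ f y‖ ≤ (32 * C / R^2) * ‖z - y‖ := by
  have hC0 : 0 ≤ C := (norm_nonneg _).trans (hC x (mem_ball_self hR))
  have hsub : ∀ y ∈ ball x (R/2), ball y (R/2) ⊆ ball x R := by
    intro y hy
    apply ball_subset_ball'
    rw [mem_ball] at hy; linarith
  have hb : ∀ y ∈ ball x (R/2), ‖fderiv ℂ f y‖ ≤ 4 * C / R := by
    intro y hy
    have := cauchy_fderiv_bound (f := f) (x := y) (R := R/2) (C := C) (by positivity)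
      (hf.mono (hsub y hy)) (fun z hz => hC z (hsub y hy hz))
    refine this.trans (le_of_eq (by field_simp; ring))
  have hlip : ∀ y ∈ ball x (R/2), ∀ z ∈ ball x (R/2), ‖f z - f y‖ ≤ 4 * C / R * ‖z - y‖ := by
    intro y hy z hz
    exact (convex_ball x (R/2)).norm_image_sub_le_of_norm_fderiv_le (𝕜 := ℂ) (fun w hw =>
      hf.differentiableAt (isOpen_ball.mem_nhds (ball_subset_ball (by linarith) hw))) hb hy hz
  intro y hy z hz
  by_cases hyz : z = y
  · simp [hyz]
  set h := z - y with hh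
  -- consider w ↦ f (w + h) - f w near y
  have hnear : ∀ w ∈ ball y (R/4), w ∈ ball x (R/2) ∧ w + h ∈ ball x R := by
    intro w hw
    rw [mem_ball, dist_eq_norm] at *
    constructor
    · calc ‖w - x‖ = ‖(w - y) + (y - x)‖ := by congr 1; abel
        _ ≤ _ := norm_add_le _ _
        _ < R/2 := by linarith
    · rw [mem_ball, dist_eq_norm]
      calc ‖w + h - x‖ = ‖(w - y) + (z - x)‖ := by congr 1; rw [hh]; abel
        _ ≤ _ := norm_add_le _ _
        _ < R := by linarith
  have hnear2 : ∀ w ∈ ball y (R/4), w + h ∈ ball x (R/2) := by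
    intro w hw
    rw [mem_ball, dist_eq_norm] at *
    calc ‖w + h - x‖ = ‖(w - y) + (z - x)‖ := by congr 1; rw [hh]; abel
        _ ≤ _ := norm_add_le _ _
        _ < R/2 := by linarith
  have hd : DifferentiableOn ℂ (fun w => f (w + h)) (ball y (R/4)) := by
    refine hf.comp (by fun_prop) (fun w hw => (hnear w hw).2)
  have hd2 : DifferentiableOn ℂ f (ball y (R/4)) :=
    hf.mono (fun w hw => ball_subset_ball (by linarith) (hnear w hw).1)
  have hkey := cauchy_fderiv_bound (f := fun w => f (w + h) - f w) (x := y) (R := R/4)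
    (C := 4 * C / R * ‖h‖) (by positivity) (hd.sub hd2) (fun w hw => by
      have := hlip w (hnear w hw).1 (w + h) (hnear2 w hw)
      simpa using this)
  have hyy : y ∈ ball y (R/4) := mem_ball_self (by positivity)
  have e1 : fderiv ℂ (fun w => f (w + h) - f w) y = fderiv ℂ f z - fderiv ℂ f y := by
    have h1 := hd.differentiableAt (isOpen_ball.mem_nhds hyy)
    have h2 := hd2.differentiableAt (isOpen_ball.mem_nhds hyy)
    rw [fderiv_fun_sub h1 h2, fderiv_comp_add_right]
    simp [hh]
  rw [e1] at hkey
  refine hkey.trans (le_of_eq ?_)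
  field_simp; ring

theorem hol_locally_bounded {f : E → F} {U : Set E} (hU : IsOpen U)
    (hf : ContinuousOn f U) {x : E} (hx : x ∈ U) :
    ∃ R > 0, ball x R ⊆ U ∧ ∃ C, ∀ y ∈ ball x R, ‖f y‖ ≤ C := by
  have hc : ContinuousAt f x := hf.continuousAt (hU.mem_nhds hx)
  have h1 : ∀ᶠ y in 𝓝 x, ‖f y‖ < ‖f x‖ + 1 := hc.norm.eventually (gt_mem_nhds (lt_add_one _))
  obtain ⟨R, hR, hb⟩ := Metric.eventually_nhds_iff_ball.mp (h1.and (hU.mem_nhds hx))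
  exact ⟨R, hR, fun y hy => (hb y hy).2, _, fun y hy => (hb y hy).1.le⟩

theorem continuousOn_fderiv_of_hol {f : E → F} {U : Set E} (hU : IsOpen U)
    (hf : DifferentiableOn ℂ f U) : ContinuousOn (fderiv ℂ f) U := by
  intro x hx
  obtain ⟨R, hR, hsub, C, hC⟩ := hol_locally_bounded hU hf.continuousOn hx
  have hl := fderiv_lipschitz_of_hol hR (hf.mono hsub) hC
  have hxx : x ∈ ball x (R/4) := mem_ball_self (by positivity)
  have : LipschitzOnWith (Real.toNNReal (32 * C / R^2)) (fderiv ℂ f) (ball x (R/4)) := by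
    refine LipschitzOnWith.of_dist_le_mul fun y hy z hz => ?_
    rw [dist_eq_norm, dist_eq_norm]
    refine (hl z hz y hy).trans ?_
    gcongr
    exact Real.le_coe_toNNReal _
  exact (this.continuousOn.continuousAt (isOpen_ball.mem_nhds hxx)).continuousWithinAt

theorem differentiableOn_fderiv_apply_of_hol [CompleteSpace F] {f : E → F} {U : Set E} (hU : IsOpen U)
    (hf : DifferentiableOn ℂ f U) (v : E) : DifferentiableOn ℂ (fun x => fderiv ℂ f x v) U := by
  intro x hx
  obtain ⟨R, hR, hsub, C, hC⟩ := hol_locally_bounded hU hf.continuousOn hx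
  have hl := fderiv_lipschitz_of_hol hR (hf.mono hsub) hC
  have hC0 : 0 ≤ C := (norm_nonneg _).trans (hC x (mem_ball_self hR))
  obtain ⟨N, hN⟩ := exists_nat_gt (‖v‖ * 8 / R)
  set t : ℕ → ℝ := fun n => 1 / ((n:ℝ) + N + 1) with ht
  have htpos : ∀ n, 0 < t n := fun n => by simp only [ht]; positivity
  have htv : ∀ n, t n * ‖v‖ < R / 8 := by
    intro n
    simp only [ht]
    rw [div_mul_eq_mul_div, one_mul, div_lt_iff₀ (by positivity)]
    have h8 : ‖v‖ * 8 < N * R := by rwa [div_lt_iff₀ hR] at hN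
    nlinarith [Nat.cast_nonneg (α := ℝ) n]
  have htlim : Tendsto t atTop (𝓝 0) := by
    have h1 : Tendsto (fun n : ℕ => ((n:ℝ) + N + 1)) atTop atTop :=
      tendsto_atTop_add_const_right _ _
        (tendsto_atTop_add_const_right _ _ tendsto_natCast_atTop_atTop)
    refine h1.inv_tendsto_atTop.congr fun n => ?_
    simp [ht]
  have hmem : ∀ y ∈ ball x (R/8), ∀ n, y + (t n : ℂ) • v ∈ ball x (R/4) := by
    intro y hy n
    rw [mem_ball, dist_eq_norm] at *
    calc ‖y + (t n:ℂ) • v - x‖ = ‖(y - x) + (t n:ℂ) • v‖ := by congr 1; abel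
      _ ≤ ‖y - x‖ + ‖(t n:ℂ) • v‖ := norm_add_le _ _
      _ < R/4 := by
        rw [norm_smul, Complex.norm_real, Real.norm_of_nonneg (htpos n).le]
        have := htv n; linarith
  refine (weierstrass_ball (f := fun n y => ((t n : ℂ))⁻¹ • (f (y + (t n : ℂ) • v) - f y))
    (R := R/8) (by positivity) (fun n => ?_) ?_).differentiableWithinAt
  · refine DifferentiableOn.const_smul (DifferentiableOn.sub ?_ ?_) _
    · exact hf.comp (t := U) (by fun_prop) (fun y hy => hsub (ball_subset_ball (by linarith)
        (hmem y hy n)))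
    · exact hf.mono (fun y hy => hsub (ball_subset_ball (by linarith) hy))
  · rw [Metric.tendstoUniformlyOn_iff]
    intro ε hε
    have hK : Tendsto (fun n => (32 * C / R^2) * ‖v‖ * ‖v‖ * t n) atTop (𝓝 0) := by
      simpa using htlim.const_mul ((32 * C / R^2) * ‖v‖ * ‖v‖)
    filter_upwards [hK.eventually (gt_mem_nhds hε)] with n hn y hy
    have hyq : y ∈ ball x (R/4) := ball_subset_ball (by linarith) hy
    have key : ‖f (y + (t n : ℂ) • v) - f y - fderiv ℂ f y ((y + (t n : ℂ) • v) - y)‖ ≤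
        ((32 * C / R^2) * (t n * ‖v‖)) * ‖(y + (t n : ℂ) • v) - y‖ := by
      set s := segment ℝ y (y + (t n : ℂ) • v)
      have hs : s ⊆ ball x (R/4) := (convex_ball x (R/4)).segment_subset hyq (hmem y hy n)
      refine (convex_segment y (y + (t n : ℂ) • v)).norm_image_sub_le_of_norm_hasFDerivWithin_le'
        (𝕜 := ℂ) (f' := fderiv ℂ f) (fun w hw => ?_) (fun w hw => ?_) (left_mem_segment ℝ _ _)
        (right_mem_segment ℝ _ _)
      · exact (hf.differentiableAt (hU.mem_nhds (hsub (ball_subset_ball (by linarith)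
          (hs hw))))).hasFDerivAt.hasFDerivWithinAt
      · refine (hl y hyq w (hs hw)).trans ?_
        have : ‖w - y‖ ≤ t n * ‖v‖ := by
          obtain ⟨a, ha, rfl⟩ := by simpa [s, segment_eq_image'] using hw
          rw [add_sub_cancel_left, norm_smul, norm_smul,
            Real.norm_of_nonneg (htpos n).le, Real.norm_of_nonneg ha.1]
          have : 0 ≤ t n * ‖v‖ := mul_nonneg (htpos n).le (norm_nonneg _)
          nlinarith [ha.2]
        gcongr
    rw [add_sub_cancel_left, norm_smul, Complex.norm_real, Real.norm_of_nonneg (htpos n).le] at key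
    have htc : (t n : ℂ) ≠ 0 := by exact_mod_cast (htpos n).ne'
    rw [dist_eq_norm, norm_sub_rev]
    have e : ((t n : ℂ))⁻¹ • (f (y + (t n : ℂ) • v) - f y) - fderiv ℂ f y v =
        ((t n : ℂ))⁻¹ • (f (y + (t n : ℂ) • v) - f y - fderiv ℂ f y ((t n : ℂ) • v)) := by
      rw [map_smul, smul_sub _ _ ((t n : ℂ) • _), smul_smul, inv_mul_cancel₀ htc, one_smul]
    rw [e, norm_smul, norm_inv, Complex.norm_real, Real.norm_of_nonneg (htpos n).le]
    refine lt_of_le_of_lt ?_ hn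
    rw [inv_mul_le_iff₀ (htpos n)]
    refine key.trans (le_of_eq (by ring))

theorem contDiffOn_nat_of_hol [CompleteSpace F] [FiniteDimensional ℂ E] {U : Set E}
    (hU : IsOpen U) (n : ℕ) : ∀ {f : E → F}, DifferentiableOn ℂ f U → ContDiffOn ℂ n f U := by
  induction n with
  | zero => intro f hf; exact contDiffOn_zero.mpr hf.continuousOn
  | succ n ih =>
    intro f hf
    have : ((n + 1 : ℕ) : WithTop ℕ∞) = (n : WithTop ℕ∞) + 1 := by norm_cast
    rw [this, contDiffOn_succ_iff_fderiv_of_isOpen hU]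
    refine ⟨hf, by simp, ?_⟩
    rw [contDiffOn_clm_apply]
    intro y
    exact ih (differentiableOn_fderiv_apply_of_hol hU hf y)

/-- Weierstrass M-test. -/
theorem hol_tsum {ι : Type*} [CompleteSpace F] {f : ι → E → F} {u : ι → ℝ} {U : Set E}
    (hU : IsOpen U) (hu : Summable u) (hf : ∀ i, DifferentiableOn ℂ (f i) U)
    (hfu : ∀ i, ∀ x ∈ U, ‖f i x‖ ≤ u i) : DifferentiableOn ℂ (fun x => ∑' i, f i x) U := by
  intro x hx
  obtain ⟨R, hR, hsub⟩ := Metric.isOpen_iff.mp hU x hx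
  have ht := tendstoUniformlyOn_tsum (s := ball x R) hu (fun i y hy => hfu i y (hsub hy))
  -- pass to a sequence
  obtain ⟨s, hs⟩ : ∃ s : ℕ → Finset ι, TendstoUniformlyOn (fun n y => ∑ i ∈ s n, f i y)
      (fun y => ∑' i, f i y) atTop (ball x R) := by
    rw [Metric.tendstoUniformlyOn_iff] at ht
    have h1 : ∀ n : ℕ, ∃ s : Finset ι, ∀ y ∈ ball x R,
        dist (∑' i, f i y) (∑ i ∈ s, f i y) < 1 / ((n:ℝ)+1) := by
      intro n
      exact (ht (1/((n:ℝ)+1)) (by positivity)).exists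
    choose s hs using h1
    refine ⟨s, ?_⟩
    rw [Metric.tendstoUniformlyOn_iff]
    intro ε hε
    have := (tendsto_one_div_add_atTop_nhds_zero_nat (𝕜 := ℝ)).eventually (gt_mem_nhds hε)
    filter_upwards [this] with n hn y hy
    exact (hs n y hy).trans hn
  refine (weierstrass_ball hR (fun n => ?_) hs).differentiableWithinAt
  exact DifferentiableOn.fun_sum fun i _ => (hf i).mono hsub

end Tools

section ParamInt
variable {X F : Type*} [NormedAddCommGroup F] [NormedSpace ℝ F]

theorem tube_bound [TopologicalSpace X] {G : Type*} [NormedAddCommGroup G] {S : Set X} {a b : ℝ}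
    {g : X → ℝ → G}
    (hg : ContinuousOn (fun p : X × ℝ => g p.1 p.2) (S ×ˢ Icc a b)) {x₀ : X} (hx : x₀ ∈ S) :
    ∃ u ∈ 𝓝[S] x₀, ∃ C, ∀ x ∈ u, ∀ t ∈ Icc a b, ‖g x t‖ ≤ C := by
  refine isCompact_Icc.induction_on (p := fun A => ∃ u ∈ 𝓝[S] x₀, ∃ C, ∀ x ∈ u, ∀ t ∈ A, ‖g x t‖ ≤ C)
    ⟨univ, univ_mem, 0, by simp⟩ ?_ ?_ ?_
  · rintro s t hst ⟨u, hu, C, h⟩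
    exact ⟨u, hu, C, fun x hx y hy => h x hx y (hst hy)⟩
  · rintro s t ⟨u, hu, C, h⟩ ⟨u', hu', C', h'⟩
    refine ⟨u ∩ u', inter_mem hu hu', max C C', fun x hx y hy => ?_⟩
    rcases hy with hy | hy
    · exact (h x hx.1 y hy).trans (le_max_left _ _)
    · exact (h' x hx.2 y hy).trans (le_max_right _ _)
  · intro t ht
    have h1 := (hg (x₀, t) ⟨hx, ht⟩).norm
    have h2 : ∀ᶠ p in 𝓝[S ×ˢ Icc a b] (x₀, t), ‖g p.1 p.2‖ < ‖g x₀ t‖ + 1 :=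
      h1.eventually (gt_mem_nhds (lt_add_one _))
    rw [nhdsWithin_prod_eq] at h2
    obtain ⟨u, hu, v, hv, huv⟩ := Filter.mem_prod_iff.mp h2
    refine ⟨v, hv, u, hu, ‖g x₀ t‖ + 1, fun x hx y hy => ?_⟩
    have : (x, y) ∈ u ×ˢ v := ⟨hx, hy⟩
    exact (huv this).le

theorem continuousOn_slice [TopologicalSpace X] {G : Type*} [TopologicalSpace G] {S : Set X} {a b : ℝ}
    {g : X → ℝ → G}
    (hg : ContinuousOn (fun p : X × ℝ => g p.1 p.2) (S ×ˢ Icc a b)) {x₀ : X} (hx : x₀ ∈ S) :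
    ContinuousOn (g x₀) (Icc a b) := by
  have : ContinuousOn (fun t : ℝ => (x₀, t)) (Icc a b) := by fun_prop
  exact hg.comp this (fun t ht => ⟨hx, ht⟩)

theorem paramInt_continuousOn [NormedAddCommGroup X] {S : Set X} {a b : ℝ} (hab : a ≤ b)
    {K : X → ℝ → F}
    (hK : ContinuousOn (fun p : X × ℝ => K p.1 p.2) (S ×ˢ Icc a b)) :
    ContinuousOn (fun x => ∫ t in a..b, K x t) S := by
  intro x₀ hx
  obtain ⟨u, hu, C, hC⟩ := tube_bound hK hx
  refine intervalIntegral.continuousWithinAt_of_dominated_interval (bound := fun _ => C) ?_ ?_ ?_ ?_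
  · filter_upwards [self_mem_nhdsWithin] with x hx
    have := (continuousOn_slice hK hx).aestronglyMeasurable (μ := MeasureTheory.volume) measurableSet_Icc
    rw [uIoc_of_le hab]
    exact this.mono_measure (MeasureTheory.Measure.restrict_mono Ioc_subset_Icc_self le_rfl)
  · filter_upwards [hu] with x hx
    refine Eventually.of_forall fun t ht => ?_
    rw [uIoc_of_le hab] at ht
    exact hC x hx t (Ioc_subset_Icc_self ht)
  · exact intervalIntegrable_const
  · refine Eventually.of_forall fun t ht => ?_
    rw [uIoc_of_le hab] at ht
    have h2 : ContinuousWithinAt (fun x : X => (x, t)) S x₀ := by fun_prop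
    exact ContinuousWithinAt.comp (f := fun x : X => (x, t)) (hK (x₀, t) ⟨hx, Ioc_subset_Icc_self ht⟩) h2 (fun x hx => ⟨hx, Ioc_subset_Icc_self ht⟩)

theorem aesm_of_continuousOn_Icc {G : Type*} [NormedAddCommGroup G] {a b : ℝ} (hab : a ≤ b)
    {g : ℝ → G} (hg : ContinuousOn g (Icc a b)) :
    MeasureTheory.AEStronglyMeasurable g (MeasureTheory.volume.restrict (uIoc a b)) := by
  have := hg.aestronglyMeasurable (μ := MeasureTheory.volume) measurableSet_Icc
  rw [uIoc_of_le hab]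
  exact this.mono_measure (MeasureTheory.Measure.restrict_mono Ioc_subset_Icc_self le_rfl)

theorem paramInt_hasFDerivAt {𝕜 : Type*} [RCLike 𝕜] [NormedAddCommGroup X] [NormedSpace 𝕜 X]
    [NormedSpace 𝕜 F] [SMulCommClass ℝ 𝕜 F]
    {U : Set X} (hU : IsOpen U) {a b : ℝ} (hab : a ≤ b) {K : X → ℝ → F} {K' : X → ℝ → X →L[𝕜] F}
    (hd : ∀ x ∈ U, ∀ t ∈ Icc a b, HasFDerivAt (fun x => K x t) (K' x t) x)
    (hK : ContinuousOn (fun p : X × ℝ => K p.1 p.2) (U ×ˢ Icc a b))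
    (hK' : ContinuousOn (fun p : X × ℝ => K' p.1 p.2) (U ×ˢ Icc a b)) {x₀ : X} (hx : x₀ ∈ U) :
    HasFDerivAt (fun x => ∫ t in a..b, K x t) (∫ t in a..b, K' x₀ t) x₀ := by
  obtain ⟨u, hu, C, hC⟩ := tube_bound hK' hx
  rw [hU.nhdsWithin_eq hx] at hu
  refine intervalIntegral.hasFDerivAt_integral_of_dominated_of_fderiv_le (s := u ∩ U)
    (bound := fun _ => C) (F' := K') (inter_mem hu (hU.mem_nhds hx)) ?_ ?_ ?_ ?_ ?_ ?_
  · filter_upwards [hU.mem_nhds hx] with x hx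
    exact aesm_of_continuousOn_Icc hab (continuousOn_slice hK hx)
  · exact (continuousOn_slice hK hx).intervalIntegrable_of_Icc hab
  · exact aesm_of_continuousOn_Icc hab (continuousOn_slice hK' hx)
  · refine Eventually.of_forall fun t ht x hxu => ?_
    rw [uIoc_of_le hab] at ht
    exact hC x hxu.1 t (Ioc_subset_Icc_self ht)
  · exact intervalIntegrable_const
  · refine Eventually.of_forall fun t ht x hxu => ?_
    rw [uIoc_of_le hab] at ht
    exact hd x hxu.2 t (Ioc_subset_Icc_self ht)
end ParamInt

/-- Morera: a continuous function on a disc centered on the real line, holomorphic off the real line,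
is holomorphic. -/
theorem hol_of_hol_off_real {f : ℂ → ℂ} {c : ℝ} {r : ℝ} (hc : ContinuousOn f (ball (c:ℂ) r))
    (hf : ∀ z ∈ ball (c:ℂ) r, z.im ≠ 0 → DifferentiableAt ℂ f z) :
    DifferentiableOn ℂ f (ball (c:ℂ) r) := by
  refine ((IsConservativeOn.isExactOn_ball hc ?_).differentiableOn isOpen_ball)
  intro z w hzw
  rw [← add_eq_zero_iff_eq_neg, wedgeIntegral_add_wedgeIntegral_eq]
  have hin : ∀ x ∈ uIcc z.re w.re, ∀ y ∈ uIcc z.im w.im, ((x:ℂ) + y * I) ∈ ball (c:ℂ) r := by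
    intro x hx y hy
    apply hzw
    rw [Rectangle, mem_reProdIm]
    simpa using ⟨hx, hy⟩
  have hcol : ∀ x y y' : ℝ, ((x:ℂ) + y * I) ∈ ball (c:ℂ) r → |y'| ≤ |y| →
      ((x:ℂ) + y' * I) ∈ ball (c:ℂ) r := by
    intro x y y' h hy
    rw [mem_ball, dist_eq_norm] at *
    have e : ∀ t : ℝ, ((x:ℂ) + t * I - c) = ((x - c : ℝ) : ℂ) + t * I := by intro t; push_cast; ring
    rw [e] at *
    refine lt_of_le_of_lt ?_ h
    rw [Complex.norm_add_mul_I, Complex.norm_add_mul_I]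
    apply Real.sqrt_le_sqrt
    have := sq_le_sq.mpr hy
    linarith
  -- the integral over a rectangle with one side on the real line
  have hrect : ∀ x₁ x₂ y : ℝ, (∀ x ∈ uIcc x₁ x₂, ((x:ℂ) + y * I) ∈ ball (c:ℂ) r) →
      (∫ x : ℝ in x₁..x₂, f (x + y * I)) - (∫ x : ℝ in x₁..x₂, f (x + (0:ℝ) * I)) +
      I • (∫ t : ℝ in y..0, f (x₂ + t * I)) - I • (∫ t : ℝ in y..0, f (x₁ + t * I)) = 0 := by
    intro x₁ x₂ y h
    have h2 : ∀ x ∈ uIcc x₁ x₂, ∀ t ∈ uIcc y 0, ((x:ℂ) + t * I) ∈ ball (c:ℂ) r := by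
      intro x hx t ht
      refine hcol x y t (h x hx) ?_
      rcases le_total y 0 with hy | hy
      · rw [uIcc_of_le hy] at ht
        rw [abs_of_nonpos hy, abs_of_nonpos ht.2]; linarith [ht.1]
      · rw [uIcc_of_ge hy] at ht
        rw [abs_of_nonneg hy, abs_of_nonneg ht.1]; exact ht.2
    have := integral_boundary_rect_eq_zero_of_continuousOn_of_differentiableOn f ⟨x₁, y⟩ ⟨x₂, 0⟩
      (hc.mono (by
        intro p hp
        rw [mem_reProdIm] at hp
        have := h2 _ hp.1 _ hp.2
        rwa [Complex.re_add_im] at this)) (by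
        intro p hp
        rw [mem_reProdIm] at hp
        refine (hf p ?_ ?_).differentiableWithinAt
        · have := h2 _ (Ioo_subset_Icc_self hp.1) _ (Ioo_subset_Icc_self hp.2)
          rwa [Complex.re_add_im] at this
        · have := hp.2
          simp only at this
          rcases le_total y 0 with hy | hy
          · rw [min_eq_left hy, max_eq_right hy] at this; exact this.2.ne
          · rw [min_eq_right hy, max_eq_left hy] at this; exact this.1.ne')
    simpa using this
  have hA := hrect z.re w.re z.im (fun x hx => hin x hx _ left_mem_uIcc)
  have hB := hrect z.re w.re w.im (fun x hx => hin x hx _ right_mem_uIcc)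
  have hntg : ∀ x ∈ uIcc z.re w.re, ∀ y ∈ uIcc z.im w.im,
      IntervalIntegrable (fun t : ℝ => f (x + t * I)) MeasureTheory.volume y 0 := by
    intro x hx y hy
    apply ContinuousOn.intervalIntegrable
    refine hc.comp (by fun_prop) (fun t ht => hcol x y t (hin x hx y hy) ?_)
    rcases le_total y 0 with hy | hy
    · rw [uIcc_of_le hy] at ht
      rw [abs_of_nonpos hy, abs_of_nonpos ht.2]; linarith [ht.1]
    · rw [uIcc_of_ge hy] at ht
      rw [abs_of_nonneg hy, abs_of_nonneg ht.1]; exact ht.2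
  have s1 : ∀ x ∈ uIcc z.re w.re, (∫ t : ℝ in z.im..w.im, f (x + t * I)) =
      (∫ t : ℝ in z.im..0, f (x + t * I)) - (∫ t : ℝ in w.im..0, f (x + t * I)) := by
    intro x hx
    rw [← intervalIntegral.integral_add_adjacent_intervals (hntg x hx _ left_mem_uIcc)
      (hntg x hx _ right_mem_uIcc).symm, intervalIntegral.integral_symm w.im 0]
    ring
  rw [s1 _ right_mem_uIcc, s1 _ left_mem_uIcc]
  simp only [smul_eq_mul] at *
  linear_combination hA - hB

/-- The parameter derivative of a C¹ family of holomorphic functions is holomorphic. -/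
theorem hol_param_deriv {H : Type*} [NormedAddCommGroup H] [NormedSpace ℝ H] {U : Set (H × ℂ)}
    (hU : IsOpen U) {f : H × ℂ → ℂ} (hf : ContDiffOn ℝ 1 f U)
    (hz : ∀ p ∈ U, DifferentiableAt ℂ (fun z => f (p.1, z)) p.2) {p : H × ℂ} (hp : p ∈ U) (v : H) :
    DifferentiableAt ℂ (fun z => fderiv ℝ f (p.1, z) (v, 0)) p.2 := by
  obtain ⟨w, z₀⟩ := p
  simp only
  set V : Set ℂ := {z | (w, z) ∈ U} with hV
  have hVo : IsOpen V := hU.preimage (by fun_prop : Continuous fun z : ℂ => (w, z))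
  have hdf : ∀ q ∈ U, DifferentiableAt ℝ f q := fun q hq =>
    (hf.differentiableOn (by norm_num)).differentiableAt (hU.mem_nhds hq)
  have hcf : ContinuousOn (fderiv ℝ f) U := hf.continuousOn_fderiv_of_isOpen hU le_rfl
  -- local statement
  have key : ∀ z₁ ∈ V, ∀ ε > 0, ∃ δ > 0, ∀ t : ℝ, 0 < t → t * ‖v‖ < δ → ∀ y ∈ ball z₁ δ,
      (w + t • v, y) ∈ U ∧
      ‖(t:ℂ)⁻¹ * (f (w + t • v, y) - f (w, y)) - fderiv ℝ f (w, y) (v, 0)‖ ≤ ε * ‖v‖ := by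
    intro z₁ hz₁ ε hε
    have hc : ContinuousAt (fderiv ℝ f) (w, z₁) := hcf.continuousAt (hU.mem_nhds hz₁)
    have h1 : ∀ᶠ q in 𝓝 (w, z₁), q ∈ U ∧ dist (fderiv ℝ f q) (fderiv ℝ f (w, z₁)) < ε / 2 :=
      Filter.Eventually.and (hU.mem_nhds hz₁) (Metric.continuousAt_iff'.mp hc _ (by positivity))
    obtain ⟨δ, hδ, hb⟩ := Metric.eventually_nhds_iff_ball.mp h1
    refine ⟨δ, hδ, fun t ht htv y hy => ?_⟩
    have hm1 : (w, y) ∈ ball (w, z₁) δ := by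
      rw [← ball_prod_same]; exact ⟨mem_ball_self hδ, hy⟩
    have hm2 : (w + t • v, y) ∈ ball (w, z₁) δ := by
      rw [← ball_prod_same]
      refine ⟨?_, hy⟩
      simp only [mem_ball, dist_eq_norm, add_sub_cancel_left, norm_smul, Real.norm_of_nonneg ht.le]
      exact htv
    refine ⟨(hb _ hm2).1, ?_⟩
    have h2 := (convex_ball (w, z₁) δ).norm_image_sub_le_of_norm_fderiv_le' (𝕜 := ℝ)
      (f := f) (φ := fderiv ℝ f (w, y)) (C := ε)
      (fun q hq => hdf q (hb q hq).1) (fun q hq => by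
        have a1 := (hb q hq).2
        have a2 := (hb _ hm1).2
        rw [← dist_eq_norm]
        exact (dist_triangle_right _ _ _).trans (by linarith)) hm1 hm2
    have e : ((w + t • v, y) : H × ℂ) - (w, y) = t • (v, (0:ℂ)) := by ext <;> simp
    rw [e, map_smul, norm_smul, Real.norm_of_nonneg ht.le, Prod.norm_mk, norm_zero,
      max_eq_left (norm_nonneg _)] at h2
    have htc : (t:ℂ) ≠ 0 := by exact_mod_cast ht.ne'
    have e2 : (t:ℂ)⁻¹ * (f (w + t • v, y) - f (w, y)) - fderiv ℝ f (w, y) (v, 0) =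
        (t:ℂ)⁻¹ * (f (w + t • v, y) - f (w, y) - t • fderiv ℝ f (w, y) (v, 0)) := by
      rw [Complex.real_smul]; field_simp
    rw [e2, norm_mul, norm_inv, Complex.norm_real, Real.norm_of_nonneg ht.le, inv_mul_le_iff₀ ht]
    linarith
  have hlu : ∃ δ > 0, ∀ z ∈ ball z₀ δ, z ∈ V := by
    obtain ⟨δ, hδ, h⟩ := Metric.isOpen_iff.mp hVo z₀ hp
    exact ⟨δ, hδ, h⟩
  obtain ⟨δ₀, hδ₀, hV0⟩ := hlu
  obtain ⟨δ₁, hδ₁, hk₁⟩ := key z₀ hp 1 one_pos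
  obtain ⟨N, hN⟩ := exists_nat_gt (‖v‖ / δ₁)
  set t : ℕ → ℝ := fun n => 1 / ((n:ℝ) + N + 1) with ht
  have htpos : ∀ n, 0 < t n := fun n => by simp only [ht]; positivity
  have htv : ∀ n, t n * ‖v‖ < δ₁ := by
    intro n
    simp only [ht]
    rw [div_mul_eq_mul_div, one_mul, div_lt_iff₀ (by positivity)]
    have h8 : ‖v‖ < N * δ₁ := by rwa [div_lt_iff₀ hδ₁] at hN
    nlinarith [Nat.cast_nonneg (α := ℝ) n]
  have htlim : Tendsto t atTop (𝓝 0) := by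
    have h1 : Tendsto (fun n : ℕ => ((n:ℝ) + N + 1)) atTop atTop :=
      tendsto_atTop_add_const_right _ _
        (tendsto_atTop_add_const_right _ _ tendsto_natCast_atTop_atTop)
    refine h1.inv_tendsto_atTop.congr fun n => ?_
    simp [ht]
  have hlim : TendstoLocallyUniformlyOn
      (fun n y => ((t n : ℝ):ℂ)⁻¹ * (f (w + t n • v, y) - f (w, y)))
      (fun y => fderiv ℝ f (w, y) (v, 0)) atTop (ball z₀ (min δ₀ δ₁)) := by
    rw [Metric.tendstoLocallyUniformlyOn_iff]
    intro ε hε z₁ hz₁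
    obtain ⟨δ, hδ, hk⟩ := key z₁ (hV0 z₁ (ball_subset_ball (min_le_left _ _) hz₁))
      (ε / (‖v‖ + 1)) (by positivity)
    refine ⟨ball z₁ δ, mem_nhdsWithin_of_mem_nhds (ball_mem_nhds _ hδ), ?_⟩
    have : Tendsto (fun n => t n * ‖v‖) atTop (𝓝 0) := by simpa using htlim.mul_const ‖v‖
    filter_upwards [this.eventually (gt_mem_nhds hδ)] with n hn y hy
    rw [dist_comm, dist_eq_norm]
    refine lt_of_le_of_lt (hk (t n) (htpos n) hn y hy).2 ?_
    rw [div_mul_eq_mul_div, div_lt_iff₀ (by positivity)]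
    nlinarith [norm_nonneg v]
  refine (hlim.differentiableOn (Eventually.of_forall fun n => ?_) isOpen_ball).differentiableAt
    (ball_mem_nhds _ (by positivity))
  intro y hy
  refine (DifferentiableAt.const_mul (DifferentiableAt.sub ?_ ?_) _).differentiableWithinAt
  · exact hz _ (hk₁ (t n) (htpos n) (htv n) y (ball_subset_ball (min_le_right _ _) hy)).1
  · exact hz (w, y) (hV0 y (ball_subset_ball (min_le_left _ _) hy))

/-- A real-differentiable function with vanishing antiholomorphic derivative is holomorphic. -/
theorem differentiableAt_complex_of_real {E : Type*} [NormedAddCommGroup E] [NormedSpace ℂ E]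
    {f : E → ℂ} {x : E} (hf : DifferentiableAt ℝ f x)
    (h : ∀ v, fderiv ℝ f x (I • v) = I * fderiv ℝ f x v) : DifferentiableAt ℂ f x := by
  rw [differentiableAt_iff_restrictScalars ℝ hf]
  refine ⟨⟨⟨⟨fderiv ℝ f x, map_add _⟩, ?_⟩, (fderiv ℝ f x).cont⟩, ?_⟩
  · intro c v
    simp only [RingHom.id_apply, smul_eq_mul]
    have e : c • v = c.re • v + c.im • (I • v) := by
      conv_lhs => rw [← Complex.re_add_im c]
      rw [add_smul, mul_smul]; rfl
    rw [e, map_add, map_smul, map_smul, h]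
    conv_rhs => rw [← Complex.re_add_im c]
    simp only [Complex.real_smul]
    ring
  · ext v; rfl

section ConjTools
variable {m : ℕ}

/-- Conjugation on `ℂ^m` as a real continuous linear map. -/
def cW (m : ℕ) : (Fin m → ℂ) →L[ℝ] (Fin m → ℂ) :=
  ContinuousLinearMap.pi fun i => (Complex.conjCLE : ℂ →L[ℝ] ℂ).comp (ContinuousLinearMap.proj i)

def cC : ℂ →L[ℝ] ℂ := (Complex.conjCLE : ℂ →L[ℝ] ℂ)

def cCS (m : ℕ) : CS m →L[ℝ] CS m := (cW m).prodMap cC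

theorem cW_apply (w : Fin m → ℂ) : cW m w = conjW w := by
  ext i; simp [cW, conjW]
theorem cC_apply (z : ℂ) : cC z = (starRingEnd ℂ) z := by simp [cC]
theorem cCS_apply (t : CS m) : cCS m t = conjCS t := by
  simp [cCS, conjCS, Prod.map, cW_apply, cC_apply]

@[simp] theorem conjW_apply (w : Fin m → ℂ) (i : Fin m) : conjW w i = (starRingEnd ℂ) (w i) := rfl
@[simp] theorem conjW_conjW (w : Fin m → ℂ) : conjW (conjW w) = w := by ext i; simp
@[simp] theorem conjW_zero : conjW (0 : Fin m → ℂ) = 0 := by ext i; simp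
@[simp] theorem conjCS_conjCS (t : CS m) : conjCS (conjCS t) = t := by simp [conjCS]
@[simp] theorem conjCS_zero : conjCS (0 : CS m) = 0 := by simp [conjCS]
theorem conjW_add (v w : Fin m → ℂ) : conjW (v + w) = conjW v + conjW w := by ext i; simp
theorem conjW_sub (v w : Fin m → ℂ) : conjW (v - w) = conjW v - conjW w := by ext i; simp
theorem conjW_smul (c : ℂ) (w : Fin m → ℂ) : conjW (c • w) = (starRingEnd ℂ c) • conjW w := by
  ext i; simp
@[simp] theorem norm_conjW (w : Fin m → ℂ) : ‖conjW w‖ = ‖w‖ := by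
  simp [Pi.norm_def, conjW]
@[simp] theorem norm_conjCS (t : CS m) : ‖conjCS t‖ = ‖t‖ := by
  simp [Prod.norm_def, conjCS]
theorem continuous_conjW : Continuous (conjW : (Fin m → ℂ) → _) := by
  have := (cW m).continuous
  exact this.congr cW_apply
theorem continuous_conjCS : Continuous (conjCS : CS m → _) := by
  have := (cCS m).continuous
  exact this.congr cCS_apply

theorem cW_I (w : Fin m → ℂ) : cW m (I • w) = -(I • cW m w) := by
  ext i; simp [cW]
theorem cCS_I (w : CS m) : cCS m (I • w) = -(I • cCS m w) := by
  rw [cCS_apply, cCS_apply]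
  ext <;> simp [conjCS]

theorem diff_conj_comp {E E' : Type*} [NormedAddCommGroup E] [NormedSpace ℂ E]
    [NormedAddCommGroup E'] [NormedSpace ℂ E'] (c : E →L[ℝ] E') (hc : ∀ v, c (I • v) = -(I • c v))
    {f : E' → ℂ} {x : E} (hf : DifferentiableAt ℂ f (c x)) :
    DifferentiableAt ℂ (fun x => (starRingEnd ℂ) (f (c x))) x := by
  have h1 : HasFDerivAt f ((fderiv ℂ f (c x)).restrictScalars ℝ) (c x) :=
    hf.hasFDerivAt.restrictScalars ℝ
  have h2 : HasFDerivAt (fun x => cC (f (c x)))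
      (cC.comp (((fderiv ℂ f (c x)).restrictScalars ℝ).comp c)) x :=
    cC.hasFDerivAt.comp x (h1.comp x c.hasFDerivAt)
  have h3 : (fun x => (starRingEnd ℂ) (f (c x))) = fun x => cC (f (c x)) := by
    ext x; rw [cC_apply]
  rw [h3]
  refine differentiableAt_complex_of_real h2.differentiableAt fun v => ?_
  rw [h2.fderiv]
  simp [hc, cC_apply]

end ConjTools

/-- Complexification of a germ of real analytic function on a real finite dimensional space,
in the coordinates of a real basis. -/
theorem complexify_basis {E : Type*} [NormedAddCommGroup E] [NormedSpace ℝ E]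
    {N : ℕ} (b : Module.Basis (Fin N) ℝ E) {ρ : E → ℝ} (hρ : AnalyticAt ℝ ρ 0) :
    ∃ (R : (Fin N → ℂ) → ℂ), (∀ᶠ ξ in 𝓝 0, DifferentiableAt ℂ R ξ) ∧
      ∀ᶠ x : Fin N → ℝ in 𝓝 0, R (fun i => (x i : ℂ)) = ρ (∑ i, x i • b i) := by
  obtain ⟨p, r, hp⟩ := hρ
  obtain ⟨a, ha0, har⟩ := ENNReal.lt_iff_exists_nnreal_btwn.mp hp.r_pos
  have ha : 0 < (a:ℝ) := by exact_mod_cast ha0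
  have hsum : Summable fun n => ‖p n‖ * (a:ℝ) ^ n :=
    p.summable_norm_mul_pow (har.trans_le hp.r_le)
  set T : ℕ → (Fin N → ℂ) → ℂ := fun n ξ =>
    ∑ i : Fin n → Fin N, (∏ k, ξ (i k)) * (p n (fun k => b (i k)) : ℂ) with hT
  set D : Set (Fin N → ℂ) := {ξ | ∑ j, ‖ξ j‖ * ‖b j‖ < a} with hD
  have hDo : IsOpen D := isOpen_lt (by fun_prop) continuous_const
  have hD0 : (0 : Fin N → ℂ) ∈ D := by simp [hD, ha]
  refine ⟨fun ξ => ∑' n, T n ξ, ?_, ?_⟩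
  · have := hol_tsum (f := T) hDo hsum (fun n => ?_) (fun n ξ hξ => ?_)
    · filter_upwards [hDo.mem_nhds hD0] with ξ hξ
      exact this.differentiableAt (hDo.mem_nhds hξ)
    · apply Differentiable.differentiableOn
      simp only [hT]
      fun_prop
    · simp only [hT]
      calc ‖∑ i : Fin n → Fin N, (∏ k, ξ (i k)) * (p n (fun k => b (i k)) : ℂ)‖
          ≤ ∑ i : Fin n → Fin N, ‖(∏ k, ξ (i k)) * (p n (fun k => b (i k)) : ℂ)‖ :=
            norm_sum_le _ _
        _ ≤ ∑ i : Fin n → Fin N, ‖p n‖ * ∏ k, (‖ξ (i k)‖ * ‖b (i k)‖) := by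
            refine Finset.sum_le_sum fun i _ => ?_
            rw [norm_mul, norm_prod, Complex.norm_real, Finset.prod_mul_distrib]
            have := (p n).le_opNorm (fun k => b (i k))
            calc (∏ k, ‖ξ (i k)‖) * ‖p n fun k => b (i k)‖
                ≤ (∏ k, ‖ξ (i k)‖) * (‖p n‖ * ∏ k, ‖b (i k)‖) := by
                  gcongr
              _ = _ := by ring
        _ = ‖p n‖ * (∑ j, ‖ξ j‖ * ‖b j‖) ^ n := by
            rw [← Finset.mul_sum]
            congr 1
            have := Finset.prod_univ_sum (ι := Fin n) (κ := fun _ => Fin N)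
              (fun _ => (Finset.univ : Finset (Fin N))) (fun _ j => ‖ξ j‖ * ‖b j‖)
            simp only [Finset.prod_const, Finset.card_univ, Fintype.card_fin,
              Fintype.piFinset_univ] at this
            rw [this]
        _ ≤ ‖p n‖ * (a:ℝ)^n := by
            have h1 : ∑ j, ‖ξ j‖ * ‖b j‖ ≤ a := le_of_lt hξ
            have h0 : 0 ≤ ∑ j, ‖ξ j‖ * ‖b j‖ := Finset.sum_nonneg fun j _ => by positivity
            gcongr
  · have hc : Continuous fun x : Fin N → ℝ => ∑ i, x i • b i := by fun_prop
    have hball : Metric.eball (0:E) r ∈ 𝓝 (0:E) := Metric.eball_mem_nhds 0 hp.r_pos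
    have h1 : ∀ᶠ x : Fin N → ℝ in 𝓝 0, ∑ i, x i • b i ∈ Metric.eball (0:E) r := by
      apply hc.continuousAt
      simpa using hball
    filter_upwards [h1] with x hx
    have h2 := hp.hasSum hx
    rw [zero_add] at h2
    have h3 : HasSum (fun n => ((p n fun _ => ∑ i, x i • b i : ℝ) : ℂ)) (ρ (∑ i, x i • b i) : ℂ) := by
      exact_mod_cast h2
    rw [← h3.tsum_eq]
    congr 1
    ext n
    simp only [hT]
    rw [(p n).map_sum]
    push_cast
    refine Finset.sum_congr rfl fun i _ => ?_
    rw [(p n).map_smul_univ, smul_eq_mul]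
    push_cast
    rfl

theorem complexify {m : ℕ} {ρ : CS m → ℝ} (hρ : AnalyticAt ℝ ρ 0) :
    ∃ R : CS m × CS m → ℂ, (∀ᶠ p in 𝓝 0, DifferentiableAt ℂ R p) ∧
      (∀ᶠ t in 𝓝 0, R (t, conjCS t) = ρ t) ∧
      ∀ t τ, (starRingEnd ℂ) (R (t, τ)) = R (conjCS τ, conjCS t) := by
  let b := Module.finBasis ℝ (CS m)
  obtain ⟨R₁, hR1, hR2⟩ := complexify_basis b hρ
  let c : Fin (Module.finrank ℝ (CS m)) → CS m →L[ℝ] ℝ := fun i => (b.coord i).toContinuousLinearMap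
  have hcc : ∀ i t, c i t = b.repr t i := fun i t => rfl
  let L : Fin (Module.finrank ℝ (CS m)) → CS m → ℂ := fun i t => (c i t - I * c i (I • t)) / 2
  have hL : ∀ i, Differentiable ℂ (L i) := by
    intro i t
    have h1 : HasFDerivAt (L i) (((2:ℝ)⁻¹) • (Complex.ofRealCLM.comp (c i) -
        (I • (Complex.ofRealCLM.comp ((c i).comp (I • ContinuousLinearMap.id ℝ (CS m))))))) t := by
      have e : L i = fun t => (((2:ℝ)⁻¹) • (Complex.ofRealCLM.comp (c i) -
        (I • (Complex.ofRealCLM.comp ((c i).comp (I • ContinuousLinearMap.id ℝ (CS m))))))) t := by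
        ext t
        simp [L]
        ring
      rw [e]
      exact ContinuousLinearMap.hasFDerivAt _
    refine differentiableAt_complex_of_real h1.differentiableAt fun v => ?_
    rw [h1.fderiv]
    simp only [ContinuousLinearMap.smul_apply, ContinuousLinearMap.sub_apply,
      ContinuousLinearMap.comp_apply, ContinuousLinearMap.id_apply, smul_smul, I_mul_I, neg_smul,
      one_smul, map_neg, smul_eq_mul, Complex.ofRealCLM_apply, Complex.real_smul]
    push_cast
    ring_nf
    rw [I_sq]; ring
  have hLre : ∀ i t, L i t + (starRingEnd ℂ) (L i t) = c i t := by
    intro i t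
    simp only [L, map_div₀, map_sub, map_mul, Complex.conj_ofReal, Complex.conj_I, map_ofNat]
    ring
  let ξ : CS m × CS m → (Fin (Module.finrank ℝ (CS m)) → ℂ) := fun p i =>
    L i p.1 + (starRingEnd ℂ) (L i (conjCS p.2))
  have hξ : Differentiable ℂ ξ := by
    rw [differentiable_pi]
    intro i
    refine Differentiable.add ((hL i).comp differentiable_fst) ?_
    have : Differentiable ℂ (fun t : CS m => (starRingEnd ℂ) (L i (conjCS t))) := by
      intro t
      have := diff_conj_comp (cCS m) cCS_I (f := L i) (x := t) (hL i _)
      simpa only [cCS_apply] using this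
    exact this.comp differentiable_snd
  have hL0 : ∀ i, L i 0 = 0 := by intro i; simp [L]
  have hξ0 : ξ 0 = 0 := by ext i; simp [ξ, hL0]
  let R₀ : CS m × CS m → ℂ := fun p => R₁ (ξ p)
  have hR0d : ∀ᶠ p in 𝓝 0, DifferentiableAt ℂ R₀ p := by
    have h := hξ.continuous.continuousAt (x := 0)
    rw [ContinuousAt, hξ0] at h
    filter_upwards [h.eventually hR1] with p hp
    exact hp.comp p (hξ p)
  have hR0v : ∀ᶠ t in 𝓝 0, R₀ (t, conjCS t) = ρ t := by
    have hcont : Continuous fun t : CS m => (fun i => c i t) := by fun_prop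
    have h := hcont.continuousAt (x := 0)
    have h0 : (fun i => c i (0 : CS m)) = 0 := by ext i; simp
    rw [ContinuousAt, h0] at h
    filter_upwards [h.eventually hR2] with t ht
    have e1 : ξ (t, conjCS t) = fun i => ((c i t : ℝ) : ℂ) := by
      ext i
      simp only [ξ, conjCS_conjCS, hLre]
    simp only [R₀]
    rw [e1, ht]
    congr 2
    simp only [hcc]
    exact b.sum_repr t
  have hsw : Continuous fun p : CS m × CS m => (conjCS p.2, conjCS p.1) :=
    (continuous_conjCS.comp continuous_snd).prodMk (continuous_conjCS.comp continuous_fst)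
  refine ⟨fun p => (R₀ p + (starRingEnd ℂ) (R₀ (conjCS p.2, conjCS p.1))) / 2, ?_, ?_, ?_⟩
  · have h := hsw.continuousAt (x := 0)
    rw [ContinuousAt] at h
    simp only [Prod.fst_zero, Prod.snd_zero, conjCS_zero] at h
    filter_upwards [hR0d, h.eventually hR0d] with p hp hp2
    suffices hs : DifferentiableAt ℂ (fun p : CS m × CS m => (starRingEnd ℂ) (R₀ (conjCS p.2, conjCS p.1))) p from
      (DifferentiableAt.fun_add hp hs).mul_const ((2:ℂ)⁻¹)
    let C : CS m × CS m →L[ℝ] CS m × CS m :=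
      ((cCS m).comp (ContinuousLinearMap.snd ℝ _ _)).prod ((cCS m).comp (ContinuousLinearMap.fst ℝ _ _))
    have hC : ∀ p, C p = (conjCS p.2, conjCS p.1) := by
      intro p; simp [C, cCS_apply]
    have := diff_conj_comp C (fun v => by
      simp [C, cCS_I]) (f := R₀) (x := p) (by rw [hC]; exact hp2)
    simpa only [hC] using this
  · filter_upwards [hR0v] with t ht
    simp only [conjCS_conjCS, ht, Complex.conj_ofReal]
    ring
  · intro t τ
    simp only [map_div₀, map_add, Complex.conj_conj, conjCS_conjCS, map_ofNat]
    ring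

/-- eventual differentiability gives a ball of differentiability -/
theorem diffOn_ball_of_eventually {E F : Type*} [NormedAddCommGroup E] [NormedSpace ℂ E]
    [NormedAddCommGroup F] [NormedSpace ℂ F] {f : E → F} {x : E}
    (h : ∀ᶠ y in 𝓝 x, DifferentiableAt ℂ f y) :
    ∃ r > 0, DifferentiableOn ℂ f (ball x r) := by
  obtain ⟨r, hr, h⟩ := Metric.eventually_nhds_iff_ball.mp h
  exact ⟨r, hr, fun y hy => (h y hy).differentiableWithinAt⟩

theorem contDiffAt_of_eventually_hol {E F : Type*} [NormedAddCommGroup E] [NormedSpace ℂ E]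
    [FiniteDimensional ℂ E] [NormedAddCommGroup F] [NormedSpace ℂ F] [CompleteSpace F]
    {f : E → F} {x : E} (n : ℕ)
    (h : ∀ᶠ y in 𝓝 x, DifferentiableAt ℂ f y) : ContDiffAt ℂ n f x := by
  obtain ⟨r, hr, h⟩ := diffOn_ball_of_eventually h
  exact (contDiffOn_nat_of_hol isOpen_ball n h).contDiffAt (ball_mem_nhds x hr)

theorem hol_implicit {E₁ E₂ F : Type*} [NormedAddCommGroup E₁] [NormedSpace ℂ E₁]
    [FiniteDimensional ℂ E₁] [NormedAddCommGroup E₂] [NormedSpace ℂ E₂]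
    [FiniteDimensional ℂ E₂] [NormedAddCommGroup F] [NormedSpace ℂ F] [CompleteSpace F]
    {G : E₁ × E₂ → F} (hG : ∀ᶠ p in 𝓝 0, DifferentiableAt ℂ G p) (h0 : G 0 = 0)
    (hb : Function.Bijective fun y : E₂ => fderiv ℂ G 0 (0, y)) :
    ∃ ψ : E₁ → E₂, ψ 0 = 0 ∧ (∀ᶠ x in 𝓝 0, DifferentiableAt ℂ ψ x) ∧
      (∀ᶠ p in 𝓝 (0 : E₁ × E₂), (G p = 0 ↔ p.2 = ψ p.1)) ∧
      ∀ x, fderiv ℂ G 0 (x, fderiv ℂ ψ 0 x) = 0 := by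
  haveI : CompleteSpace E₁ := FiniteDimensional.complete ℂ E₁
  haveI : CompleteSpace E₂ := FiniteDimensional.complete ℂ E₂
  have hc : ContDiffAt ℂ (1:ℕ) G 0 := contDiffAt_of_eventually_hol 1 hG
  have hc1 : ContDiffAt ℂ 1 G 0 := by exact_mod_cast hc
  have hinv : (fderiv ℂ G 0 ∘L ContinuousLinearMap.inr ℂ E₁ E₂).IsInvertible := by
    have hb' : Function.Bijective (fderiv ℂ G 0 ∘L ContinuousLinearMap.inr ℂ E₁ E₂) := by
      exact hb
    exact ⟨ContinuousLinearEquiv.ofBijective _ (LinearMap.ker_eq_bot.mpr hb'.1)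
      (LinearMap.range_eq_top.mpr hb'.2), by ext; simp⟩
  set ψ := hc1.implicitFunction one_ne_zero hinv with hψ
  have hψ0 : ψ 0 = 0 := hc1.implicitFunction_apply_self one_ne_zero hinv
  have hψc : ContDiffAt ℂ 1 ψ 0 := hc1.contDiffAt_implicitFunction one_ne_zero hinv
  have hψd : ∀ᶠ x in 𝓝 (0:E₁), DifferentiableAt ℂ ψ x :=
    (hψc.eventually (by simp)).mono fun x hx => hx.differentiableAt (by simp)
  refine ⟨ψ, hψ0, hψd, ?_, ?_⟩
  · have := hc1.eventually_apply_eq_iff_implicitFunction one_ne_zero hinv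
    filter_upwards [this] with p hp
    rw [h0] at hp
    rw [hp]
    exact eq_comm
  · intro x
    have h1 : ∀ᶠ x in 𝓝 (0:E₁), G (x, ψ x) = 0 := by
      have := hc1.eventually_apply_implicitFunction one_ne_zero hinv
      filter_upwards [this] with x hx
      rw [hx, h0]
    have hψa : HasFDerivAt ψ (fderiv ℂ ψ 0) 0 := hψd.self_of_nhds.hasFDerivAt
    have h2 : HasFDerivAt (fun x => (x, ψ x)) ((ContinuousLinearMap.id ℂ E₁).prod (fderiv ℂ ψ 0)) 0 :=
      (hasFDerivAt_id _).prodMk hψa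
    have h3 : HasFDerivAt G (fderiv ℂ G 0) ((0:E₁), ψ 0) := by
      rw [hψ0]; exact hG.self_of_nhds.hasFDerivAt
    have h4 := h3.comp (0:E₁) h2
    have h5 : HasFDerivAt (fun x : E₁ => (0:F)) (0 : E₁ →L[ℂ] F) 0 := hasFDerivAt_const _ _
    have h6 : (G ∘ fun x => (x, ψ x)) =ᶠ[𝓝 0] fun x => (0:F) := h1
    have := (h5.congr_of_eventuallyEq h6).unique h4
    have := congrArg (fun T => T x) this
    simpa using this.symm

theorem exists_adapted {m : ℕ} (ℓ : CS m →L[ℝ] ℝ) (hℓ : ℓ ≠ 0) :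
    ∃ A : CS m ≃L[ℂ] CS m, ∀ t, (A t).2.im = ℓ t := by
  let L : CS m →ₗ[ℂ] ℂ :=
    { toFun := fun t => (ℓ (I • t) : ℂ) + I * (ℓ t : ℂ)
      map_add' := by intro x y; simp; ring
      map_smul' := by
        intro c x
        have h1 : c • x = c.re • x + c.im • (I • x) := by
          conv_lhs => rw [← Complex.re_add_im c]
          rw [add_smul, mul_smul]; rfl
        have h2 : I • c • x = c.re • (I • x) - c.im • x := by
          rw [h1, smul_add, smul_comm I c.re, smul_comm I c.im (I • x), smul_smul I I]
          simp [sub_eq_add_neg]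
        rw [h2, h1]
        simp only [map_add, map_sub, map_smul, smul_eq_mul, RingHom.id_apply]
        conv_rhs => rw [← Complex.re_add_im c]
        push_cast
        ring_nf
        rw [I_sq]
        ring }
  have hLa : ∀ t, L t = (ℓ (I • t) : ℂ) + I * (ℓ t : ℂ) := fun t => rfl
  have hLim : ∀ t, (L t).im = ℓ t := by intro t; rw [hLa]; simp
  have hL0 : L ≠ 0 := by
    intro h
    apply hℓ
    ext t
    · rw [ContinuousLinearMap.comp_apply, ← hLim, h]; simp
    · rw [ContinuousLinearMap.comp_apply, ← hLim, h]; simp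
  have hLs : Function.Surjective L := LinearMap.surjective hL0
  obtain ⟨e, he⟩ := hLs 1
  have hfr : Module.finrank ℂ (LinearMap.ker L) = Module.finrank ℂ (Fin m → ℂ) := by
    have h := LinearMap.finrank_range_add_finrank_ker L
    rw [LinearMap.range_eq_top.mpr hLs, finrank_top] at h
    simp [CS, Module.finrank_prod] at h ⊢
    omega
  let φ := LinearEquiv.ofFinrankEq _ _ hfr
  let P : CS m →ₗ[ℂ] LinearMap.ker L := LinearMap.codRestrict _
    (LinearMap.id - L.smulRight e) (by intro t; simp [he])
  let A0 : CS m →ₗ[ℂ] CS m := (φ.toLinearMap.comp P).prod L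
  have hinj : Function.Injective A0 := by
    rw [← LinearMap.ker_eq_bot, LinearMap.ker_eq_bot']
    intro t ht
    have h1 : φ (P t) = 0 := congrArg Prod.fst ht
    have h2 : L t = 0 := congrArg Prod.snd ht
    have h3 : P t = 0 := by simpa using h1
    have h4 : t - L t • e = 0 := congrArg Subtype.val h3
    simpa [h2] using h4
  refine ⟨(LinearEquiv.ofInjectiveEndo A0 hinj).toContinuousLinearEquiv, fun t => ?_⟩
  exact hLim t

theorem complexify_fderiv {m : ℕ} {ρ : CS m → ℝ} {R : CS m × CS m → ℂ}
    (hρ : DifferentiableAt ℝ ρ 0) (hρ' : ∀ t, fderiv ℝ ρ 0 t = t.2.im)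
    (hR : DifferentiableAt ℂ R 0) (hRρ : ∀ᶠ t in 𝓝 0, R (t, conjCS t) = ρ t) (t τ : CS m) :
    fderiv ℂ R 0 (t, τ) = (t.2 - τ.2) / (2 * I) := by
  have key : ∀ t : CS m, fderiv ℂ R 0 (t, conjCS t) = (t.2.im : ℂ) := by
    intro t
    have h1 : HasFDerivAt R ((fderiv ℂ R 0).restrictScalars ℝ) 0 := hR.hasFDerivAt.restrictScalars ℝ
    have h2 : HasFDerivAt (fun t => (t, cCS m t)) ((ContinuousLinearMap.id ℝ (CS m)).prod (cCS m)) 0 :=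
      (hasFDerivAt_id _).prodMk (cCS m).hasFDerivAt
    have h3 : HasFDerivAt R ((fderiv ℂ R 0).restrictScalars ℝ) ((0 : CS m), cCS m 0) := by
      rw [map_zero]; exact h1
    have h4 := h3.comp (0 : CS m) h2
    have h5 : HasFDerivAt (fun t => ((ρ t : ℝ) : ℂ)) (Complex.ofRealCLM.comp (fderiv ℝ ρ 0)) 0 :=
      Complex.ofRealCLM.hasFDerivAt.comp _ hρ.hasFDerivAt
    have h6 : (R ∘ fun t => (t, cCS m t)) =ᶠ[𝓝 0] fun t => ((ρ t : ℝ) : ℂ) := by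
      filter_upwards [hRρ] with t ht
      simp [cCS_apply, ht]
    have h7 := (h5.congr_of_eventuallyEq h6).unique h4
    have h8 := congrArg (fun T => T t) h7
    simp [hρ', cCS_apply] at h8
    exact h8.symm
  set a : CS m := (2⁻¹ : ℂ) • (t + conjCS τ) with ha
  set b : CS m := ((2 * I)⁻¹ : ℂ) • (t - conjCS τ) with hb
  have e : (t, τ) = (a, conjCS a) + I • (b, conjCS b) := by
    refine Prod.ext ?_ ?_
    · simp only [Prod.fst_add, Prod.smul_fst, ha, hb, smul_smul]
      have : I * (2 * I)⁻¹ = 2⁻¹ := by field_simp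
      rw [this, ← smul_add, add_add_sub_cancel, ← two_smul ℂ t, smul_smul]; simp
    · simp only [Prod.snd_add, Prod.smul_snd]
      have hh : ∀ (c : ℂ) (x : CS m), conjCS (c • x) = (starRingEnd ℂ c) • conjCS x := by
        intro c x; simp [conjCS, conjW_smul]
      have h1 : ∀ x y : CS m, conjCS (x + y) = conjCS x + conjCS y := by
        intro x y; simp [conjCS, conjW_add]
      have h2 : ∀ x y : CS m, conjCS (x - y) = conjCS x - conjCS y := by
        intro x y; simp [conjCS, conjW_sub]
      rw [ha, hb, hh, hh, h1, h2, conjCS_conjCS, smul_smul]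
      have e1 : (starRingEnd ℂ) (2⁻¹ : ℂ) = 2⁻¹ := by rw [map_inv₀, map_ofNat]
      have e2 : I * (starRingEnd ℂ) ((2 * I)⁻¹ : ℂ) = - 2⁻¹ := by
        rw [map_inv₀, map_mul, map_ofNat, conj_I]; field_simp
      rw [e1, e2, neg_smul, ← sub_eq_add_neg, ← smul_sub, add_sub_sub_cancel, ← two_smul ℂ τ, smul_smul]
      simp
  rw [e, map_add, map_smul, key, key]
  have im_eq : ∀ z : ℂ, (z.im : ℂ) = (z - (starRingEnd ℂ) z) / (2 * I) := by
    intro z; rw [Complex.sub_conj]; push_cast; field_simp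
  rw [im_eq, im_eq]
  have f1 : t.2 = a.2 + I * b.2 := congrArg (fun p => p.1.2) e
  have f2 : τ.2 = (starRingEnd ℂ) a.2 + I * (starRingEnd ℂ) b.2 := congrArg (fun p => p.2.2) e
  rw [f1, f2, smul_eq_mul]
  ring

/-- Normalized local model of a real analytic hypersurface. -/
structure IsModel {m : ℕ} (M : Set (CS m)) (q : CS m)
    (Φ : (Fin m → ℂ) × (Fin m → ℂ) × ℂ → ℂ) (κ σ : CS m → CS m) (r : ℝ) : Prop where
  rpos : 0 < r
  hol : DifferentiableOn ℂ Φ (ball 0 r)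
  zero : Φ 0 = 0
  dzero : fderiv ℂ Φ 0 = 0
  dbound : ∀ p ∈ ball 0 r, ‖fderiv ℂ Φ p‖ ≤ 1 / 8
  conj : ∀ w ω s, (w, ω, s) ∈ ball (0 : (Fin m → ℂ) × (Fin m → ℂ) × ℂ) r →
    (starRingEnd ℂ) (Φ (w, ω, s)) = Φ (conjW ω, conjW w, (starRingEnd ℂ) s)
  norm0 : ∀ w, ‖w‖ < r → Φ (w, 0, 0) = 0
  κ0 : κ 0 = q
  σκ : ∀ p, σ (κ p) = p
  κσ : ∀ p, κ (σ p) = p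
  κdiff : DifferentiableOn ℂ κ (ball 0 r)
  σdiff : ∀ᶠ x in 𝓝 q, DifferentiableAt ℂ σ x
  mem : ∀ p ∈ ball (0 : CS m) r, (κ p ∈ M ↔ p.2.im = (Φ (p.1, conjW p.1, (p.2.re : ℂ))).re)
  nonflat : ¬ ∀ᶠ w in 𝓝 0, Φ (w, conjW w, 0) = 0

theorem exists_model {m : ℕ} {M : Set (CS m)} (hM : IsRealAnalyticHypersurface M)
    {q : CS m} (hq : q ∈ M) (hmin : MinimalAt M q) :
    ∃ Φ κ σ r, IsModel M q Φ κ σ r := by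
  obtain ⟨U, ρ, hU, hqU, hρ, hρ0, hMU⟩ := hM.2 q hq
  obtain ⟨A, hA⟩ := exists_adapted (fderiv ℝ ρ q) hρ0
  set B : CS m → CS m := fun t => q + A.symm t with hB
  have hB0 : B 0 = q := by simp [hB]
  have hBd : Differentiable ℂ B := by
    simp only [hB]; exact (differentiable_const q).add A.symm.differentiable
  have hBc : ContinuousAt B 0 := hBd.continuous.continuousAt
  have hρq : AnalyticAt ℝ ρ q := hρ q hqU
  have hBan : AnalyticAt ℝ B 0 :=
    analyticAt_const.add ((A.symm : CS m →L[ℂ] CS m).restrictScalars ℝ |>.analyticAt 0)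
  have hρan : AnalyticAt ℝ (fun t => ρ (B t)) 0 :=
    AnalyticAt.comp (g := ρ) (f := B) (by rw [hB0]; exact hρq) hBan
  have hBder : HasFDerivAt B ((A.symm : CS m →L[ℂ] CS m).restrictScalars ℝ) 0 :=
    ((A.symm : CS m →L[ℂ] CS m).restrictScalars ℝ).hasFDerivAt.const_add q
  have hρd : HasFDerivAt (fun t => ρ (B t))
      ((fderiv ℝ ρ q).comp ((A.symm : CS m →L[ℂ] CS m).restrictScalars ℝ)) 0 := by
    have h1 : HasFDerivAt ρ (fderiv ℝ ρ q) (B 0) := by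
      rw [hB0]; exact hρq.differentiableAt.hasFDerivAt
    exact h1.comp 0 hBder
  obtain ⟨R, hRd, hRρ, hRc⟩ := complexify hρan
  have hDR := complexify_fderiv hρd.differentiableAt (fun t => by
    rw [hρd.fderiv]
    have := hA (A.symm t)
    simp at this
    simp [this]) hRd.self_of_nhds hRρ
  have hRfd : HasFDerivAt R (fderiv ℂ R 0) 0 := hRd.self_of_nhds.hasFDerivAt
  have hR0 : R 0 = 0 := by
    have := hRρ.self_of_nhds
    simp only [conjCS_zero, hB0] at this
    have hq' : ρ q = 0 := by
      have : q ∈ M ∩ U := ⟨hq, hqU⟩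
      rw [hMU] at this
      exact this.2
    rw [hq'] at this
    exact_mod_cast this
  -- the function Q
  have hI0 : (2 * I : ℂ) ≠ 0 := by simp
  obtain ⟨Q, hQ0, hQd, hQiff, hQ'⟩ : ∃ Q : (Fin m → ℂ) → ℂ, Q 0 = 0 ∧
      (∀ᶠ x in 𝓝 0, DifferentiableAt ℂ Q x) ∧
      (∀ᶠ p in 𝓝 (0 : CS m), (R (p, 0) = 0 ↔ p.2 = Q p.1)) ∧ fderiv ℂ Q 0 = 0 := by
    have hfd : HasFDerivAt (fun p : CS m => R (p, 0)) ((fderiv ℂ R 0).comp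
        (ContinuousLinearMap.inl ℂ (CS m) (CS m))) 0 := by
      have h1 : HasFDerivAt R (fderiv ℂ R 0) (ContinuousLinearMap.inl ℂ (CS m) (CS m) 0) := by
        exact hRfd
      exact h1.comp 0 (ContinuousLinearMap.inl ℂ (CS m) (CS m)).hasFDerivAt
    have hev : ∀ᶠ p in 𝓝 (0 : CS m), DifferentiableAt ℂ (fun p : CS m => R (p, 0)) p := by
      have hc : ContinuousAt (fun p : CS m => (p, (0 : CS m))) 0 := by fun_prop
      filter_upwards [hc.eventually hRd] with p hp
      exact hp.comp (f := fun p : CS m => (p, (0 : CS m))) p (by fun_prop)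
    have hv : ∀ x, fderiv ℂ (fun p : CS m => R (p, 0)) 0 x = x.2 / (2 * I) := by
      intro x; rw [hfd.fderiv]; simp [hDR]
    obtain ⟨Q, h1, h2, h3, h4⟩ := hol_implicit (G := fun p : CS m => R (p, 0)) hev hR0 (by
      constructor
      · intro x y hxy
        simp only [hv] at hxy
        field_simp at hxy
        exact hxy
      · intro y
        refine ⟨y * (2 * I), ?_⟩
        simp only [hv]
        field_simp)
    refine ⟨Q, h1, h2, h3, ?_⟩
    ext x
    have := h4 x
    rw [hv] at this
    simpa [hI0] using this
  set Qc : (Fin m → ℂ) → ℂ := fun ω => (starRingEnd ℂ) (Q (conjW ω)) with hQc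
  have hQc0 : Qc 0 = 0 := by simp [hQc, hQ0]
  have hQcd : ∀ᶠ x in 𝓝 0, DifferentiableAt ℂ Qc x := by
    have h := continuous_conjW.continuousAt (x := (0 : Fin m → ℂ))
    rw [ContinuousAt, conjW_zero] at h
    filter_upwards [h.eventually hQd] with x hx
    have := diff_conj_comp (cW m) cW_I (f := Q) (x := x) (by rw [cW_apply]; exact hx)
    simpa only [cW_apply] using this
  have hQfd : HasFDerivAt Q (0 : (Fin m → ℂ) →L[ℂ] ℂ) 0 := by
    have := hQd.self_of_nhds.hasFDerivAt; rwa [hQ'] at this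
  have hQcfd : HasFDerivAt Qc (0 : (Fin m → ℂ) →L[ℂ] ℂ) 0 := by
    have h1 : HasFDerivAt Q (0 : (Fin m → ℂ) →L[ℝ] ℂ) (cW m 0) := by
      rw [map_zero]; simpa using hQfd.restrictScalars ℝ
    have h2 : HasFDerivAt (fun x => cC (Q (cW m x))) (cC.comp ((0 : (Fin m → ℂ) →L[ℝ] ℂ).comp (cW m))) 0 :=
      cC.hasFDerivAt.comp _ (h1.comp _ (cW m).hasFDerivAt)
    have h3 : (fun x => cC (Q (cW m x))) = Qc := by
      ext x; simp [hQc, cC_apply, cW_apply]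
    rw [h3] at h2
    have h4 := hQcd.self_of_nhds.hasFDerivAt
    have h5 := (h4.restrictScalars ℝ).unique h2
    have : fderiv ℂ Qc 0 = 0 := by
      ext x
      have := congrArg (fun T => T x) h5
      simpa using this
    rwa [this] at h4
  -- the function G
  set a : ((Fin m → ℂ) × (Fin m → ℂ) × ℂ) × ℂ → CS m × CS m := fun x =>
    ((x.1.1, x.1.2.2 + I * x.2 + Q x.1.1), (x.1.2.1, x.1.2.2 - I * x.2 + Qc x.1.2.1)) with ha
  have ha0 : a 0 = 0 := by simp [ha, hQ0, hQc0]
  have had : ∀ᶠ x in 𝓝 0, DifferentiableAt ℂ a x := by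
    have c1 : ContinuousAt (fun x : ((Fin m → ℂ) × (Fin m → ℂ) × ℂ) × ℂ => x.1.1) 0 := by fun_prop
    have c2 : ContinuousAt (fun x : ((Fin m → ℂ) × (Fin m → ℂ) × ℂ) × ℂ => x.1.2.1) 0 := by fun_prop
    filter_upwards [c1.eventually hQd, c2.eventually hQcd] with x h1 h2
    have e1 : DifferentiableAt ℂ (fun x : ((Fin m → ℂ) × (Fin m → ℂ) × ℂ) × ℂ => Q x.1.1) x :=
      DifferentiableAt.comp (g := Q) x h1 (by fun_prop)
    have e2 : DifferentiableAt ℂ (fun x : ((Fin m → ℂ) × (Fin m → ℂ) × ℂ) × ℂ => Qc x.1.2.1) x :=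
      DifferentiableAt.comp (g := Qc) x h2 (by fun_prop)
    simp only [ha]
    fun_prop
  have hac : ContinuousAt a 0 := had.self_of_nhds.continuousAt
  have hGd : ∀ᶠ x in 𝓝 0, DifferentiableAt ℂ (fun x => R (a x)) x := by
    have hac' := hac
    rw [ContinuousAt, ha0] at hac'
    filter_upwards [had, hac'.eventually hRd] with x h1 h2
    exact h2.comp x h1
  have hG0 : R (a 0) = 0 := by rw [ha0, hR0]
  have hGfd : ∀ x, fderiv ℂ (fun x => R (a x)) 0 x = x.2 := by
    intro x
    have e1 : HasFDerivAt (fun x : ((Fin m → ℂ) × (Fin m → ℂ) × ℂ) × ℂ => Q x.1.1)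
        (0 : ((Fin m → ℂ) × (Fin m → ℂ) × ℂ) × ℂ →L[ℂ] ℂ) 0 := by
      have := HasFDerivAt.comp (g := Q) (f := fun x : ((Fin m → ℂ) × (Fin m → ℂ) × ℂ) × ℂ => x.1.1) 0
        hQfd (by fun_prop : DifferentiableAt ℂ _ _).hasFDerivAt
      rw [ContinuousLinearMap.zero_comp] at this
      exact this
    have e2 : HasFDerivAt (fun x : ((Fin m → ℂ) × (Fin m → ℂ) × ℂ) × ℂ => Qc x.1.2.1)
        (0 : ((Fin m → ℂ) × (Fin m → ℂ) × ℂ) × ℂ →L[ℂ] ℂ) 0 := by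
      have := HasFDerivAt.comp (g := Qc) (f := fun x : ((Fin m → ℂ) × (Fin m → ℂ) × ℂ) × ℂ => x.1.2.1) 0
        hQcfd (by fun_prop : DifferentiableAt ℂ _ _).hasFDerivAt
      rw [ContinuousLinearMap.zero_comp] at this
      exact this
    have e3 : HasFDerivAt a (((ContinuousLinearMap.fst ℂ (Fin m → ℂ) ((Fin m → ℂ) × ℂ)
        ∘L ContinuousLinearMap.fst ℂ _ ℂ).prod
        ((ContinuousLinearMap.snd ℂ _ ℂ ∘L ContinuousLinearMap.snd ℂ (Fin m → ℂ) ((Fin m → ℂ) × ℂ)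
        ∘L ContinuousLinearMap.fst ℂ _ ℂ) + I • ContinuousLinearMap.snd ℂ _ ℂ + 0)).prod
        ((ContinuousLinearMap.fst ℂ _ ℂ ∘L ContinuousLinearMap.snd ℂ (Fin m → ℂ) ((Fin m → ℂ) × ℂ)
        ∘L ContinuousLinearMap.fst ℂ _ ℂ).prod ((ContinuousLinearMap.snd ℂ _ ℂ ∘L ContinuousLinearMap.snd ℂ (Fin m → ℂ) ((Fin m → ℂ) × ℂ)
        ∘L ContinuousLinearMap.fst ℂ _ ℂ) - I • ContinuousLinearMap.snd ℂ _ ℂ + 0))) 0 := by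
      simp only [ha]
      refine HasFDerivAt.prodMk (HasFDerivAt.prodMk (ContinuousLinearMap.hasFDerivAt (ContinuousLinearMap.fst ℂ (Fin m → ℂ) ((Fin m → ℂ) × ℂ) ∘L ContinuousLinearMap.fst ℂ _ ℂ)) ?_)
        (HasFDerivAt.prodMk (ContinuousLinearMap.hasFDerivAt (ContinuousLinearMap.fst ℂ _ ℂ ∘L
          ContinuousLinearMap.snd ℂ (Fin m → ℂ) ((Fin m → ℂ) × ℂ) ∘L ContinuousLinearMap.fst ℂ _ ℂ)) ?_)
      · refine HasFDerivAt.add ?_ e1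
        exact ContinuousLinearMap.hasFDerivAt ((ContinuousLinearMap.snd ℂ _ ℂ ∘L ContinuousLinearMap.snd ℂ (Fin m → ℂ) ((Fin m → ℂ) × ℂ)
          ∘L ContinuousLinearMap.fst ℂ _ ℂ) + I • ContinuousLinearMap.snd ℂ _ ℂ)
      · refine HasFDerivAt.add ?_ e2
        exact ContinuousLinearMap.hasFDerivAt ((ContinuousLinearMap.snd ℂ _ ℂ ∘L ContinuousLinearMap.snd ℂ (Fin m → ℂ) ((Fin m → ℂ) × ℂ)
          ∘L ContinuousLinearMap.fst ℂ _ ℂ) - I • ContinuousLinearMap.snd ℂ _ ℂ)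
    have e4 : HasFDerivAt R (fderiv ℂ R 0) (a 0) := by rw [ha0]; exact hRfd
    have e5 := e4.comp (0 : ((Fin m → ℂ) × (Fin m → ℂ) × ℂ) × ℂ) e3
    have e6 : fderiv ℂ (fun x => R (a x)) 0 = _ := e5.fderiv
    rw [e6, ContinuousLinearMap.comp_apply]
    have : ∀ p : CS m × CS m, fderiv ℂ R 0 p = (p.1.2 - p.2.2) / (2 * I) := fun p => hDR p.1 p.2
    rw [this]
    simp
    field_simp
    ring
  obtain ⟨Φ, hΦ0, hΦd, hΦiff, hΦ'⟩ := hol_implicit (G := fun x => R (a x)) hGd hG0 (by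
    simp only [hGfd]; exact Function.bijective_id)
  have hΦ'0 : fderiv ℂ Φ 0 = 0 := by
    refine ContinuousLinearMap.ext fun x => ?_
    have := hΦ' x
    rw [hGfd] at this
    simpa using this
  -- symmetry of G
  have hGc : ∀ w ω s v, (starRingEnd ℂ) (R (a ((w, ω, s), v))) =
      R (a ((conjW ω, conjW w, (starRingEnd ℂ) s), (starRingEnd ℂ) v)) := by
    intro w ω s v
    simp only [ha, hRc]
    congr 1
    simp [conjCS, hQc, sub_eq_add_neg]
  have hΦc0 : ContinuousAt Φ 0 := hΦd.self_of_nhds.continuousAt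
  have hΦconj : ∀ᶠ x in 𝓝 (0 : (Fin m → ℂ) × (Fin m → ℂ) × ℂ), (starRingEnd ℂ) (Φ x) =
      Φ (conjW x.2.1, conjW x.1, (starRingEnd ℂ) x.2.2) := by
    have t1 : Tendsto (fun x => (x, Φ x)) (𝓝 0) (𝓝 (0 : ((Fin m → ℂ) × (Fin m → ℂ) × ℂ) × ℂ)) := by
      have : ContinuousAt (fun x => (x, Φ x)) 0 := continuousAt_id.prodMk hΦc0
      rw [ContinuousAt, hΦ0] at this
      exact this
    have t2 : Tendsto (fun x : (Fin m → ℂ) × (Fin m → ℂ) × ℂ => (((conjW x.2.1, conjW x.1, (starRingEnd ℂ) x.2.2), (starRingEnd ℂ) (Φ x)) :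
        ((Fin m → ℂ) × (Fin m → ℂ) × ℂ) × ℂ)) (𝓝 0) (𝓝 0) := by
      have : ContinuousAt (fun x : (Fin m → ℂ) × (Fin m → ℂ) × ℂ => (((conjW x.2.1, conjW x.1, (starRingEnd ℂ) x.2.2), (starRingEnd ℂ) (Φ x)) :
        ((Fin m → ℂ) × (Fin m → ℂ) × ℂ) × ℂ)) 0 := by
        refine ContinuousAt.prodMk (Continuous.continuousAt ?_) (continuous_conj.continuousAt.comp hΦc0)
        exact (continuous_conjW.comp (by fun_prop)).prodMk
          ((continuous_conjW.comp (by fun_prop)).prodMk (continuous_conj.comp (by fun_prop)))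
      rw [ContinuousAt] at this
      simp only [Prod.fst_zero, Prod.snd_zero, conjW_zero, hΦ0, map_zero] at this
      exact this
    filter_upwards [t1.eventually hΦiff, t2.eventually hΦiff] with x h1 h2
    refine h2.mp ?_
    rw [← hGc]
    have h3 := h1.mpr rfl
    rw [h3, map_zero]
  have hnorm0 : ∀ᶠ w in 𝓝 (0 : Fin m → ℂ), Φ (w, 0, 0) = 0 := by
    have t1 : Tendsto (fun w : Fin m → ℂ => (((w, 0, 0), 0) : ((Fin m → ℂ) × (Fin m → ℂ) × ℂ) × ℂ))
        (𝓝 0) (𝓝 0) := by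
      have : Continuous (fun w : Fin m → ℂ => (((w, 0, 0), 0) : ((Fin m → ℂ) × (Fin m → ℂ) × ℂ) × ℂ)) := by fun_prop
      exact this.tendsto 0
    have t2 : Tendsto (fun w : Fin m → ℂ => ((w, Q w) : CS m)) (𝓝 0) (𝓝 0) := by
      have : ContinuousAt (fun w : Fin m → ℂ => ((w, Q w) : CS m)) 0 :=
        continuousAt_id.prodMk hQd.self_of_nhds.continuousAt
      rw [ContinuousAt, hQ0] at this
      exact this
    filter_upwards [t1.eventually hΦiff, t2.eventually hQiff] with w h1 h2
    refine (h1.mp ?_).symm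
    have := h2.mpr rfl
    simp only [ha, hQc0, mul_zero, add_zero, zero_add, sub_zero]
    exact this
  set κ : CS m → CS m := fun p => B (p.1, p.2 + Q p.1) with hκ
  set σ : CS m → CS m := fun x => ((A (x - q)).1, (A (x - q)).2 - Q (A (x - q)).1) with hσ
  have hκ0 : κ 0 = q := by simp only [hκ, Prod.fst_zero, Prod.snd_zero, hQ0, zero_add]; exact hB0
  have hσκ : ∀ p, σ (κ p) = p := by intro p; simp [hσ, hκ, hB]
  have hκσ : ∀ p, κ (σ p) = p := by
    intro p; simp only [hσ, hκ, hB, sub_add_cancel, Prod.mk.eta, ContinuousLinearEquiv.symm_apply_apply, add_sub_cancel]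
  have hκd : ∀ᶠ p in 𝓝 (0 : CS m), DifferentiableAt ℂ κ p := by
    have c1 : ContinuousAt (fun p : CS m => p.1) 0 := by fun_prop
    filter_upwards [c1.eventually hQd] with p hp
    have e1 : DifferentiableAt ℂ (fun p : CS m => Q p.1) p :=
      DifferentiableAt.comp (g := Q) p hp (by fun_prop)
    refine (hBd _).comp p ?_
    fun_prop
  have hσd : ∀ᶠ x in 𝓝 q, DifferentiableAt ℂ σ x := by
    have c1 : ContinuousAt (fun x : CS m => (A (x - q)).1) q := by fun_prop
    rw [ContinuousAt] at c1
    simp only [sub_self, map_zero, Prod.fst_zero] at c1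
    filter_upwards [c1.eventually hQd] with p hp
    have e1 : DifferentiableAt ℂ (fun x : CS m => Q (A (x - q)).1) p :=
      DifferentiableAt.comp (g := Q) p hp (by fun_prop)
    simp only [hσ]
    fun_prop
  have hmem : ∀ᶠ p in 𝓝 (0 : CS m),
      (κ p ∈ M ↔ p.2.im = (Φ (p.1, conjW p.1, (p.2.re : ℂ))).re) := by
    have c0 : Tendsto (fun p : CS m => ((p.1, conjW p.1, (p.2.re : ℂ)) : (Fin m → ℂ) × (Fin m → ℂ) × ℂ))
        (𝓝 0) (𝓝 0) := by
      have : Continuous (fun p : CS m => ((p.1, conjW p.1, (p.2.re : ℂ)) : (Fin m → ℂ) × (Fin m → ℂ) × ℂ)) := by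
        have := continuous_conjW (m := m)
        fun_prop
      have := this.tendsto 0
      simp only [Prod.fst_zero, Prod.snd_zero, conjW_zero, Complex.zero_re, Complex.ofReal_zero] at this
      exact this
    have c1 : Tendsto (fun p : CS m => (((p.1, conjW p.1, (p.2.re : ℂ)), (p.2.im : ℂ)) :
        ((Fin m → ℂ) × (Fin m → ℂ) × ℂ) × ℂ)) (𝓝 0) (𝓝 0) := by
      have h2 : Tendsto (fun p : CS m => (p.2.im : ℂ)) (𝓝 0) (𝓝 0) := by
        have : Continuous (fun p : CS m => (p.2.im : ℂ)) := by fun_prop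
        simpa using this.tendsto 0
      exact c0.prodMk_nhds h2
    have c2 : Tendsto (fun p : CS m => ((p.1, p.2 + Q p.1) : CS m)) (𝓝 0) (𝓝 0) := by
      have h1 : ContinuousAt (fun p : CS m => Q p.1) 0 :=
        ContinuousAt.comp (g := Q) (f := fun p : CS m => p.1) hQd.self_of_nhds.continuousAt (by fun_prop)
      have : ContinuousAt (fun p : CS m => ((p.1, p.2 + Q p.1) : CS m)) 0 :=
        continuousAt_fst.prodMk (continuousAt_snd.add h1)
      rw [ContinuousAt] at this
      simp only [Prod.fst_zero, Prod.snd_zero, hQ0, add_zero] at this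
      exact this
    have c3 : Tendsto κ (𝓝 0) (𝓝 q) := by
      have := hκd.self_of_nhds.continuousAt
      rwa [ContinuousAt, hκ0] at this
    filter_upwards [c1.eventually hΦiff, c2.eventually hRρ, c3.eventually (hU.mem_nhds hqU),
      c0.eventually hΦconj] with p h1 h2 h3 h4
    replace h3 : κ p ∈ U := h3
    have e1 : κ p ∈ M ↔ ρ (κ p) = 0 := by
      have : κ p ∈ M ↔ κ p ∈ M ∩ U := by simp [h3]
      rw [this, hMU]; simp [h3]
    have e2 : a ((p.1, conjW p.1, (p.2.re : ℂ)), (p.2.im : ℂ)) = ((p.1, p.2 + Q p.1), conjCS (p.1, p.2 + Q p.1)) := by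
      have f1 : (p.2.re : ℂ) + I * p.2.im = p.2 := by rw [mul_comm]; exact Complex.re_add_im _
      have f2 : (p.2.re : ℂ) - I * p.2.im = (starRingEnd ℂ) p.2 := by
        apply Complex.ext <;> simp
      simp only [ha, conjCS, hQc, conjW_conjW, f1, f2, map_add]
    have e3 : ((p.2.im : ℂ) = Φ (p.1, conjW p.1, (p.2.re : ℂ))) ↔ p.2.im = (Φ (p.1, conjW p.1, (p.2.re : ℂ))).re := by
      simp only [conjW_conjW, Complex.conj_ofReal] at h4
      have h5 := Complex.conj_eq_iff_real.mp h4
      obtain ⟨y, hy⟩ := h5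
      rw [hy]
      simp
    rw [e1, ← e3, ← h1, e2, h2]
    simp [hκ]
  -- nonflatness
  have hnf : ¬ ∀ᶠ w in 𝓝 (0 : Fin m → ℂ), Φ (w, conjW w, 0) = 0 := by
    intro hfl
    apply hmin
    have hσq : σ q = 0 := by rw [← hκ0, hσκ]
    have cσ : Tendsto σ (𝓝 q) (𝓝 0) := by
      have := hσd.self_of_nhds.continuousAt
      rwa [ContinuousAt, hσq] at this
    have cσ1 : Tendsto (fun x => (σ x).1) (𝓝 q) (𝓝 0) := by
      exact (continuous_fst.tendsto (0 : CS m)).comp cσ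
    have hall : ∀ᶠ x in 𝓝 q, DifferentiableAt ℂ σ x ∧ ((σ x).2 = 0 → x ∈ M) := by
      filter_upwards [hσd, cσ.eventually hmem, cσ1.eventually hfl] with x h1 h2 h3
      refine ⟨h1, fun h4 => ?_⟩
      rw [hκσ, h4] at h2
      rw [h2]
      simp [h3]
    obtain ⟨V, hV, hVo, hqV⟩ := _root_.eventually_nhds_iff.mp hall
    refine ⟨V, fun x => (σ x).2, hVo, hqV, fun x hx => ?_, by simp [hσq], ?_, fun x hx => (hV x hx.1).2 hx.2⟩
    · exact ((hV x hx).1.snd).differentiableWithinAt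
    · intro hz
      have c3 : Tendsto κ (𝓝 0) (𝓝 q) := by
        have := hκd.self_of_nhds.continuousAt
        rwa [ContinuousAt, hκ0] at this
      have h1 := c3.eventually hz
      simp only [hσκ] at h1
      have c4 : Tendsto (fun z : ℂ => ((0, z) : CS m)) (𝓝 0) (𝓝 0) := by
        have : Continuous (fun z : ℂ => ((0, z) : CS m)) := by fun_prop
        exact this.tendsto 0
      have h2 := c4.eventually h1
      obtain ⟨ε, hε, h3⟩ := Metric.eventually_nhds_iff.mp h2
      have := @h3 ((ε/2 : ℝ) : ℂ) (by simp [abs_of_pos hε, hε])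
      simp at this
      exact hε.ne' this
  -- radius
  have hder : ∀ᶠ p in 𝓝 (0 : (Fin m → ℂ) × (Fin m → ℂ) × ℂ), ‖fderiv ℂ Φ p‖ ≤ 1 / 8 := by
    obtain ⟨ε, hε, hdo⟩ := diffOn_ball_of_eventually hΦd
    have hco := continuousOn_fderiv_of_hol isOpen_ball hdo
    have hca := (hco.continuousAt (ball_mem_nhds _ hε)).norm
    rw [ContinuousAt, hΦ'0, norm_zero] at hca
    exact hca.eventually (ge_mem_nhds (by norm_num))
  obtain ⟨r1, hr1, H1⟩ := Metric.eventually_nhds_iff_ball.mp (hΦd.and (hder.and hΦconj))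
  obtain ⟨r2, hr2, H2⟩ := Metric.eventually_nhds_iff_ball.mp hnorm0
  obtain ⟨r3, hr3, H3⟩ := Metric.eventually_nhds_iff_ball.mp (hκd.and hmem)
  refine ⟨Φ, κ, σ, min r1 (min r2 r3), ?_⟩
  have l1 : min r1 (min r2 r3) ≤ r1 := min_le_left _ _
  have l2 : min r1 (min r2 r3) ≤ r2 := (min_le_right _ _).trans (min_le_left _ _)
  have l3 : min r1 (min r2 r3) ≤ r3 := (min_le_right _ _).trans (min_le_right _ _)
  exact {
    rpos := by positivity
    hol := fun p hp => (H1 p (ball_subset_ball l1 hp)).1.differentiableWithinAt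
    zero := hΦ0
    dzero := hΦ'0
    dbound := fun p hp => (H1 p (ball_subset_ball l1 hp)).2.1
    conj := fun w ω s hp => (H1 _ (ball_subset_ball l1 hp)).2.2
    norm0 := fun w hw => H2 w (by rw [mem_ball_zero_iff]; exact hw.trans_le l2)
    κ0 := hκ0
    σκ := hσκ
    κσ := hκσ
    κdiff := fun p hp => (H3 p (ball_subset_ball l3 hp)).1.differentiableWithinAt
    σdiff := hσd
    mem := fun p hp => (H3 p (ball_subset_ball l3 hp)).2
    nonflat := hnf }

theorem circleAverage_zpow (e : ℤ) :
    Real.circleAverage (fun z : ℂ => z ^ e) 0 1 = if e = 0 then 1 else 0 := by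
  split_ifs with h
  · subst h; simp [Real.circleAverage_const]
  · rw [Real.circleAverage_eq_circleIntegral (by norm_num : (1:ℝ) ≠ 0)]
    have h1 : (∮ z in C(0, 1), (z - 0)⁻¹ • z ^ e) = ∮ z in C(0, 1), (z - 0) ^ (e - 1) := by
      refine circleIntegral.integral_congr (by norm_num) fun z hz => ?_
      have hz0 : z ≠ 0 := by rintro rfl; simp at hz
      simp only [sub_zero, smul_eq_mul]
      rw [zpow_sub_one₀ hz0, mul_comm]
    rw [h1, circleIntegral.integral_sub_zpow_of_ne (by omega)]
    simp

theorem trig_real_part {ι : Type*} (s : Finset ι) (a : ι → ℂ) (e : ι → ℤ) :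
    ∃ g : ℂ → ℂ, Differentiable ℂ g ∧ (∀ ζ : ℂ, ‖ζ‖ = 1 → (g ζ).re = (∑ i ∈ s, a i * ζ ^ (e i)).re) ∧
      (g 0).re = (∑ i ∈ s, if e i = 0 then a i else 0).re := by
  refine ⟨fun ζ => ∑ i ∈ s, (if 0 ≤ e i then a i else (starRingEnd ℂ) (a i)) * ζ ^ (e i).natAbs,
    by fun_prop, fun ζ hζ => ?_, ?_⟩
  · rw [Complex.re_sum, Complex.re_sum]
    refine Finset.sum_congr rfl fun i _ => ?_
    split_ifs with h
    · congr 2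
      rw [← zpow_natCast, Int.natAbs_of_nonneg h]
    · have h2 : e i = -((e i).natAbs : ℤ) := by omega
      have h3 : ζ⁻¹ = (starRingEnd ℂ) ζ := by
        rw [Complex.inv_def, Complex.normSq_eq_norm_sq, hζ]; simp
      conv_rhs => rw [h2, zpow_neg, ← inv_zpow, h3, zpow_natCast]
      rw [← Complex.conj_re]
      simp
  · congr 1
    refine Finset.sum_congr rfl fun i _ => ?_
    by_cases h : e i = 0
    · simp [h]
    · simp [h]

theorem circleAverage_trig {ι : Type*} (s : Finset ι) (a : ι → ℂ) (e : ι → ℤ) :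
    Real.circleAverage (fun z : ℂ => ∑ i ∈ s, a i * z ^ (e i)) 0 1 = ∑ i ∈ s, if e i = 0 then a i else 0 := by
  have hntg : ∀ i, CircleIntegrable (fun z : ℂ => a i * z ^ (e i)) 0 1 := by
    intro i
    apply ContinuousOn.circleIntegrable (by norm_num)
    refine continuousOn_const.mul (ContinuousOn.zpow₀ continuousOn_id _ fun z hz => Or.inl ?_)
    rintro rfl
    simp at hz
  have := Real.circleAverage_fun_sum (s := s) (f := fun i z => a i * z ^ (e i)) (c := 0) (R := 1) (fun i _ => hntg i)
  rw [this]
  refine Finset.sum_congr rfl fun i _ => ?_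
  have := Real.circleAverage_fun_smul (a := a i) (f := fun z : ℂ => z ^ (e i)) (c := 0) (R := 1)
  simp only [smul_eq_mul] at this
  rw [this, circleAverage_zpow]
  simp

theorem disc_combinatorics {j l : ℕ} (hj : 0 < j) (hl : 0 < l) (c : ℕ → ℂ) (hcj : c j ≠ 0)
    (hreal : ∀ z : ℂ, (∑ i ∈ Finset.range (j + l + 1), c i * z ^ i * (starRingEnd ℂ) z ^ (j + l - i)).im = 0) :
    ∃ lam g : ℂ → ℂ, Differentiable ℂ lam ∧ Differentiable ℂ g ∧ lam 0 = 0 ∧ (g 0).re ≠ 0 ∧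
      ∀ ζ : ℂ, ‖ζ‖ = 1 → (g ζ).re = (∑ i ∈ Finset.range (j + l + 1), c i * lam ζ ^ i *
        (starRingEnd ℂ) (lam ζ) ^ (j + l - i)).re := by
  set k := j + l with hk
  set S := Finset.range (k + 1) ×ˢ Finset.range (k + 1) with hS
  let A : ℂ → ℕ × ℕ → ℂ := fun β x => c x.1 * (k.choose x.2 : ℂ) * β ^ ((x.1 : ℤ) - (x.2 : ℤ))
  let e : ℕ × ℕ → ℤ := fun x => l * x.2 + j * (k - x.2) - k * (k - x.1)
  let lam : ℂ → ℂ → ℂ := fun β ζ => ζ ^ l + β * ζ ^ j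
  have hf : ∀ β ζ : ℂ, ‖β‖ = 1 → ‖ζ‖ = 1 → ∑ i ∈ Finset.range (k + 1), c i * lam β ζ ^ i *
        (starRingEnd ℂ) (lam β ζ) ^ (k - i) = ∑ x ∈ S, A β x * ζ ^ (e x) := by
    intro β ζ hβ hζ
    have hβ0 : β ≠ 0 := by rintro rfl; simp at hβ
    have hζ0 : ζ ≠ 0 := by rintro rfl; simp at hζ
    have conj_inv : ∀ z : ℂ, ‖z‖ = 1 → (starRingEnd ℂ) z = z⁻¹ := by
      intro z hz
      rw [Complex.inv_def, Complex.normSq_eq_norm_sq, hz]; simp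
    have h1 : (starRingEnd ℂ) (lam β ζ) = β⁻¹ * (ζ ^ k)⁻¹ * lam β ζ := by
      simp only [lam, map_add, map_mul, map_pow, conj_inv β hβ, conj_inv ζ hζ, hk, pow_add, inv_pow]
      field_simp
      ring
    rw [hS, Finset.sum_product]
    refine Finset.sum_congr rfl fun i hi => ?_
    have hi' : i ≤ k := by simpa [Nat.lt_succ_iff] using hi
    rw [h1, mul_pow, mul_assoc (c i), mul_left_comm (lam β ζ ^ i), ← pow_add, Nat.add_sub_cancel' hi']
    have h2 : lam β ζ ^ k = ∑ a ∈ Finset.range (k + 1), (ζ ^ l) ^ a * (β * ζ ^ j) ^ (k - a) * (k.choose a : ℂ) := by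
      simp only [lam]; rw [add_pow]
    rw [h2, Finset.mul_sum, Finset.mul_sum]
    refine Finset.sum_congr rfl fun a ha => ?_
    have ha' : a ≤ k := by simpa [Nat.lt_succ_iff] using ha
    simp only [A, e]
    have e1 : ((k - i : ℕ) : ℤ) = (k : ℤ) - i := by push_cast [hi']; ring
    have e2 : ((k - a : ℕ) : ℤ) = (k : ℤ) - a := by push_cast [ha']; ring
    have z1 : ζ ^ ((l:ℤ) * a + j * (k - a) - k * (k - i)) = (ζ ^ l) ^ a * (ζ ^ j) ^ (k - a) * ((ζ ^ k) ^ (k - i))⁻¹ := by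
      rw [zpow_sub₀ hζ0, zpow_add₀ hζ0, ← e1, ← e2, div_eq_mul_inv]
      simp only [zpow_mul, zpow_natCast]
    have z2 : β ^ ((i : ℤ) - a) = β ^ (k - a) * (β ^ (k - i))⁻¹ := by
      have : ((i : ℤ) - a) = ((k - a : ℕ) : ℤ) - ((k - i : ℕ) : ℤ) := by rw [e1, e2]; ring
      rw [this, zpow_sub₀ hβ0, zpow_natCast, zpow_natCast, div_eq_mul_inv]
    rw [z1, z2]
    simp only [mul_pow, inv_pow]
    ring
  let mu : ℂ → ℂ := fun β => ∑ x ∈ S, if e x = 0 then A β x else 0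
  have hmu : ∃ β : ℂ, ‖β‖ = 1 ∧ mu β ≠ 0 := by
    by_contra hcon
    push Not at hcon
    have h1 : Real.circleAverage (fun β : ℂ => β ^ l * mu β) 0 1 = 0 := by
      apply Real.circleAverage_const_on_circle
      intro x hx
      have : ‖x‖ = 1 := by simpa using hx
      rw [hcon x this, mul_zero]
    have h2 : Real.circleAverage (fun β : ℂ => β ^ l * mu β) 0 1 =
        Real.circleAverage (fun β : ℂ => ∑ x ∈ S, (if e x = 0 then c x.1 * (k.choose x.2 : ℂ) else 0) *
          β ^ ((l : ℤ) + x.1 - x.2)) 0 1 := by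
      apply Real.circleAverage_congr_sphere
      intro β hβ
      have hβ0 : β ≠ 0 := by rintro rfl; simp at hβ
      simp only [mu, Finset.mul_sum]
      refine Finset.sum_congr rfl fun x _ => ?_
      split_ifs with h
      · simp only [A]
        rw [add_sub_assoc, zpow_add₀ hβ0, zpow_natCast]; ring
      · simp
    rw [h2, circleAverage_trig] at h1
    have h3 : ∑ x ∈ S, (if (l : ℤ) + x.1 - x.2 = 0 then (if e x = 0 then c x.1 * (k.choose x.2 : ℂ) else 0) else 0) = c j := by
      rw [Finset.sum_eq_single (j, k)]
      · have : e (j, k) = 0 := by simp only [e, hk]; push_cast; ring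
        rw [if_pos this, if_pos (by simp [hk]; ring)]
        simp
      · rintro ⟨i, a⟩ hx hne
        by_cases c1 : (l : ℤ) + i - a = 0
        · by_cases c2 : e (i, a) = 0
          · exfalso
            apply hne
            simp only [e, hk] at c2
            have ha : (a : ℤ) = l + i := by omega
            rw [ha] at c2
            push_cast at c2
            have : (l : ℤ) * (2 * ((i:ℤ) - j)) = 0 := by linarith
            have hl' : (l : ℤ) ≠ 0 := by exact_mod_cast hl.ne'
            have h0 : 2 * ((i : ℤ) - j) = 0 := by
              rcases mul_eq_zero.mp this with h | h
              · exact absurd h hl'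
              · exact h
            have hij : i = j := by omega
            ext <;> simp <;> omega
          · simp [c2]
        · simp [c1]
      · intro h
        exfalso; apply h
        simp [hS, hk]
    exact hcj (h3.symm.trans h1)
  obtain ⟨β, hβ, hmβ⟩ := hmu
  obtain ⟨g, hg1, hg2, hg3⟩ := trig_real_part S (A β) e
  refine ⟨lam β, g, by simp only [lam]; fun_prop, hg1, by simp [lam, hj.ne', hl.ne'], ?_, fun ζ hζ => ?_⟩
  · rw [hg3]
    intro h0
    apply hmβ
    apply Complex.ext h0
    have h1 := circleAverage_trig S (A β) e
    have h2 : Real.circleAverage (fun z : ℂ => ∑ i ∈ S, A β i * z ^ (e i)) 0 1 =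
        Real.circleAverage (fun z : ℂ => (((∑ i ∈ S, A β i * z ^ (e i)).re : ℝ) : ℂ)) 0 1 := by
      apply Real.circleAverage_congr_sphere
      intro z hz
      have hz1 : ‖z‖ = 1 := by simpa using hz
      have := hreal (lam β z)
      rw [hf β z hβ hz1] at this
      apply Complex.ext
      · simp
      · simpa using this
    have h3 : (mu β).im = 0 := by
      have : mu β = Real.circleAverage (fun z : ℂ => (((∑ i ∈ S, A β i * z ^ (e i)).re : ℝ) : ℂ)) 0 1 := by
        rw [← h2, h1]
      rw [this, Real.circleAverage, intervalIntegral.integral_ofReal]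
      simp
    simpa using h3
  · rw [hg2 ζ hζ, hf β ζ hβ hζ]

/-- Homogeneous Taylor polynomial of degree `k` at the origin. -/
def tay {E : Type*} [NormedAddCommGroup E] [NormedSpace ℂ E] (f : E → ℂ) (k : ℕ) (v : E) : ℂ :=
  ((k.factorial : ℂ))⁻¹ * iteratedFDeriv ℂ k f 0 (fun _ => v)

theorem tay_slice {E : Type*} [NormedAddCommGroup E] [NormedSpace ℂ E] [FiniteDimensional ℂ E]
    {f : E → ℂ} {r : ℝ} (hr : 0 < r) (hf : DifferentiableOn ℂ f (ball 0 r)) (k : ℕ) (v : E) :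
    iteratedDeriv k (fun x : ℂ => f (x • v)) 0 = iteratedFDeriv ℂ k f 0 (fun _ => v) := by
  set g : ℂ →L[ℂ] E := ContinuousLinearMap.toSpanSingleton ℂ v with hg
  have h1 := g.iteratedFDerivWithin_comp_right (x := 0) (contDiffOn_nat_of_hol isOpen_ball k hf)
    isOpen_ball.uniqueDiffOn (isOpen_ball.preimage g.continuous).uniqueDiffOn (by simpa using hr)
    (i := k) le_rfl
  have h2 : (fun x : ℂ => f (x • v)) = f ∘ g := by ext x; simp [hg, ContinuousLinearMap.toSpanSingleton_apply]
  rw [iteratedFDerivWithin_of_isOpen k (isOpen_ball.preimage g.continuous) (by simpa using hr),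
    iteratedFDerivWithin_of_isOpen k isOpen_ball (by simpa using hr)] at h1
  rw [iteratedDeriv_eq_iteratedFDeriv, h2, h1]
  simp [hg, ContinuousLinearMap.toSpanSingleton_apply]

theorem hol_taylor {E : Type*} [NormedAddCommGroup E] [NormedSpace ℂ E] [FiniteDimensional ℂ E]
    {f : E → ℂ} {r : ℝ} (hr : 0 < r) (hf : DifferentiableOn ℂ f (ball 0 r)) :
    ∃ R > 0, ∃ C ≥ 0, ∀ t > 0, t ≤ R → ∀ v : E, ‖v‖ ≤ t → HasSum (fun n => tay f n v) (f v) ∧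
      ∀ n, ‖tay f n v‖ ≤ C * (t / (2 * R)) ^ n := by
  obtain ⟨R0, hR0, hsub, C, hC⟩ := hol_locally_bounded isOpen_ball hf.continuousOn
    (mem_ball_self hr)
  refine ⟨R0 / 4, by positivity, C, (norm_nonneg _).trans (hC 0 (mem_ball_self hR0)), ?_⟩
  intro t ht htR v hv
  have hmem : ∀ x : ℂ, ‖x‖ < R0 / t → x • v ∈ ball (0 : E) R0 := by
    intro x hx
    rw [mem_ball_zero_iff, norm_smul]
    calc ‖x‖ * ‖v‖ ≤ ‖x‖ * t := by gcongr
      _ < R0 / t * t := by gcongr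
      _ = R0 := by field_simp
  have hH : DifferentiableOn ℂ (fun x : ℂ => f (x • v)) (ball 0 (R0 / t)) := by
    refine (hf.mono hsub).comp (f := fun x : ℂ => x • v) (by fun_prop) ?_
    intro x hx
    exact hmem x (by simpa using hx)
  have h4 : 4 ≤ R0 / t := by rw [le_div_iff₀ ht]; linarith
  constructor
  · have := Complex.hasSum_taylorSeries_on_ball (r := R0 / t) (c := 0) (z := 1)
      (f := fun x : ℂ => f (x • v)) hH (by simp; linarith)
    simp only [sub_zero, one_pow, one_smul, tay_slice hr hf, smul_eq_mul, one_mul] at this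
    exact this
  · intro n
    have hD : DiffContOnCl ℂ (fun x : ℂ => f (x • v)) (ball 0 (R0 / (2 * t))) := by
      refine DifferentiableOn.diffContOnCl (hH.mono ?_)
      refine closure_ball_subset_closedBall.trans (closedBall_subset_ball ?_)
      rw [div_lt_div_iff₀ (by positivity) ht]; nlinarith [mul_pos hR0 ht]
    have := Complex.norm_iteratedDeriv_le_of_forall_mem_sphere_norm_le n (by positivity) hD (C := C) (by
      intro z hz
      refine hC _ (hmem z ?_)
      rw [mem_sphere_zero_iff_norm] at hz
      rw [hz, div_lt_div_iff₀ (by positivity) ht]; nlinarith [mul_pos hR0 ht])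
    rw [tay_slice hr hf] at this
    rw [tay, norm_mul, norm_inv, Complex.norm_natCast]
    have hn : (0:ℝ) < n.factorial := by exact_mod_cast n.factorial_pos
    rw [inv_mul_le_iff₀ hn]
    refine this.trans (le_of_eq ?_)
    have : t / (2 * (R0 / 4)) = (R0 / (2 * t))⁻¹ := by field_simp; norm_num
    rw [this, inv_pow]; field_simp

theorem hol_taylor_lead {E : Type*} [NormedAddCommGroup E] [NormedSpace ℂ E] [FiniteDimensional ℂ E]
    {f : E → ℂ} {r : ℝ} (hr : 0 < r) (hf : DifferentiableOn ℂ f (ball 0 r)) (K : ℕ) :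
    ∃ R > 0, ∃ C ≥ 0, ∀ t > 0, t ≤ R → ∀ v : E, ‖v‖ ≤ t → (∀ j < K, tay f j v = 0) → 
      ‖f v - tay f K v‖ ≤ C * t ^ (K + 1) := by
  obtain ⟨R, hR, C, hC, h⟩ := hol_taylor hr hf
  refine ⟨R, hR, 2 * C / (2 * R) ^ (K + 1), by positivity, ?_⟩
  intro t ht htR v hv hj
  obtain ⟨h1, h2⟩ := h t ht htR v hv
  have h3 := (hasSum_nat_add_iff' (K + 1)).mpr h1
  have h4 : ∑ i ∈ Finset.range (K + 1), tay f i v = tay f K v := by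
    rw [Finset.sum_range_succ, Finset.sum_eq_zero, zero_add]
    intro i hi; exact hj i (by simpa using hi)
  rw [h4] at h3
  set q := t / (2 * R) with hq
  have hq0 : 0 ≤ q := by positivity
  have hq2 : q ≤ 1 / 2 := by rw [hq, div_le_div_iff₀ (by positivity) (by norm_num)]; linarith
  have hg : HasSum (fun n : ℕ => C * q ^ (K + 1) * (1 / 2 : ℝ) ^ n) (C * q ^ (K + 1) * 2) :=
    hasSum_geometric_two.mul_left _
  have := tsum_of_norm_bounded hg (f := fun n => tay f (n + (K + 1)) v) (fun n => by
    refine (h2 _).trans ?_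
    rw [pow_add]
    have : q ^ n ≤ (1 / 2) ^ n := by gcongr
    nlinarith [mul_le_mul_of_nonneg_left this (mul_nonneg hC (pow_nonneg hq0 (K + 1)))])
  rw [h3.tsum_eq] at this
  refine this.trans (le_of_eq ?_)
  rw [hq, div_pow]; ring

/-- Two-variable expansion of a homogeneous form. -/
theorem tay_expand {E : Type*} [NormedAddCommGroup E] [NormedSpace ℂ E] (f : E → ℂ) (k : ℕ) (a b : E) :
    ∃ c : ℕ → ℂ, c 0 = tay f k b ∧ c k = tay f k a ∧
      ∀ l u : ℂ, tay f k (l • a + u • b) = ∑ i ∈ Finset.range (k + 1), c i * l ^ i * u ^ (k - i) := by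
  set p := (iteratedFDeriv ℂ k f 0).toMultilinearMap with hp
  have hexp : ∀ l u : ℂ, p (fun _ => l • a + u • b) = ∑ s : Finset (Fin k),
      l ^ s.card * u ^ (k - s.card) * p (s.piecewise (fun _ => a) (fun _ => b)) := by
    intro l u
    have := p.map_add_univ (fun _ => l • a) (fun _ => u • b)
    rw [show (fun _ : Fin k => l • a + u • b) = (fun _ => l • a) + (fun _ => u • b) from rfl, this]
    refine Finset.sum_congr rfl fun s _ => ?_
    have h1 : s.piecewise (fun _ : Fin k => l • a) (fun _ => u • b) =
        fun i => (s.piecewise (fun _ => l) (fun _ => u) i : ℂ) • s.piecewise (fun _ => a) (fun _ => b) i := by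
      ext i; by_cases hi : i ∈ s <;> simp [hi]
    rw [h1, p.map_smul_univ, smul_eq_mul]
    congr 1
    rw [Finset.prod_piecewise]
    simp [Finset.card_sdiff]
  let c : ℕ → ℂ := fun i => ((k.factorial : ℂ))⁻¹ * ∑ s : Finset (Fin k) with s.card = i,
    p (s.piecewise (fun _ => a) (fun _ => b))
  have hmain : ∀ l u : ℂ, tay f k (l • a + u • b) = ∑ i ∈ Finset.range (k + 1), c i * l ^ i * u ^ (k - i) := by
    intro l u
    have : tay f k (l • a + u • b) = ((k.factorial : ℂ))⁻¹ * p (fun _ => l • a + u • b) := rfl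
    rw [this, hexp, ← Finset.sum_fiberwise_of_maps_to (s := Finset.univ) (t := Finset.range (k + 1))
      (g := fun s : Finset (Fin k) => s.card)
      (fun s _ => by simpa [Nat.lt_succ_iff] using Finset.card_le_univ s), Finset.mul_sum]
    refine Finset.sum_congr rfl fun i _ => ?_
    simp only [c]
    rw [mul_assoc, mul_assoc, Finset.sum_mul]
    congr 1
    refine Finset.sum_congr rfl fun s hs => ?_
    rw [(Finset.mem_filter.mp hs).2]; ring
  refine ⟨c, ?_, ?_, hmain⟩
  · have := hmain 0 1
    simp only [zero_smul, one_smul, zero_add] at this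
    rw [this, Finset.sum_eq_single 0]
    · simp
    · intro i _ hi; simp [hi]
    · simp
  · have := hmain 1 0
    simp only [zero_smul, one_smul, add_zero] at this
    rw [this, Finset.sum_eq_single k]
    · simp
    · intro i hi hik
      have : k - i ≠ 0 := by have := Finset.mem_range.mp hi; omega
      simp [this]
    · simp

theorem tay_smul {E : Type*} [NormedAddCommGroup E] [NormedSpace ℂ E] (f : E → ℂ) (k : ℕ) (x : ℂ) (v : E) :
    tay f k (x • v) = x ^ k * tay f k v := by
  have := (iteratedFDeriv ℂ k f 0).toMultilinearMap.map_smul_univ (fun _ => x) (fun _ => v)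
  simp only [Finset.prod_const, Finset.card_univ, Fintype.card_fin, smul_eq_mul] at this
  have h2 : iteratedFDeriv ℂ k f 0 (fun _ => x • v) = x ^ k * iteratedFDeriv ℂ k f 0 (fun _ => v) := this
  rw [tay, h2, tay]; ring

theorem tay_zero_of_line {E : Type*} [NormedAddCommGroup E] [NormedSpace ℂ E] [FiniteDimensional ℂ E]
    {f : E → ℂ} {r : ℝ} (hr : 0 < r) (hf : DifferentiableOn ℂ f (ball 0 r)) (k : ℕ) (v : E)
    (h : ∀ᶠ x : ℂ in 𝓝 0, f (x • v) = 0) : tay f k v = 0 := by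
  rw [tay, ← tay_slice hr hf]
  have h2 : (fun x : ℂ => f (x • v)) =ᶠ[𝓝 0] fun _ => (0 : ℂ) := h
  rw [h2.iteratedDeriv_eq]
  simp [iteratedDeriv_const]

theorem exists_bound_disc {F : Type*} [NormedAddCommGroup F] {g : ℂ → F} (hg : Continuous g) :
    ∃ B > 0, ∀ ζ : ℂ, ‖ζ‖ ≤ 1 → ‖g ζ‖ ≤ B := by
  obtain ⟨B, hB⟩ := (isCompact_closedBall (0 : ℂ) 1).exists_bound_of_continuousOn hg.continuousOn
  exact ⟨max B 1, by positivity, fun ζ h => (hB ζ (by simpa using h)).trans (le_max_left _ _)⟩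

theorem disc_lemma {m : ℕ} {Φ : (Fin m → ℂ) × (Fin m → ℂ) × ℂ → ℂ} {r : ℝ} (hr : 0 < r)
    (hol : DifferentiableOn ℂ Φ (ball 0 r)) (dzero : fderiv ℂ Φ 0 = 0)
    (hconj : ∀ w ω s, (w, ω, s) ∈ ball (0 : (Fin m → ℂ) × (Fin m → ℂ) × ℂ) r →
      (starRingEnd ℂ) (Φ (w, ω, s)) = Φ (conjW ω, conjW w, (starRingEnd ℂ) s))
    (norm0 : ∀ w, ‖w‖ < r → Φ (w, 0, 0) = 0)
    (nonflat : ¬ ∀ᶠ w in 𝓝 0, Φ (w, conjW w, 0) = 0) :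
    ∃ s : ℝ, (s = 1 ∨ s = -1) ∧ ∀ ε > 0, ∃ (Λ : ℂ → (Fin m → ℂ)) (qd : ℂ → ℂ), Differentiable ℂ Λ ∧
      Differentiable ℂ qd ∧ Λ 0 = 0 ∧ qd 0 = 0 ∧ (∀ ζ, ‖ζ‖ ≤ 1 → ‖Λ ζ‖ ≤ ε ∧ ‖qd ζ‖ ≤ ε) ∧
      ∀ ζ, ‖ζ‖ = 1 → 0 < s * ((Φ (Λ ζ, conjW (Λ ζ), ((qd ζ).re : ℂ))).re - (qd ζ).im) := by
  set d : (Fin m → ℂ) → (Fin m → ℂ) × (Fin m → ℂ) × ℂ := fun w => (w, conjW w, 0) with hd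
  have hdn : ∀ w, ‖d w‖ = ‖w‖ := by intro w; simp [hd, Prod.norm_def]
  have hdsm : ∀ (t : ℝ) w, d ((t : ℂ) • w) = (t : ℂ) • d w := by
    intro t w
    ext i <;> simp [hd]
  have hex : ∃ k, ∃ w, tay Φ k (d w) ≠ 0 := by
    by_contra hcon
    push Not at hcon
    apply nonflat
    obtain ⟨R, hR, C, hC, h⟩ := hol_taylor hr hol
    filter_upwards [ball_mem_nhds 0 hR] with w hw
    have h1 := (h R hR le_rfl (d w) (by rw [hdn]; simpa using (mem_ball_zero_iff.mp hw).le)).1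
    simp only [hcon] at h1
    exact h1.unique hasSum_zero
  classical
  set k := Nat.find hex with hk
  obtain ⟨ws, hws⟩ := Nat.find_spec hex
  rw [← hk] at hws
  have hlow : ∀ j < k, ∀ w, tay Φ j (d w) = 0 := by
    intro j hj w
    by_contra hne
    exact Nat.find_min hex hj ⟨w, hne⟩
  have hreal0 : ∀ w, ‖w‖ < r → (Φ (d w)).im = 0 := by
    intro w hw
    have := hconj w (conjW w) 0 (by rw [mem_ball_zero_iff, hdn w]; exact hw)
    simp only [conjW_conjW, map_zero] at this
    exact Complex.conj_eq_iff_im.mp this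
  obtain ⟨R, hR, C, hC, htay⟩ := hol_taylor_lead hr hol k
  have htayreal : ∀ w, (tay Φ k (d w)).im = 0 := by
    intro w
    set N := ‖w‖ + 1
    have hN : 0 < N := by positivity
    have hb : ∀ᶠ t : ℝ in 𝓝[>] 0, |(tay Φ k (d w)).im| ≤ C * N ^ (k + 1) * t := by
      have hlim : Tendsto (fun t : ℝ => t * N) (𝓝[>] 0) (𝓝 0) := by
        have : Tendsto (fun t : ℝ => t * N) (𝓝 0) (𝓝 (0 * N)) := (continuous_id.mul continuous_const).tendsto 0
        rw [zero_mul] at this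
        exact this.mono_left nhdsWithin_le_nhds
      filter_upwards [self_mem_nhdsWithin, hlim.eventually (gt_mem_nhds hR), hlim.eventually (gt_mem_nhds hr)] with t ht htR htr
      replace ht : 0 < t := ht
      have hwn : ‖(t : ℂ) • w‖ ≤ t * N := by
        rw [norm_smul, Complex.norm_real, Real.norm_of_nonneg ht.le]
        gcongr; simp [N]
      have h1 := htay (t * N) (by positivity) htR.le (d ((t : ℂ) • w)) (by rw [hdn]; exact hwn)
        (fun j hj => hlow j hj _)
      have h2 : |(Φ (d ((t : ℂ) • w)) - tay Φ k (d ((t : ℂ) • w))).im| ≤ C * (t * N) ^ (k + 1) :=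
        (Complex.abs_im_le_norm _).trans h1
      rw [Complex.sub_im, hreal0 _ (hwn.trans_lt htr), hdsm, tay_smul, ← Complex.ofReal_pow,
        Complex.im_ofReal_mul , zero_sub, abs_neg, abs_mul, abs_of_pos (pow_pos ht k)] at h2
      have h3 : C * (t * N) ^ (k + 1) = t ^ k * (C * N ^ (k + 1) * t) := by ring
      rw [h3] at h2
      exact le_of_mul_le_mul_left h2 (pow_pos ht k)
    have hlim : Tendsto (fun t : ℝ => C * N ^ (k + 1) * t) (𝓝[>] 0) (𝓝 0) := by
      have : Tendsto (fun t : ℝ => C * N ^ (k + 1) * t) (𝓝 0) (𝓝 (C * N ^ (k + 1) * 0)) :=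
        (continuous_const.mul continuous_id).tendsto 0
      rw [mul_zero] at this
      exact this.mono_left nhdsWithin_le_nhds
    have := ge_of_tendsto hlim hb
    exact abs_eq_zero.mp (le_antisymm this (abs_nonneg _))
  obtain ⟨c, hc0, hck, hc⟩ := tay_expand Φ k (ws, 0, 0) (0, conjW ws, 0)
  have hds : ∀ z : ℂ, z • ((ws, 0, 0) : (Fin m → ℂ) × (Fin m → ℂ) × ℂ) +
      (starRingEnd ℂ) z • ((0, conjW ws, 0) : (Fin m → ℂ) × (Fin m → ℂ) × ℂ) = d (z • ws) := by
    intro z; ext i <;> simp [hd]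
  have hsmall : ∀ᶠ x : ℂ in 𝓝 0, ‖x • ws‖ < r := by
    have : Tendsto (fun x : ℂ => ‖x • ws‖) (𝓝 0) (𝓝 ‖(0 : ℂ) • ws‖) :=
      (by fun_prop : Continuous fun x : ℂ => ‖x • ws‖).tendsto 0
    refine this.eventually (gt_mem_nhds (by simpa using hr))
  have hck0 : c k = 0 := by
    rw [hck]
    refine tay_zero_of_line hr hol k _ ?_
    filter_upwards [hsmall] with x hx
    have := norm0 (x • ws) hx
    simpa using this
  have hc00 : c 0 = 0 := by
    rw [hc0]
    refine tay_zero_of_line hr hol k _ ?_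
    have hcc : Tendsto (fun x : ℂ => (starRingEnd ℂ) x) (𝓝 0) (𝓝 0) := by
      have := (continuous_conj).tendsto (0 : ℂ); simpa using this
    filter_upwards [hcc.eventually hsmall] with x hx
    have h1 := norm0 _ hx
    have h2 := hconj ((starRingEnd ℂ) x • ws) 0 0 (by rw [mem_ball_zero_iff]; simpa [Prod.norm_def] using hx)
    rw [h1] at h2
    simp only [map_zero, conjW_zero] at h2
    have h3 : conjW ((starRingEnd ℂ) x • ws) = x • conjW ws := by ext i; simp
    rw [h3] at h2
    simpa using h2.symm
  have hsum1 : ∑ i ∈ Finset.range (k + 1), c i ≠ 0 := by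
    have := hc 1 1
    have h2 := hds 1
    simp only [map_one] at h2
    rw [h2, one_smul] at this
    simp only [one_pow, mul_one] at this
    rw [← this]; exact hws
  obtain ⟨j, hj, hcj⟩ := Finset.exists_ne_zero_of_sum_ne_zero hsum1
  have hj0 : 0 < j := by
    rcases Nat.eq_zero_or_pos j with h | h
    · exact absurd (h ▸ hc00) hcj
    · exact h
  have hjk : j < k := by
    rcases Nat.lt_or_ge j k with h | h
    · exact h
    · have : j = k := by have := Finset.mem_range.mp hj; omega
      exact absurd (this ▸ hck0) hcj
  obtain ⟨l, hl⟩ : ∃ l, k = j + l := ⟨k - j, by omega⟩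
  have hl0 : 0 < l := by omega
  have hP : ∀ z : ℂ, tay Φ k (d (z • ws)) = ∑ i ∈ Finset.range (k + 1), c i * z ^ i * (starRingEnd ℂ) z ^ (k - i) := by
    intro z
    rw [← hds, hc]
  obtain ⟨lam, g, hlam, hg, hlam0, hg0, hlg⟩ := disc_combinatorics hj0 hl0 c hcj (by
    rw [← hl]; intro z; rw [← hP]; exact htayreal _)
  rw [← hl] at hlg
  set c0 := (g 0).re with hc0'
  obtain ⟨B, hB, hlamB⟩ := exists_bound_disc (g := fun ζ => lam ζ • ws) (by have := hlam.continuous; fun_prop)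
  obtain ⟨B', hB', hgB⟩ := exists_bound_disc (g := fun ζ => g ζ - g 0) (by have := hg.continuous; fun_prop)
  set η := |c0| / (4 * B') with hη
  have hac : 0 < |c0| := abs_pos.mpr hg0
  have hη0 : 0 < η := by positivity
  obtain ⟨δ, hδ, hδr, hδη⟩ : ∃ δ > 0, δ ≤ r ∧ ∀ p ∈ ball (0 : (Fin m → ℂ) × (Fin m → ℂ) × ℂ) δ, ‖fderiv ℂ Φ p‖ ≤ η := by
    have h1 : ContinuousAt (fderiv ℂ Φ) 0 :=
      (continuousOn_fderiv_of_hol isOpen_ball hol).continuousAt (ball_mem_nhds 0 hr)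
    have h2 : ∀ᶠ p in 𝓝 0, ‖fderiv ℂ Φ p‖ < η :=
      h1.norm.eventually (gt_mem_nhds (by simpa [dzero] using hη0))
    obtain ⟨δ, hδ, h⟩ := Metric.eventually_nhds_iff_ball.mp h2
    exact ⟨min δ r, lt_min hδ hr, min_le_right _ _, fun p hp => (h p (ball_subset_ball (min_le_left _ _) hp)).le⟩
  refine ⟨if 0 < c0 then 1 else -1, by split_ifs <;> simp, ?_⟩
  have hsc : (if 0 < c0 then (1:ℝ) else -1) * c0 = |c0| := by
    split_ifs with h
    · rw [abs_of_pos h, one_mul]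
    · rw [abs_of_nonpos (not_lt.mp h)]; ring
  have hs1 : |(if 0 < c0 then (1:ℝ) else -1)| = 1 := by split_ifs <;> simp
  set s : ℝ := if 0 < c0 then (1:ℝ) else -1
  intro ε hε
  obtain ⟨ρ, hρ, hρ1, hρε, hρε', hρδ, hρδ', hρR, hρC⟩ : ∃ ρ : ℝ, 0 < ρ ∧ ρ ≤ 1 ∧ ρ * B ≤ ε ∧ ρ * B' ≤ ε ∧
      ρ * B < δ ∧ ρ * B' < δ ∧ ρ * B ≤ R ∧ C * B ^ (k + 1) * ρ ≤ |c0| / 4 := by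
    have hev : ∀ X > (0:ℝ), ∀ Y : ℝ, ∀ᶠ ρ : ℝ in 𝓝[>] 0, ρ * Y < X := by
      intro X hX Y
      have : Tendsto (fun t : ℝ => t * Y) (𝓝 0) (𝓝 (0 * Y)) := (continuous_id.mul continuous_const).tendsto 0
      rw [zero_mul] at this
      exact (this.mono_left nhdsWithin_le_nhds).eventually (gt_mem_nhds hX)
    have := (((((((eventually_mem_nhdsWithin (a := (0:ℝ)) (s := Ioi 0)).and (hev 1 one_pos 1)).and (hev ε hε B)).and
      (hev ε hε B')).and (hev δ hδ B)).and (hev δ hδ B')).and (hev R hR B)).and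
      (hev (|c0| / 4) (by positivity) (C * B ^ (k + 1)))
    obtain ⟨ρ, ⟨⟨⟨⟨⟨⟨h1, h2⟩, h3⟩, h4⟩, h5⟩, h6⟩, h7⟩, h8⟩ := this.exists
    exact ⟨ρ, h1, by linarith, h3.le, h4.le, h5, h6, h7.le, by linarith⟩
  have hk1 : 1 ≤ k := by omega
  have hρk : ρ ^ k ≤ ρ := by
    calc ρ ^ k ≤ ρ ^ 1 := pow_le_pow_of_le_one hρ.le hρ1 hk1
      _ = ρ := pow_one _
  have hΛn : ∀ ζ, ‖ζ‖ ≤ 1 → ‖((ρ : ℂ) * lam ζ) • ws‖ ≤ ρ * B := by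
    intro ζ hζ
    rw [mul_smul, norm_smul, Complex.norm_real, Real.norm_of_nonneg hρ.le]
    exact mul_le_mul_of_nonneg_left (hlamB ζ hζ) hρ.le
  have hqn : ∀ ζ, ‖ζ‖ ≤ 1 → ‖((ρ ^ k : ℝ) : ℂ) * (I * (g ζ - g 0))‖ ≤ ρ ^ k * B' := by
    intro ζ hζ
    rw [norm_mul, norm_mul, Complex.norm_I, one_mul, Complex.norm_real, Real.norm_of_nonneg (by positivity)]
    exact mul_le_mul_of_nonneg_left (hgB ζ hζ) (by positivity)
  have hqn' : ρ ^ k * B' ≤ ρ * B' := mul_le_mul_of_nonneg_right hρk hB'.le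
  refine ⟨fun ζ => ((ρ : ℂ) * lam ζ) • ws, fun ζ => ((ρ ^ k : ℝ) : ℂ) * (I * (g ζ - g 0)), by fun_prop, by fun_prop,
    by simp [hlam0], by simp, fun ζ hζ => ⟨(hΛn ζ hζ).trans hρε, (hqn ζ hζ).trans (hqn'.trans hρε')⟩, ?_⟩
  intro ζ hζ
  have hΛ1 := hΛn ζ hζ.le
  have hq1 := hqn ζ hζ.le
  set w := ((ρ : ℂ) * lam ζ) • ws with hw
  set qv := ((ρ ^ k : ℝ) : ℂ) * (I * (g ζ - g 0)) with hqv
  have hqim : qv.im = ρ ^ k * ((g ζ).re - c0) := by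
    rw [hqv, Complex.im_ofReal_mul]; simp [hc0']
  have hqre : ‖(qv.re : ℂ)‖ ≤ ρ ^ k * B' := by
    rw [Complex.norm_real]; exact (Complex.abs_re_le_norm _).trans hq1
  have e1 : ‖Φ (w, conjW w, (qv.re : ℂ)) - Φ (d w)‖ ≤ η * (ρ ^ k * B') := by
    have := (convex_ball (0 : (Fin m → ℂ) × (Fin m → ℂ) × ℂ) δ).norm_image_sub_le_of_norm_fderiv_le (𝕜 := ℂ) (f := Φ)
      (fun p hp => (hol p (ball_subset_ball hδr hp)).differentiableAt (isOpen_ball.mem_nhds (ball_subset_ball hδr hp)))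
      hδη (x := d w) (y := (w, conjW w, (qv.re : ℂ))) (by rw [mem_ball_zero_iff, hdn]; linarith)
      (by rw [mem_ball_zero_iff]; simp only [Prod.norm_def, norm_conjW, max_lt_iff]; exact ⟨by linarith, by linarith, by linarith⟩)
    refine this.trans ?_
    gcongr
    have : ((w, conjW w, (qv.re : ℂ)) : (Fin m → ℂ) × (Fin m → ℂ) × ℂ) - d w = (0, 0, (qv.re : ℂ)) := by
      simp [hd]
    rw [this]; simpa [Prod.norm_def] using hqre
  have e2 : ‖Φ (d w) - tay Φ k (d w)‖ ≤ C * (ρ * B) ^ (k + 1) :=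
    htay (ρ * B) (by positivity) hρR (d w) (by rw [hdn]; exact hΛ1) (fun j hj => hlow j hj _)
  have e3 : (tay Φ k (d w)).re = ρ ^ k * (g ζ).re := by
    rw [hw, mul_smul, hdsm, tay_smul, hP, ← Complex.ofReal_pow, Complex.re_ofReal_mul, hlg ζ hζ]
  have e4 : |(Φ (w, conjW w, (qv.re : ℂ)) - tay Φ k (d w)).re| ≤ η * (ρ ^ k * B') + C * (ρ * B) ^ (k + 1) := by
    refine (Complex.abs_re_le_norm _).trans ?_
    have := norm_add_le (Φ (w, conjW w, (qv.re : ℂ)) - Φ (d w)) (Φ (d w) - tay Φ k (d w))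
    rw [sub_add_sub_cancel] at this
    linarith
  have e5 : η * (ρ ^ k * B') + C * (ρ * B) ^ (k + 1) ≤ ρ ^ k * (|c0| / 2) := by
    have h1 : η * (ρ ^ k * B') = ρ ^ k * (|c0| / 4) := by rw [hη]; field_simp
    have h2 : C * (ρ * B) ^ (k + 1) = ρ ^ k * (C * B ^ (k + 1) * ρ) := by ring
    have h3 := mul_le_mul_of_nonneg_left hρC (pow_pos hρ k).le
    rw [h1, h2]; linarith
  rw [Complex.sub_re, e3] at e4
  set X := (Φ (w, conjW w, (qv.re : ℂ))).re with hX
  have e6 : s * (X - qv.im) = ρ ^ k * |c0| + s * (X - ρ ^ k * (g ζ).re) := by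
    rw [hqim, ← hsc]; ring
  have e7 : |s * (X - ρ ^ k * (g ζ).re)| ≤ ρ ^ k * (|c0| / 2) := by
    rw [abs_mul, hs1, one_mul]; exact e4.trans e5
  have e8 := (abs_le.mp e7).1
  have e9 : 0 < ρ ^ k * (|c0| / 2) := by positivity
  rw [e6]; linarith

/-- Small entire discs through the origin with boundary strictly below the model hypersurface. -/
def HasDiscs {m : ℕ} (Φ : (Fin m → ℂ) × (Fin m → ℂ) × ℂ → ℂ) : Prop :=
  ∀ ε > 0, ∃ (Λ : ℂ → (Fin m → ℂ)) (qd : ℂ → ℂ), Differentiable ℂ Λ ∧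
      Differentiable ℂ qd ∧ Λ 0 = 0 ∧ qd 0 = 0 ∧ (∀ ζ, ‖ζ‖ ≤ 1 → ‖Λ ζ‖ ≤ ε ∧ ‖qd ζ‖ ≤ ε) ∧
      ∀ ζ, ‖ζ‖ = 1 → (qd ζ).im < (Φ (Λ ζ, conjW (Λ ζ), ((qd ζ).re : ℂ))).re

theorem exists_model_discs {m : ℕ} {M : Set (CS m)} (hM : IsRealAnalyticHypersurface M)
    {q : CS m} (hq : q ∈ M) (hmin : MinimalAt M q) :
    ∃ Φ κ σ r, IsModel M q Φ κ σ r ∧ HasDiscs Φ := by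
  obtain ⟨Φ, κ, σ, r, h⟩ := exists_model hM hq hmin
  obtain ⟨s, hs, hdisc⟩ := disc_lemma h.rpos h.hol h.dzero h.conj h.norm0 h.nonflat
  rcases hs with rfl | rfl
  · refine ⟨Φ, κ, σ, r, h, fun ε hε => ?_⟩
    obtain ⟨Λ, qd, h1, h2, h3, h4, h5, h6⟩ := hdisc ε hε
    exact ⟨Λ, qd, h1, h2, h3, h4, h5, fun ζ hζ => by have := h6 ζ hζ; linarith⟩
  · let A : ((Fin m → ℂ) × (Fin m → ℂ) × ℂ) →L[ℂ] ((Fin m → ℂ) × (Fin m → ℂ) × ℂ) :=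
      (ContinuousLinearMap.fst ℂ _ _).prod (((ContinuousLinearMap.fst ℂ _ _).comp (ContinuousLinearMap.snd ℂ _ _)).prod
        (-((ContinuousLinearMap.snd ℂ _ _).comp (ContinuousLinearMap.snd ℂ _ _))))
    have hA : ∀ p, A p = (p.1, p.2.1, -p.2.2) := fun p => rfl
    have hAn : ∀ p, ‖A p‖ = ‖p‖ := by intro p; rw [hA]; simp [Prod.norm_def]
    have hAb : ∀ p ∈ ball (0 : (Fin m → ℂ) × (Fin m → ℂ) × ℂ) r, A p ∈ ball (0 : (Fin m → ℂ) × (Fin m → ℂ) × ℂ) r := by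
      intro p hp; rw [mem_ball_zero_iff] at hp ⊢; rw [hAn]; exact hp
    let B : CS m →L[ℂ] CS m := (ContinuousLinearMap.fst ℂ _ _).prod (-(ContinuousLinearMap.snd ℂ _ _))
    have hB : ∀ p, B p = (p.1, -p.2) := fun p => rfl
    have hBB : ∀ p, B (B p) = p := by intro p; simp [hB]
    have hBb : ∀ p ∈ ball (0 : CS m) r, B p ∈ ball (0 : CS m) r := by
      intro p hp; rw [mem_ball_zero_iff] at hp ⊢; rw [hB]; simpa [Prod.norm_def] using hp
    have hΦd : ∀ p ∈ ball (0 : (Fin m → ℂ) × (Fin m → ℂ) × ℂ) r, HasFDerivAt (fun p => - Φ (A p)) (-((fderiv ℂ Φ (A p)).comp A)) p := by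
      intro p hp
      have h1 : HasFDerivAt Φ (fderiv ℂ Φ (A p)) (A p) :=
        ((h.hol _ (hAb p hp)).differentiableAt (isOpen_ball.mem_nhds (hAb p hp))).hasFDerivAt
      exact (h1.comp p A.hasFDerivAt).neg
    refine ⟨fun p => - Φ (A p), fun p => κ (B p), fun p => B (σ p), r, ⟨h.rpos, ?_, ?_, ?_, ?_, ?_, ?_, ?_, ?_, ?_, ?_, ?_, ?_, ?_⟩, ?_⟩
    · exact fun p hp => (hΦd p hp).differentiableAt.differentiableWithinAt
    · simp only [map_zero, h.zero, neg_zero]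
    · rw [(hΦd 0 (mem_ball_self h.rpos)).fderiv, map_zero, h.dzero]; simp
    · intro p hp
      rw [(hΦd p hp).fderiv, norm_neg]
      refine ContinuousLinearMap.opNorm_le_bound _ (by norm_num) fun v => ?_
      rw [ContinuousLinearMap.comp_apply]
      refine (ContinuousLinearMap.le_opNorm _ _).trans ?_
      rw [hAn]
      exact mul_le_mul_of_nonneg_right (h.dbound _ (hAb p hp)) (norm_nonneg _)
    · intro w ω s hp
      have hp2 : (w, ω, -s) ∈ ball (0 : (Fin m → ℂ) × (Fin m → ℂ) × ℂ) r := by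
        rw [mem_ball_zero_iff] at hp ⊢
        simpa [Prod.norm_def] using hp
      have := h.conj w ω (-s) hp2
      simp only [hA, map_neg] at this ⊢
      rw [this]
    · intro w hw
      have := h.norm0 w hw
      simp only [hA, neg_zero, this]
    · simp only [map_zero, h.κ0]
    · intro p; simp only [h.σκ, hBB]
    · intro p; simp only [h.κσ, hBB]
    · have hBd : DifferentiableOn ℂ B (ball 0 r) := B.differentiable.differentiableOn
      exact DifferentiableOn.comp h.κdiff hBd hBb
    · filter_upwards [h.σdiff] with x hx
      have hBd : DifferentiableAt ℂ B (σ x) := B.differentiableAt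
      exact DifferentiableAt.comp x hBd hx
    · intro p hp
      have := h.mem (B p) (hBb p hp)
      simp only [hB, hA, Complex.neg_im, Complex.neg_re, Complex.ofReal_neg] at this ⊢
      rw [this]
      constructor
      · intro h; linarith
      · intro h; linarith
    · intro hcon
      apply h.nonflat
      filter_upwards [hcon] with w hw
      simpa [hA] using hw
    · intro ε hε
      obtain ⟨Λ, qd, h1, h2, h3, h4, h5, h6⟩ := hdisc ε hε
      refine ⟨Λ, fun ζ => - qd ζ, h1, h2.neg, h3, by simp [h4], fun ζ hζ => by simpa using h5 ζ hζ, fun ζ hζ => ?_⟩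
      have := h6 ζ hζ
      simp only [hA, Complex.neg_im, Complex.neg_re, Complex.ofReal_neg, neg_neg] at this ⊢
      linarith

theorem paramInt_C1 {X F : Type*} [NormedAddCommGroup X] [NormedSpace ℝ X]
    [NormedAddCommGroup F] [NormedSpace ℝ F] [CompleteSpace F]
    {O : Set (X × ℝ)} (hO : IsOpen O) {k : X × ℝ → F}
    (hk : ContDiffOn ℝ 1 k O) {U : Set X} (hU : IsOpen U) {a b : ℝ} (hab : a ≤ b)
    (hsub : ∀ x ∈ U, ∀ t ∈ Icc a b, (x, t) ∈ O) :
    ContDiffOn ℝ 1 (fun x => ∫ t in a..b, k (x, t)) U ∧ ∀ x ∈ U, ∀ v,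
      fderiv ℝ (fun x => ∫ t in a..b, k (x, t)) x v = ∫ t in a..b, fderiv ℝ k (x, t) (v, 0) := by
  have hd : ∀ p ∈ O, HasFDerivAt k (fderiv ℝ k p) p := fun p hp =>
    ((hk.differentiableOn (by norm_num)).differentiableAt (hO.mem_nhds hp)).hasFDerivAt
  have hfc : ContinuousOn (fderiv ℝ k) O := hk.continuousOn_fderiv_of_isOpen hO le_rfl
  have hsub' : U ×ˢ Icc a b ⊆ O := fun p hp => hsub p.1 hp.1 p.2 hp.2
  set K' : X → ℝ → X →L[ℝ] F := fun x t => (fderiv ℝ k (x, t)).comp (ContinuousLinearMap.inl ℝ X ℝ) with hK'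
  have hK'c : ContinuousOn (fun p : X × ℝ => K' p.1 p.2) (U ×ˢ Icc a b) :=
    (hfc.mono hsub').clm_comp continuousOn_const
  have hmain : ∀ x ∈ U, HasFDerivAt (fun x => ∫ t in a..b, k (x, t)) (∫ t in a..b, K' x t) x := by
    intro x hx
    refine paramInt_hasFDerivAt (𝕜 := ℝ) hU hab (K := fun x t => k (x, t)) (K' := K') ?_ ?_ hK'c hx
    · intro x hx t ht
      exact (hd _ (hsub x hx t ht)).comp x (hasFDerivAt_prodMk_left x t)
    · exact hk.continuousOn.mono hsub'
  have hntg : ∀ x ∈ U, IntervalIntegrable (K' x) MeasureTheory.volume a b := fun x hx =>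
    (ContinuousOn.intervalIntegrable (by rw [uIcc_of_le hab]; exact continuousOn_slice hK'c hx))
  refine ⟨?_, ?_⟩
  · rw [show (1 : WithTop ℕ∞) = 0 + 1 from (zero_add 1).symm, contDiffOn_succ_iff_fderiv_of_isOpen hU]
    refine ⟨fun x hx => (hmain x hx).differentiableAt.differentiableWithinAt, by simp, ?_⟩
    rw [contDiffOn_zero]
    exact (paramInt_continuousOn hab hK'c).congr fun x hx => (hmain x hx).fderiv
  · intro x hx v
    rw [(hmain x hx).fderiv, ContinuousLinearMap.intervalIntegral_apply (hntg x hx) v]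
    rfl

theorem antiCDeriv_smul {f : ℂ → ℂ} {q : ℂ} (c : ℂ) :
    antiCDeriv f q c = (starRingEnd ℂ) c * antiCDeriv f q 1 := by
  set D := fderiv ℝ f q
  have h : ∀ c : ℂ, D c = c.re * D 1 + c.im * D I := by
    intro c
    have : c = c.re • (1 : ℂ) + c.im • I := by simp [Complex.re_add_im]
    conv_lhs => rw [this, map_add, map_smul, map_smul]
    simp
  simp only [antiCDeriv, smul_eq_mul]
  change (D c + I * D (I * c)) / 2 = (starRingEnd ℂ) c * ((D 1 + I * D (I * 1)) / 2)
  rw [h c, h (I * c), mul_one]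
  have hc : (starRingEnd ℂ) c = c.re - c.im * I := by
    apply Complex.ext <;> simp
  rw [hc]
  simp
  linear_combination ((c.im : ℂ) * D I / 2) * Complex.I_sq

theorem pompeiu {K : ℂ → ℂ} {U : Set ℂ} (hU : IsOpen U) (hK : ContDiffOn ℝ 1 K U)
    (hsub : closedBall 0 1 ⊆ U) :
    ∫ θ in (0:ℝ)..2 * Real.pi, K (cexp (θ * I)) =
    2 * Real.pi * K 0 + ∫ ρ in (0:ℝ)..1, ∫ θ in (0:ℝ)..2 * Real.pi,
      2 * cexp (-(θ * I)) * antiCDeriv K (ρ * cexp (θ * I)) 1 := by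
  have h2pi : (0:ℝ) ≤ 2 * Real.pi := by positivity
  set e : ℝ → ℂ := fun θ => cexp (θ * I) with he
  have hen : ∀ θ, ‖e θ‖ = 1 := fun θ => Complex.norm_exp_ofReal_mul_I θ
  have hec : ContDiff ℝ 1 e := by
    have : ContDiff ℝ 1 fun θ : ℝ => (θ : ℂ) := Complex.ofRealCLM.contDiff
    exact (this.mul contDiff_const).cexp
  have hed : ∀ θ, HasDerivAt e (I * e θ) θ := by
    intro θ
    have h1 : HasDerivAt (fun θ : ℝ => (θ : ℂ) * I) (1 * I) θ :=
      (Complex.ofRealCLM.hasDerivAt).mul_const I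
    have := h1.cexp
    simpa [he, mul_comm] using this
  have hdK : ∀ p ∈ U, HasFDerivAt K (fderiv ℝ K p) p := fun p hp =>
    ((hK.differentiableOn (by norm_num)).differentiableAt (hU.mem_nhds hp)).hasFDerivAt
  have hfc : ContinuousOn (fderiv ℝ K) U := hK.continuousOn_fderiv_of_isOpen hU le_rfl
  set O : Set (ℝ × ℝ) := {p | (p.1 : ℂ) * e p.2 ∈ U} with hO
  have hce : ContDiff ℝ 1 fun p : ℝ × ℝ => (p.1 : ℂ) * e p.2 :=
    (Complex.ofRealCLM.contDiff.comp contDiff_fst).mul (hec.comp contDiff_snd)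
  have hOo : IsOpen O := hU.preimage hce.continuous
  have hkC : ContDiffOn ℝ 1 (fun p : ℝ × ℝ => K ((p.1 : ℂ) * e p.2)) O :=
    hK.comp hce.contDiffOn (fun p hp => hp)
  have hin : ∀ ρ ∈ Icc (0:ℝ) 1, ∀ θ, ((ρ : ℂ) * e θ) ∈ U := by
    intro ρ hρ θ
    apply hsub
    rw [mem_closedBall_zero_iff, norm_mul, hen, mul_one, Complex.norm_real, Real.norm_of_nonneg hρ.1]
    exact hρ.2
  set m : ℝ → ℂ := fun ρ => ∫ θ in (0:ℝ)..2 * Real.pi, K ((ρ : ℂ) * e θ) with hm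
  have hmc : ContinuousOn m (Icc 0 1) := by
    refine paramInt_continuousOn (X := ℝ) h2pi (K := fun ρ θ => K ((ρ : ℂ) * e θ)) ?_
    exact hkC.continuousOn.mono (fun p hp => hin p.1 hp.1 p.2)
  obtain ⟨-, hmd⟩ := paramInt_C1 hOo hkC (U := Ioo 0 1) isOpen_Ioo h2pi
    (fun x hx t _ => hin x ⟨hx.1.le, hx.2.le⟩ t)
  have hmC := (paramInt_C1 hOo hkC (U := Ioo 0 1) isOpen_Ioo h2pi
    (fun x hx t _ => hin x ⟨hx.1.le, hx.2.le⟩ t)).1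
  set D : ℝ → ℝ → ℂ := fun ρ θ => 2 * cexp (-(θ * I)) * antiCDeriv K (ρ * cexp (θ * I)) 1 with hD
  have hDc : ContinuousOn (fun p : ℝ × ℝ => D p.1 p.2) (Icc 0 1 ×ˢ Icc 0 (2 * Real.pi)) := by
    have h1 : ContinuousOn (fun p : ℝ × ℝ => fderiv ℝ K ((p.1 : ℂ) * e p.2)) (Icc 0 1 ×ˢ Icc 0 (2 * Real.pi)) :=
      hfc.comp hce.continuous.continuousOn (fun p hp => hin p.1 hp.1 p.2)
    simp only [hD, antiCDeriv]
    refine ContinuousOn.mul (by fun_prop) (ContinuousOn.div_const (ContinuousOn.add (h1.clm_apply continuousOn_const)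
      (continuousOn_const.mul (h1.clm_apply continuousOn_const))) _)
  have hderiv : ∀ ρ ∈ Ioo (0:ℝ) 1, HasDerivAt m (∫ θ in (0:ℝ)..2 * Real.pi, D ρ θ) ρ := by
    intro ρ hρ
    have hρ' : ρ ∈ Icc (0:ℝ) 1 := ⟨hρ.1.le, hρ.2.le⟩
    have h0 : DifferentiableAt ℝ m ρ :=
      (hmC.differentiableOn (by norm_num)).differentiableAt (isOpen_Ioo.mem_nhds hρ)
    have h1 := h0.hasDerivAt
    have h2 : deriv m ρ = ∫ θ in (0:ℝ)..2 * Real.pi, fderiv ℝ K ((ρ : ℂ) * e θ) (e θ) := by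
      rw [← fderiv_apply_one_eq_deriv]
      have := hmd ρ hρ 1
      rw [hm, this]
      congr 1; ext θ
      have hc : HasFDerivAt (fun p : ℝ × ℝ => K ((p.1 : ℂ) * e p.2)) _ (ρ, θ) :=
        (hdK _ (hin ρ hρ' θ)).comp (ρ, θ) ((hce.differentiable (by norm_num)) (ρ, θ)).hasFDerivAt
      rw [hc.fderiv, ContinuousLinearMap.comp_apply]
      congr 1
      have hl : HasDerivAt (fun x : ℝ => (x : ℂ) * e θ) (1 * e θ) ρ := (Complex.ofRealCLM.hasDerivAt).mul_const _
      have hl2 := ((hce.differentiable (by norm_num)) (ρ, θ)).hasFDerivAt.comp_hasDerivAt ρ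
        ((hasDerivAt_id ρ).prodMk (hasDerivAt_const ρ θ))
      have := hl2.unique hl
      rw [one_mul] at this
      exact this
    have hcI : ContinuousOn (fun θ => fderiv ℝ K ((ρ : ℂ) * e θ)) (uIcc 0 (2 * Real.pi)) :=
      hfc.comp (by have := hec.continuous; fun_prop) (fun θ _ => hin ρ hρ' θ)
    have heC : ContinuousOn e (uIcc 0 (2 * Real.pi)) := hec.continuous.continuousOn
    have h3 : ∫ θ in (0:ℝ)..2 * Real.pi, fderiv ℝ K ((ρ : ℂ) * e θ) (I * e θ) = 0 := by
      have hF : ∀ θ ∈ uIcc (0:ℝ) (2 * Real.pi), HasDerivAt (fun θ => K ((ρ : ℂ) * e θ))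
          ((ρ:ℂ) * fderiv ℝ K ((ρ : ℂ) * e θ) (I * e θ)) θ := by
        intro θ _
        have h5 : HasDerivAt (fun θ => (ρ : ℂ) * e θ) ((ρ : ℂ) * (I * e θ)) θ := (hed θ).const_mul _
        have := (hdK _ (hin ρ hρ' θ)).comp_hasDerivAt θ h5
        have h6 : fderiv ℝ K ((ρ : ℂ) * e θ) ((ρ : ℂ) * (I * e θ)) = (ρ:ℂ) * fderiv ℝ K ((ρ : ℂ) * e θ) (I * e θ) := by
          rw [show (ρ : ℂ) * (I * e θ) = ρ • (I * e θ) by simp, map_smul]; simp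
        rw [h6] at this
        exact this
      have := intervalIntegral.integral_eq_sub_of_hasDerivAt hF
        (ContinuousOn.intervalIntegrable (continuousOn_const.mul (hcI.clm_apply (continuousOn_const.mul heC))))
      rw [intervalIntegral.integral_const_mul] at this
      have h7 : e (2 * Real.pi) = e 0 := by simp [he]
      rw [h7, sub_self] at this
      exact (mul_eq_zero.mp this).resolve_left (by exact_mod_cast hρ.1.ne')
    have h4 : ∫ θ in (0:ℝ)..2 * Real.pi, D ρ θ = deriv m ρ := by
      rw [h2]
      have h8 : ∀ θ, D ρ θ = fderiv ℝ K ((ρ : ℂ) * e θ) (e θ) + I * fderiv ℝ K ((ρ : ℂ) * e θ) (I * e θ) := by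
        intro θ
        have h9 := antiCDeriv_smul (f := K) (q := (ρ : ℂ) * e θ) (e θ)
        have h10 : (starRingEnd ℂ) (e θ) = cexp (-(θ * I)) := by
          rw [he]; simp only; rw [← Complex.exp_conj]; simp
        rw [h10] at h9
        change 2 * cexp (-(θ * I)) * antiCDeriv K ((ρ : ℂ) * e θ) 1 = _
        rw [mul_assoc, ← h9, antiCDeriv, smul_eq_mul]; ring
      simp only [h8]
      rw [intervalIntegral.integral_add, intervalIntegral.integral_const_mul, h3]
      · simp
      · exact ContinuousOn.intervalIntegrable (hcI.clm_apply heC)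
      · exact ContinuousOn.intervalIntegrable (continuousOn_const.mul (hcI.clm_apply (continuousOn_const.mul heC)))
    rw [h4]; exact h1
  have hFTC := intervalIntegral.integral_eq_sub_of_hasDerivAt_of_le zero_le_one hmc hderiv
    (ContinuousOn.intervalIntegrable (by
      rw [uIcc_of_le zero_le_one]
      exact paramInt_continuousOn (X := ℝ) h2pi (K := D) hDc))
  change _ = _ + ∫ ρ in (0:ℝ)..1, ∫ θ in (0:ℝ)..2 * Real.pi, D ρ θ
  rw [hFTC]
  simp [hm, he]

structure GraphData {m : ℕ} (φ : (Fin m → ℂ) × ℝ → ℝ) (R : ℝ) : Prop where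
  rpos : 0 < R
  smooth : ContDiffOn ℝ 2 φ (ball 0 R)
  zero : φ 0 = 0
  lip : ∀ p ∈ ball 0 R, ∀ q ∈ ball 0 R, |φ p - φ q| ≤ ‖p - q‖ / 8

def gZ {m : ℕ} (φ : (Fin m → ℂ) × ℝ → ℝ) (p : (Fin m → ℂ) × ℝ) : ℂ := p.2 + I * φ p

def gZu {m : ℕ} (φ : (Fin m → ℂ) × ℝ → ℝ) (p : (Fin m → ℂ) × ℝ) : ℂ :=
  fderiv ℝ (gZ φ) p (0, 1)

def dbarW {m : ℕ} (g : (Fin m → ℂ) × ℝ → ℂ) (p : (Fin m → ℂ) × ℝ) (v : Fin m → ℂ) : ℂ :=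
  (fderiv ℝ g p (v, 0) + I * fderiv ℝ g p (I • v, 0)) / 2

structure IsCRg {m : ℕ} (φ : (Fin m → ℂ) × ℝ → ℝ) (R : ℝ) (f : (Fin m → ℂ) × ℝ → ℂ) : Prop where
  smooth : ContDiffOn ℝ 1 f (ball 0 R)
  cr : ∀ p ∈ ball 0 R, ∀ v, dbarW f p v * gZu φ p = dbarW (gZ φ) p v * fderiv ℝ f p (0, 1)

theorem mem_ball_WR {m : ℕ} {w : Fin m → ℂ} {u R : ℝ} (hw : ‖w‖ < R) (hu : |u| < R) :
    (w, u) ∈ ball (0 : (Fin m → ℂ) × ℝ) R := by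
  rw [mem_ball_zero_iff, Prod.norm_def]; exact max_lt hw hu

section
variable {m : ℕ} {φ : (Fin m → ℂ) × ℝ → ℝ} {R : ℝ}

theorem GraphData.smoothZ (G : GraphData φ R) : ContDiffOn ℝ 2 (gZ φ) (ball 0 R) := by
  have h1 : ContDiff ℝ 2 fun p : (Fin m → ℂ) × ℝ => (p.2 : ℂ) := Complex.ofRealCLM.contDiff.comp contDiff_snd
  exact h1.contDiffOn.add (contDiffOn_const.mul (Complex.ofRealCLM.contDiff.comp_contDiffOn G.smooth))

theorem gZ_re (p : (Fin m → ℂ) × ℝ) : (gZ φ p).re = p.2 := by simp [gZ]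
theorem gZ_im (p : (Fin m → ℂ) × ℝ) : (gZ φ p).im = φ p := by simp [gZ]

theorem GraphData.hasZ (G : GraphData φ R) {p} (hp : p ∈ ball 0 R) : HasFDerivAt (gZ φ) (fderiv ℝ (gZ φ) p) p :=
  ((G.smoothZ.differentiableOn (by norm_num)).differentiableAt (isOpen_ball.mem_nhds hp)).hasFDerivAt

theorem GraphData.smoothDZ (G : GraphData φ R) : ContDiffOn ℝ 1 (fderiv ℝ (gZ φ)) (ball 0 R) :=
  G.smoothZ.fderiv_of_isOpen isOpen_ball (by norm_num)

theorem GraphData.smoothDZe (G : GraphData φ R) (e) : ContDiffOn ℝ 1 (fun p => fderiv ℝ (gZ φ) p e) (ball 0 R) :=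
  G.smoothDZ.clm_apply contDiffOn_const

theorem GraphData.smoothZu (G : GraphData φ R) : ContDiffOn ℝ 1 (gZu φ) (ball 0 R) := G.smoothDZe _

theorem GraphData.smoothdbar (G : GraphData φ R) (v) : ContDiffOn ℝ 1 (fun p => dbarW (gZ φ) p v) (ball 0 R) := by
  simp only [dbarW]
  exact ((G.smoothDZe _).add (contDiffOn_const.mul (G.smoothDZe _))).div_const _

theorem hasFDerivAt_of_C1 {E F : Type*} [NormedAddCommGroup E] [NormedSpace ℝ E] [NormedAddCommGroup F] [NormedSpace ℝ F]
    {f : E → F} {U : Set E} (hf : ContDiffOn ℝ 1 f U) (hU : IsOpen U) {p : E} (hp : p ∈ U) :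
    HasFDerivAt f (fderiv ℝ f p) p :=
  ((hf.differentiableOn (by norm_num)).differentiableAt (hU.mem_nhds hp)).hasFDerivAt

theorem GraphData.symm (G : GraphData φ R) {p} (hp : p ∈ ball 0 R) (e d) :
    fderiv ℝ (fun p => fderiv ℝ (gZ φ) p e) p d = fderiv ℝ (fun p => fderiv ℝ (gZ φ) p d) p e := by
  have h1 : HasFDerivAt (fderiv ℝ (gZ φ)) _ p := hasFDerivAt_of_C1 G.smoothDZ isOpen_ball hp
  have h2 : ∀ e, HasFDerivAt (fun p => fderiv ℝ (gZ φ) p e) _ p := fun e => h1.clm_apply (hasFDerivAt_const e p)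
  rw [(h2 e).fderiv, (h2 d).fderiv]
  have hs : IsSymmSndFDerivAt ℝ (gZ φ) p :=
    (G.smoothZ.contDiffAt (isOpen_ball.mem_nhds hp)).isSymmSndFDerivAt (by simp)
  simpa using hs d e

theorem GraphData.dbar_symm (G : GraphData φ R) {p} (hp : p ∈ ball 0 R) (v) :
    dbarW (gZu φ) p v = fderiv ℝ (fun p => dbarW (gZ φ) p v) p (0, 1) := by
  have h : ∀ e, HasFDerivAt (fun p => fderiv ℝ (gZ φ) p e) _ p := fun e => hasFDerivAt_of_C1 (G.smoothDZe e) isOpen_ball hp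
  have h1 := ((h (v, 0)).fun_add ((h (I • v, 0)).const_mul I)).mul_const (2:ℂ)⁻¹
  have e1 : (fun p => dbarW (gZ φ) p v) = fun p => (fderiv ℝ (gZ φ) p (v, 0) + I * fderiv ℝ (gZ φ) p (I • v, 0)) * (2:ℂ)⁻¹ := by
    ext p; rw [dbarW, div_eq_mul_inv]
  rw [e1, h1.fderiv]
  simp only [dbarW]
  have e2 : gZu φ = fun p => fderiv ℝ (gZ φ) p (0, 1) := rfl
  rw [e2, G.symm hp (0, 1), G.symm hp (0, 1)]
  simp
  ring

/-- Offset Cauchy transform. -/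
def cauC (φ : (Fin m → ℂ) × ℝ → ℝ) (f : (Fin m → ℂ) × ℝ → ℂ) (a : ℝ) (x : CS m) : ℂ :=
  ∫ u in -a..a, f (x.1, u) * gZu φ (x.1, u) * (gZ φ (x.1, u) - x.2)⁻¹

def cauB (φ : (Fin m → ℂ) × ℝ → ℝ) (f : (Fin m → ℂ) × ℝ → ℂ) (u : ℝ) (x : CS m) (v : Fin m → ℂ) : ℂ :=
  f (x.1, u) * dbarW (gZ φ) (x.1, u) v * (gZ φ (x.1, u) - x.2)⁻¹

def offM (φ : (Fin m → ℂ) × ℝ → ℝ) (R : ℝ) : Set (CS m) :=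
  {x | ‖x.1‖ < R ∧ |x.2.re| < R ∧ x.2.im ≠ φ (x.1, x.2.re)}

theorem GraphData.isOpen_cyl (R : ℝ) : IsOpen {x : CS m | ‖x.1‖ < R ∧ |x.2.re| < R} := by
  have h1 : Continuous fun x : CS m => ‖x.1‖ := by fun_prop
  have h2 : Continuous fun x : CS m => |x.2.re| := (continuous_re.comp continuous_snd).abs
  exact (isOpen_lt h1 continuous_const).inter (isOpen_lt h2 continuous_const)

theorem GraphData.cont_phi (G : GraphData φ R) :
    ContinuousOn (fun x : CS m => φ (x.1, x.2.re)) {x : CS m | ‖x.1‖ < R ∧ |x.2.re| < R} := by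
  refine G.smooth.continuousOn.comp (by fun_prop) fun x hx => mem_ball_WR hx.1 hx.2

theorem GraphData.isOpen_offM (G : GraphData φ R) : IsOpen (offM φ R) := by
  have h1 : ContinuousOn (fun x : CS m => x.2.im - φ (x.1, x.2.re)) {x : CS m | ‖x.1‖ < R ∧ |x.2.re| < R} :=
    ContinuousOn.sub (by fun_prop) G.cont_phi
  have := h1.isOpen_inter_preimage (GraphData.isOpen_cyl R) (isOpen_ne (x := (0:ℝ)))
  convert this using 1
  ext x
  simp [offM, sub_eq_zero, and_assoc]

theorem GraphData.ne_of_offM {x : CS m} (hx : x ∈ offM φ R) (u : ℝ) : gZ φ (x.1, u) - x.2 ≠ 0 := by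
  intro h
  rw [sub_eq_zero] at h
  have h1 : u = x.2.re := by rw [← h, gZ_re]
  apply hx.2.2
  rw [← h1, ← h, gZ_im]

theorem cauC_props (G : GraphData φ R) {f : (Fin m → ℂ) × ℝ → ℂ} (hf : IsCRg φ R f) {a : ℝ} (ha : 0 < a) (haR : a < R) :
    ContDiffOn ℝ 1 (cauC φ f a) (offM φ R) ∧ ∀ x ∈ offM φ R,
      (∀ c : ℂ, fderiv ℝ (cauC φ f a) x (0, I * c) = I * fderiv ℝ (cauC φ f a) x (0, c)) ∧
      ∀ v, antiCDeriv (cauC φ f a) x (v, 0) = cauB φ f a x v - cauB φ f (-a) x v := by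
  set O : Set (CS m × ℝ) := {p | ‖p.1.1‖ < R ∧ |p.2| < R} ∩ (fun p : CS m × ℝ => gZ φ (p.1.1, p.2) - p.1.2) ⁻¹' {y | y ≠ 0} with hO
  let π : (CS m × ℝ) →L[ℝ] ((Fin m → ℂ) × ℝ) :=
    ((ContinuousLinearMap.fst ℝ _ _).comp (ContinuousLinearMap.fst ℝ _ _)).prod (ContinuousLinearMap.snd ℝ _ _)
  let ζ : (CS m × ℝ) →L[ℝ] ℂ := (ContinuousLinearMap.snd ℝ _ _).comp (ContinuousLinearMap.fst ℝ _ _)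
  have hπ : ∀ p, π p = (p.1.1, p.2) := fun p => rfl
  have hζ : ∀ p, ζ p = p.1.2 := fun p => rfl
  have hcyl : IsOpen {p : CS m × ℝ | ‖p.1.1‖ < R ∧ |p.2| < R} := by
    have h1 : Continuous fun p : CS m × ℝ => ‖p.1.1‖ := by fun_prop
    have h2 : Continuous fun p : CS m × ℝ => |p.2| := by fun_prop
    exact (isOpen_lt h1 continuous_const).inter (isOpen_lt h2 continuous_const)
  have hπm : MapsTo π {p : CS m × ℝ | ‖p.1.1‖ < R ∧ |p.2| < R} (ball 0 R) := fun p hp => mem_ball_WR hp.1 hp.2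
  have hZm : ContDiffOn ℝ 1 (fun p : CS m × ℝ => gZ φ (p.1.1, p.2) - p.1.2) {p : CS m × ℝ | ‖p.1.1‖ < R ∧ |p.2| < R} :=
    ((G.smoothZ.of_le (by norm_num)).comp π.contDiff.contDiffOn hπm).sub ζ.contDiff.contDiffOn
  have hOo : IsOpen O := hZm.continuousOn.isOpen_inter_preimage hcyl isOpen_ne
  have hA : ContDiffOn ℝ 1 (fun p => f p * gZu φ p) (ball 0 R) := hf.smooth.mul G.smoothZu
  have hk : ContDiffOn ℝ 1 (fun p : CS m × ℝ => f (p.1.1, p.2) * gZu φ (p.1.1, p.2) * (gZ φ (p.1.1, p.2) - p.1.2)⁻¹) O :=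
    ((hA.comp π.contDiff.contDiffOn hπm).mono inter_subset_left).mul ((hZm.mono inter_subset_left).inv (fun p hp => hp.2))
  have hsub : ∀ x ∈ offM φ R, ∀ t ∈ Icc (-a) a, (x, t) ∈ O := by
    intro x hx t ht
    exact ⟨⟨hx.1, (abs_le.mpr ht).trans_lt haR⟩, GraphData.ne_of_offM hx t⟩
  obtain ⟨h1, h2⟩ := paramInt_C1 hOo hk G.isOpen_offM (by linarith : -a ≤ a) hsub
  refine ⟨h1, fun x hx => ?_⟩
  have hC : cauC φ f a = fun x : CS m => ∫ u in -a..a, (fun p : CS m × ℝ => f (p.1.1, p.2) * gZu φ (p.1.1, p.2) * (gZ φ (p.1.1, p.2) - p.1.2)⁻¹) (x, u) := rfl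
  replace h2 := h2 x hx
  have hin : ∀ t ∈ Icc (-a) a, (x.1, t) ∈ ball (0 : (Fin m → ℂ) × ℝ) R := fun t ht =>
    mem_ball_WR hx.1 ((abs_le.mpr ht).trans_lt haR)
  have hkd : ∀ t ∈ Icc (-a) a, ∀ v c, fderiv ℝ (fun p : CS m × ℝ => f (p.1.1, p.2) * gZu φ (p.1.1, p.2) * (gZ φ (p.1.1, p.2) - p.1.2)⁻¹) (x, t) ((v, c), 0) =
      (fderiv ℝ f (x.1, t) (v, 0) * gZu φ (x.1, t) + f (x.1, t) * fderiv ℝ (gZu φ) (x.1, t) (v, 0)) * (gZ φ (x.1, t) - x.2)⁻¹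
      - f (x.1, t) * gZu φ (x.1, t) * ((fderiv ℝ (gZ φ) (x.1, t) (v, 0) - c) * ((gZ φ (x.1, t) - x.2) ^ 2)⁻¹) := by
    intro t ht v c
    have hp := hin t ht
    have d1 : HasFDerivAt (fun p : CS m × ℝ => f (p.1.1, p.2)) ((fderiv ℝ (f) (x.1, t)).comp π) (x, t) :=
      HasFDerivAt.comp (g := f) (f := π) (x, t) (hasFDerivAt_of_C1 hf.smooth isOpen_ball hp) π.hasFDerivAt
    have d2 : HasFDerivAt (fun p : CS m × ℝ => gZu φ (p.1.1, p.2)) ((fderiv ℝ (gZu φ) (x.1, t)).comp π) (x, t) :=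
      HasFDerivAt.comp (g := gZu φ) (f := π) (x, t) (hasFDerivAt_of_C1 G.smoothZu isOpen_ball hp) π.hasFDerivAt
    have d3 : HasFDerivAt (fun p : CS m × ℝ => gZ φ (p.1.1, p.2)) ((fderiv ℝ (gZ φ) (x.1, t)).comp π) (x, t) :=
      HasFDerivAt.comp (g := gZ φ) (f := π) (x, t) (G.hasZ hp) π.hasFDerivAt
    have hne := GraphData.ne_of_offM hx t
    have d4 : HasFDerivAt (fun p : CS m × ℝ => (gZ φ (p.1.1, p.2) - p.1.2)) _ (x, t) := d3.sub ζ.hasFDerivAt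
    have d5 := (hasDerivAt_inv hne).comp_hasFDerivAt (x, t) d4
    have d6 := (d1.fun_mul d2).fun_mul d5
    have d7 := HasFDerivAt.fderiv d6
    simp only [Function.comp_apply] at d7
    rw [d7]
    simp only [ContinuousLinearMap.add_apply, ContinuousLinearMap.smul_apply, ContinuousLinearMap.comp_apply, hπ, hζ,
      ContinuousLinearMap.sub_apply, smul_eq_mul, Function.comp_apply]
    ring
  have hsubu : ∀ t ∈ uIcc (-a) a, t ∈ Icc (-a) a := by intro t ht; rwa [uIcc_of_le (by linarith)] at ht
  have hntg : ∀ e, IntervalIntegrable (fun t => fderiv ℝ (fun p : CS m × ℝ => f (p.1.1, p.2) * gZu φ (p.1.1, p.2) * (gZ φ (p.1.1, p.2) - p.1.2)⁻¹) (x, t) e)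
      MeasureTheory.volume (-a) a := by
    intro e
    apply ContinuousOn.intervalIntegrable
    have := (hk.continuousOn_fderiv_of_isOpen hOo le_rfl).comp (f := fun t : ℝ => (x, t)) (s := uIcc (-a) a) (by fun_prop)
      (fun t ht => hsub x hx t (hsubu t ht))
    exact this.clm_apply continuousOn_const
  constructor
  · intro c
    rw [hC, h2, h2, ← intervalIntegral.integral_const_mul]
    refine intervalIntegral.integral_congr fun t ht => ?_
    rw [hkd t (hsubu t ht), hkd t (hsubu t ht)]
    have : ((0, 0) : (Fin m → ℂ) × ℝ) = 0 := rfl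
    simp only [this, map_zero]
    ring
  · intro v
    have hβ : ∀ t ∈ uIcc (-a) a, HasDerivAt (fun t => cauB φ f t x v)
        ((fderiv ℝ (fun p : CS m × ℝ => f (p.1.1, p.2) * gZu φ (p.1.1, p.2) * (gZ φ (p.1.1, p.2) - p.1.2)⁻¹) (x, t) ((v, 0), 0) +
          I * fderiv ℝ (fun p : CS m × ℝ => f (p.1.1, p.2) * gZu φ (p.1.1, p.2) * (gZ φ (p.1.1, p.2) - p.1.2)⁻¹) (x, t) ((I • v, 0), 0)) / 2) t := by
      intro t ht
      rw [hkd t (hsubu t ht), hkd t (hsubu t ht)]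
      have hp := hin t (hsubu t ht)
      have hl : HasDerivAt (fun t : ℝ => (x.1, t)) ((0 : Fin m → ℂ), (1:ℝ)) t := (hasDerivAt_const t x.1).prodMk (hasDerivAt_id t)
      have d1 := (hasFDerivAt_of_C1 hf.smooth isOpen_ball hp).comp_hasDerivAt t hl
      have d2 := (hasFDerivAt_of_C1 (G.smoothdbar v) isOpen_ball hp).comp_hasDerivAt t hl
      have d3 := ((G.hasZ hp).comp_hasDerivAt t hl).sub_const x.2
      have hne := GraphData.ne_of_offM hx t
      have d4 := (d1.fun_mul d2).fun_mul (d3.fun_inv hne)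
      refine d4.congr_deriv ?_
      have hcr := hf.cr _ hp v
      have hsy := G.dbar_symm hp v
      simp only [Function.comp_apply] at *
      rw [← hsy]
      change (_ * _ + _ * _) * _ + _ * (-gZu φ (x.1, t) / _) = _
      simp only [dbarW] at *
      field_simp
      linear_combination (-2 * (gZ φ (x.1, t) - x.2)) * hcr
    have := intervalIntegral.integral_eq_sub_of_hasDerivAt hβ (((hntg _).add ((hntg _).const_mul I)).div_const 2)
    rw [← this, antiCDeriv]
    rw [hC, h2, h2, intervalIntegral.integral_div, intervalIntegral.integral_add (hntg _) ((hntg _).const_mul I), intervalIntegral.integral_const_mul]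
    simp
end

theorem isOpen_forall_compact {X Y : Type*} [TopologicalSpace X] [TopologicalSpace Y] {O : Set (X × Y)} (hO : IsOpen O)
    {K : Set Y} (hK : IsCompact K) : IsOpen {x | ∀ t ∈ K, (x, t) ∈ O} := by
  rw [isOpen_iff_mem_nhds]
  intro x hx
  exact hK.eventually_forall_of_forall_eventually (x₀ := x) (P := fun x t => (x, t) ∈ O) fun t ht => hO.mem_nhds (hx t ht)

theorem paramInt2_C1 {H : Type*} [NormedAddCommGroup H] [NormedSpace ℝ H] [FiniteDimensional ℝ H]
    {k : (H × ℝ) × ℝ → ℂ} {O : Set ((H × ℝ) × ℝ)}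
    (hO : IsOpen O) (hk : ContDiffOn ℝ 1 k O) {U : Set H} (hU : IsOpen U) {a b c d : ℝ} (hab : a ≤ b) (hcd : c ≤ d)
    (hsub : ∀ x ∈ U, ∀ s ∈ Icc a b, ∀ t ∈ Icc c d, ((x, s), t) ∈ O) :
    ContDiffOn ℝ 1 (fun x => ∫ s in a..b, ∫ t in c..d, k ((x, s), t)) U ∧
    ∀ x ∈ U, ∀ v, fderiv ℝ (fun x => ∫ s in a..b, ∫ t in c..d, k ((x, s), t)) x v =
      ∫ s in a..b, ∫ t in c..d, fderiv ℝ k ((x, s), t) ((v, 0), 0) := by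
  have hU' := isOpen_forall_compact hO (isCompact_Icc (a := c) (b := d))
  obtain ⟨h1, h2⟩ := paramInt_C1 hO hk hU' hcd (fun x hx => hx)
  obtain ⟨h3, h4⟩ := paramInt_C1 hU' h1 hU hab (fun x hx s hs => hsub x hx s hs)
  refine ⟨h3, fun x hx v => ?_⟩
  rw [h4 x hx v]
  refine intervalIntegral.integral_congr fun s hs => ?_
  rw [uIcc_of_le hab] at hs
  exact h2 (x, s) (hsub x hx s hs) (v, 0)

section
variable {m : ℕ} {φ : (Fin m → ℂ) × ℝ → ℝ} {R : ℝ}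

def cauD (φ : (Fin m → ℂ) × ℝ → ℝ) (f : (Fin m → ℂ) × ℝ → ℂ) (a : ℝ) (x : CS m) (v : Fin m → ℂ) : ℂ :=
  cauB φ f a x v - cauB φ f (-a) x v

def cyl (m : ℕ) (R a : ℝ) : Set (CS m) := {x | ‖x.1‖ < R ∧ |x.2.re| < a}

theorem isOpen_cyl' (R a : ℝ) : IsOpen (cyl m R a) := by
  have h1 : Continuous fun x : CS m => ‖x.1‖ := by fun_prop
  have h2 : Continuous fun x : CS m => |x.2.re| := (continuous_re.comp continuous_snd).abs
  exact (isOpen_lt h1 continuous_const).inter (isOpen_lt h2 continuous_const)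

theorem cauB_ne {a u : ℝ} {x : CS m} (hx : |x.2.re| < a) (hu : |u| = a) : gZ φ (x.1, u) - x.2 ≠ 0 := by
  intro h
  rw [sub_eq_zero] at h
  have h1 : u = x.2.re := by rw [← h, gZ_re]
  rw [← h1, hu] at hx
  exact lt_irrefl _ hx

theorem cauB_smooth (G : GraphData φ R) {f : (Fin m → ℂ) × ℝ → ℂ} (hf : IsCRg φ R f) {a u : ℝ} (haR : a < R) (hu : |u| = a) :
    ContDiffOn ℝ 1 (fun p : CS m × (Fin m → ℂ) => cauB φ f u p.1 p.2) (cyl m R a ×ˢ univ) := by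
  let ι : (CS m × (Fin m → ℂ)) → (Fin m → ℂ) × ℝ := fun p => (p.1.1, u)
  have hι : ContDiff ℝ 1 ι := by fun_prop
  have hm : MapsTo ι (cyl m R a ×ˢ univ) (ball 0 R) := fun p hp => mem_ball_WR hp.1.1 (by rw [hu]; exact haR)
  have h1 : ContDiffOn ℝ 1 (fun p : CS m × (Fin m → ℂ) => f (ι p)) (cyl m R a ×ˢ univ) := hf.smooth.comp hι.contDiffOn hm
  have h2 : ContDiffOn ℝ 1 (fun p : CS m × (Fin m → ℂ) => gZ φ (ι p) - p.1.2) (cyl m R a ×ˢ univ) :=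
    ((G.smoothZ.of_le (by norm_num)).comp hι.contDiffOn hm).sub (by fun_prop)
  have h3 : ContDiffOn ℝ 1 (fun p : CS m × (Fin m → ℂ) => fderiv ℝ (gZ φ) (ι p)) (cyl m R a ×ˢ univ) :=
    G.smoothDZ.comp hι.contDiffOn hm
  have h4 : ContDiffOn ℝ 1 (fun p : CS m × (Fin m → ℂ) => dbarW (gZ φ) (ι p) p.2) (cyl m R a ×ˢ univ) := by
    simp only [dbarW]
    have l1 : ContDiff ℝ 1 fun p : CS m × (Fin m → ℂ) => (p.2, (0:ℝ)) := by fun_prop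
    have l2 : ContDiff ℝ 1 fun p : CS m × (Fin m → ℂ) => (I • p.2, (0:ℝ)) := (contDiff_snd.const_smul I).prodMk contDiff_const
    exact ((h3.clm_apply l1.contDiffOn).add (contDiffOn_const.mul (h3.clm_apply l2.contDiffOn))).div_const _
  exact (h1.mul h4).mul (h2.inv fun p hp => cauB_ne hp.1.2 hu)

theorem cauD_smooth (G : GraphData φ R) {f : (Fin m → ℂ) × ℝ → ℂ} (hf : IsCRg φ R f) {a : ℝ} (ha : 0 < a) (haR : a < R) :
    ContDiffOn ℝ 1 (fun p : CS m × (Fin m → ℂ) => cauD φ f a p.1 p.2) (cyl m R a ×ˢ univ) :=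
  (cauB_smooth G hf haR (abs_of_pos ha)).sub (cauB_smooth G hf haR (by rw [abs_neg, abs_of_pos ha]))

theorem cauD_holz (f : (Fin m → ℂ) × ℝ → ℂ) {a : ℝ} (ha : 0 < a) {x : CS m} (hx : |x.2.re| < a) (v) :
    DifferentiableAt ℂ (fun z => cauD φ f a (x.1, z) v) x.2 := by
  have h : ∀ u, |u| = a → DifferentiableAt ℂ (fun z => cauB φ f u (x.1, z) v) x.2 := by
    intro u hu
    have := cauB_ne (φ := φ) hx hu
    simp only [cauB]
    refine DifferentiableAt.mul (by fun_prop) (DifferentiableAt.inv (by fun_prop) this)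
  exact (h a (abs_of_pos ha)).sub (h (-a) (by rw [abs_neg, abs_of_pos ha]))

/-- relation between real derivative and slice holomorphy -/
theorem fderiv_slice_iff {g : CS m → ℂ} {x : CS m} (hg : DifferentiableAt ℝ g x) :
    DifferentiableAt ℂ (fun z => g (x.1, z)) x.2 ↔ ∀ c : ℂ, fderiv ℝ g x (0, I * c) = I * fderiv ℝ g x (0, c) := by
  have hl : HasFDerivAt (fun z : ℂ => (x.1, z)) (ContinuousLinearMap.inr ℝ (Fin m → ℂ) ℂ) x.2 := hasFDerivAt_prodMk_right x.1 x.2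
  have hc : HasFDerivAt (fun z => g (x.1, z)) ((fderiv ℝ g x).comp (ContinuousLinearMap.inr ℝ (Fin m → ℂ) ℂ)) x.2 :=
    HasFDerivAt.comp (g := g) x.2 hg.hasFDerivAt hl
  constructor
  · intro h c
    have h1 := h.hasFDerivAt.restrictScalars ℝ
    have h2 := hc.unique h1
    have h3 : ∀ c, fderiv ℝ g x (0, c) = (fderiv ℂ (fun z => g (x.1, z)) x.2) c := fun c => by
      simpa using congrArg (fun L => L c) h2
    rw [h3, h3, ← smul_eq_mul, map_smul, smul_eq_mul]
  · intro h
    refine differentiableAt_complex_of_real hc.differentiableAt fun v => ?_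
    rw [hc.fderiv]
    simpa using h v

end

section
variable {m : ℕ} {φ : (Fin m → ℂ) × ℝ → ℝ} {R : ℝ}

theorem fderiv_partial_left {H Y : Type*} [NormedAddCommGroup H] [NormedSpace ℝ H] [NormedAddCommGroup Y] [NormedSpace ℝ Y]
    {k : H × Y → ℂ} {x : H} {t : Y} (hk : DifferentiableAt ℝ k (x, t)) (v : H) :
    DifferentiableAt ℝ (fun x => k (x, t)) x ∧ fderiv ℝ k (x, t) (v, 0) = fderiv ℝ (fun x => k (x, t)) x v := by
  have hl : HasFDerivAt (fun x : H => (x, t)) (ContinuousLinearMap.inl ℝ H Y) x := hasFDerivAt_prodMk_left x t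
  have hc : HasFDerivAt (fun x => k (x, t)) _ x := HasFDerivAt.comp (g := k) x hk.hasFDerivAt hl
  refine ⟨hc.differentiableAt, ?_⟩
  rw [hc.fderiv]; simp

def discD (Λ : ℂ → (Fin m → ℂ)) (qd : ℂ → ℂ) (ζ : ℂ) : CS m := (Λ ζ, qd ζ)

def ext1 (φ : (Fin m → ℂ) × ℝ → ℝ) (f : (Fin m → ℂ) × ℝ → ℂ) (a : ℝ) (Λ : ℂ → (Fin m → ℂ)) (qd : ℂ → ℂ) (x : CS m) : ℂ :=
  ∫ θ in (0:ℝ)..(2 * Real.pi), cauC φ f a (x + discD Λ qd (cexp (θ * I)))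

def ext2 (φ : (Fin m → ℂ) × ℝ → ℝ) (f : (Fin m → ℂ) × ℝ → ℂ) (a : ℝ) (Λ : ℂ → (Fin m → ℂ)) (qd : ℂ → ℂ) (x : CS m) : ℂ :=
  ∫ s in (0:ℝ)..1, ∫ θ in (0:ℝ)..(2 * Real.pi), 2 * cexp (-(θ * I)) *
    cauD φ f a (x + discD Λ qd (s * cexp (θ * I))) (deriv Λ (s * cexp (θ * I)))

theorem norm_cexp_I (θ : ℝ) : ‖cexp (θ * I)‖ = 1 := Complex.norm_exp_ofReal_mul_I θ

def HolZ (g : CS m → ℂ) (U : Set (CS m)) : Prop := ∀ x ∈ U, DifferentiableAt ℂ (fun z => g (x.1, z)) x.2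

theorem HolZ.of_fderiv {g : CS m → ℂ} {U : Set (CS m)} (hU : IsOpen U) (hg : ContDiffOn ℝ 1 g U)
    (h : ∀ x ∈ U, ∀ c : ℂ, fderiv ℝ g x (0, I * c) = I * fderiv ℝ g x (0, c)) : HolZ g U := fun x hx =>
  (fderiv_slice_iff (hasFDerivAt_of_C1 hg hU hx).differentiableAt).2 (h x hx)

theorem cauC_holz (G : GraphData φ R) {f : (Fin m → ℂ) × ℝ → ℂ} (hf : IsCRg φ R f) {a : ℝ} (ha : 0 < a) (haR : a < R) :
    HolZ (cauC φ f a) (offM φ R) :=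
  HolZ.of_fderiv G.isOpen_offM (cauC_props G hf ha haR).1 fun x hx => ((cauC_props G hf ha haR).2 x hx).1

theorem ext1_props (G : GraphData φ R) {f : (Fin m → ℂ) × ℝ → ℂ} (hf : IsCRg φ R f) {a : ℝ} (ha : 0 < a) (haR : a < R)
    {Λ : ℂ → (Fin m → ℂ)} {qd : ℂ → ℂ} (hΛ : Differentiable ℂ Λ) (hq : Differentiable ℂ qd) {P : Set (CS m)} (hP : IsOpen P)
    (hb : ∀ x ∈ P, ∀ ζ : ℂ, ‖ζ‖ = 1 → x + discD Λ qd ζ ∈ offM φ R) :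
    ContDiffOn ℝ 1 (ext1 φ f a Λ qd) P ∧ HolZ (ext1 φ f a Λ qd) P := by
  have hD : ContDiff ℝ 1 (discD Λ qd) := (hΛ.contDiff.restrict_scalars ℝ).prodMk (hq.contDiff.restrict_scalars ℝ)
  have he : ContDiff ℝ 1 (fun p : CS m × ℝ => p.1 + discD Λ qd (cexp (p.2 * I))) := by
    have : ContDiff ℝ 1 fun p : CS m × ℝ => cexp (p.2 * I) :=
      ((Complex.ofRealCLM.contDiff.comp contDiff_snd).mul contDiff_const).cexp
    exact contDiff_fst.add (hD.comp this)
  obtain ⟨c1, c2⟩ := cauC_props G hf ha haR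
  have hk : ContDiffOn ℝ 1 (fun p : CS m × ℝ => cauC φ f a (p.1 + discD Λ qd (cexp (p.2 * I))))
      ((fun p : CS m × ℝ => p.1 + discD Λ qd (cexp (p.2 * I))) ⁻¹' offM φ R) := c1.comp he.contDiffOn (fun p hp => hp)
  have hO := G.isOpen_offM.preimage he.continuous
  obtain ⟨h1, h2⟩ := paramInt_C1 hO hk hP Real.two_pi_pos.le
    (fun x hx t ht => hb x hx _ (norm_cexp_I t))
  refine ⟨h1, HolZ.of_fderiv hP h1 fun x hx c => ?_⟩
  unfold ext1
  rw [h2 x hx, h2 x hx, ← intervalIntegral.integral_const_mul]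
  refine intervalIntegral.integral_congr fun t ht => ?_
  have hm : x + discD Λ qd (cexp (t * I)) ∈ offM φ R := hb x hx _ (norm_cexp_I t)
  have hd := (hasFDerivAt_of_C1 hk hO (p := (x, t)) hm).differentiableAt
  obtain ⟨e1, -⟩ := fderiv_partial_left hd 0
  rw [(fderiv_partial_left hd _).2, (fderiv_partial_left hd _).2]
  refine (fderiv_slice_iff e1).1 ?_ c
  have := cauC_holz G hf ha haR _ hm
  exact DifferentiableAt.comp (g := fun z => cauC φ f a (x.1 + Λ (cexp (t * I)), z)) x.2 this
    (f := fun z => z + qd (cexp (t * I))) (by fun_prop)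

theorem ext2_props (G : GraphData φ R) {f : (Fin m → ℂ) × ℝ → ℂ} (hf : IsCRg φ R f) {a : ℝ} (ha : 0 < a) (haR : a < R)
    {Λ : ℂ → (Fin m → ℂ)} {qd : ℂ → ℂ} (hΛ : Differentiable ℂ Λ) (hq : Differentiable ℂ qd) {P : Set (CS m)} (hP : IsOpen P)
    (hb : ∀ x ∈ P, ∀ ζ : ℂ, ‖ζ‖ ≤ 1 → x + discD Λ qd ζ ∈ cyl m R a) :
    ContDiffOn ℝ 1 (ext2 φ f a Λ qd) P ∧ HolZ (ext2 φ f a Λ qd) P := by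
  have hD : ContDiff ℝ 1 (discD Λ qd) := (hΛ.contDiff.restrict_scalars ℝ).prodMk (hq.contDiff.restrict_scalars ℝ)
  have h0 : ContDiff ℝ 1 fun p : (CS m × ℝ) × ℝ => (p.1.2 : ℂ) * cexp (p.2 * I) :=
      (Complex.ofRealCLM.contDiff.comp (contDiff_snd.comp contDiff_fst)).mul
      ((Complex.ofRealCLM.contDiff.comp contDiff_snd).mul contDiff_const).cexp
  have h0' : ContDiff ℝ 1 fun p : (CS m × ℝ) × ℝ => 2 * cexp (-(p.2 * I)) :=
      contDiff_const.mul (((Complex.ofRealCLM.contDiff.comp contDiff_snd).mul contDiff_const).neg).cexp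
  have he : ContDiff ℝ 1 (fun p : (CS m × ℝ) × ℝ => (p.1.1 + discD Λ qd (p.1.2 * cexp (p.2 * I)), deriv Λ (p.1.2 * cexp (p.2 * I)))) := by
    have hΛ' : ContDiff ℝ 1 (deriv Λ) := by
      have : ContDiff ℂ 1 (deriv Λ) := by
        have h2 : ContDiff ℂ 2 Λ := hΛ.contDiff
        have e : ((1 : WithTop ℕ∞) + 1) = 2 := by norm_num
        exact (contDiff_succ_iff_deriv (n := 1).1 (by rw [e]; exact h2)).2.2
      exact this.restrict_scalars ℝ
    exact ((contDiff_fst.comp contDiff_fst).add (hD.comp h0)).prodMk (hΛ'.comp h0)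
  have c1 := cauD_smooth G hf ha haR
  have hO : IsOpen ((fun p : (CS m × ℝ) × ℝ => (p.1.1 + discD Λ qd (p.1.2 * cexp (p.2 * I)), deriv Λ (p.1.2 * cexp (p.2 * I)))) ⁻¹'
      (cyl m R a ×ˢ univ)) := ((isOpen_cyl' R a).prod isOpen_univ).preimage he.continuous
  have hk0 := c1.comp (s := ((fun p : (CS m × ℝ) × ℝ => (p.1.1 + discD Λ qd (p.1.2 * cexp (p.2 * I)), deriv Λ (p.1.2 * cexp (p.2 * I)))) ⁻¹'
      (cyl m R a ×ˢ univ))) he.contDiffOn (fun p hp => hp)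
  have hk := h0'.contDiffOn.mul hk0
  have hm : ∀ x ∈ P, ∀ s ∈ Icc (0:ℝ) 1, ∀ t : ℝ, x + discD Λ qd (s * cexp (t * I)) ∈ cyl m R a := by
    intro x hx s hs t
    refine hb x hx _ ?_
    rw [norm_mul, norm_cexp_I, mul_one, Complex.norm_real, Real.norm_eq_abs, abs_of_nonneg hs.1]
    exact hs.2
  obtain ⟨h1, h2⟩ := paramInt2_C1 hO hk hP zero_le_one Real.two_pi_pos.le
    (fun x hx s hs t ht => ⟨hm x hx s hs t, trivial⟩)
  refine ⟨h1, HolZ.of_fderiv hP h1 fun x hx c => ?_⟩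
  unfold ext2
  have h2' := h2 x hx
  simp only [Function.comp_apply] at h2'
  rw [h2', h2', ← intervalIntegral.integral_const_mul]
  refine intervalIntegral.integral_congr fun s hs => ?_
  rw [← intervalIntegral.integral_const_mul]
  refine intervalIntegral.integral_congr fun t ht => ?_
  rw [uIcc_of_le zero_le_one] at hs
  have hms := hm x hx s hs t
  have hd := (hasFDerivAt_of_C1 hk hO (p := ((x, s), t)) ⟨hms, trivial⟩).differentiableAt
  simp only [Function.comp_apply] at hd
  obtain ⟨e1, -⟩ := fderiv_partial_left hd 0
  rw [(fderiv_partial_left hd _).2, (fderiv_partial_left hd _).2]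
  obtain ⟨e2, -⟩ := fderiv_partial_left e1 0
  rw [(fderiv_partial_left e1 _).2, (fderiv_partial_left e1 _).2]
  refine (fderiv_slice_iff e2).1 ?_ c
  have := cauD_holz (φ := φ) f ha hms.2 (deriv Λ (s * cexp (t * I)))
  refine DifferentiableAt.mul (differentiableAt_const (2 * cexp (-((t:ℂ) * I)))) ?_
  exact DifferentiableAt.comp (g := fun z => cauD φ f a (x.1 + Λ (s * cexp (t * I)), z) (deriv Λ (s * cexp (t * I)))) x.2 this
    (f := fun z => z + qd (s * cexp (t * I))) (by fun_prop)
end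

section
variable {m : ℕ} {φ : (Fin m → ℂ) × ℝ → ℝ} {R : ℝ}

theorem ext_low (G : GraphData φ R) {f : (Fin m → ℂ) × ℝ → ℂ} (hf : IsCRg φ R f) {a : ℝ} (ha : 0 < a) (haR : a < R)
    {Λ : ℂ → (Fin m → ℂ)} {qd : ℂ → ℂ} (hΛ : Differentiable ℂ Λ) (hq : Differentiable ℂ qd) (hΛ0 : Λ 0 = 0) (hq0 : qd 0 = 0)
    {x : CS m} (hx : ∀ ζ : ℂ, ‖ζ‖ ≤ 1 → x + discD Λ qd ζ ∈ offM φ R) :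
    ext1 φ f a Λ qd x = 2 * Real.pi * cauC φ f a x + ext2 φ f a Λ qd x := by
  have hD : ContDiff ℝ 1 (discD Λ qd) := (hΛ.contDiff.restrict_scalars ℝ).prodMk (hq.contDiff.restrict_scalars ℝ)
  have hD' : ContDiff ℝ 1 fun ζ => x + discD Λ qd ζ := contDiff_const.add hD
  obtain ⟨c1, c2⟩ := cauC_props G hf ha haR
  have hU := G.isOpen_offM.preimage hD'.continuous
  have hK : ContDiffOn ℝ 1 (fun ζ => cauC φ f a (x + discD Λ qd ζ)) ((fun ζ => x + discD Λ qd ζ) ⁻¹' offM φ R) :=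
    c1.comp hD'.contDiffOn fun p hp => hp
  have := pompeiu hU hK (fun ζ hζ => hx ζ (by simpa using hζ))
  unfold ext1 ext2
  rw [this]
  congr 1
  · simp [discD, hΛ0, hq0]
    congr 1
    exact add_zero x
  refine intervalIntegral.integral_congr fun s hs => ?_
  refine intervalIntegral.integral_congr fun t ht => ?_
  rw [uIcc_of_le zero_le_one] at hs
  congr 1
  set ζ := (s:ℂ) * cexp (t * I) with hζ
  have hζ1 : ‖ζ‖ ≤ 1 := by
    rw [hζ, norm_mul, norm_cexp_I, mul_one, Complex.norm_real, Real.norm_eq_abs, abs_of_nonneg hs.1]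
    exact hs.2
  have hm := hx ζ hζ1
  have d1 : HasFDerivAt (discD Λ qd) (((fderiv ℂ Λ ζ).restrictScalars ℝ).prod ((fderiv ℂ qd ζ).restrictScalars ℝ)) ζ :=
    ((hΛ ζ).hasFDerivAt.restrictScalars ℝ).prodMk ((hq ζ).hasFDerivAt.restrictScalars ℝ)
  have d2 := HasFDerivAt.comp (g := cauC φ f a) ζ (hasFDerivAt_of_C1 c1 G.isOpen_offM hm) (d1.const_add x)
  have d3 := d2.fderiv
  simp only [Function.comp_def] at d3
  obtain ⟨e1, e2⟩ := c2 _ hm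
  have e2' := e2 (deriv Λ ζ)
  rw [cauD, ← e2', antiCDeriv, antiCDeriv, d3]
  simp only [ContinuousLinearMap.comp_apply, ContinuousLinearMap.prod_apply, ContinuousLinearMap.coe_restrictScalars', smul_eq_mul, mul_one]
  have i1 : fderiv ℂ Λ ζ I = I • deriv Λ ζ := by rw [← fderiv_apply_one_eq_deriv, ← map_smul]; simp
  have i2 : fderiv ℂ qd ζ I = I * deriv qd ζ := by rw [← fderiv_apply_one_eq_deriv, ← smul_eq_mul, ← map_smul]; simp
  rw [i1, i2, fderiv_apply_one_eq_deriv, fderiv_apply_one_eq_deriv]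
  have sp : ∀ (L : CS m →L[ℝ] ℂ) (v : Fin m → ℂ) (c : ℂ), L (v, c) = L (v, 0) + L (0, c) := by
    intro L v c; rw [← map_add]; simp
  rw [sp _ (deriv Λ ζ), sp _ (I • deriv Λ ζ), e1]
  have : I • ((deriv Λ ζ, 0) : CS m) = (I • deriv Λ ζ, 0) := by ext <;> simp
  rw [this]
  have hI := I_mul_I
  linear_combination (1/2) * fderiv ℝ (cauC φ f a) (x + discD Λ qd ζ) (0, deriv qd ζ) * hI

theorem GraphData.phi_le (G : GraphData φ R) {w : Fin m → ℂ} {u c : ℝ} (hw : ‖w‖ < R) (hu : |u| < R) (h1 : ‖w‖ ≤ c) (h2 : |u| ≤ c) :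
    |φ (w, u)| ≤ c / 8 := by
  have := G.lip (w, u) (mem_ball_WR hw hu) 0 (by simpa using G.rpos)
  rw [G.zero, sub_zero, sub_zero] at this
  refine this.trans ?_
  have : ‖(w, u)‖ ≤ c := by rw [Prod.norm_def]; exact max_le h1 h2
  linarith

/-- domain below -/
def Pd (m : ℕ) (δ : ℝ) : Set (CS m) := {x | ‖x.1‖ < δ ∧ |x.2.re| < δ ∧ x.2.im < δ}

theorem isOpen_Pd (δ : ℝ) : IsOpen (Pd m δ) := by
  have h1 : Continuous fun x : CS m => ‖x.1‖ := by fun_prop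
  have h2 : Continuous fun x : CS m => |x.2.re| := (continuous_re.comp continuous_snd).abs
  have h3 : Continuous fun x : CS m => x.2.im := (continuous_im.comp continuous_snd)
  exact (isOpen_lt h1 continuous_const).inter ((isOpen_lt h2 continuous_const).inter (isOpen_lt h3 continuous_const))

theorem eqOn_of_hol_preconnected {f g : ℂ → ℂ} {S : Set ℂ} (hS : IsOpen S) (hc : IsPreconnected S)
    (hf : DifferentiableOn ℂ f S) (hg : DifferentiableOn ℂ g S) {z : ℂ} (hz : z ∈ S) (h : ∀ᶠ y in 𝓝 z, f y = g y) : EqOn f g S :=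
  (hf.analyticOnNhd hS).eqOn_of_preconnected_of_eventuallyEq (hg.analyticOnNhd hS) hc hz h

theorem ext_exists (G : GraphData φ R) {f : (Fin m → ℂ) × ℝ → ℂ} (hf : IsCRg φ R f) {a : ℝ} (ha : 0 < a) (haR : a < R)
    {Λ : ℂ → (Fin m → ℂ)} {qd : ℂ → ℂ} (hΛ : Differentiable ℂ Λ) (hq : Differentiable ℂ qd) (hΛ0 : Λ 0 = 0) (hq0 : qd 0 = 0)
    {ε : ℝ} (hε : 0 < ε) (hεa : 4 * ε ≤ a) (hb : ∀ ζ : ℂ, ‖ζ‖ ≤ 1 → ‖Λ ζ‖ ≤ ε ∧ ‖qd ζ‖ ≤ ε)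
    (hbd : ∀ ζ : ℂ, ‖ζ‖ = 1 → (qd ζ).im < φ (Λ ζ, (qd ζ).re)) :
    ∃ δ > 0, δ ≤ ε ∧ ∃ E : CS m → ℂ, ContDiffOn ℝ 1 E (Pd m δ) ∧ HolZ E (Pd m δ) ∧
      (∀ x ∈ Pd m δ, x.2.im < φ (x.1, x.2.re) → E x = cauC φ f a x) ∧
      ∀ x ∈ Pd m δ, ∀ v, antiCDeriv E x (v, 0) = cauD φ f a x v := by
  -- margin
  have hre : ∀ ζ : ℂ, ‖ζ‖ ≤ 1 → |(qd ζ).re| ≤ ε := fun ζ h => (abs_re_le_norm _).trans (hb ζ h).2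
  have him : ∀ ζ : ℂ, ‖ζ‖ ≤ 1 → |(qd ζ).im| ≤ ε := fun ζ h => (abs_im_le_norm _).trans (hb ζ h).2
  obtain ⟨μ, hμ, hμb⟩ : ∃ μ > 0, ∀ ζ : ℂ, ‖ζ‖ = 1 → (qd ζ).im + μ ≤ φ (Λ ζ, (qd ζ).re) := by
    have hc : ContinuousOn (fun ζ => φ (Λ ζ, (qd ζ).re) - (qd ζ).im) (sphere (0:ℂ) 1) := by
      have c1 : Continuous fun ζ => (Λ ζ, (qd ζ).re) := hΛ.continuous.prodMk (continuous_re.comp hq.continuous)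
      refine ContinuousOn.sub (G.smooth.continuousOn.comp c1.continuousOn fun ζ hζ => ?_) (continuous_im.comp hq.continuous).continuousOn
      have : ‖ζ‖ ≤ 1 := by rw [mem_sphere_zero_iff_norm] at hζ; exact hζ.le
      have := hre ζ this
      have := (hb ζ ‹_›).1
      refine mem_ball_WR ?_ ?_ <;> linarith
    obtain ⟨ζ0, hζ0, hmin⟩ := (isCompact_sphere (0:ℂ) 1).exists_isMinOn ⟨1, by simp⟩ hc
    refine ⟨φ (Λ ζ0, (qd ζ0).re) - (qd ζ0).im, ?_, fun ζ hζ => ?_⟩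
    · have := hbd ζ0 (by simpa using hζ0); linarith
    · have := hmin (show ζ ∈ sphere (0:ℂ) 1 by simpa using hζ)
      simp only [mem_setOf_eq] at this
      linarith
  set δ := min ε (μ / 2) with hδ
  have hδ0 : 0 < δ := lt_min hε (by linarith)
  have hδε : δ ≤ ε := min_le_left _ _
  have hδμ : δ ≤ μ / 2 := min_le_right _ _
  have hcyl : ∀ x ∈ Pd m δ, ∀ ζ : ℂ, ‖ζ‖ ≤ 1 → ‖(x + discD Λ qd ζ).1‖ ≤ 2 * ε ∧ |(x + discD Λ qd ζ).2.re| ≤ 2 * ε := by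
    intro x hx ζ hζ
    have h1 := hre ζ hζ
    have h2 := (hb ζ hζ).1
    have h3 := hx.1
    have h4 := hx.2.1
    constructor
    · exact (norm_add_le _ _).trans (by simp only [discD]; linarith)
    · simp only [discD, Prod.snd_add, Complex.add_re]
      exact (abs_add_le _ _).trans (by linarith)
  have hbO : ∀ x ∈ Pd m δ, ∀ ζ : ℂ, ‖ζ‖ = 1 → x + discD Λ qd ζ ∈ offM φ R := by
    intro x hx ζ hζ
    obtain ⟨h1, h2⟩ := hcyl x hx ζ hζ.le
    refine ⟨by linarith, by linarith, ne_of_lt ?_⟩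
    have h3 := hμb ζ hζ
    have h5 := hre ζ hζ.le
    have h6 := (hb ζ hζ.le).1
    have h4 := G.lip _ (mem_ball_WR (w := (x + discD Λ qd ζ).1) (u := (x + discD Λ qd ζ).2.re) (by linarith) (by linarith)) _
      (mem_ball_WR (w := Λ ζ) (u := (qd ζ).re) (by linarith) (by linarith))
    have h7 : ‖((x + discD Λ qd ζ).1, (x + discD Λ qd ζ).2.re) - (Λ ζ, (qd ζ).re)‖ ≤ δ := by
      simp only [discD, Prod.fst_add, Prod.snd_add, Complex.add_re, Prod.mk_sub_mk, add_sub_cancel_right, Prod.norm_def]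
      exact max_le hx.1.le hx.2.1.le
    have h8 := (abs_le.mp h4).1
    have h9 := hx.2.2
    have h10 : (x + discD Λ qd ζ).2.im = x.2.im + (qd ζ).im := rfl
    rw [h10]
    linarith
  have hbC : ∀ x ∈ Pd m δ, ∀ ζ : ℂ, ‖ζ‖ ≤ 1 → x + discD Λ qd ζ ∈ cyl m R a := by
    intro x hx ζ hζ
    obtain ⟨h1, h2⟩ := hcyl x hx ζ hζ
    exact ⟨by linarith, by linarith⟩
  obtain ⟨p1, p2⟩ := ext1_props G hf ha haR hΛ hq (isOpen_Pd δ) hbO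
  obtain ⟨r1, r2⟩ := ext2_props G hf ha haR hΛ hq (isOpen_Pd δ) hbC
  obtain ⟨c1, c2⟩ := cauC_props G hf ha haR
  set E : CS m → ℂ := fun x => (ext1 φ f a Λ qd x - ext2 φ f a Λ qd x) * (2 * Real.pi : ℂ)⁻¹ with hE
  have hE1 : ContDiffOn ℝ 1 E (Pd m δ) := (p1.sub r1).mul contDiffOn_const
  have hEz : HolZ E (Pd m δ) := fun x hx => ((p2 x hx).sub (r2 x hx)).mul_const _
  have hpi : (2 * Real.pi : ℂ) ≠ 0 := by exact_mod_cast Real.two_pi_pos.ne'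
  have hlow : ∀ x ∈ Pd m δ, x.2.im < -2 * ε → E x = cauC φ f a x := by
    intro x hx hl
    have := ext_low G hf ha haR hΛ hq hΛ0 hq0 (x := x) (fun ζ hζ => by
      obtain ⟨h1, h2⟩ := hcyl x hx ζ hζ
      refine ⟨by linarith, by linarith, ne_of_lt ?_⟩
      have h3 := (abs_le.mp (G.phi_le (by linarith) (by linarith) h1 h2)).1
      have h4 := (abs_le.mp (him ζ hζ)).2
      have h10 : (x + discD Λ qd ζ).2.im = x.2.im + (qd ζ).im := rfl
      rw [h10]; linarith)
    simp only [hE]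
    rw [this]; field_simp; ring
  have hphi : ∀ {w : Fin m → ℂ} {u : ℝ}, ‖w‖ < δ → |u| < δ → |φ (w, u)| < δ := by
    intro w u hw hu
    have := G.phi_le (w := w) (u := u) (by linarith) (by linarith) hw.le hu.le
    linarith
  have hmem : ∀ x ∈ Pd m δ, x.2.im < φ (x.1, x.2.re) → x ∈ offM φ R := fun x hx h =>
    ⟨by linarith [hx.1], by linarith [hx.2.1], h.ne⟩
  have hEq : ∀ x ∈ Pd m δ, x.2.im < φ (x.1, x.2.re) → E x = cauC φ f a x := by
    intro x hx hlt
    obtain ⟨w, z⟩ := x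
    simp only at hlt
    set S : Set ℂ := {z | |z.re| < δ ∧ z.im < φ (w, z.re)} with hS
    have hw : ‖w‖ < δ := hx.1
    have hSP : ∀ z ∈ S, (w, z) ∈ Pd m δ := fun z hz => ⟨hw, hz.1, hz.2.trans ((le_abs_self _).trans_lt (hphi hw hz.1))⟩
    have hSo : IsOpen S := by
      have e : S = (fun z : ℂ => (w, z)) ⁻¹' (Pd m δ ∩ {x | x ∈ offM φ R ∧ x.2.im < φ (x.1, x.2.re)}) := by
        ext z
        constructor
        · intro hz; exact ⟨hSP z hz, hmem _ (hSP z hz) hz.2, hz.2⟩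
        · rintro ⟨h1, h2⟩; exact ⟨h1.2.1, h2.2⟩
      rw [e]
      refine IsOpen.preimage (by fun_prop) ((isOpen_Pd δ).inter ?_)
      have hcon : ContinuousOn (fun x : CS m => x.2.im - φ (x.1, x.2.re)) (offM φ R) :=
        ContinuousOn.sub (by fun_prop) (G.cont_phi.mono fun x hx => ⟨hx.1, hx.2.1⟩)
      have := hcon.isOpen_inter_preimage G.isOpen_offM (isOpen_Iio (a := (0:ℝ)))
      convert this using 1
      ext x; simp
    have hSc : IsPreconnected S := by
      have e : S = (fun p : ℝ × ℝ => (p.1 : ℂ) + I * ((φ (w, p.1) - p.2 : ℝ) : ℂ)) '' (Ioo (-δ) δ ×ˢ Ioi 0) := by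
        ext z
        constructor
        · intro hz
          refine ⟨(z.re, φ (w, z.re) - z.im), ⟨abs_lt.mp hz.1, by simpa using hz.2⟩, ?_⟩
          apply Complex.ext <;> simp
        · rintro ⟨⟨u, t⟩, ⟨h1, h2⟩, rfl⟩
          simp only [mem_Ioi] at h2
          refine ⟨?_, ?_⟩
          · simpa using abs_lt.mpr h1
          · simp; exact h2
      rw [e]
      refine IsPreconnected.image (isPreconnected_Ioo.prod isPreconnected_Ioi) _ ?_
      have c0 : ContinuousOn (fun p : ℝ × ℝ => φ (w, p.1)) (Ioo (-δ) δ ×ˢ Ioi 0) :=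
        G.smooth.continuousOn.comp (by fun_prop) fun p hp => mem_ball_WR (by linarith) (by linarith [abs_lt.mpr hp.1])
      exact ContinuousOn.add (by fun_prop) (continuousOn_const.mul (continuous_ofReal.comp_continuousOn (c0.sub (by fun_prop))))
    have hz0 : (-3 * ε * I : ℂ) ∈ S := by
      refine ⟨by simpa using hδ0, ?_⟩
      have := (abs_lt.mp (hphi hw (u := (-3 * ε * I : ℂ).re) (by simpa using hδ0))).1
      simp at this ⊢
      linarith
    refine eqOn_of_hol_preconnected hSo hSc (f := fun z => E (w, z)) (g := fun z => cauC φ f a (w, z))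
      (fun z hz => (hEz (w, z) (hSP z hz)).differentiableWithinAt)
      (fun z hz => (cauC_holz G hf ha haR (w, z) (hmem _ (hSP z hz) hz.2)).differentiableWithinAt) hz0 ?_ ⟨hx.2.1, hlt⟩
    have hl : ∀ᶠ y : ℂ in 𝓝 (-3 * ε * I : ℂ), y.im < -2 * ε := by
      refine (isOpen_lt continuous_im continuous_const).mem_nhds ?_
      simp; linarith
    filter_upwards [hl, hSo.mem_nhds hz0] with y hy hyS
    exact hlow (w, y) (hSP y hyS) hy
  refine ⟨δ, hδ0, hδε, E, hE1, hEz, hEq, ?_⟩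
  intro x hx v
  obtain ⟨w, z⟩ := x
  have hw : ‖w‖ < δ := hx.1
  set S : Set ℂ := {z | |z.re| < δ ∧ z.im < δ} with hS
  have hSP : ∀ z ∈ S, (w, z) ∈ Pd m δ := fun z hz => ⟨hw, hz.1, hz.2⟩
  have hSo : IsOpen S := (isOpen_lt continuous_re.abs continuous_const).inter (isOpen_lt continuous_im continuous_const)
  have hSc : IsPreconnected S := by
    have e : S = (fun p : ℝ × ℝ => (p.1 : ℂ) + I * (p.2 : ℂ)) '' (Ioo (-δ) δ ×ˢ Iio δ) := by
      ext z
      constructor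
      · intro hz
        refine ⟨(z.re, z.im), ⟨abs_lt.mp hz.1, hz.2⟩, ?_⟩
        apply Complex.ext <;> simp
      · rintro ⟨⟨u, t⟩, ⟨h1, h2⟩, rfl⟩
        simp only [mem_Iio] at h2
        refine ⟨?_, ?_⟩
        · simpa using abs_lt.mpr h1
        · simpa using h2
    rw [e]
    exact IsPreconnected.image (isPreconnected_Ioo.prod isPreconnected_Iio) _ (by fun_prop)
  have hz0 : (-3 * ε * I : ℂ) ∈ S := by
    refine ⟨by simpa using hδ0, ?_⟩
    simp; linarith
  have hsm : ∀ v : Fin m → ℂ, (I • ((v, 0) : CS m)) = (I • v, 0) := fun v => by ext <;> simp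
  refine eqOn_of_hol_preconnected hSo hSc (f := fun z => antiCDeriv E (w, z) (v, 0)) (g := fun z => cauD φ f a (w, z) v)
    (fun z hz => ?_) (fun z hz => ?_) hz0 ?_ ⟨hx.2.1, hx.2.2⟩
  · have h1 := hol_param_deriv (isOpen_Pd δ) hE1 hEz (hSP z hz)
    have := ((h1 v).add ((h1 (I • v)).const_mul I)).mul_const (2:ℂ)⁻¹
    simp only [antiCDeriv, hsm, div_eq_mul_inv]
    exact this.differentiableWithinAt
  · refine (cauD_holz (φ := φ) f ha (x := (w, z)) ?_ v).differentiableWithinAt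
    have := hz.1
    simp only
    linarith
  · have hl : ∀ᶠ y : ℂ in 𝓝 (-3 * ε * I : ℂ), y.im < -2 * ε := by
      refine (isOpen_lt continuous_im continuous_const).mem_nhds ?_
      simp; linarith
    filter_upwards [hl, hSo.mem_nhds hz0] with y hy hyS
    have hP := hSP y hyS
    have hlt : y.im < φ (w, y.re) := by
      have := (abs_lt.mp (hphi hw hyS.1)).1
      linarith
    have hev : E =ᶠ[𝓝 (w, y)] cauC φ f a := by
      have o2 : IsOpen {x : CS m | x.2.im < -2 * ε} := isOpen_lt (continuous_im.comp continuous_snd) continuous_const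
      filter_upwards [(isOpen_Pd δ).mem_nhds hP, o2.mem_nhds (show (w, y) ∈ {x : CS m | x.2.im < -2 * ε} from hy)] with x' h1 h2
      exact hlow x' h1 h2
    rw [antiCDeriv, hev.fderiv_eq, ← antiCDeriv, (c2 _ (hmem _ hP hlt)).2 v, cauD]
end

theorem kernel_bound {A x y : ℝ} (hA : 0 < A) (hy : 0 < y) :
    ∫ u in (-A)..A, |u - x| * y / ((u - x) ^ 2 + y ^ 2) ≤ √y * (Real.pi + 2 * A) := by
  have hpos : ∀ u : ℝ, 0 < (u - x) ^ 2 + y ^ 2 := fun u => by positivity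
  have hs : 0 < √y := Real.sqrt_pos.mpr hy
  have hss : √y * √y = y := Real.mul_self_sqrt hy.le
  have hc1 : Continuous fun u : ℝ => |u - x| * y / ((u - x) ^ 2 + y ^ 2) :=
    Continuous.div (by fun_prop) (by fun_prop) fun u => (hpos u).ne'
  have hc2 : Continuous fun u : ℝ => y / ((u - x) ^ 2 + y ^ 2) :=
    Continuous.div (by fun_prop) (by fun_prop) fun u => (hpos u).ne'
  have hpt : ∀ u : ℝ, |u - x| * y / ((u - x) ^ 2 + y ^ 2) ≤ √y * (y / ((u - x) ^ 2 + y ^ 2)) + √y := by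
    intro u
    set t := |u - x| with ht
    have ht0 : 0 ≤ t := abs_nonneg _
    have e : (u - x) ^ 2 = t ^ 2 := (sq_abs _).symm
    have hp := hpos u
    rw [e] at hp ⊢
    rw [← mul_div_assoc, div_add' _ _ _ hp.ne', div_le_div_iff_of_pos_right hp]
    rcases le_total t (√y) with h | h
    · have : t * y ≤ √y * y := by gcongr
      have : 0 ≤ √y * (t ^ 2 + y ^ 2) := by positivity
      linarith
    · have : t * y ≤ √y * t ^ 2 := by
        calc t * y = √y * (t * √y) := by rw [← hss]; ring_nf; rw [Real.sqrt_sq hs.le]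
          _ ≤ √y * (t * t) := by gcongr
          _ = _ := by ring
      have : 0 ≤ √y * y := by positivity
      have : 0 ≤ √y * y ^ 2 := by positivity
      nlinarith
  have hprim : ∫ u in (-A)..A, y / ((u - x) ^ 2 + y ^ 2) = Real.arctan ((A - x) / y) - Real.arctan ((-A - x) / y) := by
    refine intervalIntegral.integral_eq_sub_of_hasDerivAt (f := fun u => Real.arctan ((u - x) / y)) (fun u _ => ?_) (hc2.intervalIntegrable _ _)
    have := (((hasDerivAt_id u).sub_const x).div_const y).arctan
    refine this.congr_deriv ?_
    simp only [id]
    have := hpos u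
    field_simp
    ring
  calc ∫ u in (-A)..A, |u - x| * y / ((u - x) ^ 2 + y ^ 2)
      ≤ ∫ u in (-A)..A, (√y * (y / ((u - x) ^ 2 + y ^ 2)) + √y) :=
        intervalIntegral.integral_mono_on (by linarith) (hc1.intervalIntegrable _ _)
          (((continuous_const.mul hc2).add continuous_const).intervalIntegrable _ _) (fun u _ => hpt u)
    _ = √y * (Real.arctan ((A - x) / y) - Real.arctan ((-A - x) / y)) + √y * (2 * A) := by
        rw [intervalIntegral.integral_add ((continuous_const.fun_mul hc2).intervalIntegrable _ _) (continuous_const.intervalIntegrable _ _),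
          intervalIntegral.integral_const_mul, hprim, intervalIntegral.integral_const]
        simp; ring
    _ ≤ √y * Real.pi + √y * (2 * A) := by
        have h1 := Real.arctan_lt_pi_div_two ((A - x) / y)
        have h2 := Real.neg_pi_div_two_lt_arctan ((-A - x) / y)
        gcongr
        linarith
    _ = _ := by ring

theorem log_sub_log_neg {c : ℂ} (hc : 0 < c.im) : Complex.log c - Complex.log (-c) = Real.pi * I := by
  rw [Complex.log, Complex.log, norm_neg, Complex.arg_neg_eq_arg_sub_pi_of_im_pos hc]
  push_cast; ring

section
variable {m : ℕ} {φ : (Fin m → ℂ) × ℝ → ℝ} {R : ℝ}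

theorem gZ_sub_bound (G : GraphData φ R) {w : Fin m → ℂ} {u x : ℝ} (hw : ‖w‖ < R) (hu : |u| < R) (hx : |x| < R) :
    |(gZ φ (w, u) - gZ φ (w, x)).im| ≤ |u - x| / 8 := by
  have := G.lip _ (mem_ball_WR hw hu) _ (mem_ball_WR hw hx)
  rw [Complex.sub_im, gZ_im, gZ_im]
  refine this.trans ?_
  simp [Prod.norm_def]

theorem denom_bound {t s y : ℝ} (hs : |s| ≤ |t| / 8) : (t ^ 2 + y ^ 2) / 2 ≤ ‖((t : ℂ) + I * s) ^ 2 + (y:ℂ) ^ 2‖ := by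
  refine le_trans ?_ (Complex.re_le_norm _)
  have : (((t : ℂ) + I * s) ^ 2 + (y:ℂ) ^ 2).re = t ^ 2 - s ^ 2 + y ^ 2 := by
    simp [pow_two]
  rw [this]
  have h1 : s ^ 2 ≤ (|t| / 8) ^ 2 := by rw [← sq_abs s]; gcongr
  have h2 : |t| ^ 2 = t ^ 2 := sq_abs t
  nlinarith [sq_nonneg y, sq_nonneg t]

/-- decomposition of jump -/
theorem jump_formula (G : GraphData φ R) {f : (Fin m → ℂ) × ℝ → ℂ} (hf : IsCRg φ R f) {a : ℝ} (ha : 0 < a) (haR : a < R)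
    {b K N : ℝ} (hb : b < R) (hab : a ≤ b) 
    (hK : ∀ p ∈ closedBall (0 : (Fin m → ℂ) × ℝ) b, ∀ q ∈ closedBall (0 : (Fin m → ℂ) × ℝ) b, ‖f p - f q‖ ≤ K * ‖p - q‖)
    (hN : ∀ p ∈ closedBall (0 : (Fin m → ℂ) × ℝ) b, ‖gZu φ p‖ ≤ N)
    {w : Fin m → ℂ} {x y : ℝ} (hw : ‖w‖ ≤ b) (hx : |x| < a) (hy : 0 < y) :
    ‖(cauC φ f a (w, gZ φ (w, x) + I * y) - cauC φ f a (w, gZ φ (w, x) - I * y)) -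
      f (w, x) * ((Complex.log (y + I * (gZ φ (w, a) - gZ φ (w, x))) - Complex.log (y - I * (gZ φ (w, a) - gZ φ (w, x)))) -
       (Complex.log (y + I * (gZ φ (w, -a) - gZ φ (w, x))) - Complex.log (y - I * (gZ φ (w, -a) - gZ φ (w, x)))))‖
      ≤ 4 * K * N * (√y * (Real.pi + 2 * a)) := by
  have hu : ∀ u ∈ uIcc (-a) a, |u| ≤ a := fun u hu => by rw [uIcc_of_le (by linarith)] at hu; exact abs_le.mpr hu
  have hmem : ∀ u ∈ uIcc (-a) a, (w, u) ∈ ball (0 : (Fin m → ℂ) × ℝ) R := fun u h => mem_ball_WR (by linarith) (by linarith [hu u h])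
  have hmemb : ∀ u, |u| ≤ a → (w, u) ∈ closedBall (0 : (Fin m → ℂ) × ℝ) b := fun u h => by
    rw [mem_closedBall_zero_iff, Prod.norm_def]; exact max_le hw (by simpa using h.trans hab)
  set α : ℝ → ℂ := fun u => gZ φ (w, u) - gZ φ (w, x) with hα
  have hαre : ∀ u, (α u).re = u - x := fun u => by simp only [hα, Complex.sub_re, gZ_re]
  have hαim : ∀ u ∈ uIcc (-a) a, |(α u).im| ≤ |u - x| / 8 := fun u h =>
    gZ_sub_bound G (by linarith) (by linarith [hu u h]) (by linarith)
  have hαe : ∀ u, α u = ((u - x : ℝ) : ℂ) + I * ((α u).im : ℝ) := fun u => by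
    rw [← hαre, mul_comm]; exact (Complex.re_add_im _).symm
  have hden : ∀ u ∈ uIcc (-a) a, ((u - x) ^ 2 + y ^ 2) / 2 ≤ ‖α u ^ 2 + (y:ℂ) ^ 2‖ := fun u h => by
    rw [hαe u]; exact denom_bound (hαim u h)
  have hdpos : ∀ u : ℝ, 0 < ((u - x) ^ 2 + y ^ 2) / 2 := fun u => by positivity
  have hdne : ∀ u ∈ uIcc (-a) a, α u ^ 2 + (y:ℂ) ^ 2 ≠ 0 := fun u h => norm_pos_iff.mp ((hdpos u).trans_le (hden u h))
  have cl : ContinuousOn (fun u : ℝ => (w, u)) (uIcc (-a) a) := by fun_prop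
  have cf : ContinuousOn (fun u => f (w, u)) (uIcc (-a) a) := hf.smooth.continuousOn.comp cl hmem
  have cZ : ContinuousOn (fun u => gZ φ (w, u)) (uIcc (-a) a) := G.smoothZ.continuousOn.comp cl hmem
  have cZu : ContinuousOn (fun u => gZu φ (w, u)) (uIcc (-a) a) := G.smoothZu.continuousOn.comp cl hmem
  have cα : ContinuousOn α (uIcc (-a) a) := cZ.sub continuousOn_const
  have cκ : ContinuousOn (fun u => gZu φ (w, u) * (2 * I * y) * (α u ^ 2 + (y:ℂ) ^ 2)⁻¹) (uIcc (-a) a) :=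
    (cZu.mul continuousOn_const).mul (((cα.pow 2).add continuousOn_const).inv₀ hdne)
  have hfac : ∀ u, α u ^ 2 + (y:ℂ) ^ 2 = (α u - I * y) * (α u + I * y) := fun u => by
    have := I_sq; linear_combination (y:ℂ)^2 * this * (1)
  have hn1 : ∀ u ∈ uIcc (-a) a, α u - I * y ≠ 0 := fun u h h0 => hdne u h (by rw [hfac, h0, zero_mul])
  have hn2 : ∀ u ∈ uIcc (-a) a, α u + I * y ≠ 0 := fun u h h0 => hdne u h (by rw [hfac, h0, mul_zero])
  have e1 : cauC φ f a (w, gZ φ (w, x) + I * y) - cauC φ f a (w, gZ φ (w, x) - I * y) =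
      ∫ u in -a..a, f (w, u) * (gZu φ (w, u) * (2 * I * y) * (α u ^ 2 + (y:ℂ) ^ 2)⁻¹) := by
    unfold cauC
    rw [← intervalIntegral.integral_sub]
    · refine intervalIntegral.integral_congr fun u h => ?_
      have t1 : gZ φ (w, u) - (gZ φ (w, x) + I * y) = α u - I * y := by simp only [hα]; ring
      have t2 : gZ φ (w, u) - (gZ φ (w, x) - I * y) = α u + I * y := by simp only [hα]; ring
      simp only [t1, t2, hfac]
      have := hn1 u h
      have := hn2 u h
      field_simp
      ring
    · refine ContinuousOn.intervalIntegrable ((cf.mul cZu).mul ((cZ.sub continuousOn_const).inv₀ fun u h => ?_))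
      have t1 : gZ φ (w, u) - (gZ φ (w, x) + I * y) = α u - I * y := by simp only [hα]; ring
      change gZ φ (w, u) - (gZ φ (w, x) + I * y) ≠ 0; rw [t1]; exact hn1 u h
    · refine ContinuousOn.intervalIntegrable ((cf.mul cZu).mul ((cZ.sub continuousOn_const).inv₀ fun u h => ?_))
      have t2 : gZ φ (w, u) - (gZ φ (w, x) - I * y) = α u + I * y := by simp only [hα]; ring
      change gZ φ (w, u) - (gZ φ (w, x) - I * y) ≠ 0; rw [t2]; exact hn2 u h
  have hsl : ∀ u ∈ uIcc (-a) a, (y + I * α u) ∈ slitPlane ∧ (y - I * α u) ∈ slitPlane := by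
    intro u h
    simp only [Complex.mem_slitPlane_iff]
    by_cases hux : u = x
    · have : α u = 0 := by simp [hα, hux]
      rw [this]; simp [hy]
    · have h2 : u - x ≠ 0 := sub_ne_zero.mpr hux
      have h3 : x - u ≠ 0 := sub_ne_zero.mpr (Ne.symm hux)
      constructor <;> right <;> simp [hαre, h2, h3]
  have e2 : ∫ u in -a..a, gZu φ (w, u) * (2 * I * y) * (α u ^ 2 + (y:ℂ) ^ 2)⁻¹ =
      (Complex.log (y + I * α a) - Complex.log (y - I * α a)) - (Complex.log (y + I * α (-a)) - Complex.log (y - I * α (-a))) := by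
    refine intervalIntegral.integral_eq_sub_of_hasDerivAt (f := fun u => Complex.log (y + I * α u) - Complex.log (y - I * α u)) (fun u h => ?_) cκ.intervalIntegrable
    have hl : HasDerivAt (fun t : ℝ => (w, t)) ((0 : Fin m → ℂ), (1:ℝ)) u := (hasDerivAt_const u w).prodMk (hasDerivAt_id u)
    have d3 : HasDerivAt α (gZu φ (w, u)) u := ((G.hasZ (hmem u h)).comp_hasDerivAt u hl).sub_const (gZ φ (w, x))
    have d4 := ((d3.const_mul I).const_add (y:ℂ)).clog_real (hsl u h).1
    have d5 := ((d3.const_mul I).const_sub (y:ℂ)).clog_real (hsl u h).2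
    refine (d4.sub d5).congr_deriv ?_
    have n1 := slitPlane_ne_zero (hsl u h).1
    have n2 := slitPlane_ne_zero (hsl u h).2
    have n3 := hdne u h
    have n4 : α u ^ 2 + (y:ℂ) ^ 2 = (y + I * α u) * (y - I * α u) := by
      have := I_sq; linear_combination (α u)^2 * this
    rw [n4]
    field_simp
    ring
  rw [e1, ← e2, ← intervalIntegral.integral_const_mul, ← intervalIntegral.integral_sub (cf.fun_mul cκ).intervalIntegrable
    (continuousOn_const.fun_mul cκ).intervalIntegrable]
  refine (intervalIntegral.norm_integral_le_integral_norm (by linarith)).trans ?_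
  have hK0 : 0 ≤ K := by
    by_contra hneg
    push Not at hneg
    have := hK _ (hmemb a (by rw [abs_of_pos ha])) _ (hmemb 0 (by simpa using ha.le))
    have h2 : 0 < ‖((w, a) : (Fin m → ℂ) × ℝ) - (w, 0)‖ := by
      rw [norm_pos_iff, sub_ne_zero]; intro h; simp at h; linarith
    nlinarith [norm_nonneg (f (w, a) - f (w, 0))]
  have hN0 : 0 ≤ N := (norm_nonneg _).trans (hN _ (hmemb 0 (by simpa using ha.le)))
  have hpos : ∀ u : ℝ, 0 < (u - x) ^ 2 + y ^ 2 := fun u => by positivity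
  have hc1 : Continuous fun u : ℝ => |u - x| * y / ((u - x) ^ 2 + y ^ 2) :=
    Continuous.div (by fun_prop) (by fun_prop) fun u => (hpos u).ne'
  calc ∫ u in (-a)..a, ‖f (w, u) * (gZu φ (w, u) * (2 * I * y) * (α u ^ 2 + (y:ℂ) ^ 2)⁻¹) - f (w, x) * (gZu φ (w, u) * (2 * I * y) * (α u ^ 2 + (y:ℂ) ^ 2)⁻¹)‖
      ≤ ∫ u in (-a)..a, 4 * K * N * (|u - x| * y / ((u - x) ^ 2 + y ^ 2)) := by
        refine intervalIntegral.integral_mono_on (by linarith) ?_ ((continuous_const.mul hc1).intervalIntegrable _ _) (fun u h => ?_)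
        · exact ((cf.mul cκ).sub (continuousOn_const.mul cκ)).norm.intervalIntegrable
        · rw [← uIcc_of_le (by linarith : -a ≤ a)] at h
          rw [← sub_mul, norm_mul, norm_mul, norm_mul, norm_inv]
          have h1 := hK _ (hmemb u (hu u h)) _ (hmemb x hx.le)
          have h1' : ‖((w, u) : (Fin m → ℂ) × ℝ) - (w, x)‖ = |u - x| := by simp [Prod.norm_def]
          rw [h1'] at h1
          have h2 := hN _ (hmemb u (hu u h))
          have h3 : ‖(2 * I * y : ℂ)‖ = 2 * y := by simp [abs_of_pos hy]
          have h4 : ‖α u ^ 2 + (y:ℂ) ^ 2‖⁻¹ ≤ (((u - x) ^ 2 + y ^ 2) / 2)⁻¹ := inv_anti₀ (hdpos u) (hden u h)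
          rw [h3]
          calc ‖f (w, u) - f (w, x)‖ * (‖gZu φ (w, u)‖ * (2 * y) * ‖α u ^ 2 + (y:ℂ) ^ 2‖⁻¹)
              ≤ (K * |u - x|) * (N * (2 * y) * (((u - x) ^ 2 + y ^ 2) / 2)⁻¹) := by gcongr
            _ = _ := by have := hpos u; field_simp; ring
    _ = 4 * K * N * ∫ u in (-a)..a, (|u - x| * y / ((u - x) ^ 2 + y ^ 2)) := intervalIntegral.integral_const_mul _ _
    _ ≤ _ := by
        have := kernel_bound (x := x) ha hy
        gcongr
end

section
variable {m : ℕ} {φ : (Fin m → ℂ) × ℝ → ℝ} {R : ℝ}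

def jumpL (φ : (Fin m → ℂ) × ℝ → ℝ) (a : ℝ) (x : CS m) : ℂ :=
  (Complex.log (((x.2.im - φ (x.1, x.2.re) : ℝ) : ℂ) + I * (gZ φ (x.1, a) - gZ φ (x.1, x.2.re))) -
    Complex.log (((x.2.im - φ (x.1, x.2.re) : ℝ) : ℂ) - I * (gZ φ (x.1, a) - gZ φ (x.1, x.2.re)))) -
  (Complex.log (((x.2.im - φ (x.1, x.2.re) : ℝ) : ℂ) + I * (gZ φ (x.1, -a) - gZ φ (x.1, x.2.re))) -
    Complex.log (((x.2.im - φ (x.1, x.2.re) : ℝ) : ℂ) - I * (gZ φ (x.1, -a) - gZ φ (x.1, x.2.re))))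

theorem jumpL_bdry {a : ℝ} {x : CS m} (hx : |x.2.re| < a) (h0 : x.2.im = φ (x.1, x.2.re)) : jumpL φ a x = 2 * Real.pi * I := by
  have h := abs_lt.mp hx
  unfold jumpL
  rw [h0, sub_self, Complex.ofReal_zero]
  simp only [zero_add, zero_sub]
  have h1 := log_sub_log_neg (c := I * (gZ φ (x.1, a) - gZ φ (x.1, x.2.re))) (by simp [gZ_re]; linarith)
  have h2 := log_sub_log_neg (c := -(I * (gZ φ (x.1, -a) - gZ φ (x.1, x.2.re)))) (by simp [gZ_re]; linarith)
  rw [neg_neg] at h2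
  linear_combination h1 + h2

theorem contOn_phi' (G : GraphData φ R) {x : CS m} (h1 : ‖x.1‖ < R) (h2 : |x.2.re| < R) :
    ContinuousAt (fun x : CS m => φ (x.1, x.2.re)) x :=
  G.cont_phi.continuousAt ((GraphData.isOpen_cyl R).mem_nhds ⟨h1, h2⟩)

theorem cont_gZ' (G : GraphData φ R) {x : CS m} (h1 : ‖x.1‖ < R) (h2 : |x.2.re| < R) :
    ContinuousAt (fun x : CS m => gZ φ (x.1, x.2.re)) x := by
  have c : ContinuousAt (fun x : CS m => (x.1, x.2.re)) x := by fun_prop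
  exact ContinuousAt.comp (f := fun x : CS m => (x.1, x.2.re)) (G.smoothZ.continuousOn.continuousAt (isOpen_ball.mem_nhds (mem_ball_WR h1 h2))) c

theorem cont_gZa (G : GraphData φ R) {x : CS m} {a : ℝ} (h1 : ‖x.1‖ < R) (h2 : |a| < R) :
    ContinuousAt (fun x : CS m => gZ φ (x.1, a)) x := by
  have c : ContinuousAt (fun x : CS m => (x.1, a)) x := by fun_prop
  exact ContinuousAt.comp (f := fun x : CS m => (x.1, a)) (G.smoothZ.continuousOn.continuousAt (isOpen_ball.mem_nhds (mem_ball_WR h1 h2))) c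

theorem jumpL_cont (G : GraphData φ R) {a : ℝ} (ha : 0 < a) (haR : a < R) {x : CS m} (h1 : ‖x.1‖ < R) (hx : |x.2.re| < a) :
    ContinuousAt (jumpL φ a) x := by
  have h := abs_lt.mp hx
  have c0 : ContinuousAt (fun x : CS m => ((x.2.im - φ (x.1, x.2.re) : ℝ) : ℂ)) x :=
    continuous_ofReal.continuousAt.comp ((by fun_prop : ContinuousAt (fun x : CS m => x.2.im) x).sub (contOn_phi' G h1 (hx.trans haR)))
  have c1 : ∀ b : ℝ, |b| < R → ContinuousAt (fun x : CS m => I * (gZ φ (x.1, b) - gZ φ (x.1, x.2.re))) x := fun b hb =>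
    continuousAt_const.mul ((cont_gZa G h1 hb).sub (cont_gZ' G h1 (hx.trans haR)))
  have ha1 : |a| < R := by rwa [abs_of_pos ha]
  have ha2 : |-a| < R := by rwa [abs_neg]
  unfold jumpL
  have n1 : a - x.2.re ≠ 0 := by linarith
  have n2 : -a - x.2.re ≠ 0 := by linarith
  have n3 : x.2.re - a ≠ 0 := by linarith
  have n4 : x.2.re + a ≠ 0 := by linarith
  refine ContinuousAt.sub (ContinuousAt.sub ?_ ?_) (ContinuousAt.sub ?_ ?_)
  · refine (c0.add (c1 a ha1)).clog (Complex.mem_slitPlane_iff.mpr (Or.inr ?_))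
    simp [gZ_re, n1]
  · refine (c0.sub (c1 a ha1)).clog (Complex.mem_slitPlane_iff.mpr (Or.inr ?_))
    simp [gZ_re, n1, n3]
  · refine (c0.add (c1 (-a) ha2)).clog (Complex.mem_slitPlane_iff.mpr (Or.inr ?_))
    simp [gZ_re, n2]
  · refine (c0.sub (c1 (-a) ha2)).clog (Complex.mem_slitPlane_iff.mpr (Or.inr ?_))
    simp [gZ_re, n2, n4]

def Upc (φ : (Fin m → ℂ) × ℝ → ℝ) (δ : ℝ) : Set (CS m) := {x | x ∈ Pd m δ ∧ φ (x.1, x.2.re) ≤ x.2.im}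
def Upo (φ : (Fin m → ℂ) × ℝ → ℝ) (δ : ℝ) : Set (CS m) := {x | x ∈ Pd m δ ∧ φ (x.1, x.2.re) < x.2.im}

def GDiscs (φ : (Fin m → ℂ) × ℝ → ℝ) : Prop := ∀ ε > 0, ∃ (Λ : ℂ → (Fin m → ℂ)) (qd : ℂ → ℂ), Differentiable ℂ Λ ∧ Differentiable ℂ qd ∧
  Λ 0 = 0 ∧ qd 0 = 0 ∧ (∀ ζ : ℂ, ‖ζ‖ ≤ 1 → ‖Λ ζ‖ ≤ ε ∧ ‖qd ζ‖ ≤ ε) ∧ ∀ ζ : ℂ, ‖ζ‖ = 1 → (qd ζ).im < φ (Λ ζ, (qd ζ).re)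

theorem onesided (G : GraphData φ R) (hD : GDiscs φ) {f : (Fin m → ℂ) × ℝ → ℂ} (hf : IsCRg φ R f) :
    ∃ δ > 0, δ < R ∧ ∃ F : CS m → ℂ, DifferentiableOn ℂ F (Upo φ δ) ∧ ContinuousOn F (Upc φ δ) ∧
      ∀ w u, ‖w‖ < δ → |u| < δ → F (w, gZ φ (w, u)) = f (w, u) := by
  have hR := G.rpos
  set a := R / 2 with ha'
  have ha : 0 < a := by linarith
  have haR : a < R := by linarith
  obtain ⟨Λ, qd, hΛ, hq, hΛ0, hq0, hb, hbd⟩ := hD (a / 4) (by linarith)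
  obtain ⟨δ, hδ, hδε, E, hE1, hEz, hEC, hEd⟩ := ext_exists G hf ha haR hΛ hq hΛ0 hq0 (by linarith) (by linarith) hb hbd
  obtain ⟨c1, c2⟩ := cauC_props G hf ha haR
  have hpi : (2 * Real.pi * I : ℂ) ≠ 0 := Complex.two_pi_I_ne_zero
  set F : CS m → ℂ := fun x => if x.2.im = φ (x.1, x.2.re) then f (x.1, x.2.re) else (cauC φ f a x - E x) * (2 * Real.pi * I : ℂ)⁻¹ with hF
  have hUoff : ∀ x ∈ Upo φ δ, x ∈ offM φ R := fun x hx => ⟨by linarith [hx.1.1], by linarith [hx.1.2.1], hx.2.ne'⟩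
  have hUo : IsOpen (Upo φ δ) := by
    have hcon : ContinuousOn (fun x : CS m => φ (x.1, x.2.re) - x.2.im) (Pd m δ) :=
      ContinuousOn.sub (G.cont_phi.mono fun x hx => ⟨by linarith [hx.1], by linarith [hx.2.1]⟩) (by fun_prop)
    have := hcon.isOpen_inter_preimage (isOpen_Pd δ) (isOpen_Iio (a := (0:ℝ)))
    convert this using 1
    ext x; simp [Upo]
  have hsm : ∀ v : Fin m → ℂ, (I • ((v, 0) : CS m)) = (I • v, 0) := fun v => by ext <;> simp
  have hFo : DifferentiableOn ℂ F (Upo φ δ) := by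
    intro x hx
    have hC := (hasFDerivAt_of_C1 c1 G.isOpen_offM (hUoff x hx))
    have hEe := (hasFDerivAt_of_C1 hE1 (isOpen_Pd δ) hx.1)
    have hev : (fun x => (cauC φ f a x - E x) * (2 * Real.pi * I : ℂ)⁻¹) =ᶠ[𝓝 x] F := by
      filter_upwards [hUo.mem_nhds hx] with y hy
      simp only [hF]; rw [if_neg hy.2.ne']
    have hd : DifferentiableAt ℂ (fun x => (cauC φ f a x - E x)) x := by
      have hd := hC.fun_sub hEe
      refine differentiableAt_complex_of_real hd.differentiableAt fun v => ?_
      rw [hd.fderiv]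
      have z1 := (c2 x (hUoff x hx)).1
      have z2 := (fderiv_slice_iff hEe.differentiableAt).1 (hEz x hx.1)
      have w1 := (c2 x (hUoff x hx)).2 v.1
      have w2 := hEd x hx.1 v.1
      rw [cauD, ← w1] at w2
      simp only [antiCDeriv, hsm] at w2
      have sp : ∀ (L : CS m →L[ℝ] ℂ) (v : Fin m → ℂ) (c : ℂ), L (v, c) = L (v, 0) + L (0, c) := by
        intro L v c; rw [← map_add]; simp
      have hv : I • v = (I • v.1, I * v.2) := rfl
      have hv' : v = (v.1, v.2) := rfl
      rw [hv, ContinuousLinearMap.sub_apply, sp _ (I • v.1) (I * v.2), sp (fderiv ℝ E x) (I • v.1) (I * v.2), z1, z2, ContinuousLinearMap.sub_apply]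
      conv_rhs => rw [hv', sp _ v.1 v.2, sp (fderiv ℝ E x) v.1 v.2]
      have hI := I_mul_I
      linear_combination (2 * I) * w2 - (fderiv ℝ E x (I • v.1, 0) - fderiv ℝ (cauC φ f a) x (I • v.1, 0)) * hI
    exact ((hd.mul_const _).congr_of_eventuallyEq hev.symm).differentiableWithinAt
  -- Lipschitz constants
  have hcb : closedBall (0 : (Fin m → ℂ) × ℝ) a ⊆ ball 0 R := closedBall_subset_ball haR
  obtain ⟨K, hK⟩ := (isCompact_closedBall (0 : (Fin m → ℂ) × ℝ) a).exists_bound_of_continuousOn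
    ((hf.smooth.continuousOn_fderiv_of_isOpen isOpen_ball le_rfl).mono hcb)
  obtain ⟨N, hN⟩ := (isCompact_closedBall (0 : (Fin m → ℂ) × ℝ) a).exists_bound_of_continuousOn (G.smoothZu.continuousOn.mono hcb)
  have hKl : ∀ p ∈ closedBall (0 : (Fin m → ℂ) × ℝ) a, ∀ q ∈ closedBall (0 : (Fin m → ℂ) × ℝ) a, ‖f p - f q‖ ≤ K * ‖p - q‖ :=
    fun p hp q hq => (convex_closedBall _ _).norm_image_sub_le_of_norm_fderiv_le
      (fun x hx => (hasFDerivAt_of_C1 hf.smooth isOpen_ball (hcb hx)).differentiableAt) hK hq hp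
  have hN0 : 0 ≤ N := (norm_nonneg _).trans (hN 0 (by simpa using ha.le))
  have hK0 : 0 ≤ K := (norm_nonneg _).trans (hK 0 (by simpa using ha.le))
  refine ⟨δ, hδ, by linarith, F, hFo, ?_, ?_⟩
  · intro x hx
    rcases hx.2.lt_or_eq with hlt | heq
    · exact (hFo.differentiableAt (hUo.mem_nhds ⟨hx.1, hlt⟩)).continuousAt.continuousWithinAt
    -- boundary point
    set H : CS m → ℂ := fun x => (f (x.1, x.2.re) * jumpL φ a x +
      (E (x.1, gZ φ (x.1, x.2.re) - I * ((x.2.im - φ (x.1, x.2.re) : ℝ) : ℂ)) - E x)) * (2 * Real.pi * I : ℂ)⁻¹ with hH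
    have hxr : ‖x.1‖ < R := by linarith [hx.1.1]
    have hxu : |x.2.re| < R := by linarith [hx.1.2.1]
    have hZx : ∀ x : CS m, gZ φ (x.1, x.2.re) + I * ((x.2.im - φ (x.1, x.2.re) : ℝ) : ℂ) = x.2 := by
      intro x; apply Complex.ext <;> simp [gZ]
    have hx0 : (x.1, gZ φ (x.1, x.2.re) - I * ((x.2.im - φ (x.1, x.2.re) : ℝ) : ℂ)) = x := by
      have := hZx x
      rw [heq, sub_self] at this ⊢
      simp only [ofReal_zero, mul_zero, add_zero, sub_zero] at this ⊢
      rw [this]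
    have hHx : H x = F x := by
      simp only [hH, hF]
      rw [hx0, if_pos heq.symm, jumpL_bdry (by linarith [hx.1.2.1]) heq.symm]
      field_simp
      ring
    have hHc : ContinuousAt H x := by
      have cE : ContinuousAt E x := (hasFDerivAt_of_C1 hE1 (isOpen_Pd δ) hx.1).continuousAt
      have cm : ContinuousAt (fun x : CS m => (x.1, gZ φ (x.1, x.2.re) - I * ((x.2.im - φ (x.1, x.2.re) : ℝ) : ℂ))) x := by
        refine ContinuousAt.prodMk (by fun_prop) ((cont_gZ' G hxr hxu).sub (continuousAt_const.mul ?_))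
        exact continuous_ofReal.continuousAt.comp ((by fun_prop : ContinuousAt (fun x : CS m => x.2.im) x).sub (contOn_phi' G hxr hxu))
      have cEm : ContinuousAt (fun x : CS m => E (x.1, gZ φ (x.1, x.2.re) - I * ((x.2.im - φ (x.1, x.2.re) : ℝ) : ℂ))) x :=
        ContinuousAt.comp (g := E) (by rw [hx0]; exact cE) cm
      have c : ContinuousAt (fun x : CS m => (x.1, x.2.re)) x := by fun_prop
      have cf : ContinuousAt (fun x : CS m => f (x.1, x.2.re)) x :=
        ContinuousAt.comp (f := fun x : CS m => (x.1, x.2.re)) (g := f) (hf.smooth.continuousOn.continuousAt (isOpen_ball.mem_nhds (mem_ball_WR hxr hxu))) c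
      exact ((cf.mul (jumpL_cont G ha haR hxr (by linarith [hx.1.2.1]))).add (cEm.sub cE)).mul continuousAt_const
    set c := 4 * K * N * (Real.pi + 2 * a) * ‖(2 * Real.pi * I : ℂ)⁻¹‖ with hc
    have hbound : ∀ y ∈ Upc φ δ, ‖F y - H y‖ ≤ c * √(y.2.im - φ (y.1, y.2.re)) := by
      intro y hy
      have hy1 := hy.1.1
      have hy2 := hy.1.2.1
      rcases hy.2.lt_or_eq with hlt | heq
      · have hpos : 0 < y.2.im - φ (y.1, y.2.re) := by linarith
        have hj := jump_formula G hf ha haR haR le_rfl hKl hN (w := y.1) (x := y.2.re) (by linarith) (by linarith) hpos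
        have hbel : E (y.1, gZ φ (y.1, y.2.re) - I * ((y.2.im - φ (y.1, y.2.re) : ℝ) : ℂ)) =
            cauC φ f a (y.1, gZ φ (y.1, y.2.re) - I * ((y.2.im - φ (y.1, y.2.re) : ℝ) : ℂ)) := by
          have hre : (gZ φ (y.1, y.2.re) - I * ((y.2.im - φ (y.1, y.2.re) : ℝ) : ℂ)).re = y.2.re := by simp [gZ]
          have him : (gZ φ (y.1, y.2.re) - I * ((y.2.im - φ (y.1, y.2.re) : ℝ) : ℂ)).im = φ (y.1, y.2.re) - (y.2.im - φ (y.1, y.2.re)) := by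
            simp [gZ]
          have := (abs_le.mp (G.phi_le (w := y.1) (u := y.2.re) (by linarith) (by linarith) hy1.le hy2.le)).2
          refine hEC _ ⟨hy1, by rw [hre]; exact hy2, ?_⟩ ?_
          · simp only; rw [him]; linarith
          · simp only; rw [him, hre]; linarith
        rw [hZx] at hj
        simp only [hF, hH]
        rw [if_neg hlt.ne', hbel, ← sub_mul, norm_mul]
        have e : cauC φ f a y - E y - (f (y.1, y.2.re) * jumpL φ a y + (cauC φ f a (y.1, gZ φ (y.1, y.2.re) - I * ((y.2.im - φ (y.1, y.2.re) : ℝ) : ℂ)) - E y))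
          = (cauC φ f a y - cauC φ f a (y.1, gZ φ (y.1, y.2.re) - I * ((y.2.im - φ (y.1, y.2.re) : ℝ) : ℂ))) - f (y.1, y.2.re) * jumpL φ a y := by ring
        rw [e]
        calc _ ≤ 4 * K * N * (√(y.2.im - φ (y.1, y.2.re)) * (Real.pi + 2 * a)) * ‖(2 * Real.pi * I : ℂ)⁻¹‖ := by
              gcongr
              exact hj
          _ = _ := by rw [hc]; ring
      · have hy0 : (y.1, gZ φ (y.1, y.2.re) - I * ((y.2.im - φ (y.1, y.2.re) : ℝ) : ℂ)) = y := by
          have := hZx y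
          rw [heq, sub_self] at this ⊢
          simp only [ofReal_zero, mul_zero, add_zero, sub_zero] at this ⊢
          rw [this]
        have : H y = F y := by
          simp only [hH, hF]
          rw [hy0, if_pos heq.symm, jumpL_bdry (by linarith) heq.symm]
          field_simp
          ring
        rw [this, sub_self, norm_zero]; positivity
    have hlim : Tendsto (fun y : CS m => c * √(y.2.im - φ (y.1, y.2.re))) (𝓝[Upc φ δ] x) (𝓝 0) := by
      have : ContinuousAt (fun y : CS m => c * √(y.2.im - φ (y.1, y.2.re))) x :=
        continuousAt_const.mul (((by fun_prop : ContinuousAt (fun x : CS m => x.2.im) x).sub (contOn_phi' G hxr hxu)).sqrt)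
      have h2 := this.tendsto.mono_left (nhdsWithin_le_nhds (s := Upc φ δ))
      simpa [heq] using h2
    have h3 : Tendsto (fun y => F y - H y) (𝓝[Upc φ δ] x) (𝓝 0) :=
      squeeze_zero_norm' (eventually_mem_nhdsWithin.mono hbound) hlim
    have h4 := h3.add (hHc.tendsto.mono_left (nhdsWithin_le_nhds (s := Upc φ δ)))
    rw [zero_add, hHx] at h4
    simpa [ContinuousWithinAt] using h4
  · intro w u hw hu
    simp only [hF]
    rw [if_pos (by simp [gZ])]
    simp [gZ]
end

/-- real parametrization `(w,u) ↦ (w, w̄, u)` -/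
def iotaR (m : ℕ) : (Fin m → ℂ) × ℝ →L[ℝ] (Fin m → ℂ) × (Fin m → ℂ) × ℂ :=
  (ContinuousLinearMap.fst ℝ _ _).prod (((cW m).comp (ContinuousLinearMap.fst ℝ _ _)).prod
    (Complex.ofRealCLM.comp (ContinuousLinearMap.snd ℝ _ _)))

theorem iotaR_apply {m : ℕ} (p : (Fin m → ℂ) × ℝ) : iotaR m p = (p.1, conjW p.1, (p.2 : ℂ)) := by
  simp [iotaR, cW_apply]

theorem norm_iotaR {m : ℕ} (p : (Fin m → ℂ) × ℝ) : ‖iotaR m p‖ = ‖p‖ := by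
  rw [iotaR_apply, Prod.norm_def, Prod.norm_def, Prod.norm_def, norm_conjW]
  simp

def mphi {m : ℕ} (Φ : (Fin m → ℂ) × (Fin m → ℂ) × ℂ → ℂ) (p : (Fin m → ℂ) × ℝ) : ℝ :=
  (Φ (p.1, conjW p.1, (p.2 : ℂ))).re

theorem GraphData.mono {m : ℕ} {φ : (Fin m → ℂ) × ℝ → ℝ} {R R' : ℝ} (G : GraphData φ R) (h0 : 0 < R') (h : R' ≤ R) :
    GraphData φ R' where
  rpos := h0
  smooth := G.smooth.mono (ball_subset_ball h)
  zero := G.zero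
  lip p hp q hq := G.lip p (ball_subset_ball h hp) q (ball_subset_ball h hq)

theorem IsCRg.mono {m : ℕ} {φ : (Fin m → ℂ) × ℝ → ℝ} {R R' : ℝ} {f} (G : IsCRg φ R f) (h : R' ≤ R) :
    IsCRg φ R' f where
  smooth := G.smooth.mono (ball_subset_ball h)
  cr p hp := G.cr p (ball_subset_ball h hp)

section
variable {m : ℕ} {M : Set (CS m)} {q : CS m} {Φ : (Fin m → ℂ) × (Fin m → ℂ) × ℂ → ℂ} {κ σ : CS m → CS m} {r : ℝ}

theorem IsModel.lip (H : IsModel M q Φ κ σ r) {p q' : (Fin m → ℂ) × (Fin m → ℂ) × ℂ} (hp : p ∈ ball 0 r) (hq : q' ∈ ball 0 r) :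
    ‖Φ p - Φ q'‖ ≤ ‖p - q'‖ / 8 := by
  have := (convex_ball (0 : (Fin m → ℂ) × (Fin m → ℂ) × ℂ) r).norm_image_sub_le_of_norm_fderiv_le (𝕜 := ℂ)
    (fun x hx => (H.hol x hx).differentiableAt (isOpen_ball.mem_nhds hx)) H.dbound hq hp
  linarith

theorem IsModel.graph (H : IsModel M q Φ κ σ r) : GraphData (mphi Φ) r where
  rpos := H.rpos
  smooth := by
    have h1 : ContDiffOn ℝ 2 Φ (ball 0 r) := (contDiffOn_nat_of_hol isOpen_ball 2 H.hol).restrict_scalars ℝ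
    have h2 : ContDiffOn ℝ 2 (fun p => Φ (iotaR m p)) (ball 0 r) :=
      h1.comp (iotaR m).contDiff.contDiffOn (fun p hp => by
        simp only [mem_ball_zero_iff, norm_iotaR] at hp ⊢; exact hp)
    have h3 := Complex.reCLM.contDiff.comp_contDiffOn h2
    refine h3.congr fun p hp => ?_
    simp [mphi, iotaR_apply]
  zero := by
    have : ((0 : Fin m → ℂ), (0 : Fin m → ℂ), (0 : ℂ)) = 0 := rfl
    simp [mphi, this, H.zero]
  lip p hp p' hp' := by
    have := H.lip (p := iotaR m p) (q' := iotaR m p') (by simpa [norm_iotaR] using hp) (by simpa [norm_iotaR] using hp')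
    rw [← map_sub, norm_iotaR] at this
    refine le_trans ?_ this
    simp only [mphi, iotaR_apply]
    rw [← Complex.sub_re]; exact Complex.abs_re_le_norm _

theorem IsModel.phi_real (H : IsModel M q Φ κ σ r) {p : (Fin m → ℂ) × ℝ} (hp : p ∈ ball 0 r) :
    Φ (p.1, conjW p.1, (p.2 : ℂ)) = (mphi Φ p : ℂ) := by
  have h1 : (p.1, conjW p.1, (p.2 : ℂ)) ∈ ball (0 : (Fin m → ℂ) × (Fin m → ℂ) × ℂ) r := by
    rw [← iotaR_apply]; simpa [norm_iotaR] using hp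
  have h2 := H.conj _ _ _ h1
  rw [conjW_conjW, Complex.conj_ofReal] at h2
  exact (Complex.conj_eq_iff_re.1 h2).symm

theorem GDiscs_of (hD : HasDiscs Φ) : GDiscs (mphi Φ) := by
  intro ε hε
  obtain ⟨Λ, qd, h⟩ := hD ε hε
  exact ⟨Λ, qd, h⟩

def gam (φ : (Fin m → ℂ) × ℝ → ℝ) (p : (Fin m → ℂ) × ℝ) : CS m := (p.1, gZ φ p)

theorem IsModel.gam_mem (H : IsModel M q Φ κ σ r) {p : (Fin m → ℂ) × ℝ} (hp : p ∈ ball 0 (r/2)) :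
    gam (mphi Φ) p ∈ ball 0 r := by
  have hr := H.rpos
  have hp1 := mem_ball_zero_iff.1 hp
  have h1 := H.graph.lip p (ball_subset_ball (by linarith) hp) 0 (by simpa using hr)
  rw [H.graph.zero, sub_zero, sub_zero] at h1
  rw [mem_ball_zero_iff, gam, Prod.norm_def]
  have h2 : ‖p.1‖ ≤ ‖p‖ := norm_fst_le p
  have h3 : ‖p.2‖ ≤ ‖p‖ := norm_snd_le p
  have h4 : ‖gZ (mphi Φ) p‖ ≤ ‖p.2‖ + |mphi Φ p| := by
    refine (norm_add_le _ _).trans ?_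
    simp
  simp only [max_lt_iff]
  constructor <;> linarith

theorem IsModel.gam_in (H : IsModel M q Φ κ σ r) {p : (Fin m → ℂ) × ℝ} (hp : p ∈ ball 0 (r/2)) :
    κ (gam (mphi Φ) p) ∈ M := by
  rw [H.mem _ (H.gam_mem hp)]
  simp only [gam, gZ_re, gZ_im]; rfl

theorem IsModel.hasgam (H : IsModel M q Φ κ σ r) {p : (Fin m → ℂ) × ℝ} (hp : p ∈ ball 0 (r/2)) :
    HasFDerivAt (gam (mphi Φ)) ((ContinuousLinearMap.fst ℝ _ _).prod (fderiv ℝ (gZ (mphi Φ)) p)) p := by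
  have hr := H.rpos
  exact hasFDerivAt_fst.prodMk (H.graph.hasZ (ball_subset_ball (by linarith) hp))

theorem IsModel.hasκ (H : IsModel M q Φ κ σ r) {x : CS m} (hx : x ∈ ball 0 r) :
    HasFDerivAt κ ((fderiv ℂ κ x).restrictScalars ℝ) x :=
  ((H.κdiff.differentiableAt (isOpen_ball.mem_nhds hx)).hasFDerivAt).restrictScalars ℝ

theorem IsModel.hasκg (H : IsModel M q Φ κ σ r) {p : (Fin m → ℂ) × ℝ} (hp : p ∈ ball 0 (r/2)) :
    HasFDerivAt (fun p => κ (gam (mphi Φ) p)) (((fderiv ℂ κ (gam (mphi Φ) p)).restrictScalars ℝ).comp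
      ((ContinuousLinearMap.fst ℝ _ _).prod (fderiv ℝ (gZ (mphi Φ)) p))) p :=
  HasFDerivAt.comp (g := κ) p (H.hasκ (H.gam_mem hp)) (H.hasgam hp)

theorem IsModel.tangent (H : IsModel M q Φ κ σ r) {p : (Fin m → ℂ) × ℝ} (hp : p ∈ ball 0 (r/2)) (e) :
    TangentAt M (κ (gam (mphi Φ) p)) (fderiv ℂ κ (gam (mphi Φ) p) (e.1, fderiv ℝ (gZ (mphi Φ)) p e)) := by
  intro ρ hρ hz
  have h1 := HasFDerivAt.comp (g := ρ) p hρ.hasFDerivAt (H.hasκg hp)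
  have hc : Tendsto (fun p => κ (gam (mphi Φ) p)) (𝓝 p) (𝓝 (κ (gam (mphi Φ) p))) :=
    (H.hasκg hp).continuousAt
  have h2 : (ρ ∘ fun p => κ (gam (mphi Φ) p)) =ᶠ[𝓝 p] fun _ => 0 := by
    filter_upwards [hc.eventually hz, isOpen_ball.mem_nhds hp] with x hx hxb
    exact hx (H.gam_in hxb)
  have h3 := h1.unique ((hasFDerivAt_const (0:ℝ) p).congr_of_eventuallyEq h2)
  have h4 := DFunLike.congr_fun h3 e
  simpa using h4

theorem gZu_ne (φ : (Fin m → ℂ) × ℝ → ℝ) {p} (hd : DifferentiableAt ℝ (gZ φ) p) : gZu φ p ≠ 0 := by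
  intro h0
  have h1 := HasFDerivAt.comp (g := fun z : ℂ => z.re) p Complex.reCLM.hasFDerivAt hd.hasFDerivAt
  have h2 : ((fun z : ℂ => z.re) ∘ gZ φ) = fun p => p.2 := by ext x; simp [gZ_re]
  rw [h2] at h1
  have h3 := DFunLike.congr_fun (h1.unique hasFDerivAt_snd) ((0 : Fin m → ℂ), (1 : ℝ))
  simp only [gZu] at h0
  simp [h0] at h3

theorem IsModel.isCRg (H : IsModel M q Φ κ σ r) {U : Set (CS m)} {g : CS m → ℂ} (hU : IsOpen U)
    (hg : ContDiffOn ℝ 1 g U) (hcr : ∀ q ∈ M ∩ U, ∀ v, ComplexTangentAt M q v → antiCDeriv g q v = 0)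
    {R : ℝ} (hR : R ≤ r / 2) (hRU : ∀ p ∈ ball 0 R, κ (gam (mphi Φ) p) ∈ U) :
    IsCRg (mphi Φ) R (fun p => g (κ (gam (mphi Φ) p))) := by
  have hr := H.rpos
  constructor
  · refine hg.comp ?_ hRU
    have h1 : ContDiffOn ℝ 1 κ (ball 0 r) := (contDiffOn_nat_of_hol isOpen_ball 1 H.κdiff).restrict_scalars ℝ
    refine h1.comp ?_ (fun p hp => H.gam_mem (ball_subset_ball hR hp))
    exact contDiff_fst.contDiffOn.prodMk ((H.graph.smoothZ.of_le (by norm_num)).mono (ball_subset_ball (by linarith)))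
  · intro p hp v
    have hp2 := ball_subset_ball hR hp
    have hpU := hRU p hp
    set x := κ (gam (mphi Φ) p) with hx
    have hgx : HasFDerivAt g (fderiv ℝ g x) x := hasFDerivAt_of_C1 hg hU hpU
    have h1 := HasFDerivAt.comp (g := g) p hgx (H.hasκg hp2)
    set L := fderiv ℝ (gZ (mphi Φ)) p with hL
    have hD : ∀ e, fderiv ℝ (fun p => g (κ (gam (mphi Φ) p))) p e
        = fderiv ℝ g x (fderiv ℂ κ (gam (mphi Φ) p) (e.1, L e)) := by
      intro e
      have := h1.fderiv
      change fderiv ℝ (fun p => g (κ (gam (mphi Φ) p))) p = _ at this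
      rw [this]; simp
    have hne : gZu (mphi Φ) p ≠ 0 := gZu_ne _ (H.graph.hasZ (ball_subset_ball (by linarith) hp2)).differentiableAt
    have hLs : ∀ v (c : ℝ), L (v, c) = L (v, 0) + c * gZu (mphi Φ) p := by
      intro v c
      have : ((v, c) : (Fin m → ℂ) × ℝ) = (v, 0) + c • (0, 1) := by simp
      rw [this, map_add, map_smul, gZu, Complex.real_smul]
    set C : ℂ := -2 * dbarW (gZ (mphi Φ)) p v / gZu (mphi Φ) p with hC
    have hCe : (C.re + I * C.im) * gZu (mphi Φ) p = -(L (v, 0) + I * L (I • v, 0)) := by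
      have : (C.re : ℂ) + I * C.im = C := by rw [mul_comm]; exact Complex.re_add_im C
      rw [this, hC, dbarW]; field_simp; rfl
    have hI : I • fderiv ℂ κ (gam (mphi Φ) p) (v, L (v, C.re)) =
        fderiv ℂ κ (gam (mphi Φ) p) (I • v, L (I • v, C.im)) := by
      rw [← map_smul]; congr 1
      rw [Prod.smul_mk]; congr 1
      rw [hLs v C.re, hLs (I • v) C.im, smul_eq_mul]
      linear_combination (I) * hCe + (-(C.im : ℂ) * gZu (mphi Φ) p - L (I • v, 0)) * Complex.I_sq
    have ht : ComplexTangentAt M x (fderiv ℂ κ (gam (mphi Φ) p) (v, L (v, C.re))) :=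
      ⟨H.tangent hp2 (v, C.re), by rw [hI]; exact H.tangent hp2 (I • v, C.im)⟩
    have h2 := hcr x ⟨H.gam_in hp2, hpU⟩ _ ht
    rw [antiCDeriv, hI] at h2
    have e1 := hD (v, C.re)
    have e2 := hD (I • v, C.im)
    simp only at e1 e2
    rw [← e1, ← e2] at h2
    set D := fderiv ℝ (fun p => g (κ (gam (mphi Φ) p))) p with hDD
    have hDs : ∀ v (c : ℝ), D (v, c) = D (v, 0) + c * D (0, 1) := by
      intro v c
      have : ((v, c) : (Fin m → ℂ) × ℝ) = (v, 0) + c • (0, 1) := by simp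
      rw [this, map_add, map_smul, Complex.real_smul]
    rw [hDs v, hDs (I • v)] at h2
    simp only [dbarW]
    rw [← hDD, ← hL]
    linear_combination gZu (mphi Φ) p * h2 - (1/2) * D (0,1) * hCe
end

def Om (m : ℕ) (r : ℝ) (N : ℕ) : Set ((Fin m → ℂ) × (Fin m → ℂ) × ℂ) :=
  {p | ‖p.1‖ < r ∧ ‖p.2.2‖ < r ∧ 0 < -p.2.2.im ∧ ‖p.2.1 - conjW p.1‖ < (-p.2.2.im) ^ N}

def Lo (m : ℕ) (r : ℝ) : Set (CS m) := {x | ‖x.1‖ < r ∧ ‖x.2‖ < r ∧ 0 ≤ -x.2.im}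

def diagA {m : ℕ} (x : CS m) : (Fin m → ℂ) × (Fin m → ℂ) × ℂ := (x.1, conjW x.1, x.2)

theorem continuous_diagA {m : ℕ} : Continuous (diagA (m := m)) :=
  continuous_fst.prodMk ((continuous_conjW.comp continuous_fst).prodMk continuous_snd)

theorem isOpen_Om {m : ℕ} {r : ℝ} {N : ℕ} : IsOpen (Om m r N) := by
  have h1 : Continuous fun p : (Fin m → ℂ) × (Fin m → ℂ) × ℂ => ‖p.1‖ := continuous_fst.norm
  have h2 : Continuous fun p : (Fin m → ℂ) × (Fin m → ℂ) × ℂ => ‖p.2.2‖ := continuous_snd.snd.norm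
  have h3 : Continuous fun p : (Fin m → ℂ) × (Fin m → ℂ) × ℂ => -p.2.2.im :=
    (Complex.continuous_im.comp continuous_snd.snd).neg
  have h4 : Continuous fun p : (Fin m → ℂ) × (Fin m → ℂ) × ℂ => ‖p.2.1 - conjW p.1‖ :=
    (continuous_snd.fst.sub (continuous_conjW.comp continuous_fst)).norm
  exact (isOpen_lt h1 continuous_const).inter ((isOpen_lt h2 continuous_const).inter
    ((isOpen_lt continuous_const h3).inter (isOpen_lt h4 (h3.pow N))))

theorem neg_im_le_norm (s : ℂ) : -s.im ≤ ‖s‖ := (neg_le_abs _).trans (Complex.abs_im_le_norm s)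

theorem Om_mono {m : ℕ} {r r' : ℝ} {N N' : ℕ} (hr : r' ≤ r) (hr1 : r' ≤ 1) (hN : N ≤ N') : Om m r' N' ⊆ Om m r N := by
  rintro p ⟨h1, h2, h3, h4⟩
  refine ⟨h1.trans_le hr, h2.trans_le hr, h3, h4.trans_le ?_⟩
  exact pow_le_pow_of_le_one h3.le (by linarith [neg_im_le_norm p.2.2]) hN

theorem Lo_mono {m : ℕ} {r r' : ℝ} (hr : r' ≤ r) : Lo m r' ⊆ Lo m r := by
  rintro p ⟨h1, h2, h3⟩
  exact ⟨h1.trans_le hr, h2.trans_le hr, h3⟩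

theorem diag_mem_Om {m : ℕ} {r : ℝ} {N : ℕ} {x : CS m} (hx : x ∈ Lo m r) (h : 0 < -x.2.im) : diagA x ∈ Om m r N := by
  refine ⟨hx.1, hx.2.1, h, ?_⟩
  simp only [diagA, sub_self, norm_zero]
  exact pow_pos h N

section
variable {m : ℕ} {E F : Type*} [NormedAddCommGroup E] [NormedSpace ℂ E] [NormedAddCommGroup F] [NormedSpace ℂ F]

structure PreA (Q : (Fin m → ℂ) × ℝ → E) (Qs : (Fin m → ℂ) × (Fin m → ℂ) × ℂ → E) (r : ℝ) (N K : ℕ) (C : ℝ) : Prop where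
  rpos : 0 < r
  r1 : r ≤ 1
  hol : DifferentiableOn ℂ Qs (Om m r N)
  bound : ∀ p ∈ Om m r N, ‖Qs p‖ * (-p.2.2.im) ^ K ≤ C
  cont : ContinuousOn (fun x => Qs (diagA x)) (Lo m r)
  bdry : ∀ w (u : ℝ), ‖w‖ < r → |u| < r → Qs (diagA (w, (u:ℂ))) = Q (w, u)

def InA (Q : (Fin m → ℂ) × ℝ → E) : Prop := ∃ Qs r N K C, PreA Q Qs r N K C

theorem PreA.mono {Q : (Fin m → ℂ) × ℝ → E} {Qs} {r r' : ℝ} {N N' K : ℕ} {C : ℝ} (H : PreA Q Qs r N K C)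
    (h0 : 0 < r') (hr : r' ≤ r) (hN : N ≤ N') : PreA Q Qs r' N' K C where
  rpos := h0
  r1 := hr.trans H.r1
  hol := H.hol.mono (Om_mono hr (hr.trans H.r1) hN)
  bound p hp := H.bound p (Om_mono hr (hr.trans H.r1) hN hp)
  cont := H.cont.mono (Lo_mono hr)
  bdry w u hw hu := H.bdry w u (hw.trans_le hr) (hu.trans_le hr)

theorem PreA.near {Q : (Fin m → ℂ) × ℝ → E} {Qs} {r : ℝ} {N K : ℕ} {C : ℝ} (H : PreA Q Qs r N K C) {ε : ℝ} (hε : 0 < ε) :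
    ∃ r' > 0, r' ≤ r ∧ (∀ p ∈ Om m r' (N + K + 1), ‖Qs p - Q 0‖ < ε) ∧ ∀ x ∈ Lo m r', ‖Qs (diagA x) - Q 0‖ < ε := by
  have hr := H.rpos
  have h00 : Qs (diagA ((0 : Fin m → ℂ), (0 : ℂ))) = Q 0 := by
    have := H.bdry 0 0 (by simpa using hr) (by simpa using hr)
    simpa [show ((0 : Fin m → ℂ), (0 : ℝ)) = 0 from rfl] using this
  have hc := H.cont ((0 : Fin m → ℂ), (0 : ℂ)) ⟨by simpa using hr, by simpa using hr, by simp⟩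
  rw [Metric.continuousWithinAt_iff] at hc
  obtain ⟨δ, hδ, hd⟩ := hc (ε / 2) (by linarith)
  simp only [h00] at hd
  set r' := min (min δ r) (ε / (4 * (|C| + 1))) with hr'
  have hC1 : 0 < |C| + 1 := by positivity
  have hr0 : 0 < r' := lt_min (lt_min hδ hr) (by positivity)
  have hrr : r' ≤ r := (min_le_left _ _).trans (min_le_right _ _)
  have hrδ : r' ≤ δ := (min_le_left _ _).trans (min_le_left _ _)
  have hrε : r' * (4 * (|C| + 1)) ≤ ε := by
    rw [← le_div_iff₀ (by positivity)]; exact min_le_right _ _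
  have hLo : ∀ x ∈ Lo m r', ‖Qs (diagA x) - Q 0‖ < ε / 2 := by
    intro x hx
    rw [← dist_eq_norm]
    apply hd (Lo_mono hrr hx)
    rw [show ((0 : Fin m → ℂ), (0 : ℂ)) = 0 from rfl, dist_zero_right, Prod.norm_def]
    exact max_lt (hx.1.trans_le hrδ) (hx.2.1.trans_le hrδ)
  refine ⟨r', hr0, hrr, ?_, fun x hx => (hLo x hx).trans (by linarith)⟩
  rintro ⟨w, ω, s⟩ ⟨h1, h2, h3, h4⟩
  simp only at h1 h2 h3 h4
  set y := -s.im with hy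
  have hyr : y < r' := (neg_im_le_norm s).trans_lt h2
  have hy1 : y ≤ 1 := by linarith [H.r1]
  have hmem : ∀ ω' ∈ ball (conjW w) (y ^ N), (w, ω', s) ∈ Om m r N := by
    intro ω' hω'
    refine ⟨h1.trans_le hrr, h2.trans_le hrr, h3, ?_⟩
    simpa [dist_eq_norm] using hω'
  have hb : ∀ ω' ∈ ball (conjW w) (y ^ N), ‖Qs (w, ω', s)‖ ≤ C / y ^ K := by
    intro ω' hω'
    rw [le_div_iff₀ (pow_pos h3 K)]
    exact H.bound _ (hmem ω' hω')
  have hcc : conjW w ∈ ball (conjW w) (y ^ N) := mem_ball_self (pow_pos h3 N)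
  have hC0 : 0 ≤ C / y ^ K := (norm_nonneg _).trans (hb _ hcc)
  have hω : ω ∈ ball (conjW w) (y ^ N) := by
    rw [mem_ball, dist_eq_norm]
    exact h4.trans_le (pow_le_pow_of_le_one h3.le hy1 (by omega))
  have hs := Complex.dist_le_div_mul_dist_of_mapsTo_ball (f := fun ω' => Qs (w, ω', s)) (c := conjW w) (R₁ := y ^ N)
    (R₂ := 2 * (C / y ^ K)) (z := ω)
    (fun ω' hω' => by
      have h5 := (H.hol _ (hmem ω' hω')).differentiableAt (isOpen_Om.mem_nhds (hmem ω' hω'))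
      have h6 : DifferentiableAt ℂ (fun ω' : Fin m → ℂ => (w, ω', s)) ω' :=
        (differentiableAt_const w).prodMk (differentiableAt_id.prodMk (differentiableAt_const s))
      exact (DifferentiableAt.comp (g := Qs) ω' h5 h6).differentiableWithinAt)
    (fun ω' hω' => by
      rw [mem_closedBall, dist_eq_norm]
      refine (norm_sub_le _ _).trans ?_
      linarith [hb _ hω', hb _ hcc]) hω
  simp only [dist_eq_norm] at hs
  have hd2 : ‖Qs (w, ω, s) - Qs (w, conjW w, s)‖ ≤ ε / 2 := by
    refine hs.trans ?_
    calc 2 * (C / y ^ K) / y ^ N * ‖ω - conjW w‖ ≤ 2 * (C / y ^ K) / y ^ N * y ^ (N + K + 1) := by gcongr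
      _ = 2 * C * y := by rw [pow_add, pow_add]; field_simp
      _ ≤ 2 * (|C| + 1) * r' := by
          have := le_abs_self C
          have : C * y ≤ (|C| + 1) * y := by nlinarith
          nlinarith
      _ ≤ ε / 2 := by nlinarith
  have hx := hLo (w, s) ⟨h1, h2, h3.le⟩
  have : Qs (w, ω, s) - Q 0 = (Qs (w, ω, s) - Qs (w, conjW w, s)) + (Qs (diagA (w, s)) - Q 0) := by
    simp [diagA]
  rw [this]
  exact (norm_add_le _ _).trans_lt (by linarith)

theorem InA.comp {Q : (Fin m → ℂ) × ℝ → E} (H : InA Q) {Ψ : E → F} (hΨ : ∀ᶠ x in 𝓝 (Q 0), DifferentiableAt ℂ Ψ x) :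
    InA (fun p => Ψ (Q p)) := by
  obtain ⟨Qs, r, N, K, C, H⟩ := H
  have hcont : ContinuousAt Ψ (Q 0) := hΨ.self_of_nhds.continuousAt
  have hb : ∀ᶠ x in 𝓝 (Q 0), ‖Ψ x - Ψ (Q 0)‖ < 1 := by
    have := Metric.continuousAt_iff'.1 hcont 1 one_pos
    simpa [dist_eq_norm] using this
  obtain ⟨ε, hε, hεb⟩ := Metric.eventually_nhds_iff_ball.1 (hΨ.and hb)
  obtain ⟨r', hr0, hrr, h1, h2⟩ := H.near hε
  refine ⟨fun p => Ψ (Qs p), r', N + K + 1, 0, ‖Ψ (Q 0)‖ + 1, hr0, hrr.trans H.r1, ?_, ?_, ?_, ?_⟩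
  · intro p hp
    have hp' := Om_mono hrr (hrr.trans H.r1) (show N ≤ N + K + 1 by omega) hp
    have h3 := (H.hol _ hp').differentiableAt (isOpen_Om.mem_nhds hp')
    have h4 := (hεb (Qs p) (by rw [mem_ball, dist_eq_norm]; exact h1 p hp)).1
    exact (DifferentiableAt.comp (g := Ψ) p h4 h3).differentiableWithinAt
  · intro p hp
    have h4 := (hεb (Qs p) (by rw [mem_ball, dist_eq_norm]; exact h1 p hp)).2
    rw [pow_zero, mul_one]
    have : Ψ (Qs p) = (Ψ (Qs p) - Ψ (Q 0)) + Ψ (Q 0) := by simp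
    rw [this]
    exact (norm_add_le _ _).trans (by linarith)
  · intro x hx
    have h4 := (hεb (Qs (diagA x)) (by rw [mem_ball, dist_eq_norm]; exact h2 x hx)).1
    exact ContinuousAt.comp_continuousWithinAt (g := Ψ) h4.continuousAt ((H.cont.mono (Lo_mono hrr)) x hx)
  · intro w u hw hu
    rw [H.bdry w u (hw.trans_le hrr) (hu.trans_le hrr)]

theorem InA.prodMk {Q : (Fin m → ℂ) × ℝ → E} {Q' : (Fin m → ℂ) × ℝ → F} (H : InA Q) (H' : InA Q') :
    InA (fun p => (Q p, Q' p)) := by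
  obtain ⟨Qs, r, N, K, C, H⟩ := H
  obtain ⟨Qs', r', N', K', C', H'⟩ := H'
  have hr0 := lt_min H.rpos H'.rpos
  have G := H.mono hr0 (min_le_left _ _) (Nat.le_add_right N N')
  have G' := H'.mono hr0 (min_le_right _ _) (Nat.le_add_left N' N)
  refine ⟨fun p => (Qs p, Qs' p), min r r', N + N', K + K', max C C', hr0, G.r1, G.hol.prodMk G'.hol, ?_,
    G.cont.prodMk G'.cont, ?_⟩
  · intro p hp
    have hy0 : 0 < -p.2.2.im := hp.2.2.1
    have hy1 : -p.2.2.im ≤ 1 := (neg_im_le_norm _).trans (hp.2.1.le.trans G.r1)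
    have hK : (-p.2.2.im) ^ (K + K') ≤ (-p.2.2.im) ^ K := pow_le_pow_of_le_one hy0.le hy1 (by omega)
    have hK' : (-p.2.2.im) ^ (K + K') ≤ (-p.2.2.im) ^ K' := pow_le_pow_of_le_one hy0.le hy1 (by omega)
    rw [Prod.norm_def, max_mul_of_nonneg _ _ (by positivity)]
    refine max_le_max ?_ ?_
    · exact (mul_le_mul_of_nonneg_left hK (norm_nonneg _)).trans (G.bound p hp)
    · exact (mul_le_mul_of_nonneg_left hK' (norm_nonneg _)).trans (G'.bound p hp)
  · intro w u hw hu
    simp only [G.bdry w u hw hu, G'.bdry w u hw hu]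

theorem InA.const (c : E) : InA (fun _ : (Fin m → ℂ) × ℝ => c) :=
  ⟨fun _ => c, 1, 0, 0, ‖c‖, one_pos, le_rfl, differentiableOn_const c, fun p hp => by simp, continuousOn_const,
    fun _ _ _ _ => rfl⟩

theorem InA.add {Q Q' : (Fin m → ℂ) × ℝ → E} (H : InA Q) (H' : InA Q') : InA (fun p => Q p + Q' p) :=
  (H.prodMk H').comp (Ψ := fun x : E × E => x.1 + x.2)
    (Eventually.of_forall fun x => differentiableAt_fst.add differentiableAt_snd)

theorem InA.smul {Q : (Fin m → ℂ) × ℝ → ℂ} {Q' : (Fin m → ℂ) × ℝ → E} (H : InA Q) (H' : InA Q') : InA (fun p => Q p • Q' p) :=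
  (H.prodMk H').comp (Ψ := fun x : ℂ × E => x.1 • x.2)
    (Eventually.of_forall fun x => differentiableAt_fst.smul differentiableAt_snd)

theorem InA.mul {Q Q' : (Fin m → ℂ) × ℝ → ℂ} (H : InA Q) (H' : InA Q') : InA (fun p => Q p * Q' p) := H.smul H'

theorem InA.inv {Q : (Fin m → ℂ) × ℝ → ℂ} (H : InA Q) (h0 : Q 0 ≠ 0) : InA (fun p => (Q p)⁻¹) :=
  H.comp (Ψ := fun x : ℂ => x⁻¹) (by
    filter_upwards [isOpen_ne.mem_nhds h0] with x hx using differentiableAt_inv hx)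

theorem InA.clm {Q : (Fin m → ℂ) × ℝ → E} (H : InA Q) (L : E →L[ℂ] F) : InA (fun p => L (Q p)) :=
  H.comp (Eventually.of_forall fun x => L.differentiableAt)

theorem InA.finsum {ι : Type*} (s : Finset ι) {Q : ι → (Fin m → ℂ) × ℝ → E} (H : ∀ i ∈ s, InA (Q i)) :
    InA (fun p => ∑ i ∈ s, Q i p) := by
  classical
  induction s using Finset.induction_on with
  | empty => simpa using InA.const (0 : E)
  | insert a s ha ih =>
    have := (H a (by simp)).add (ih fun i hi => H i (by simp [hi]))
    simpa [Finset.sum_insert ha] using this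

theorem InA.pi {ι : Type*} [Fintype ι] {Q : ι → (Fin m → ℂ) × ℝ → ℂ} (H : ∀ i, InA (Q i)) :
    InA (fun p i => Q i p) := by
  classical
  have := InA.finsum Finset.univ (Q := fun i p => Q i p • (Pi.single i 1 : ι → ℂ))
    (fun i _ => (H i).smul (InA.const _))
  convert this using 2 with p
  ext j
  simp [Finset.sum_apply, Pi.single_apply]

theorem InA.congr {Q Q' : (Fin m → ℂ) × ℝ → E} (H : InA Q) (h : Q' =ᶠ[𝓝 0] Q) : InA Q' := by
  obtain ⟨Qs, r, N, K, C, H⟩ := H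
  obtain ⟨ε, hε, hb⟩ := Metric.eventually_nhds_iff_ball.1 h
  have G := H.mono (r' := min r ε) (lt_min H.rpos hε) (min_le_left _ _) le_rfl
  refine ⟨Qs, min r ε, N, K, C, G.rpos, G.r1, G.hol, G.bound, G.cont, fun w u hw hu => ?_⟩
  rw [G.bdry w u hw hu, hb]
  exact mem_ball_WR (hw.trans_le (min_le_right _ _)) (hu.trans_le (min_le_right _ _))

/-- holomorphic functions of `(w, w̄, u)` -/
theorem InA.hol {f : (Fin m → ℂ) × (Fin m → ℂ) × ℂ → E} {r : ℝ} (hr : 0 < r) (hf : DifferentiableOn ℂ f (ball 0 r)) :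
    InA (fun p => f (iotaR m p)) := by
  obtain ⟨R, hR, hRr, C, hC⟩ := hol_locally_bounded isOpen_ball hf.continuousOn (mem_ball_self hr)
  set r' := min (R / 2) 1 with hr'
  have hr0 : 0 < r' := lt_min (by linarith) one_pos
  have hrR : r' ≤ R / 2 := min_le_left _ _
  have hmem : ∀ p ∈ Om m r' 1, p ∈ ball (0 : (Fin m → ℂ) × (Fin m → ℂ) × ℂ) R := by
    rintro ⟨w, ω, s⟩ ⟨h1, h2, h3, h4⟩
    simp only [pow_one] at h1 h2 h3 h4
    have h5 := neg_im_le_norm s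
    have h6 : ‖ω‖ ≤ ‖ω - conjW w‖ + ‖w‖ := by
      have := norm_add_le (ω - conjW w) (conjW w); simpa using this
    rw [mem_ball_zero_iff, Prod.norm_def, Prod.norm_def]
    simp only [max_lt_iff]
    exact ⟨by linarith, by linarith, by linarith⟩
  have hmem2 : ∀ x ∈ Lo m r', diagA x ∈ ball (0 : (Fin m → ℂ) × (Fin m → ℂ) × ℂ) R := by
    rintro ⟨w, s⟩ ⟨h1, h2, h3⟩
    simp only at h1 h2 h3
    rw [mem_ball_zero_iff, Prod.norm_def, Prod.norm_def]
    simp only [diagA, max_lt_iff, norm_conjW]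
    exact ⟨by linarith, by linarith, by linarith⟩
  refine ⟨f, r', 1, 0, C, hr0, min_le_right _ _, hf.mono fun p hp => hRr (hmem p hp), fun p hp => ?_, ?_, ?_⟩
  · simpa using hC p (hmem p hp)
  · exact hf.continuousOn.comp continuous_diagA.continuousOn fun x hx => hRr (hmem2 x hx)
  · intro w u hw hu
    simp [iotaR_apply, diagA]
end

theorem whitney {m : ℕ} {r : ℝ} (hr : 0 < r) (N : ℕ) : ∃ r' > 0, r' ≤ r ∧ r' ≤ 1 ∧ ∀ p ∈ Om m r' (N + 2),
    ∀ p' ∈ ball p ((-p.2.2.im) ^ (N + 2)), p' ∈ Om m r N ∧ (-p.2.2.im) / 2 ≤ -p'.2.2.im := by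
  have hh : 0 < ((1:ℝ)/2) ^ N := by positivity
  have hh1 : ((1:ℝ)/2) ^ N ≤ 1 := pow_le_one₀ (by norm_num) (by norm_num)
  set r' := min (r / 2) ((1/2) ^ N / 6) with hr'
  have h6 : r' ≤ (1/2) ^ N / 6 := min_le_right _ _
  have h7 : r' ≤ r / 2 := min_le_left _ _
  refine ⟨r', lt_min (by linarith) (by linarith), by linarith, by linarith, ?_⟩
  rintro ⟨w, ω, s⟩ ⟨h1, h2, h3, h4⟩ ⟨w', ω', s'⟩ hp'
  simp only at h1 h2 h3 h4 hp' ⊢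
  set y := -s.im with hy
  have hyr : y < r' := (neg_im_le_norm s).trans_lt h2
  set ρ := y ^ (N + 2) with hρ
  have hρe : ρ = y ^ N * y * y := by rw [hρ]; ring
  have hyN : y ^ N ≤ 1 := pow_le_one₀ h3.le (by linarith)
  have hyN0 : 0 < y ^ N := pow_pos h3 N
  have hρy : ρ ≤ y / 6 := by
    rw [hρe]
    have : y ^ N * y ≤ 1 * y := by gcongr
    nlinarith
  rw [mem_ball, dist_eq_norm, Prod.norm_def, Prod.norm_def] at hp'
  simp only [Prod.fst_sub, Prod.snd_sub, max_lt_iff] at hp'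
  obtain ⟨d1, d2, d3⟩ := hp'
  have e1 : ‖w'‖ ≤ ‖w' - w‖ + ‖w‖ := by have := norm_add_le (w' - w) w; simpa using this
  have e3 : ‖s'‖ ≤ ‖s' - s‖ + ‖s‖ := by have := norm_add_le (s' - s) s; simpa using this
  have e4 : |(s' - s).im| ≤ ‖s' - s‖ := Complex.abs_im_le_norm _
  have e5 := (abs_le.1 e4).2
  rw [Complex.sub_im] at e5
  have hy' : y / 2 ≤ -s'.im := by linarith
  refine ⟨⟨by show ‖w'‖ < r; linarith, by show ‖s'‖ < r; linarith, by show 0 < -s'.im; linarith, ?_⟩, hy'⟩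
  show ‖ω' - conjW w'‖ < (-s'.im) ^ N
  have e6 : ‖ω' - conjW w'‖ ≤ ‖ω' - ω‖ + ‖ω - conjW w‖ + ‖w' - w‖ := by
    have : ω' - conjW w' = (ω' - ω) + (ω - conjW w) - conjW (w' - w) := by rw [conjW_sub]; abel
    rw [this]
    refine (norm_sub_le _ _).trans ?_
    rw [norm_conjW]
    gcongr
    exact norm_add_le _ _
  calc ‖ω' - conjW w'‖ < 3 * ρ := by linarith
    _ ≤ (y / 2) ^ N := by
        rw [div_eq_mul_inv, mul_pow, hρe, show ((2:ℝ)⁻¹) = 1/2 by norm_num]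
        have : 3 * y * y ≤ (1/2) ^ N := by nlinarith
        calc 3 * (y ^ N * y * y) = y ^ N * (3 * y * y) := by ring
          _ ≤ _ := by gcongr
    _ ≤ (-s'.im) ^ N := by gcongr

section
variable {m : ℕ}

theorem fderivA {Qs : (Fin m → ℂ) × (Fin m → ℂ) × ℂ → ℂ} {r : ℝ} {N K : ℕ} {C : ℝ} (hr : 0 < r)
    (hol : DifferentiableOn ℂ Qs (Om m r N)) (bound : ∀ p ∈ Om m r N, ‖Qs p‖ * (-p.2.2.im) ^ K ≤ C) :
    ∃ r' > 0, r' ≤ r ∧ r' ≤ 1 ∧ ∀ p ∈ Om m r' (N + 2), ‖fderiv ℂ Qs p‖ * (-p.2.2.im) ^ (K + (N + 2)) ≤ 2 ^ (K + 1) * C := by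
  obtain ⟨r', hr0, hrr, hr1, hw⟩ := whitney (m := m) hr N
  refine ⟨r', hr0, hrr, hr1, fun p hp => ?_⟩
  have hy : 0 < -p.2.2.im := hp.2.2.1
  set y := -p.2.2.im with hyd
  have h1 := cauchy_fderiv_bound (f := Qs) (x := p) (R := y ^ (N + 2)) (C := C / (y / 2) ^ K) (pow_pos hy _)
    (hol.mono fun p' hp' => (hw p hp p' hp').1) (fun p' hp' => by
      obtain ⟨h2, h3⟩ := hw p hp p' hp'
      rw [le_div_iff₀ (by positivity)]
      refine le_trans ?_ (bound p' h2)
      gcongr)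
  calc ‖fderiv ℂ Qs p‖ * y ^ (K + (N + 2)) ≤ 2 * (C / (y / 2) ^ K) / y ^ (N + 2) * y ^ (K + (N + 2)) := by gcongr
    _ = 2 ^ (K + 1) * C := by rw [div_pow, pow_add y K]; field_simp; ring

theorem half_disc_max {f : ℂ → ℂ} {ρ ε : ℝ} {K : ℕ} (hρ : 0 < ρ) (hρ1 : ρ ≤ 1) (hε : 0 ≤ ε)
    (hc : ContinuousOn f {s | ‖s‖ ≤ ρ ∧ 0 ≤ -s.im}) (hd : DifferentiableOn ℂ f {s | ‖s‖ < ρ ∧ 0 < -s.im})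
    (hre : ∀ s : ℂ, ‖s‖ ≤ ρ → s.im = 0 → ‖f s‖ ≤ ε) (harc : ∀ s : ℂ, ‖s‖ = ρ → 0 < -s.im → ‖f s‖ * (-s.im) ^ K ≤ ε)
    {s : ℂ} (hs : ‖s‖ ≤ ρ / 2) (hs0 : 0 ≤ -s.im) : ‖f s‖ ≤ 2 ^ K / (3 * ρ ^ 2 / 4) ^ K * ε := by
  set U : Set ℂ := {s | ‖s‖ < ρ ∧ 0 < -s.im} with hU
  have hcU : closure U ⊆ {s | ‖s‖ ≤ ρ ∧ 0 ≤ -s.im} := by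
    have : IsClosed {s : ℂ | ‖s‖ ≤ ρ ∧ 0 ≤ -s.im} :=
      (isClosed_le continuous_norm continuous_const).inter (isClosed_le continuous_const Complex.continuous_im.neg)
    exact closure_minimal (fun s hs => ⟨hs.1.le, hs.2.le⟩) this
  have hUo : IsOpen U :=
    (isOpen_lt continuous_norm continuous_const).inter (isOpen_lt continuous_const Complex.continuous_im.neg)
  have hχ : Differentiable ℂ fun s : ℂ => (s ^ 2 - (ρ:ℂ) ^ 2) ^ K :=
    (((differentiable_id.pow 2).sub (differentiable_const _)).pow K)
  have hdc : DiffContOnCl ℂ (fun s => (s ^ 2 - (ρ:ℂ) ^ 2) ^ K * f s) U :=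
    ⟨hχ.differentiableOn.mul hd, (hχ.continuous.continuousOn.mul (hc.mono hcU))⟩
  have hb : Bornology.IsBounded U := isBounded_ball.subset (fun s hs => by
    have := hs.1; simpa using this : U ⊆ ball 0 ρ)
  have h2K : (1:ℝ) ≤ 2 ^ K := one_le_pow₀ (by norm_num)
  have hsmall : ∀ s : ℂ, ‖s‖ ≤ ρ → s.im = 0 → ‖(s ^ 2 - (ρ:ℂ) ^ 2) ^ K‖ ≤ 1 := by
    intro s h1 h2
    rw [norm_pow]
    refine pow_le_one₀ (norm_nonneg _) ?_
    have hsr : s = (s.re : ℂ) := by apply Complex.ext <;> simp [h2]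
    rw [hsr, ← Complex.ofReal_pow, ← Complex.ofReal_pow, ← Complex.ofReal_sub, Complex.norm_real, Real.norm_eq_abs, abs_le]
    have h3 := (Complex.abs_re_le_norm s).trans h1
    have := abs_le.1 h3
    constructor <;> nlinarith
  have hfr : ∀ z ∈ frontier U, ‖(z ^ 2 - (ρ:ℂ) ^ 2) ^ K * f z‖ ≤ 2 ^ K * ε := by
    intro z hz
    have hz1 := hcU hz.1
    have hz2 : z ∉ U := by have := hz.2; rwa [hUo.interior_eq] at this
    by_cases h0 : z.im = 0
    · rw [norm_mul]
      calc _ ≤ 1 * ε := by gcongr; exacts [hsmall z hz1.1 h0, hre z hz1.1 h0]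
        _ ≤ 2 ^ K * ε := by gcongr
    · have h3 : 0 < -z.im := lt_of_le_of_ne hz1.2 (by simpa [eq_comm] using h0)
      have h4 : ‖z‖ = ρ := le_antisymm hz1.1 (by by_contra h; exact hz2 ⟨not_le.1 h, h3⟩)
      have h5 : z ^ 2 - (ρ:ℂ) ^ 2 = z * (2 * I * z.im) := by
        have : (ρ:ℂ) ^ 2 = z * (starRingEnd ℂ) z := by rw [Complex.mul_conj, Complex.normSq_eq_norm_sq, h4]; simp
        rw [this]
        have := Complex.sub_conj z
        push_cast at this
        linear_combination z * this
      have h6 : ‖z ^ 2 - (ρ:ℂ) ^ 2‖ ≤ 2 * (-z.im) := by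
        rw [h5, norm_mul, h4]
        have : ‖(2 * I * z.im : ℂ)‖ = 2 * (-z.im) := by
          simp [abs_of_neg (neg_pos.1 h3)]
        rw [this]; nlinarith
      rw [norm_mul, norm_pow]
      calc _ ≤ (2 * (-z.im)) ^ K * ‖f z‖ := by gcongr
        _ = 2 ^ K * (‖f z‖ * (-z.im) ^ K) := by rw [mul_pow]; ring
        _ ≤ _ := by gcongr; exact harc z h4 h3
  have hlow : (3 * ρ ^ 2 / 4) ^ K ≤ ‖(s ^ 2 - (ρ:ℂ) ^ 2) ^ K‖ := by
    rw [norm_pow]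
    gcongr
    have h1 : ‖(ρ:ℂ) ^ 2‖ - ‖s ^ 2‖ ≤ ‖s ^ 2 - (ρ:ℂ) ^ 2‖ := by rw [norm_sub_rev]; exact norm_sub_norm_le _ _
    have h2 : ‖s ^ 2‖ ≤ (ρ / 2) ^ 2 := by rw [norm_pow]; gcongr
    have h3 : ‖(ρ:ℂ) ^ 2‖ = ρ ^ 2 := by simp
    nlinarith
  have hfin : ‖(s ^ 2 - (ρ:ℂ) ^ 2) ^ K * f s‖ ≤ 2 ^ K * ε := by
    by_cases h0 : s.im = 0
    · rw [norm_mul]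
      calc _ ≤ 1 * ε := by gcongr; exacts [hsmall s (by linarith) h0, hre s (by linarith) h0]
        _ ≤ 2 ^ K * ε := by gcongr
    · have h3 : 0 < -s.im := lt_of_le_of_ne hs0 (by simpa [eq_comm] using h0)
      exact Complex.norm_le_of_forall_mem_frontier_norm_le hb hdc hfr (subset_closure ⟨by linarith, h3⟩)
  rw [norm_mul] at hfin
  have hpos : 0 < (3 * ρ ^ 2 / 4) ^ K := by positivity
  rw [div_mul_eq_mul_div, le_div_iff₀ hpos]
  calc _ ≤ ‖f s‖ * ‖(s ^ 2 - (ρ:ℂ) ^ 2) ^ K‖ := by gcongr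
    _ ≤ _ := by rw [mul_comm]; exact hfin

theorem diffquot_unif {H : Type*} [NormedAddCommGroup H] [NormedSpace ℝ H] [FiniteDimensional ℝ H] {Q : H → ℂ} {R : ℝ}
    (hR : 0 < R) (hQ : ContDiffOn ℝ 1 Q (ball 0 R)) (e : H) {ε : ℝ} (hε : 0 < ε) :
    ∃ t0 > 0, ∀ t : ℝ, 0 < t → t < t0 → ∀ x : H, ‖x‖ ≤ R / 2 →
      ‖(t:ℂ)⁻¹ * (Q (x + t • e) - Q x) - fderiv ℝ Q x e‖ ≤ ε := by
  have hcont : ContinuousOn (fderiv ℝ Q) (ball 0 R) := hQ.continuousOn_fderiv_of_isOpen isOpen_ball (by norm_num)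
  haveI : ProperSpace H := FiniteDimensional.proper_real H
  have hsub : closedBall (0:H) (3 * R / 4) ⊆ ball 0 R := closedBall_subset_ball (by linarith)
  have huc := (isCompact_closedBall (0:H) (3*R/4)).uniformContinuousOn_of_continuous (hcont.mono hsub)
  have he1 : 0 < ‖e‖ + 1 := by positivity
  obtain ⟨δ, hδ, hd⟩ := Metric.uniformContinuousOn_iff.1 huc (ε / (‖e‖ + 1)) (by positivity)
  refine ⟨min δ (R / 4) / (‖e‖ + 1), by positivity, fun t ht0 ht x hx => ?_⟩
  rw [lt_div_iff₀ he1] at ht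
  have hm1 := min_le_left δ (R / 4)
  have hm2 := min_le_right δ (R / 4)
  have hτ : ∀ τ ∈ Icc (0:ℝ) t, x + τ • e ∈ closedBall (0:H) (3*R/4) ∧ dist (x + τ • e) x < δ := by
    intro τ hτ
    have h1 : ‖τ • e‖ < min δ (R / 4) := by
      rw [norm_smul, Real.norm_eq_abs, abs_of_nonneg hτ.1]
      have := norm_nonneg e
      nlinarith [hτ.2]
    refine ⟨?_, ?_⟩
    · rw [mem_closedBall_zero_iff]
      refine (norm_add_le _ _).trans ?_; linarith
    · rw [dist_eq_norm, add_sub_cancel_left]; linarith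
  have hx0 : x ∈ closedBall (0:H) (3*R/4) := by rw [mem_closedBall_zero_iff]; linarith
  have hder : ∀ τ ∈ Icc (0:ℝ) t, HasDerivWithinAt (fun τ : ℝ => Q (x + τ • e) - (τ:ℂ) * fderiv ℝ Q x e)
      (fderiv ℝ Q (x + τ • e) e - fderiv ℝ Q x e) (Icc 0 t) τ := by
    intro τ hτ'
    have h1 : HasDerivAt (fun τ : ℝ => x + τ • e) e τ := by
      simpa using ((hasDerivAt_id τ).smul_const e).const_add x
    have h2 := (hasFDerivAt_of_C1 hQ isOpen_ball (hsub (hτ τ hτ').1)).comp_hasDerivAt τ h1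
    have h3 : HasDerivAt (fun τ : ℝ => (τ:ℂ) * fderiv ℝ Q x e) (fderiv ℝ Q x e) τ := by
      simpa using (Complex.ofRealCLM.hasDerivAt (x := τ)).mul_const (fderiv ℝ Q x e)
    exact (h2.sub h3).hasDerivWithinAt
  have hb := norm_image_sub_le_of_norm_deriv_le_segment' hder (C := ε) (fun τ hτ' => by
    have h1 := hτ τ ⟨hτ'.1, hτ'.2.le⟩
    have h2 := (hd _ h1.1 x hx0 h1.2).le
    rw [dist_eq_norm] at h2
    rw [← ContinuousLinearMap.sub_apply]
    refine (ContinuousLinearMap.le_opNorm _ _).trans ?_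
    calc _ ≤ ε / (‖e‖ + 1) * ‖e‖ := by gcongr
      _ ≤ ε := by rw [div_mul_eq_mul_div, div_le_iff₀ he1]; nlinarith [norm_nonneg e]) t ⟨ht0.le, le_rfl⟩
  simp only [zero_smul, add_zero, Complex.ofReal_zero, zero_mul, sub_zero] at hb
  have htc : (t:ℂ) ≠ 0 := by exact_mod_cast ht0.ne'
  have : (t:ℂ)⁻¹ * (Q (x + t • e) - Q x) - fderiv ℝ Q x e = (t:ℂ)⁻¹ * (Q (x + t • e) - t * fderiv ℝ Q x e - Q x) := by
    field_simp; ring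
  rw [this, norm_mul, norm_inv, Complex.norm_real, Real.norm_eq_abs, abs_of_pos ht0, inv_mul_le_iff₀ ht0]
  linarith
end

section
variable {m : ℕ}

theorem diagA_line (x : CS m) (v : Fin m → ℂ) (c τ : ℝ) :
    diagA (x + τ • (v, (c:ℂ))) = diagA x + τ • (v, conjW v, (c:ℂ)) := by
  have h1 : conjW (τ • v) = τ • conjW v := by
    ext i; simp [conjW_apply]
  simp [diagA, conjW_add, h1]

theorem Lo_line {r ρ : ℝ} {x : CS m} (hx : x ∈ Lo m r) (v : Fin m → ℂ) (c τ : ℝ) (hτ : |τ| * ‖((v, (c:ℂ)) : CS m)‖ ≤ ρ) :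
    x + τ • (v, (c:ℂ)) ∈ Lo m (r + ρ) ∧ (x + τ • (v, (c:ℂ))).2.im = x.2.im := by
  have him : (x + τ • (v, (c:ℂ))).2.im = x.2.im := by simp
  have hn : ‖τ • ((v, (c:ℂ)) : CS m)‖ ≤ ρ := by rw [norm_smul]; exact hτ
  refine ⟨⟨?_, ?_, by rw [him]; exact hx.2.2⟩, him⟩
  · have := norm_add_le x.1 (τ • ((v, (c:ℂ)) : CS m)).1
    have h2 := norm_fst_le (τ • ((v, (c:ℂ)) : CS m))
    have h3 := hx.1
    show ‖x.1 + (τ • ((v, (c:ℂ)) : CS m)).1‖ < _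
    linarith
  · have := norm_add_le x.2 (τ • ((v, (c:ℂ)) : CS m)).2
    have h2 := norm_snd_le (τ • ((v, (c:ℂ)) : CS m))
    have h3 := hx.2.1
    show ‖x.2 + (τ • ((v, (c:ℂ)) : CS m)).2‖ < _
    linarith

theorem diffquot_int {Qs : (Fin m → ℂ) × (Fin m → ℂ) × ℂ → ℂ} {r : ℝ} {N K : ℕ} {C : ℝ} (hr : 0 < r) (hr1 : r ≤ 1)
    (hol : DifferentiableOn ℂ Qs (Om m r N)) (bound : ∀ p ∈ Om m r N, ‖Qs p‖ * (-p.2.2.im) ^ K ≤ C)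
    (v : Fin m → ℂ) (c : ℝ) :
    ∃ r' > 0, r' ≤ r ∧ ∃ t0 > 0, ∃ (K1 K2 : ℕ) (C1 C2 : ℝ), 0 ≤ C2 ∧
      (∀ p ∈ Om m r' (N + 2), ‖fderiv ℂ Qs p (v, conjW v, (c:ℂ))‖ * (-p.2.2.im) ^ K1 ≤ C1) ∧
      (∀ t : ℝ, 0 < t → t < t0 → ∀ x ∈ Lo m r', x + t • (v, (c:ℂ)) ∈ Lo m r) ∧
      ∀ t : ℝ, 0 < t → t < t0 → ∀ x ∈ Lo m r', 0 < -x.2.im →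
        ‖(t:ℂ)⁻¹ * (Qs (diagA (x + t • (v, (c:ℂ)))) - Qs (diagA x)) - fderiv ℂ Qs (diagA x) (v, conjW v, (c:ℂ))‖
          * (-x.2.im) ^ K2 ≤ C2 * t := by
  set e : CS m := (v, (c:ℂ)) with he
  set E : (Fin m → ℂ) × (Fin m → ℂ) × ℂ := (v, conjW v, (c:ℂ)) with hE
  obtain ⟨r1, hr10, hr1r, hr11, hb1⟩ := fderivA hr hol bound
  set G := fun p => fderiv ℂ Qs p E with hG
  have hGd : DifferentiableOn ℂ G (Om m r N) := differentiableOn_fderiv_apply_of_hol isOpen_Om hol E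
  have hGb : ∀ p ∈ Om m r1 (N + 2), ‖G p‖ * (-p.2.2.im) ^ (K + (N + 2)) ≤ 2 ^ (K + 1) * C * ‖E‖ := by
    intro p hp
    have hy : 0 < -p.2.2.im := hp.2.2.1
    calc ‖G p‖ * (-p.2.2.im) ^ (K + (N + 2)) ≤ (‖fderiv ℂ Qs p‖ * ‖E‖) * (-p.2.2.im) ^ (K + (N + 2)) := by
          gcongr; exact ContinuousLinearMap.le_opNorm _ _
      _ = (‖fderiv ℂ Qs p‖ * (-p.2.2.im) ^ (K + (N + 2))) * ‖E‖ := by ring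
      _ ≤ _ := mul_le_mul_of_nonneg_right (hb1 p hp) (norm_nonneg _)
  obtain ⟨r2, hr20, hr21, hr22, hb2⟩ := fderivA hr10 (hGd.mono (Om_mono hr1r hr11 (by omega))) hGb
  set C2 := 2 ^ (K + (N + 2) + 1) * (2 ^ (K + 1) * C * ‖E‖) with hC2
  set K2 := K + (N + 2) + (N + 2 + 2) with hK2
  have he1 : 0 < ‖e‖ + 1 := by positivity
  have ht : ∀ τ t : ℝ, 0 ≤ τ → τ ≤ t → t < r2 / 2 / (‖e‖ + 1) → |τ| * ‖e‖ ≤ r2 / 2 := by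
    intro τ t h0 h1 h2
    rw [lt_div_iff₀ he1] at h2
    rw [abs_of_nonneg h0]
    nlinarith [norm_nonneg e]
  have hline : ∀ τ t : ℝ, 0 ≤ τ → τ ≤ t → t < r2 / 2 / (‖e‖ + 1) → ∀ x ∈ Lo m (r2 / 2),
      x + τ • e ∈ Lo m r2 ∧ (x + τ • e).2.im = x.2.im := by
    intro τ t h0 h1 h2 x hx
    have := Lo_line hx v c τ (ht τ t h0 h1 h2)
    rwa [add_halves] at this
  refine ⟨r2 / 2, by linarith, by linarith, r2 / 2 / (‖e‖ + 1), by positivity, K + (N + 2), K2,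
    2 ^ (K + 1) * C * ‖E‖, |C2| * ‖E‖, by positivity, ?_, ?_, ?_⟩
  · intro p hp
    exact hGb p (Om_mono (by linarith) (by linarith) le_rfl hp)
  · intro t ht0 ht' x hx
    exact Lo_mono (by linarith) (hline t t ht0.le le_rfl ht' x hx).1
  intro t ht0 ht' x hx hy
  set y := -x.2.im with hyd
  have hpt : ∀ τ ∈ Icc (0:ℝ) t, diagA x + τ • E ∈ Om m r2 (N + 2 + 2) ∧ -(diagA x + τ • E).2.2.im = y := by
    intro τ hτ
    obtain ⟨h1, h2⟩ := hline τ t hτ.1 hτ.2 ht' x hx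
    rw [← diagA_line]
    refine ⟨diag_mem_Om h1 (by rw [h2]; exact hy), ?_⟩
    show -(x + τ • e).2.im = y
    rw [h2]
  have hpt0 : ∀ τ ∈ Icc (0:ℝ) t, diagA x + τ • E ∈ Om m r N := fun τ hτ =>
    Om_mono (by linarith) hr22 (by omega) (hpt τ hτ).1
  have hlin : ∀ τ : ℝ, HasDerivAt (fun τ : ℝ => diagA x + τ • E) E τ := fun τ => by
    simpa using ((hasDerivAt_id τ).smul_const E).const_add (diagA x)
  have hDG : ∀ τ ∈ Icc (0:ℝ) t, ‖fderiv ℂ G (diagA x + τ • E) E‖ ≤ |C2| / y ^ K2 * ‖E‖ := by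
    intro τ hτ
    refine (ContinuousLinearMap.le_opNorm _ _).trans ?_
    gcongr
    rw [le_div_iff₀ (by positivity)]
    have := hb2 _ (hpt τ hτ).1
    rw [(hpt τ hτ).2] at this
    exact this.trans (le_abs_self _)
  have hGline : ∀ τ ∈ Icc (0:ℝ) t, ‖G (diagA x + τ • E) - G (diagA x)‖ ≤ |C2| / y ^ K2 * ‖E‖ * t := by
    have h1 := norm_image_sub_le_of_norm_deriv_le_segment' (f := fun τ : ℝ => G (diagA x + τ • E))
      (f' := fun τ => fderiv ℂ G (diagA x + τ • E) E) (a := 0) (b := t) (C := |C2| / y ^ K2 * ‖E‖)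
      (fun τ hτ => by
        have h2 := (hGd.differentiableAt (isOpen_Om.mem_nhds (hpt0 τ hτ))).hasFDerivAt.restrictScalars ℝ
        exact (h2.comp_hasDerivAt τ (hlin τ)).hasDerivWithinAt)
      (fun τ hτ => hDG τ ⟨hτ.1, hτ.2.le⟩)
    intro τ hτ
    have h2 := h1 τ hτ
    simp only [zero_smul, add_zero, sub_zero] at h2
    refine h2.trans ?_
    have : 0 ≤ |C2| / y ^ K2 * ‖E‖ := by positivity
    gcongr
    exact hτ.2
  have hmain := norm_image_sub_le_of_norm_deriv_le_segment' (f := fun τ : ℝ => Qs (diagA x + τ • E) - (τ:ℂ) * G (diagA x))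
    (f' := fun τ => G (diagA x + τ • E) - G (diagA x)) (a := 0) (b := t) (C := |C2| / y ^ K2 * ‖E‖ * t)
    (fun τ hτ => by
      have h2 := (hol.differentiableAt (isOpen_Om.mem_nhds (hpt0 τ hτ))).hasFDerivAt.restrictScalars ℝ
      have h3 : HasDerivAt (fun τ : ℝ => (τ:ℂ) * G (diagA x)) (G (diagA x)) τ := by
        simpa using (Complex.ofRealCLM.hasDerivAt (x := τ)).mul_const (G (diagA x))
      exact ((h2.comp_hasDerivAt τ (hlin τ)).sub h3).hasDerivWithinAt)
    (fun τ hτ => hGline τ ⟨hτ.1, hτ.2.le⟩) t ⟨ht0.le, le_rfl⟩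
  simp only [zero_smul, add_zero, sub_zero, Complex.ofReal_zero, zero_mul] at hmain
  have htc : (t:ℂ) ≠ 0 := by exact_mod_cast ht0.ne'
  have hrew : (t:ℂ)⁻¹ * (Qs (diagA (x + t • e)) - Qs (diagA x)) - fderiv ℂ Qs (diagA x) E
      = (t:ℂ)⁻¹ * (Qs (diagA x + t • E) - t * G (diagA x) - Qs (diagA x)) := by
    rw [he, diagA_line, ← hE, hG]; field_simp; ring
  rw [hrew, norm_mul, norm_inv, Complex.norm_real, Real.norm_eq_abs, abs_of_pos ht0]
  calc t⁻¹ * ‖Qs (diagA x + t • E) - t * G (diagA x) - Qs (diagA x)‖ * y ^ K2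
      ≤ t⁻¹ * (|C2| / y ^ K2 * ‖E‖ * t * t) * y ^ K2 := by gcongr
    _ = |C2| * ‖E‖ * t := by field_simp

theorem InA.deriv {Q : (Fin m → ℂ) × ℝ → ℂ} (H : InA Q) {R : ℝ} (hR : 0 < R) (hQ : ContDiffOn ℝ 1 Q (ball 0 R))
    (e : (Fin m → ℂ) × ℝ) : InA (fun p => fderiv ℝ Q p e) := by
  obtain ⟨v, c⟩ := e
  obtain ⟨Qs, r, N, K, C, H⟩ := H
  obtain ⟨r', hr'0, hr'r, t0, ht0, K1, K2, C1, C2, hC2, hG, hL, hT⟩ := diffquot_int H.rpos H.r1 H.hol H.bound v c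
  set e : CS m := (v, (c:ℂ)) with he
  set E : (Fin m → ℂ) × (Fin m → ℂ) × ℂ := (v, conjW v, (c:ℂ)) with hE
  set Qs' : (Fin m → ℂ) × (Fin m → ℂ) × ℂ → ℂ := fun p =>
    if 0 < -p.2.2.im then fderiv ℂ Qs p E else fderiv ℝ Q (p.1, p.2.2.re) (v, c) with hQs'
  set T : ℝ → CS m → ℂ := fun t x => (t:ℂ)⁻¹ * (Qs (diagA (x + t • e)) - Qs (diagA x)) with hTd
  set ρ := min (r' / 2) (R / 4) with hρd
  have hρ0 : 0 < ρ := by positivity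
  have hρr : ρ < r' := (min_le_left _ _).trans_lt (by linarith)
  have hρR : ρ ≤ R / 4 := min_le_right _ _
  have hr1 := H.r1
  -- boundary values
  have hTre : ∀ ε > 0, ∃ t1 > 0, t1 ≤ t0 ∧ ∀ t : ℝ, 0 < t → t < t1 → ∀ w (s : ℂ), ‖w‖ ≤ ρ → ‖s‖ ≤ ρ → s.im = 0 →
      ‖T t (w, s) - fderiv ℝ Q (w, s.re) (v, c)‖ ≤ ε := by
    intro ε hε
    obtain ⟨t1, ht1, h1⟩ := diffquot_unif hR hQ (v, c) hε
    refine ⟨min t0 t1, lt_min ht0 ht1, min_le_left _ _, fun t h0 ht w s hw hs hs0 => ?_⟩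
    have hx : ‖((w, s.re) : (Fin m → ℂ) × ℝ)‖ ≤ R / 2 := by
      have := Complex.abs_re_le_norm s
      rw [Prod.norm_def, Real.norm_eq_abs]; apply max_le <;> linarith
    have h2 := h1 t h0 (ht.trans_le (min_le_right _ _)) _ hx
    have hsr : s = (s.re : ℂ) := by apply Complex.ext <;> simp [hs0]
    have hxL : ((w, s) : CS m) ∈ Lo m r' := ⟨hw.trans_lt hρr, hs.trans_lt hρr, by simp [hs0]⟩
    have h3 := hL t h0 (ht.trans_le (min_le_left _ _)) _ hxL
    have h4 : ((w, s) : CS m) + t • e = (w + t • v, ((s.re + t * c : ℝ) : ℂ)) := by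
      rw [he]
      refine Prod.ext (by simp) ?_
      show s + t • (c:ℂ) = _
      conv_lhs => rw [hsr]
      push_cast; simp
    have h5 : Qs (diagA ((w, s) + t • e)) = Q (w + t • v, s.re + t * c) := by
      rw [h4] at h3 ⊢
      refine H.bdry _ _ h3.1 ?_
      have := h3.2.1
      rwa [Complex.norm_real] at this
    have h6 : Qs (diagA (w, s)) = Q (w, s.re) := by
      have h7 : ‖s.re‖ < r := lt_of_le_of_lt (Complex.abs_re_le_norm s) (by linarith)
      have := H.bdry w s.re (by linarith) h7
      rwa [← hsr] at this
    simp only [hTd]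
    rw [h5, h6]
    have h8 : ((w, s.re) : (Fin m → ℂ) × ℝ) + t • (v, c) = (w + t • v, s.re + t * c) := by simp
    rwa [h8] at h2
  have hcT : ∀ t : ℝ, 0 < t → t < t0 → ContinuousOn (T t) (Lo m r') := by
    intro t h0 ht
    refine continuousOn_const.mul (ContinuousOn.sub ?_ (H.cont.mono (Lo_mono hr'r)))
    exact H.cont.comp (f := fun x => x + t • e) (by fun_prop) (fun x hx => hL t h0 ht x hx)
  have hdT : ∀ t : ℝ, 0 < t → t < t0 → ∀ w, ‖w‖ ≤ ρ → ∀ s : ℂ, ‖s‖ ≤ ρ → 0 < -s.im →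
      DifferentiableAt ℂ (fun s => T t (w, s)) s := by
    intro t h0 ht w hw s hs hs0
    have hxL : ((w, s) : CS m) ∈ Lo m r' := ⟨hw.trans_lt hρr, hs.trans_lt hρr, hs0.le⟩
    have h1 : diagA (w, s) ∈ Om m r N := diag_mem_Om (Lo_mono hr'r hxL) hs0
    have h2 : diagA ((w, s) + t • e) ∈ Om m r N := diag_mem_Om (hL t h0 ht _ hxL) (by simpa [he] using hs0)
    have d1 := H.hol.differentiableAt (isOpen_Om.mem_nhds h1)
    have d2 := H.hol.differentiableAt (isOpen_Om.mem_nhds h2)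
    have l1 : DifferentiableAt ℂ (fun s : ℂ => diagA (w, s)) s := by
      simp only [diagA]; fun_prop
    have l2 : DifferentiableAt ℂ (fun s : ℂ => diagA ((w, s) + t • e)) s := by
      simp only [diagA_line, he]; exact l1.add_const _
    exact (DifferentiableAt.sub (DifferentiableAt.comp (g := Qs) s d2 l2)
      (DifferentiableAt.comp (g := Qs) s d1 l1)).const_mul _
  -- pointwise limit
  have hlim : ∀ x ∈ Lo m ρ, Tendsto (fun t => T t x) (𝓝[>] 0) (𝓝 (Qs' (diagA x))) := by
    rintro ⟨w, s⟩ ⟨hw, hs, hs0⟩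
    simp only at hw hs hs0
    by_cases h0 : 0 < -s.im
    · have hQ1 : Qs' (diagA (w, s)) = fderiv ℂ Qs (diagA (w, s)) E := by
        simp only [hQs', diagA, if_pos h0]
      rw [hQ1, tendsto_iff_norm_sub_tendsto_zero]
      have h1 : Tendsto (fun t : ℝ => C2 * t / (-s.im) ^ K2) (𝓝[>] 0) (𝓝 0) := by
        have : Tendsto (fun t : ℝ => C2 * t / (-s.im) ^ K2) (𝓝 0) (𝓝 (C2 * 0 / (-s.im) ^ K2)) := by
          apply Continuous.tendsto; fun_prop
        simpa using this.mono_left nhdsWithin_le_nhds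
      refine squeeze_zero' (Eventually.of_forall fun t => norm_nonneg _) ?_ h1
      filter_upwards [Ioo_mem_nhdsGT ht0] with t ht
      rw [le_div_iff₀ (pow_pos h0 K2)]
      exact hT t ht.1 ht.2 (w, s) ⟨hw.trans hρr, hs.trans hρr, h0.le⟩ h0
    · have hs1 : s.im = 0 := by linarith
      have hQ1 : Qs' (diagA (w, s)) = fderiv ℝ Q (w, s.re) (v, c) := by
        simp only [hQs', diagA, if_neg h0]
      rw [hQ1, Metric.tendsto_nhds]
      intro ε hε
      obtain ⟨t1, ht1, _, h1⟩ := hTre (ε / 2) (by linarith)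
      filter_upwards [Ioo_mem_nhdsGT ht1] with t ht
      rw [dist_eq_norm]
      exact (h1 t ht.1 ht.2 w s hw.le hs.le hs1).trans_lt (by linarith)
  -- uniform Cauchy
  have hcau : ∀ ε > 0, ∃ t1 > 0, t1 ≤ t0 ∧ ∀ t t' : ℝ, 0 < t → t < t1 → 0 < t' → t' < t1 → ∀ x ∈ Lo m (ρ / 2),
      ‖T t x - T t' x‖ ≤ 2 ^ K2 / (3 * ρ ^ 2 / 4) ^ K2 * ε := by
    intro ε hε
    obtain ⟨t1, ht1, ht10, h1⟩ := hTre (ε / 2) (by linarith)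
    refine ⟨min t1 (ε / (2 * (C2 + 1))), by positivity, (min_le_left _ _).trans ht10, ?_⟩
    intro t t' h0 ht h0' ht' x hx
    have htt1 := ht.trans_le (min_le_left _ _)
    have htt1' := ht'.trans_le (min_le_left _ _)
    have hte := ht.trans_le (min_le_right _ _)
    have hte' := ht'.trans_le (min_le_right _ _)
    rw [lt_div_iff₀ (by positivity)] at hte hte'
    have hw : ‖x.1‖ ≤ ρ := by linarith [hx.1]
    refine half_disc_max (f := fun s => T t (x.1, s) - T t' (x.1, s)) hρ0 (by linarith) hε.le ?_ ?_ ?_ ?_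
      (s := x.2) hx.2.1.le hx.2.2
    · have hmap : MapsTo (fun s : ℂ => ((x.1, s) : CS m)) {s | ‖s‖ ≤ ρ ∧ 0 ≤ -s.im} (Lo m r') := fun s hs =>
        ⟨hw.trans_lt hρr, hs.1.trans_lt hρr, hs.2⟩
      exact ((hcT t h0 (htt1.trans_le ht10)).comp (by fun_prop) hmap).sub
        ((hcT t' h0' (htt1'.trans_le ht10)).comp (by fun_prop) hmap)
    · intro s hs
      exact ((hdT t h0 (htt1.trans_le ht10) x.1 hw s hs.1.le hs.2).sub
        (hdT t' h0' (htt1'.trans_le ht10) x.1 hw s hs.1.le hs.2)).differentiableWithinAt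
    · intro s hs hs0
      have a1 := h1 t h0 htt1 x.1 s hw hs hs0
      have a2 := h1 t' h0' htt1' x.1 s hw hs hs0
      have : T t (x.1, s) - T t' (x.1, s) = (T t (x.1, s) - fderiv ℝ Q (x.1, s.re) (v, c))
        - (T t' (x.1, s) - fderiv ℝ Q (x.1, s.re) (v, c)) := by ring
      rw [this]
      exact (norm_sub_le _ _).trans (by linarith)
    · intro s hs hs0
      have hxL : ((x.1, s) : CS m) ∈ Lo m r' := ⟨hw.trans_lt hρr, by rw [hs]; exact hρr, hs0.le⟩
      have a1 := hT t h0 (htt1.trans_le ht10) _ hxL hs0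
      have a2 := hT t' h0' (htt1'.trans_le ht10) _ hxL hs0
      have : T t (x.1, s) - T t' (x.1, s) = (T t (x.1, s) - fderiv ℂ Qs (diagA (x.1, s)) E)
        - (T t' (x.1, s) - fderiv ℂ Qs (diagA (x.1, s)) E) := by ring
      rw [this]
      have hp : 0 ≤ (-s.im) ^ K2 := by positivity
      calc _ ≤ (‖T t (x.1, s) - fderiv ℂ Qs (diagA (x.1, s)) E‖ + ‖T t' (x.1, s) - fderiv ℂ Qs (diagA (x.1, s)) E‖)
            * (-s.im) ^ K2 := by gcongr; exact norm_sub_le _ _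
        _ ≤ C2 * t + C2 * t' := by rw [add_mul]; exact add_le_add a1 a2
        _ ≤ ε := by nlinarith
  have hunif : TendstoUniformlyOn T (fun x => Qs' (diagA x)) (𝓝[>] 0) (Lo m (ρ / 2)) := by
    rw [Metric.tendstoUniformlyOn_iff]
    intro ε hε
    set B := 2 ^ K2 / (3 * ρ ^ 2 / 4) ^ K2 with hB
    have hB0 : 0 < B := by positivity
    obtain ⟨t1, ht1, ht10, h1⟩ := hcau (ε / (2 * B)) (by positivity)
    filter_upwards [Ioo_mem_nhdsGT ht1] with t ht x hx
    have h2 : ‖T t x - Qs' (diagA x)‖ ≤ B * (ε / (2 * B)) := by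
      have h3 := (tendsto_const_nhds (x := T t x)).sub (hlim x (Lo_mono (by linarith) hx))
      refine le_of_tendsto h3.norm ?_
      filter_upwards [Ioo_mem_nhdsGT ht1] with t' ht'
      exact h1 t t' ht.1 ht.2 ht'.1 ht'.2 x hx
    rw [dist_comm, dist_eq_norm]
    refine h2.trans_lt ?_
    have : B * (ε / (2 * B)) = ε / 2 := by field_simp
    rw [this]; linarith
  refine ⟨Qs', ρ / 2, N + 2, K1, C1, by linarith, by linarith, ?_, ?_, ?_, ?_⟩
  · have h1 : DifferentiableOn ℂ (fun p => fderiv ℂ Qs p E) (Om m r N) :=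
      differentiableOn_fderiv_apply_of_hol isOpen_Om H.hol E
    refine (h1.mono (Om_mono (by linarith) (by linarith) (by omega))).congr fun p hp => ?_
    simp only [hQs', if_pos hp.2.2.1]
  · intro p hp
    have := hG p (Om_mono (by linarith) (by linarith) le_rfl hp)
    simp only [hQs', if_pos hp.2.2.1]
    exact this
  · refine hunif.continuousOn (Eventually.frequently ?_)
    filter_upwards [Ioo_mem_nhdsGT ht0] with t ht
    exact (hcT t ht.1 ht.2).mono (Lo_mono (by linarith))
  · intro w u hw hu
    simp [hQs', diagA]
end

section
variable {m : ℕ} {M : Set (CS m)} {q : CS m} {Φ : (Fin m → ℂ) × (Fin m → ℂ) × ℂ → ℂ} {κ σ : CS m → CS m} {r : ℝ}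

theorem isOpen_Upo {φ : (Fin m → ℂ) × ℝ → ℝ} {R δ : ℝ} (G : GraphData φ R) (h : δ < R) : IsOpen (Upo φ δ) := by
  have hcon : ContinuousOn (fun x : CS m => φ (x.1, x.2.re) - x.2.im) (Pd m δ) :=
    ContinuousOn.sub (G.cont_phi.mono fun x hx => ⟨by linarith [hx.1], by linarith [hx.2.1]⟩) (by fun_prop)
  have := hcon.isOpen_inter_preimage (isOpen_Pd δ) (isOpen_Iio (a := (0:ℝ)))
  convert this using 1
  ext x; simp [Upo]

/-- The normalising change of parameter lands above the graph. -/
theorem IsModel.zeta_up (H : IsModel M q Φ κ σ r) {δ ρ : ℝ} (hδ : δ < r) (hρ : 2 * ρ ≤ δ)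
    {a b : Fin m → ℂ} {s : ℂ} (ha : ‖a‖ < ρ) (hs : ‖s‖ < ρ) (h : ‖b - conjW a‖ ≤ s.im) :
    (a, s + I * Φ (a, b, s)) ∈ Pd m δ ∧ ‖((a, s + I * Φ (a, b, s)) : CS m)‖ < 2 * ρ ∧
      mphi Φ (a, (s + I * Φ (a, b, s)).re) + s.im / 2 ≤ (s + I * Φ (a, b, s)).im := by
  have hη : 0 ≤ s.im := (norm_nonneg _).trans h
  have hsi : s.im ≤ ‖s‖ := (le_abs_self _).trans (Complex.abs_im_le_norm s)
  have hsr : |s.re| ≤ ‖s‖ := Complex.abs_re_le_norm s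
  have hρ0 : 0 < ρ := (norm_nonneg _).trans_lt ha
  have hb : ‖b‖ < 2 * ρ := by
    have := norm_add_le (b - conjW a) (conjW a)
    simp only [sub_add_cancel, norm_conjW] at this
    linarith
  have hp : (a, b, s) ∈ ball (0 : (Fin m → ℂ) × (Fin m → ℂ) × ℂ) r := by
    rw [mem_ball_zero_iff, Prod.norm_def, Prod.norm_def]
    simp only [max_lt_iff]; exact ⟨by linarith, by linarith, by linarith⟩
  have hp0 : (a, conjW a, (s.re : ℂ)) ∈ ball (0 : (Fin m → ℂ) × (Fin m → ℂ) × ℂ) r := by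
    rw [mem_ball_zero_iff, Prod.norm_def, Prod.norm_def]
    simp only [max_lt_iff, norm_conjW, Complex.norm_real, Real.norm_eq_abs]; exact ⟨by linarith, by linarith, by linarith⟩
  have e1 : ‖Φ (a, b, s) - Φ (a, conjW a, (s.re:ℂ))‖ ≤ s.im / 8 := by
    refine (H.lip hp hp0).trans ?_
    gcongr
    rw [Prod.norm_def, Prod.norm_def]
    simp only [Prod.fst_sub, Prod.snd_sub, sub_self, norm_zero]
    refine max_le hη (max_le h ?_)
    have : s - (s.re : ℂ) = s.im * I := by apply Complex.ext <;> simp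
    rw [this]; simp [abs_of_nonneg hη]
  have e2 : Φ (a, conjW a, (s.re:ℂ)) = (mphi Φ (a, s.re) : ℂ) :=
    H.phi_real (p := (a, s.re)) (mem_ball_WR (by linarith) (by linarith))
  rw [e2] at e1
  have e0 : ‖Φ (a, b, s)‖ ≤ 2 * ρ / 8 := by
    have := H.lip hp (mem_ball_self H.rpos)
    rw [H.zero, sub_zero, sub_zero] at this
    refine this.trans ?_
    gcongr
    rw [Prod.norm_def, Prod.norm_def]
    exact max_le (by simp only; linarith) (max_le (by simp only; linarith) (by simp only; linarith))
  set P := Φ (a, b, s) with hP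
  have e3 : |P.re - mphi Φ (a, s.re)| ≤ s.im / 8 := by
    have := (Complex.abs_re_le_norm _).trans e1; simpa using this
  have e4 : |P.im| ≤ s.im / 8 := by
    have := (Complex.abs_im_le_norm _).trans e1; simpa using this
  have z1 : (s + I * P).re = s.re - P.im := by simp [sub_eq_add_neg]
  have z2 : (s + I * P).im = s.im + P.re := by simp
  have z0 : ‖s + I * P‖ < 2 * ρ := by
    have := norm_add_le s (I * P)
    rw [norm_mul, Complex.norm_I, one_mul] at this; linarith
  have z1' := (Complex.abs_re_le_norm (s + I * P))
  have z2' := (le_abs_self _).trans (Complex.abs_im_le_norm (s + I * P))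
  refine ⟨⟨by simp only; linarith, by simp only; linarith, by simp only; linarith⟩, ?_, ?_⟩
  · rw [Prod.norm_def]; exact max_lt (by simp only; linarith) z0
  · have e5 := H.graph.lip (a, s.re - P.im) (mem_ball_WR (by linarith) (by rw [← z1]; linarith))
      (a, s.re) (mem_ball_WR (by linarith) (by linarith))
    have e6 : ‖((a, s.re - P.im) : (Fin m → ℂ) × ℝ) - (a, s.re)‖ ≤ s.im / 8 := by
      rw [Prod.norm_def]
      simp only [Prod.fst_sub, Prod.snd_sub, sub_self, norm_zero]
      refine max_le (by linarith) ?_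
      rw [show s.re - P.im - s.re = -P.im by ring, norm_neg]; exact e4
    rw [z1, z2]
    have := (abs_le.mp e5).2; have := (abs_le.mp e3).1
    linarith

theorem IsModel.inA_conj (H : IsModel M q Φ κ σ r) (hD : HasDiscs Φ) {R : ℝ} (hR : 0 < R) (hRr : R ≤ r)
    {f : (Fin m → ℂ) × ℝ → ℂ} (hf : IsCRg (mphi Φ) R f) : InA (fun p => (starRingEnd ℂ) (f p)) := by
  obtain ⟨δ, hδ, hδR, F, hF1, hF2, hF3⟩ := onesided (H.graph.mono hR hRr) (GDiscs_of hD) hf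
  have hδr : δ < r := by linarith
  have h0 : (0 : CS m) ∈ Upc (mphi Φ) δ := by
    have := H.graph.zero
    refine ⟨⟨by simpa using hδ, by simpa using hδ, by simpa using hδ⟩, ?_⟩
    show mphi Φ ((0 : Fin m → ℂ), (0:ℝ)) ≤ 0
    rw [show ((0 : Fin m → ℂ), (0 : ℝ)) = 0 from rfl, this]
  obtain ⟨ε, hε, hFε⟩ := Metric.continuousWithinAt_iff.mp (hF2 0 h0) 1 one_pos
  set ρ := min (min δ ε) 1 / 2 with hρ
  have hρ0 : 0 < ρ := by have : 0 < min (min δ ε) 1 := lt_min (lt_min hδ hε) one_pos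
                         linarith
  have hρδ : 2 * ρ ≤ δ := by have : min (min δ ε) 1 ≤ δ := (min_le_left _ _).trans (min_le_left _ _)
                             linarith
  have hρε : 2 * ρ ≤ ε := by have : min (min δ ε) 1 ≤ ε := (min_le_left _ _).trans (min_le_right _ _)
                             linarith
  have hρ1 : ρ ≤ 1 := by have : min (min δ ε) 1 ≤ 1 := (min_le_right _ _)
                         linarith
  set G : (Fin m → ℂ) × (Fin m → ℂ) × ℂ → CS m := fun p => (p.2.1, p.2.2 - I * Φ p) with hG
  have hGc : ∀ w ω s, (w, ω, s) ∈ ball (0 : (Fin m → ℂ) × (Fin m → ℂ) × ℂ) r →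
      conjCS (G (w, ω, s)) = (conjW ω, (starRingEnd ℂ) s + I * Φ (conjW ω, conjW w, (starRingEnd ℂ) s)) := by
    intro w ω s hp
    rw [← H.conj w ω s hp]; simp [hG, conjCS]
  have key : ∀ w ω s, ‖w‖ < ρ / 2 → ‖s‖ < ρ / 2 → ‖ω - conjW w‖ ≤ -s.im →
      (w, ω, s) ∈ ball (0 : (Fin m → ℂ) × (Fin m → ℂ) × ℂ) r ∧
      conjCS (G (w, ω, s)) ∈ Pd m δ ∧ ‖conjCS (G (w, ω, s))‖ < 2 * ρ ∧
      mphi Φ ((conjCS (G (w, ω, s))).1, (conjCS (G (w, ω, s))).2.re) + (-s.im) / 2 ≤ (conjCS (G (w, ω, s))).2.im := by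
    intro w ω s hw hs h
    have hsi := neg_im_le_norm s
    have hω : ‖ω‖ < ρ := by
      have := norm_add_le (ω - conjW w) (conjW w)
      simp only [sub_add_cancel, norm_conjW] at this
      linarith
    have hp : (w, ω, s) ∈ ball (0 : (Fin m → ℂ) × (Fin m → ℂ) × ℂ) r := by
      rw [mem_ball_zero_iff, Prod.norm_def, Prod.norm_def]
      simp only [max_lt_iff]; exact ⟨by linarith, by linarith, by linarith⟩
    refine ⟨hp, ?_⟩
    rw [hGc w ω s hp]
    have := H.zeta_up hδr hρδ (a := conjW ω) (b := conjW w) (s := (starRingEnd ℂ) s) (by simpa using hω)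
      (by simpa using (by linarith : ‖s‖ < ρ)) (by
        rw [conjW_conjW, norm_sub_rev, Complex.conj_im]; exact h)
    simpa only [Complex.conj_im] using this
  have hdom : ∀ p ∈ Om m (ρ / 2) 1, p ∈ ball (0 : (Fin m → ℂ) × (Fin m → ℂ) × ℂ) r ∧ conjCS (G p) ∈ Upo (mphi Φ) δ ∧ ‖conjCS (G p)‖ < 2 * ρ := by
    rintro ⟨w, ω, s⟩ ⟨h1, h2, h3, h4⟩
    simp only [pow_one] at h1 h2 h3 h4
    obtain ⟨k1, k2, k3, k4⟩ := key w ω s h1 h2 h4.le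
    exact ⟨k1, ⟨k2, by linarith⟩, k3⟩
  have hdomc : ∀ x ∈ Lo m (ρ / 2), diagA x ∈ ball (0 : (Fin m → ℂ) × (Fin m → ℂ) × ℂ) r ∧ conjCS (G (diagA x)) ∈ Upc (mphi Φ) δ := by
    rintro ⟨w, s⟩ ⟨h1, h2, h3⟩
    simp only at h1 h2 h3
    obtain ⟨k1, k2, k3, k4⟩ := key w (conjW w) s h1 h2 (by simpa using h3)
    exact ⟨k1, k2, by simp only [diagA]; linarith⟩
  have hGd : DifferentiableOn ℂ G (ball 0 r) := by
    have h1 : DifferentiableOn ℂ (fun p : (Fin m → ℂ) × (Fin m → ℂ) × ℂ => p.2.1) (ball 0 r) := by fun_prop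
    have h2 : DifferentiableOn ℂ (fun p : (Fin m → ℂ) × (Fin m → ℂ) × ℂ => p.2.2) (ball 0 r) := by fun_prop
    exact h1.prodMk (h2.sub (H.hol.const_mul I))
  refine ⟨fun p => (starRingEnd ℂ) (F (conjCS (G p))), ρ / 2, 1, 0, ‖F 0‖ + 1, by linarith, by linarith, ?_, ?_, ?_, ?_⟩
  · intro p hp
    obtain ⟨k1, k2, k3⟩ := hdom p hp
    have hFd : DifferentiableAt ℂ F (cCS m (G p)) := by
      rw [cCS_apply]
      exact (hF1 _ k2).differentiableAt ((isOpen_Upo (H.graph.mono hR hRr) hδR).mem_nhds k2)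
    have := diff_conj_comp (cCS m) cCS_I hFd
    simp only [cCS_apply] at this
    exact (DifferentiableAt.comp (g := fun x => (starRingEnd ℂ) (F (conjCS x))) p this
      ((hGd p k1).differentiableAt (isOpen_ball.mem_nhds k1))).differentiableWithinAt
  · intro p hp
    obtain ⟨k1, k2, k3⟩ := hdom p hp
    have := hFε (x := conjCS (G p)) ⟨k2.1, k2.2.le⟩ (by rw [dist_zero_right]; linarith)
    rw [dist_eq_norm] at this
    have h2 := norm_add_le (F (conjCS (G p)) - F 0) (F 0)
    rw [sub_add_cancel] at h2
    simp only [pow_zero, mul_one, RCLike.norm_conj]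
    linarith
  · have c1 : ContinuousOn (fun x => conjCS (G (diagA x))) (Lo m (ρ / 2)) :=
      continuous_conjCS.comp_continuousOn (hGd.continuousOn.comp continuous_diagA.continuousOn fun x hx => (hdomc x hx).1)
    exact continuous_conj.comp_continuousOn (hF2.comp c1 fun x hx => (hdomc x hx).2)
  · intro w u hw hu
    have k := key w (conjW w) (u:ℂ) hw (by simpa using hu) (by simp)
    simp only [diagA]
    rw [hGc _ _ _ k.1, conjW_conjW, Complex.conj_ofReal, H.phi_real (p := (w, u)) (mem_ball_WR (by linarith) (by linarith))]
    rw [← hF3 w u (by linarith) (by linarith)]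
    rfl
end

section
variable {m : ℕ} {M : Set (CS m)} {q : CS m} {Φ : (Fin m → ℂ) × (Fin m → ℂ) × ℂ → ℂ} {κ σ : CS m → CS m} {r : ℝ}

def DzOp (f : CS m → ℂ) : CS m → ℂ := fun x => fderiv ℂ f x (0, 1)

theorem DzOp_iter_hol {V : Set (CS m)} (hV : IsOpen V) {f : CS m → ℂ} (hf : DifferentiableOn ℂ f V) (n : ℕ) :
    DifferentiableOn ℂ (DzOp^[n] f) V := by
  induction n with
  | zero => exact hf
  | succ n ih => rw [Function.iterate_succ_apply']; exact differentiableOn_fderiv_apply_of_hol hV ih _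

theorem DzOp_iter_eq {V : Set (CS m)} (hV : IsOpen V) {f : CS m → ℂ} (hf : DifferentiableOn ℂ f V) (n : ℕ) :
    ∀ w z, (w, z) ∈ V → iteratedDeriv n (fun z => f (w, z)) z = DzOp^[n] f (w, z) := by
  induction n with
  | zero => intro w z _; simp
  | succ n ih =>
    intro w z hz
    rw [iteratedDeriv_succ, Function.iterate_succ_apply']
    have hc : Continuous fun y : ℂ => ((w, y) : CS m) := by fun_prop
    have e : iteratedDeriv n (fun z => f (w, z)) =ᶠ[𝓝 z] fun y => DzOp^[n] f (w, y) := by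
      filter_upwards [(hV.preimage hc).mem_nhds hz] with y hy using ih w y hy
    rw [e.deriv_eq]
    have hd := ((DzOp_iter_hol hV hf n _ hz).differentiableAt (hV.mem_nhds hz)).hasFDerivAt
    have hl : HasDerivAt (fun y : ℂ => ((w, y) : CS m)) (0, 1) z := (hasDerivAt_const z w).prodMk (hasDerivAt_id z)
    exact (hd.comp_hasDerivAt z hl).deriv

theorem hartogs_disc {k : CS m → ℂ} {z1 : ℂ} {ρ0 ρ C : ℝ} {V : Set (CS m)} (hVo : IsOpen V)
    (hV : ∀ w, ‖w‖ < ρ0 → (w, z1) ∈ V) (hk : DifferentiableOn ℂ k V)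
    (hz : ∀ w, ‖w‖ < ρ0 → DifferentiableOn ℂ (fun z => k (w, z)) (ball z1 ρ))
    (hb : ∀ w z, ‖w‖ < ρ0 → z ∈ ball z1 ρ → ‖k (w, z)‖ ≤ C) :
    DifferentiableOn ℂ k {x | ‖x.1‖ < ρ0 ∧ x.2 ∈ ball z1 ρ} := by
  rintro ⟨w0, z0⟩ ⟨hw0, hz0⟩
  simp only at hw0 hz0
  rw [mem_ball] at hz0
  obtain ⟨ρ', h1, h1'⟩ := exists_between hz0
  obtain ⟨ρ'', h2, h2'⟩ := exists_between h1'
  have hp' : 0 < ρ' := dist_nonneg.trans_lt h1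
  have hp'' : 0 < ρ'' := hp'.trans h2
  set U : Set (CS m) := {x | ‖x.1‖ < ρ0 ∧ x.2 ∈ ball z1 ρ'} with hU
  have hUo : IsOpen U := by
    have c1 : Continuous fun x : CS m => ‖x.1‖ := by fun_prop
    exact (isOpen_lt c1 continuous_const).inter (isOpen_ball.preimage continuous_snd)
  have hC : 0 ≤ C := (norm_nonneg _).trans (hb w0 z0 hw0 (by rw [mem_ball]; linarith))
  set F : ℕ → CS m → ℂ := fun n x => ((n.factorial : ℂ)⁻¹ * (x.2 - z1) ^ n) * DzOp^[n] k (x.1, z1) with hF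
  have hFd : ∀ n, DifferentiableOn ℂ (F n) U := by
    intro n x hx
    have a1 : DifferentiableAt ℂ (fun x : CS m => (n.factorial : ℂ)⁻¹ * (x.2 - z1) ^ n) x := by fun_prop
    have a2 : DifferentiableAt ℂ (fun x : CS m => ((x.1, z1) : CS m)) x := by fun_prop
    have a3 : DifferentiableAt ℂ (DzOp^[n] k) (x.1, z1) :=
      (DzOp_iter_hol hVo hk n _ (hV _ hx.1)).differentiableAt (hVo.mem_nhds (hV _ hx.1))
    exact (a1.mul (DifferentiableAt.comp (g := DzOp^[n] k) x a3 a2)).differentiableWithinAt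
  have hFb : ∀ n, ∀ x ∈ U, ‖F n x‖ ≤ C * (ρ' / ρ'') ^ n := by
    intro n x hx
    have d1 : DiffContOnCl ℂ (fun z => k (x.1, z)) (ball z1 ρ'') :=
      ((hz _ hx.1).mono (closedBall_subset_ball h2')).diffContOnCl_ball subset_rfl
    have := norm_iteratedDeriv_le_of_forall_mem_sphere_norm_le n hp'' d1
      (fun z hz' => hb x.1 z hx.1 (sphere_subset_closedBall.trans (closedBall_subset_ball h2') hz'))
    rw [DzOp_iter_eq hVo hk n _ _ (hV _ hx.1)] at this
    have hx2 : ‖x.2 - z1‖ ≤ ρ' := by have := hx.2; rw [mem_ball, dist_eq_norm] at this; exact this.le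
    have hf0 : (0:ℝ) < n.factorial := by exact_mod_cast n.factorial_pos
    simp only [hF]
    rw [norm_mul, norm_mul, norm_inv, norm_pow, Complex.norm_natCast]
    calc ((n.factorial : ℝ))⁻¹ * ‖x.2 - z1‖ ^ n * ‖DzOp^[n] k (x.1, z1)‖
        ≤ ((n.factorial : ℝ))⁻¹ * ρ' ^ n * (n.factorial * C / ρ'' ^ n) := by gcongr
      _ = C * (ρ' / ρ'') ^ n := by rw [div_pow]; field_simp
  have hs : Summable fun n : ℕ => C * (ρ' / ρ'') ^ n :=
    (summable_geometric_of_lt_one (by positivity) ((div_lt_one hp'').2 h2)).mul_left C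
  have hsum := hol_tsum hUo hs hFd hFb
  have heq : ∀ x ∈ U, ∑' n, F n x = k x := by
    intro x hx
    have := Complex.hasSum_taylorSeries_on_ball (hz _ hx.1) (ball_subset_ball (h2.le.trans h2'.le) hx.2)
    rw [← this.tsum_eq]
    congr 1; ext n
    simp only [hF, smul_eq_mul]
    rw [DzOp_iter_eq hVo hk n _ _ (hV _ hx.1)]
    ring
  have hxU : ((w0, z0) : CS m) ∈ U := ⟨hw0, h1⟩
  have := (hsum _ hxU).differentiableAt (hUo.mem_nhds hxU)
  refine (this.congr_of_eventuallyEq ?_).differentiableWithinAt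
  filter_upwards [hUo.mem_nhds hxU] with y hy using (heq y hy).symm
end

section
variable {m : ℕ} {M : Set (CS m)} {q : CS m} {Φ : (Fin m → ℂ) × (Fin m → ℂ) × ℂ → ℂ} {κ σ : CS m → CS m} {r : ℝ}

theorem IsModel.psi (H : IsModel M q Φ κ σ r) : ∃ ψ : (Fin m → ℂ) × (Fin m → ℂ) × ℂ → ℂ, ψ 0 = 0 ∧
    (∀ᶠ x in 𝓝 0, DifferentiableAt ℂ ψ x) ∧ (∀ᶠ x in 𝓝 0, ψ x + I * Φ (x.1, x.2.1, ψ x) = x.2.2) ∧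
    ∀ᶠ x in 𝓝 (0 : (Fin m → ℂ) × (Fin m → ℂ) × ℂ), ψ (x.1, x.2.1, x.2.2 + I * Φ x) = x.2.2 := by
  set L : ((Fin m → ℂ) × (Fin m → ℂ) × ℂ) × ℂ →L[ℂ] (Fin m → ℂ) × (Fin m → ℂ) × ℂ :=
    ((ContinuousLinearMap.fst ℂ _ _) ∘L (ContinuousLinearMap.fst ℂ _ _)).prod
      (((ContinuousLinearMap.fst ℂ _ _) ∘L (ContinuousLinearMap.snd ℂ _ _) ∘L (ContinuousLinearMap.fst ℂ _ _)).prod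
        (ContinuousLinearMap.snd ℂ _ _)) with hL
  have hLa : ∀ p, L p = (p.1.1, p.1.2.1, p.2) := fun p => rfl
  set G : ((Fin m → ℂ) × (Fin m → ℂ) × ℂ) × ℂ → ℂ := fun p => p.2 + I * Φ (L p) - p.1.2.2 with hG
  have hΦd : ∀ p ∈ ball (0 : (Fin m → ℂ) × (Fin m → ℂ) × ℂ) r, HasFDerivAt Φ (fderiv ℂ Φ p) p := fun p hp =>
    ((H.hol p hp).differentiableAt (isOpen_ball.mem_nhds hp)).hasFDerivAt
  set B : ((Fin m → ℂ) × (Fin m → ℂ) × ℂ) × ℂ →L[ℂ] ℂ :=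
    (ContinuousLinearMap.snd ℂ _ _) ∘L (ContinuousLinearMap.snd ℂ _ _) ∘L (ContinuousLinearMap.fst ℂ _ _) with hB
  have hGd : ∀ p, L p ∈ ball 0 r → HasFDerivAt G (ContinuousLinearMap.snd ℂ _ _ + I • (fderiv ℂ Φ (L p) ∘L L) - B) p := by
    intro p hp
    exact (((ContinuousLinearMap.snd ℂ ((Fin m → ℂ) × (Fin m → ℂ) × ℂ) ℂ).hasFDerivAt).fun_add
      ((HasFDerivAt.comp (g := Φ) p (hΦd _ hp) L.hasFDerivAt).const_mul I)).fun_sub B.hasFDerivAt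
  have hev : ∀ᶠ p in 𝓝 (0 : ((Fin m → ℂ) × (Fin m → ℂ) × ℂ) × ℂ), L p ∈ ball 0 r := by
    have : L 0 ∈ ball (0 : (Fin m → ℂ) × (Fin m → ℂ) × ℂ) r := by rw [map_zero]; exact mem_ball_self H.rpos
    exact L.continuous.continuousAt.eventually_mem (isOpen_ball.mem_nhds this)
  have hL0 : L 0 = 0 := map_zero L
  obtain ⟨ψ, h0, h1, h2, h3⟩ := hol_implicit (G := G) (hev.mono fun p hp => (hGd p hp).differentiableAt)
    (by simp [hG, hL0, H.zero]) (by
      have : ∀ y : ℂ, fderiv ℂ G 0 (0, y) = y := by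
        intro y
        rw [(hGd 0 (by rw [hL0]; exact mem_ball_self H.rpos)).fderiv, hL0, H.dzero]
        simp [hB]
      simp only [this]; exact Function.bijective_id)
  refine ⟨ψ, h0, h1, ?_, ?_⟩
  · have c : ContinuousAt (fun x : (Fin m → ℂ) × (Fin m → ℂ) × ℂ => (x, ψ x)) 0 :=
      continuousAt_id.prodMk h1.self_of_nhds.continuousAt
    have c' : Tendsto (fun x : (Fin m → ℂ) × (Fin m → ℂ) × ℂ => (x, ψ x)) (𝓝 0) (𝓝 0) := by
      have := c.tendsto; rw [h0] at this; exact this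
    filter_upwards [c'.eventually h2] with x hx
    have := hx.2 rfl
    simp only [hG, hLa] at this
    exact sub_eq_zero.mp this
  · have c : ContinuousAt (fun x : (Fin m → ℂ) × (Fin m → ℂ) × ℂ => (((x.1, x.2.1, x.2.2 + I * Φ x) : (Fin m → ℂ) × (Fin m → ℂ) × ℂ), x.2.2)) 0 := by
      have := (hΦd 0 (mem_ball_self H.rpos)).continuousAt
      fun_prop
    have c' : Tendsto (fun x : (Fin m → ℂ) × (Fin m → ℂ) × ℂ => (((x.1, x.2.1, x.2.2 + I * Φ x) : (Fin m → ℂ) × (Fin m → ℂ) × ℂ), x.2.2)) (𝓝 0) (𝓝 0) := by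
      have := c.tendsto
      simp only [H.zero] at this
      convert this using 2
      simp [Prod.ext_iff]
    filter_upwards [c'.eventually h2] with x hx
    refine (hx.1 ?_).symm
    simp [hG, hLa]

theorem IsModel.two_sided (H : IsModel M q Φ κ σ r) (hD : HasDiscs Φ) {R : ℝ} (hR : 0 < R) (hRr : R ≤ r)
    {f : (Fin m → ℂ) × ℝ → ℂ} (hf : IsCRg (mphi Φ) R f) (hA : InA f) :
    ∃ ε > 0, ∃ F : CS m → ℂ, DifferentiableOn ℂ F (ball 0 ε) ∧
      ∀ w u, ‖((w, gZ (mphi Φ) (w, u)) : CS m)‖ < ε → F (w, gZ (mphi Φ) (w, u)) = f (w, u) := by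
  obtain ⟨δ, hδ, hδR, F, hF1, hF2, hF3⟩ := onesided (H.graph.mono hR hRr) (GDiscs_of hD) hf
  have hδr : δ < r := by linarith
  obtain ⟨Qs, rQ, N, K, CQ, hQ⟩ := hA
  have h0 : (0 : CS m) ∈ Upc (mphi Φ) δ := by
    have := H.graph.zero
    refine ⟨⟨by simpa using hδ, by simpa using hδ, by simpa using hδ⟩, ?_⟩
    show mphi Φ ((0 : Fin m → ℂ), (0:ℝ)) ≤ 0
    rw [show ((0 : Fin m → ℂ), (0 : ℝ)) = 0 from rfl, this]
  have h0' : (0 : CS m) ∈ Lo m rQ := ⟨by simpa using hQ.rpos, by simpa using hQ.rpos, by simp⟩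
  obtain ⟨ε, hε, hFε⟩ := Metric.continuousWithinAt_iff.mp (hF2 0 h0) 1 one_pos
  obtain ⟨ε', hε', hQε⟩ := Metric.continuousWithinAt_iff.mp (hQ.cont 0 h0') 1 one_pos
  obtain ⟨ρ, hρ0, hρδ, hρε, hρε', hρQ⟩ : ∃ ρ > 0, 2 * ρ ≤ δ ∧ 2 * ρ ≤ ε ∧ ρ ≤ ε' ∧ ρ ≤ rQ := by
    refine ⟨min (min (δ / 2) (ε / 2)) (min ε' rQ), lt_min (lt_min (by linarith) (by linarith)) (lt_min hε' hQ.rpos), ?_, ?_, ?_, ?_⟩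
    · have := (min_le_left (min (δ / 2) (ε / 2)) (min ε' rQ)).trans (min_le_left _ _); linarith
    · have := (min_le_left (min (δ / 2) (ε / 2)) (min ε' rQ)).trans (min_le_right _ _); linarith
    · exact (min_le_right _ _).trans (min_le_left _ _)
    · exact (min_le_right _ _).trans (min_le_right _ _)
  set C := (‖F 0‖ + 1) + (‖Qs (diagA 0)‖ + 1) with hC
  set A : (Fin m → ℂ) → ℂ → ℂ := fun w s => F (w, s + I * Φ (w, conjW w, s)) with hA
  set B : (Fin m → ℂ) → ℂ → ℂ := fun w s => Qs (diagA (w, s)) with hB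
  set g : (Fin m → ℂ) → ℂ → ℂ := fun w s => if 0 ≤ s.im then A w s else B w s with hg
  have hmemr : ∀ w s, ‖w‖ < ρ → ‖s‖ < ρ → (w, conjW w, s) ∈ ball (0 : (Fin m → ℂ) × (Fin m → ℂ) × ℂ) r := by
    intro w s hw hs
    rw [mem_ball_zero_iff, Prod.norm_def, Prod.norm_def]
    simp only [max_lt_iff, norm_conjW]; exact ⟨by linarith, by linarith, by linarith⟩
  have hup : ∀ w s, ‖w‖ < ρ → ‖s‖ < ρ → 0 ≤ s.im → (w, s + I * Φ (w, conjW w, s)) ∈ Upc (mphi Φ) δ ∧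
      ‖((w, s + I * Φ (w, conjW w, s)) : CS m)‖ < 2 * ρ ∧ (0 < s.im → (w, s + I * Φ (w, conjW w, s)) ∈ Upo (mphi Φ) δ) := by
    intro w s hw hs hi
    obtain ⟨a, b, c⟩ := H.zeta_up hδr hρδ (b := conjW w) hw hs (by simpa using hi)
    exact ⟨⟨a, by simp only; linarith⟩, b, fun hi => ⟨a, by simp only; linarith⟩⟩
  have hlo : ∀ w s, ‖w‖ < ρ → ‖s‖ < ρ → s.im ≤ 0 → ((w, s) : CS m) ∈ Lo m rQ := fun w s hw hs hi =>
    ⟨by simp only; linarith, by simp only; linarith, by simp only; linarith⟩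
  have hAB : ∀ w s, ‖w‖ < ρ → ‖s‖ < ρ → s.im = 0 → A w s = B w s ∧ A w s = f (w, s.re) := by
    intro w s hw hs hi
    have hs' : s = (s.re : ℂ) := by apply Complex.ext <;> simp [hi]
    have hsr : |s.re| ≤ ‖s‖ := Complex.abs_re_le_norm s
    have e1 : A w s = f (w, s.re) := by
      rw [← hF3 w s.re (by linarith) (by linarith)]
      simp only [hA]
      rw [hs', H.phi_real (p := (w, s.re)) (mem_ball_WR (by linarith) (by linarith))]
      rfl
    refine ⟨e1.trans ?_, e1⟩
    rw [← hQ.bdry w s.re (by linarith) (by linarith), ← hs']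
  have hgb : ∀ w s, ‖w‖ < ρ → ‖s‖ < ρ → ‖g w s‖ ≤ C := by
    intro w s hw hs
    by_cases hi : 0 ≤ s.im
    · simp only [hg, if_pos hi, hA]
      obtain ⟨a, b, c⟩ := hup w s hw hs hi
      have := hFε a (by rw [dist_zero_right]; linarith)
      rw [dist_eq_norm] at this
      have h2 := norm_add_le (F (w, s + I * Φ (w, conjW w, s)) - F 0) (F 0)
      rw [sub_add_cancel] at h2
      have := norm_nonneg (Qs (diagA 0))
      linarith
    · simp only [hg, if_neg hi, hB]
      have := hQε (hlo w s hw hs (by linarith)) (by rw [dist_zero_right, Prod.norm_def]; exact max_lt (by simp only; linarith) (by simp only; linarith))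
      rw [dist_eq_norm] at this
      have h2 := norm_add_le (Qs (diagA (w, s)) - Qs (diagA 0)) (Qs (diagA 0))
      rw [sub_add_cancel] at h2
      have := norm_nonneg (F 0)
      linarith
  have hΦs : ∀ w s, ‖w‖ < ρ → ‖s‖ < ρ → DifferentiableAt ℂ (fun s => ((w, s + I * Φ (w, conjW w, s)) : CS m)) s := by
    intro w s hw hs
    have h1 : DifferentiableAt ℂ Φ (w, conjW w, s) := (H.hol _ (hmemr w s hw hs)).differentiableAt (isOpen_ball.mem_nhds (hmemr w s hw hs))
    have h2 : DifferentiableAt ℂ (fun s : ℂ => (w, conjW w, s)) s := by fun_prop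
    have h3 := DifferentiableAt.comp (g := Φ) s h1 h2
    exact (differentiableAt_const w).prodMk (differentiableAt_fun_id.fun_add (h3.const_mul I))
  have hUpo := isOpen_Upo (H.graph.mono hR hRr) hδR
  have hgd : ∀ w, ‖w‖ < ρ → ∀ s ∈ ball ((0:ℝ) : ℂ) ρ, s.im ≠ 0 → DifferentiableAt ℂ (g w) s := by
    intro w hw s hs hi
    rw [mem_ball, Complex.ofReal_zero, dist_zero_right] at hs
    rcases lt_or_gt_of_ne hi with hi | hi
    · have hd : DifferentiableAt ℂ Qs (diagA (w, s)) := by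
        have := diag_mem_Om (N := N) (hlo w s hw hs hi.le) (by simp only; linarith)
        exact (hQ.hol _ this).differentiableAt (isOpen_Om.mem_nhds this)
      have h2 : DifferentiableAt ℂ (fun s : ℂ => diagA ((w, s) : CS m)) s := by simp only [diagA]; fun_prop
      refine (DifferentiableAt.comp (g := Qs) s hd h2).congr_of_eventuallyEq ?_
      filter_upwards [(isOpen_lt continuous_im continuous_const).mem_nhds hi] with y hy
      simp only [hg, hB, Function.comp]; rw [if_neg (not_le.mpr hy)]
    · have hu := (hup w s hw hs hi.le).2.2 hi
      have hd : DifferentiableAt ℂ F (w, s + I * Φ (w, conjW w, s)) := (hF1 _ hu).differentiableAt (hUpo.mem_nhds hu)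
      refine (DifferentiableAt.comp (g := F) s hd (hΦs w s hw hs)).congr_of_eventuallyEq ?_
      filter_upwards [(isOpen_lt continuous_const continuous_im).mem_nhds hi] with y hy
      simp only [hg, hA, Function.comp]; rw [if_pos (le_of_lt hy)]
  have hgc : ∀ w, ‖w‖ < ρ → ContinuousOn (g w) (ball ((0:ℝ) : ℂ) ρ) := by
    intro w hw s hs
    by_cases hi : s.im = 0
    swap
    · exact (hgd w hw s hs hi).continuousAt.continuousWithinAt
    have hsρ := hs
    rw [mem_ball, Complex.ofReal_zero, dist_zero_right] at hsρ
    have hspl : ball ((0:ℝ) : ℂ) ρ ⊆ (ball ((0:ℝ) : ℂ) ρ ∩ {s | 0 ≤ s.im}) ∪ (ball ((0:ℝ) : ℂ) ρ ∩ {s | s.im ≤ 0}) := by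
      intro y hy
      rcases le_total 0 y.im with h | h
      · exact Or.inl ⟨hy, h⟩
      · exact Or.inr ⟨hy, h⟩
    refine ContinuousWithinAt.mono (ContinuousWithinAt.union ?_ ?_) hspl
    · have cA : ContinuousOn (A w) (ball ((0:ℝ) : ℂ) ρ ∩ {s | 0 ≤ s.im}) := by
        refine hF2.comp (f := fun s => ((w, s + I * Φ (w, conjW w, s)) : CS m)) (fun s hs => ?_) (fun s hs => ?_)
        · have := hs.1; rw [mem_ball, Complex.ofReal_zero, dist_zero_right] at this
          exact (hΦs w s hw this).continuousAt.continuousWithinAt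
        · have := hs.1; rw [mem_ball, Complex.ofReal_zero, dist_zero_right] at this
          exact (hup w s hw this hs.2).1
      refine ((cA s ⟨hs, hi.ge⟩).congr (fun y hy => ?_) ?_)
      · simp only [hg]; rw [if_pos (show 0 ≤ y.im from hy.2)]
      · simp only [hg]; rw [if_pos hi.ge]
    · have cB : ContinuousOn (B w) (ball ((0:ℝ) : ℂ) ρ ∩ {s | s.im ≤ 0}) := by
        refine hQ.cont.comp (f := fun s => ((w, s) : CS m)) (by fun_prop) (fun s hs => ?_)
        have := hs.1; rw [mem_ball, Complex.ofReal_zero, dist_zero_right] at this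
        exact hlo w s hw this hs.2
      have hgB : ∀ y ∈ ball ((0:ℝ) : ℂ) ρ ∩ {s | s.im ≤ 0}, g w y = B w y := by
        intro y hy
        have hyρ := hy.1; rw [mem_ball, Complex.ofReal_zero, dist_zero_right] at hyρ
        simp only [hg]
        split_ifs with h
        · exact (hAB w y hw hyρ (le_antisymm hy.2 h)).1
        · rfl
      exact (cB s ⟨hs, hi.le⟩).congr hgB (hgB s ⟨hs, hi.le⟩)
  have hgh : ∀ w, ‖w‖ < ρ → DifferentiableOn ℂ (g w) (ball 0 ρ) := fun w hw => by
    have := hol_of_hol_off_real (hgc w hw) (hgd w hw)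
    rwa [Complex.ofReal_zero] at this
  obtain ⟨ψ, p0, p1, p2, p3⟩ := H.psi
  have p4 : ∀ᶠ x in 𝓝 0, ψ x ∈ ball (0:ℂ) ρ := p1.self_of_nhds.continuousAt.eventually_mem (by rw [p0]; exact ball_mem_nhds _ hρ0)
  obtain ⟨ε1', he0', he'⟩ := Metric.eventually_nhds_iff_ball.mp (p1.and (p2.and (p3.and p4)))
  set ε1 := min ε1' ρ with hε1
  have he0 : 0 < ε1 := lt_min he0' hρ0
  have he : ∀ y ∈ ball (0 : (Fin m → ℂ) × (Fin m → ℂ) × ℂ) ε1, _ := fun y hy => he' y (ball_subset_ball (min_le_left _ _) hy)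
  have heρ : ε1 ≤ ρ := min_le_right _ _
  have hmem1 : ∀ w z, ‖w‖ < ε1 → ‖z‖ < ε1 → (w, conjW w, z) ∈ ball (0 : (Fin m → ℂ) × (Fin m → ℂ) × ℂ) ε1 := by
    intro w s hw hs
    rw [mem_ball_zero_iff, Prod.norm_def, Prod.norm_def]
    simp only [max_lt_iff, norm_conjW]; exact ⟨by linarith, by linarith, by linarith⟩
  set k : CS m → ℂ := fun x => g x.1 (ψ (x.1, conjW x.1, x.2)) with hk
  set V : Set (CS m) := {x | ‖x.1‖ < ε1 ∧ ‖x.2‖ < ε1 ∧ ‖x.1‖ < 2 * x.2.im ∧ ‖x.2‖ < 2 * x.2.im} with hV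
  have hVo : IsOpen V := by
    have c1 : Continuous fun x : CS m => ‖x.1‖ := by fun_prop
    have c2 : Continuous fun x : CS m => ‖x.2‖ := by fun_prop
    have c3 : Continuous fun x : CS m => 2 * x.2.im := continuous_const.mul (continuous_im.comp continuous_snd)
    exact (isOpen_lt c1 continuous_const).inter ((isOpen_lt c2 continuous_const).inter ((isOpen_lt c1 c3).inter (isOpen_lt c2 c3)))
  have hkV : ∀ x ∈ V, k x = F x ∧ x ∈ Upo (mphi Φ) δ := by
    rintro ⟨w, z⟩ ⟨v1, v2, v3, v4⟩
    simp only at v1 v2 v3 v4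
    obtain ⟨-, q2, -, q4⟩ := he _ (hmem1 w z v1 v2)
    simp only [hk]
    set s := ψ (w, conjW w, z) with hs
    simp only at q2
    rw [mem_ball_zero_iff] at q4
    have hΦ : ‖Φ (w, conjW w, s)‖ ≤ max ‖w‖ ‖s‖ / 8 := by
      have := H.lip (hmemr w s (by linarith) q4) (mem_ball_self H.rpos)
      rw [H.zero, sub_zero, sub_zero, Prod.norm_def, Prod.norm_def] at this
      simp only [norm_conjW] at this
      rwa [← max_assoc, max_self] at this
    have hsn : ‖s‖ ≤ ‖z‖ + ‖Φ (w, conjW w, s)‖ := by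
      have e : s = z - I * Φ (w, conjW w, s) := by rw [← q2]; ring
      have := norm_sub_le z (I * Φ (w, conjW w, s))
      rw [norm_mul, Complex.norm_I, one_mul] at this
      rw [← e] at this; exact this
    have him : z.im = s.im + (Φ (w, conjW w, s)).re := by rw [← q2]; simp
    have hre := (le_abs_self _).trans (Complex.abs_re_le_norm (Φ (w, conjW w, s)))
    have hpos : 0 < s.im := by
      have hwn := norm_nonneg w
      rcases max_cases ‖w‖ ‖s‖ with h | h <;> rw [h.1] at hΦ <;> linarith
    have hu := hup w s (by linarith) q4 hpos.le
    rw [q2] at hu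
    refine ⟨?_, hu.2.2 hpos⟩
    simp only [hg]; rw [if_pos hpos.le]; simp only [hA]; rw [q2]
  have hkd : DifferentiableOn ℂ k V := by
    intro x hx
    have hd : DifferentiableAt ℂ F x := (hF1 _ (hkV x hx).2).differentiableAt (hUpo.mem_nhds (hkV x hx).2)
    refine (hd.congr_of_eventuallyEq ?_).differentiableWithinAt
    filter_upwards [hVo.mem_nhds hx] with y hy using (hkV y hy).1
  set z1 : ℂ := ((ε1 / 4 : ℝ) : ℂ) * I with hz1
  have hz1n : ‖z1‖ = ε1 / 4 := by rw [hz1, norm_mul, Complex.norm_I, mul_one, Complex.norm_real, Real.norm_eq_abs, abs_of_pos (by linarith)]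
  have hz1i : z1.im = ε1 / 4 := by simp [hz1]
  have hbz : ∀ z ∈ ball z1 (ε1 / 2), ‖z‖ < ε1 := by
    intro z hz
    rw [mem_ball, dist_eq_norm] at hz
    have := norm_add_le (z - z1) z1
    rw [sub_add_cancel] at this; linarith
  have hH := hartogs_disc (k := k) (z1 := z1) (ρ0 := ε1 / 4) (ρ := ε1 / 2) (C := C) hVo
    (fun w hw => ⟨by simp only; linarith, by simp only; linarith, by simp only; linarith, by simp only; linarith⟩) hkd
    (fun w hw z hz => by
      obtain ⟨q1, -, -, q4⟩ := he _ (hmem1 w z (by linarith) (hbz z hz))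
      have d1 : DifferentiableAt ℂ (g w) (ψ (w, conjW w, z)) := (hgh w (by linarith) _ q4).differentiableAt (isOpen_ball.mem_nhds q4)
      have d2 : DifferentiableAt ℂ (fun z : ℂ => (w, conjW w, z)) z := by fun_prop
      exact (DifferentiableAt.comp (g := g w) z d1 (DifferentiableAt.comp (g := ψ) z q1 d2)).differentiableWithinAt)
    (fun w z hw hz => by
      obtain ⟨-, -, -, q4⟩ := he _ (hmem1 w z (by linarith) (hbz z hz))
      rw [mem_ball_zero_iff] at q4
      exact hgb w _ (by linarith) q4)
  refine ⟨ε1 / 4, by linarith, k, hH.mono fun x hx => ?_, fun w u hwu => ?_⟩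
  · rw [mem_ball_zero_iff, Prod.norm_def, max_lt_iff] at hx
    refine ⟨hx.1, ?_⟩
    rw [mem_ball, dist_eq_norm]
    have := norm_sub_le x.2 z1
    linarith
  · rw [Prod.norm_def, max_lt_iff] at hwu
    simp only at hwu
    have hu : |u| < ε1 / 4 := by
      have := Complex.abs_re_le_norm (gZ (mphi Φ) (w, u)); rw [gZ_re] at this; simp only at this; linarith
    have hu' : ‖(u:ℂ)‖ < ε1 / 4 := by simpa using hu
    obtain ⟨-, -, q3, -⟩ := he _ (hmem1 w (u:ℂ) (by linarith) (by linarith))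
    simp only at q3
    rw [H.phi_real (p := (w, u)) (mem_ball_WR (by linarith) (by linarith))] at q3
    simp only [hk]
    rw [show gZ (mphi Φ) (w, u) = (u:ℂ) + I * (mphi Φ (w, u)) from rfl, q3]
    simp only [hg]
    rw [if_pos (by simp)]
    have := (hAB w (u:ℂ) (by linarith) (by linarith) (by simp)).2
    simpa using this
end

section
variable {m : ℕ} {M : Set (CS m)} {q : CS m} {Φ : (Fin m → ℂ) × (Fin m → ℂ) × ℂ → ℂ} {κ σ : CS m → CS m} {r R : ℝ}
variable {E F : Type*} [NormedAddCommGroup E] [NormedSpace ℂ E] [NormedAddCommGroup F] [NormedSpace ℂ F]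

/-- The tangential Cauchy-Riemann operator in graph coordinates. -/
def Lb (φ : (Fin m → ℂ) × ℝ → ℝ) (v : Fin m → ℂ) (Q : (Fin m → ℂ) × ℝ → E) (p : (Fin m → ℂ) × ℝ) : E :=
  (2 : ℂ)⁻¹ • (fderiv ℝ Q p (v, 0) + I • fderiv ℝ Q p (I • v, 0)) -
    (dbarW (gZ φ) p v * (gZu φ p)⁻¹) • fderiv ℝ Q p (0, 1)

theorem Lb_comp {φ : (Fin m → ℂ) × ℝ → ℝ} {v : Fin m → ℂ} {c : (Fin m → ℂ) × ℝ → E} {p} {θ : E → F}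
    (hθ : DifferentiableAt ℂ θ (c p)) (hc : DifferentiableAt ℝ c p) :
    Lb φ v (fun x => θ (c x)) p = fderiv ℂ θ (c p) (Lb φ v c p) := by
  have h : HasFDerivAt (fun x => θ (c x)) (((fderiv ℂ θ (c p)).restrictScalars ℝ) ∘L fderiv ℝ c p) p :=
    HasFDerivAt.comp (g := θ) p (hθ.hasFDerivAt.restrictScalars ℝ) hc.hasFDerivAt
  simp only [Lb, h.fderiv, map_sub, map_smul, map_add]
  rfl

theorem Lb_clm {φ : (Fin m → ℂ) × ℝ → ℝ} {v : Fin m → ℂ} {c : (Fin m → ℂ) × ℝ → E} {p} (ℓ : E →L[ℂ] F)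
    (hc : DifferentiableAt ℝ c p) : Lb φ v (fun x => ℓ (c x)) p = ℓ (Lb φ v c p) := by
  rw [Lb_comp ℓ.differentiableAt hc, ContinuousLinearMap.fderiv]

theorem IsCRg.Lb_zero {φ : (Fin m → ℂ) × ℝ → ℝ} (G : GraphData φ R) {f : (Fin m → ℂ) × ℝ → ℂ} (hf : IsCRg φ R f) {p}
    (hp : p ∈ ball 0 R) (v) : Lb φ v f p = 0 := by
  have h := hf.cr p hp v
  have hne := gZu_ne φ (G.hasZ hp).differentiableAt
  have : dbarW f p v = dbarW (gZ φ) p v * (gZu φ p)⁻¹ * fderiv ℝ f p (0, 1) := by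
    field_simp; rw [h]
  simp only [Lb, smul_eq_mul]
  rw [← this, dbarW]; ring

theorem IsCRg_of_Lb {φ : (Fin m → ℂ) × ℝ → ℝ} (G : GraphData φ R) {f : (Fin m → ℂ) × ℝ → ℂ} (h1 : ContDiffOn ℝ 1 f (ball 0 R))
    (h : ∀ p ∈ ball 0 R, ∀ v, Lb φ v f p = 0) : IsCRg φ R f := by
  refine ⟨h1, fun p hp v => ?_⟩
  have hne := gZu_ne φ (G.hasZ hp).differentiableAt
  have h := h p hp v
  simp only [Lb, smul_eq_mul] at h
  have h2 : dbarW f p v = dbarW (gZ φ) p v * (gZu φ p)⁻¹ * fderiv ℝ f p (0, 1) := by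
    rw [← sub_eq_zero, ← h]; simp only [dbarW]; ring
  rw [h2]; field_simp

theorem IsModel.inA_Z (H : IsModel M q Φ κ σ r) : InA (gZ (mphi Φ)) := by
  have h2 : DifferentiableOn ℂ (fun p : (Fin m → ℂ) × (Fin m → ℂ) × ℂ => p.2.2) (ball 0 r) := by fun_prop
  refine (InA.hol H.rpos (h2.fun_add (H.hol.const_mul I))).congr ?_
  filter_upwards [ball_mem_nhds _ H.rpos] with p hp
  simp only [iotaR_apply]
  rw [H.phi_real hp]; rfl

theorem InA.Lb (H : IsModel M q Φ κ σ r) (hR : 0 < R) {Q : (Fin m → ℂ) × ℝ → ℂ} (hA : InA Q)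
    (hQ : ContDiffOn ℝ 1 Q (ball 0 R)) (v) : InA (Lb (mphi Φ) v Q) := by
  have hZ1 : ContDiffOn ℝ 1 (gZ (mphi Φ)) (ball 0 r) := H.graph.smoothZ.of_le (by norm_num)
  have d := fun e => hA.deriv hR hQ e
  have z := fun e => H.inA_Z.deriv H.rpos hZ1 e
  have hzu : InA (fun p => (gZu (mphi Φ) p)⁻¹) := (z (0, 1)).inv (gZu_ne _ (H.graph.hasZ (mem_ball_self H.rpos)).differentiableAt)
  have a1 := (InA.const (2⁻¹ : ℂ)).mul ((d (v, 0)).add ((InA.const I).mul (d (I • v, 0))))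
  have a2 := ((InA.const (2⁻¹ : ℂ)).mul ((z (v, 0)).add ((InA.const I).mul (z (I • v, 0)))))
  have a3 := (InA.const (-1 : ℂ)).mul ((a2.mul hzu).mul (d (0, 1)))
  refine (a1.add a3).congr (Eventually.of_forall fun p => ?_)
  simp only [_root_.Lb, dbarW, smul_eq_mul]; ring

theorem InA.prod {ι : Type*} (s : Finset ι) {Q : ι → (Fin m → ℂ) × ℝ → ℂ} (H : ∀ i ∈ s, InA (Q i)) :
    InA (fun p => ∏ i ∈ s, Q i p) := by
  classical
  induction s using Finset.induction_on with
  | empty => simpa using InA.const (1 : ℂ)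
  | insert a s ha ih =>
    simp only [Finset.prod_insert ha]
    exact (H a (by simp)).mul (ih fun i hi => H i (by simp [hi]))

theorem InA.det {A : (Fin m → ℂ) × ℝ → Matrix (Fin m) (Fin m) ℂ} (H : ∀ i j, InA (fun p => A p i j)) :
    InA (fun p => (A p).det) := by
  simp only [Matrix.det_apply]
  refine InA.finsum _ fun s _ => ?_
  have := (InA.const ((Equiv.Perm.sign s : ℤ) : ℂ)).mul (InA.prod Finset.univ fun i _ => H (s i) i)
  refine this.congr (Eventually.of_forall fun p => ?_)
  simp [Units.smul_def]

theorem cramer_solve (A : Matrix (Fin m) (Fin m) ℂ) (x : Fin m → ℂ) (i : Fin m) (h : A.det ≠ 0) :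
    x i = (A.updateCol i (A.mulVec x)).det * (A.det)⁻¹ := by
  rw [← Matrix.cramer_apply, Matrix.cramer_eq_adjugate_mulVec, Matrix.mulVec_mulVec, Matrix.adjugate_mul]
  simp [Matrix.smul_mulVec]
  field_simp

def thL {V : Type*} [NormedAddCommGroup V] [NormedSpace ℂ V] (T : (Fin m → ℂ) × V → ℂ) : List (Fin m) → (Fin m → ℂ) × V → ℂ
  | [] => T
  | i :: L => fun x => fderiv ℂ (thL T L) x (Pi.single i 1, 0)

theorem thL_hol {V : Type*} [NormedAddCommGroup V] [NormedSpace ℂ V] [FiniteDimensional ℂ V] {T : (Fin m → ℂ) × V → ℂ} {ρ : ℝ}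
    (hT : DifferentiableOn ℂ T (ball 0 ρ)) (L : List (Fin m)) : DifferentiableOn ℂ (thL T L) (ball 0 ρ) := by
  induction L with
  | nil => exact hT
  | cons i L ih => exact differentiableOn_fderiv_apply_of_hol isOpen_ball ih _

theorem IsModel.reflect (H : IsModel M q Φ κ σ r) (hD : HasDiscs Φ) (hR : 0 < R) (hRr : R ≤ r)
    {V : Type*} [NormedAddCommGroup V] [NormedSpace ℂ V] [FiniteDimensional ℂ V]
    {hw : (Fin m → ℂ) × ℝ → Fin m → ℂ} {k : (Fin m → ℂ) × ℝ → V} {f : (Fin m → ℂ) × ℝ → ℂ}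
    (hwc : ∀ i, IsCRg (mphi Φ) R (fun p => hw p i)) (hk1 : ContDiffOn ℝ 1 k (ball 0 R))
    (hk : ∀ p ∈ ball 0 R, ∀ v, Lb (mphi Φ) v k p = 0) (hf : IsCRg (mphi Φ) R f)
    {T : (Fin m → ℂ) × V → ℂ} {ρ : ℝ} (hT : DifferentiableOn ℂ T (ball 0 ρ))
    (hmem : ∀ p ∈ ball 0 R, (conjW (hw p), k p) ∈ ball 0 ρ)
    (heq : ∀ p ∈ ball 0 R, (starRingEnd ℂ) (f p) = T (conjW (hw p), k p))
    (hJ : (Matrix.of fun j i => Lb (mphi Φ) (Pi.single j 1) (fun p => (starRingEnd ℂ) (hw p i)) 0).det ≠ 0) (L : List (Fin m)) :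
    InA (fun p => thL T L (conjW (hw p), k p)) := by
  set c : (Fin m → ℂ) × ℝ → (Fin m → ℂ) × V := fun p => (conjW (hw p), k p) with hc
  have hw1 : ContDiffOn ℝ 1 (fun p => conjW (hw p)) (ball 0 R) := by
    rw [contDiffOn_pi]
    intro i
    exact (cC.contDiff.comp_contDiffOn (hwc i).smooth).congr fun p _ => (cC_apply _).symm
  have hc1 : ContDiffOn ℝ 1 c (ball 0 R) := hw1.prodMk hk1
  have hcd : ∀ p ∈ ball 0 R, DifferentiableAt ℝ c p := fun p hp => (hasFDerivAt_of_C1 hc1 isOpen_ball hp).differentiableAt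
  have hcw : ∀ i, InA (fun p => (starRingEnd ℂ) (hw p i)) := fun i => H.inA_conj hD hR hRr (hwc i)
  have hcw1 : ∀ i, ContDiffOn ℝ 1 (fun p => (starRingEnd ℂ) (hw p i)) (ball 0 R) := fun i =>
    (contDiffOn_pi.1 hw1 i)
  have hQ1 : ∀ L, ContDiffOn ℝ 1 (fun p => thL T L (c p)) (ball 0 R) := by
    intro L
    have := (contDiffOn_nat_of_hol isOpen_ball 1 (thL_hol hT L)).restrict_scalars ℝ
    exact (this.of_le (by norm_num)).comp hc1 fun p hp => hmem p hp
  set J : (Fin m → ℂ) × ℝ → Matrix (Fin m) (Fin m) ℂ := fun p =>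
    Matrix.of fun j i => Lb (mphi Φ) (Pi.single j 1) (fun p => (starRingEnd ℂ) (hw p i)) p with hJd
  have hJA : ∀ j i, InA (fun p => J p j i) := fun j i => InA.Lb H hR (hcw i) (hcw1 i) _
  have hdetA : InA (fun p => (J p).det) := InA.det hJA
  have hdinv : InA (fun p => ((J p).det)⁻¹) := hdetA.inv hJ
  have hLbc : ∀ p ∈ ball 0 R, ∀ v, Lb (mphi Φ) v c p = (fun i => Lb (mphi Φ) v (fun p => (starRingEnd ℂ) (hw p i)) p, 0) := by
    intro p hp v
    refine Prod.ext (funext fun i => ?_) ?_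
    · exact (Lb_clm ((ContinuousLinearMap.proj i) ∘L (ContinuousLinearMap.fst ℂ (Fin m → ℂ) V)) (hcd p hp)).symm
    · exact (Lb_clm (ContinuousLinearMap.snd ℂ (Fin m → ℂ) V) (hcd p hp)).symm.trans (hk p hp v)
  have hstep : ∀ L, ∀ p ∈ ball 0 R, ∀ v, Lb (mphi Φ) v (fun p => thL T L (c p)) p =
      ∑ i, Lb (mphi Φ) v (fun p => (starRingEnd ℂ) (hw p i)) p * thL T (i :: L) (c p) := by
    intro L p hp v
    rw [Lb_comp ((thL_hol hT L _ (hmem p hp)).differentiableAt (isOpen_ball.mem_nhds (hmem p hp))) (hcd p hp), hLbc p hp v]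
    set a : Fin m → ℂ := fun i => Lb (mphi Φ) v (fun p => (starRingEnd ℂ) (hw p i)) p with ha
    have : ((a, (0:V)) : (Fin m → ℂ) × V) = ∑ i, a i • ((Pi.single i 1, 0) : (Fin m → ℂ) × V) := by
      refine Prod.ext ?_ ?_
      · rw [Prod.fst_sum]
        ext j; simp [Finset.sum_apply, Pi.single_apply]
      · rw [Prod.snd_sum]; simp
    rw [this, map_sum]
    simp only [map_smul, smul_eq_mul]
    rfl
  have hdet0 : ∀ᶠ p in 𝓝 (0 : (Fin m → ℂ) × ℝ), (J p).det ≠ 0 := by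
    have hcJ : ContinuousAt (fun p => (J p).det) 0 := by
      have hent : ∀ j i, ContinuousAt (fun p => J p j i) 0 := by
        intro j i
        have h0 : (0 : (Fin m → ℂ) × ℝ) ∈ ball (0 : (Fin m → ℂ) × ℝ) R := mem_ball_self hR
        have h0' : (0 : (Fin m → ℂ) × ℝ) ∈ ball (0 : (Fin m → ℂ) × ℝ) r := mem_ball_self H.rpos
        have b1 : ContinuousAt (fderiv ℝ (fun p => (starRingEnd ℂ) (hw p i))) 0 :=
          ((hcw1 i).continuousOn_fderiv_of_isOpen isOpen_ball le_rfl).continuousAt (isOpen_ball.mem_nhds h0)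
        have b2 := (H.graph.smoothdbar (Pi.single j 1)).continuousOn.continuousAt (isOpen_ball.mem_nhds h0')
        have b3 := H.graph.smoothZu.continuousOn.continuousAt (isOpen_ball.mem_nhds h0')
        have b4 := b3.inv₀ (gZu_ne _ (H.graph.hasZ h0').differentiableAt)
        have b1' := fun e => b1.clm_apply (continuousAt_const (y := e))
        exact (((b1' _).add ((b1' _).const_smul I)).const_smul (2⁻¹:ℂ)).sub ((b2.mul b4).smul (b1' _))
      simp only [Matrix.det_apply]
      refine tendsto_finset_sum _ fun s _ => ?_
      exact (tendsto_finset_prod _ fun i _ => hent (s i) i).const_smul _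
    exact hcJ.eventually_ne hJ
  induction L with
  | nil =>
    refine (H.inA_conj hD hR hRr hf).congr ?_
    filter_upwards [ball_mem_nhds _ hR] with p hp
    exact (heq p hp).symm
  | cons i L ih =>
    have hb : ∀ j, InA (fun p => Lb (mphi Φ) (Pi.single j 1) (fun p => thL T L (c p)) p) := fun j => InA.Lb H hR ih (hQ1 L) _
    have hcr : InA (fun p => ((J p).updateCol i (fun j => Lb (mphi Φ) (Pi.single j 1) (fun p => thL T L (c p)) p)).det) := by
      refine InA.det fun a b => ?_
      by_cases hbi : b = i
      · subst hbi; simpa [Matrix.updateCol_apply] using hb a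
      · simpa [Matrix.updateCol_apply, hbi] using hJA a b
    refine (hcr.mul hdinv).congr ?_
    filter_upwards [ball_mem_nhds _ hR, hdet0] with p hp hp0
    rw [cramer_solve (J p) (fun i => thL T (i :: L) (c p)) i hp0]
    congr 3
    ext j
    rw [hstep L p hp]
    simp [Matrix.mulVec, dotProduct, hJd]
end

theorem ift_inA {m : ℕ} {V : Type*} [NormedAddCommGroup V] [NormedSpace ℂ V] [FiniteDimensional ℂ V]
    {T : (Fin m → ℂ) × V → ℂ} {ρ : ℝ} (hρ : 0 < ρ) (hT : DifferentiableOn ℂ T (ball 0 ρ)) {ι : Type*} [Fintype ι]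
    (Λ : ι → List (Fin m)) (hinj : ∀ t : V, (∀ i, fderiv ℂ (thL T (Λ i)) 0 (0, t) = 0) → t = 0)
    {a : (Fin m → ℂ) × ℝ → Fin m → ℂ} {k : (Fin m → ℂ) × ℝ → V} (ha : InA a) (ha0 : a 0 = 0) (hk0 : k 0 = 0)
    (hac : ContinuousAt a 0) (hkc : ContinuousAt k 0) (hQ : ∀ i, InA (fun p => thL T (Λ i) (a p, k p))) : InA k := by
  set Q : (Fin m → ℂ) × V → ι → ℂ := fun x i => thL T (Λ i) x with hQd
  have hQh : DifferentiableOn ℂ Q (ball 0 ρ) := differentiableOn_pi.2 fun i => thL_hol hT (Λ i)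
  have h0 : (0 : (Fin m → ℂ) × V) ∈ ball (0 : (Fin m → ℂ) × V) ρ := mem_ball_self hρ
  have hQ0 : DifferentiableAt ℂ Q 0 := hQh.differentiableAt (isOpen_ball.mem_nhds h0)
  set B : V →L[ℂ] (ι → ℂ) := (fderiv ℂ Q 0) ∘L (ContinuousLinearMap.inr ℂ (Fin m → ℂ) V) with hB
  have hBa : ∀ t i, B t i = fderiv ℂ (thL T (Λ i)) 0 (0, t) := by
    intro t i
    have h2 : HasFDerivAt (thL T (Λ i)) ((ContinuousLinearMap.proj (R := ℂ) i).comp (fderiv ℂ Q 0)) 0 :=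
      hasFDerivAt_pi'.1 hQ0.hasFDerivAt i
    rw [h2.fderiv]; simp [hB]
  have hker : LinearMap.ker B.toLinearMap = ⊥ := by
    rw [LinearMap.ker_eq_bot']
    intro t ht
    refine hinj t fun i => ?_
    rw [← hBa]; exact congrFun ht i
  obtain ⟨P0, hP0⟩ := LinearMap.exists_leftInverse_of_injective B.toLinearMap hker
  set P : (ι → ℂ) →L[ℂ] V := LinearMap.toContinuousLinearMap P0 with hP
  have hPB : ∀ t, P (B t) = t := fun t => DFunLike.congr_fun hP0 t
  set pz : ((Fin m → ℂ) × V) × V →L[ℂ] (Fin m → ℂ) × V :=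
    ((ContinuousLinearMap.fst ℂ (Fin m → ℂ) V) ∘L (ContinuousLinearMap.fst ℂ _ V)).prod (ContinuousLinearMap.snd ℂ _ V) with hpz
  set py : ((Fin m → ℂ) × V) × V →L[ℂ] V :=
    ((ContinuousLinearMap.snd ℂ (Fin m → ℂ) V) ∘L (ContinuousLinearMap.fst ℂ _ V)) with hpy
  set G : ((Fin m → ℂ) × V) × V → V := fun x => P (Q (pz x)) - P (Q 0) - py x with hG
  have hGd : ∀ x, pz x ∈ ball (0 : (Fin m → ℂ) × V) ρ → HasFDerivAt G ((P ∘L (fderiv ℂ Q (pz x) ∘L pz)) - py) x := by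
    intro x hx
    have h1 : HasFDerivAt (fun x => Q (pz x)) (fderiv ℂ Q (pz x) ∘L pz) x :=
      HasFDerivAt.comp (g := Q) x (hQh.differentiableAt (isOpen_ball.mem_nhds hx)).hasFDerivAt pz.hasFDerivAt
    have h2 : HasFDerivAt (fun x => P (Q (pz x))) (P ∘L (fderiv ℂ Q (pz x) ∘L pz)) x :=
      HasFDerivAt.comp (g := P) x P.hasFDerivAt h1
    exact (h2.sub_const (P (Q 0))).fun_sub py.hasFDerivAt
  have hev : ∀ᶠ x in 𝓝 (0 : ((Fin m → ℂ) × V) × V), pz x ∈ ball (0 : (Fin m → ℂ) × V) ρ :=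
    pz.continuous.continuousAt.eventually (by rw [map_zero]; exact isOpen_ball.mem_nhds h0)
  have hG0 := hGd 0 hev.self_of_nhds
  have hGz : G 0 = 0 := by simp [hG]
  have hbij : Function.Bijective fun y => fderiv ℂ G 0 (0, y) := by
    have : (fun y => fderiv ℂ G 0 (0, y)) = id := by
      ext1 y
      rw [hG0.fderiv, map_zero]
      have := hPB y
      simp only [hB] at this
      simpa [hpz, hpy] using this
    rw [this]; exact Function.bijective_id
  obtain ⟨ψ, ψ0, ψd, ψe, -⟩ := hol_implicit (hev.mono fun x hx => (hGd x hx).differentiableAt) hGz hbij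
  have hy : InA (fun p => P (Q (a p, k p)) + (- P (Q 0))) := ((InA.pi hQ).clm P).add (InA.const _)
  have hall := ha.prodMk hy
  have hψ := hall.comp (Ψ := ψ) (by
    have : ((a 0, P (Q (a 0, k 0)) + (- P (Q 0))) : (Fin m → ℂ) × V) = 0 := by
      rw [ha0, hk0, show ((0 : Fin m → ℂ), (0 : V)) = 0 from rfl]; simp
    rw [this]; exact ψd)
  refine hψ.congr ?_
  have hct : Tendsto (fun p => (((a p, P (Q (a p, k p)) + (- P (Q 0))), k p) : ((Fin m → ℂ) × V) × V)) (𝓝 0) (𝓝 0) := by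
    have hq : ContinuousAt (fun p => Q (a p, k p)) 0 := by
      refine ContinuousAt.comp (g := Q) ?_ (hac.prodMk hkc)
      rw [ha0, hk0]; exact hQ0.continuousAt
    have := ((hac.prodMk ((P.continuous.continuousAt.comp hq).add (continuousAt_const (y := - P (Q 0)))))).prodMk hkc
    have h3 := this.tendsto
    have e : (((a 0, P (Q (a 0, k 0)) + (- P (Q 0))), k 0) : ((Fin m → ℂ) × V) × V) = 0 := by
      rw [ha0, hk0, show ((0 : Fin m → ℂ), (0 : V)) = 0 from rfl]; simp
    have h4 := e ▸ h3
    exact h4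
  filter_upwards [hct.eventually ψe] with p hp
  refine hp.1 ?_
  simp only [hG, hpz, hpy, ContinuousLinearMap.prod_apply, ContinuousLinearMap.comp_apply, ContinuousLinearMap.coe_fst', ContinuousLinearMap.coe_snd']
  abel

section
variable {m : ℕ}

theorem summable_half_mdeg : Summable (fun β : Fin m → ℕ => ((1:ℝ)/2) ^ mdeg β) := by
  classical
  refine summable_of_sum_le (c := ∏ i : Fin m, (2:ℝ)) (fun β => by positivity) fun s => ?_
  obtain ⟨N, hN⟩ : ∃ N : ℕ, ∀ β ∈ s, ∀ i, β i < N := by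
    refine ⟨(s.sup fun β => mdeg β) + 1, fun β hβ i => ?_⟩
    have h1 : β i ≤ mdeg β := Finset.single_le_sum (f := β) (fun _ _ => Nat.zero_le _) (Finset.mem_univ i)
    have h2 : mdeg β ≤ s.sup fun β => mdeg β := Finset.le_sup (f := fun β => mdeg β) hβ
    omega
  have hsub : s ⊆ Fintype.piFinset fun _ : Fin m => Finset.range N := by
    intro β hβ
    rw [Fintype.mem_piFinset]
    exact fun i => Finset.mem_range.2 (hN β hβ i)
  refine (Finset.sum_le_sum_of_subset_of_nonneg hsub fun β _ _ => by positivity).trans ?_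
  have : ∀ β : Fin m → ℕ, ((1:ℝ)/2) ^ mdeg β = ∏ i, ((1:ℝ)/2) ^ β i := fun β => by
    rw [mdeg, Finset.prod_pow_eq_pow_sum]
  simp only [this]
  rw [← Finset.prod_univ_sum]
  refine Finset.prod_le_prod (fun i _ => Finset.sum_nonneg fun _ _ => by positivity) fun i _ => ?_
  have h := summable_geometric_two.sum_le_tsum (Finset.range N) (fun i _ => by positivity)
  rwa [tsum_geometric_two] at h

theorem mpow_hol (β : Fin m → ℕ) : Differentiable ℂ (fun w : Fin m → ℂ => mpow w β) := by
  unfold mpow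
  fun_prop

theorem norm_mpow_le {w : Fin m → ℂ} {r : ℝ} (h : ‖w‖ ≤ r) (β : Fin m → ℕ) : ‖mpow w β‖ ≤ r ^ mdeg β := by
  rw [mpow, norm_prod, mdeg, ← Finset.prod_pow_eq_pow_sum]
  refine Finset.prod_le_prod (fun i _ => norm_nonneg _) fun i _ => ?_
  rw [norm_pow]
  exact pow_le_pow_left₀ (norm_nonneg _) ((norm_le_pi_norm w i).trans h) _

def embL (m χ : ℕ) : CS χ →L[ℂ] CS m :=
  LinearMap.toContinuousLinearMap
    { toFun := embedCS m χ
      map_add' := fun x y => by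
        refine Prod.ext (funext fun i => ?_) rfl
        by_cases h : (i : ℕ) < χ <;> simp [embedCS, h]
      map_smul' := fun c x => by
        refine Prod.ext (funext fun i => ?_) rfl
        by_cases h : (i : ℕ) < χ <;> simp [embedCS, h] }

theorem embL_apply {χ : ℕ} (t : CS χ) : embL m χ t = embedCS m χ t := rfl

theorem norm_embedCS_le {χ : ℕ} (t : CS χ) : ‖embedCS m χ t‖ ≤ ‖t‖ := by
  rw [Prod.norm_def]
  refine max_le ?_ (norm_snd_le t)
  refine (pi_norm_le_iff_of_nonneg (norm_nonneg _)).2 fun i => ?_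
  by_cases h : (i : ℕ) < χ
  · simp only [embedCS, h, dif_pos]
    exact (norm_le_pi_norm t.1 _).trans (norm_fst_le t)
  · simp [embedCS, h]

def prL {χ : ℕ} (hχ : χ ≤ m) : CS m →L[ℂ] CS χ :=
  (ContinuousLinearMap.pi fun i => (ContinuousLinearMap.proj (Fin.castLE hχ i)) ∘L (ContinuousLinearMap.fst ℂ (Fin m → ℂ) ℂ)).prod
    (ContinuousLinearMap.snd ℂ (Fin m → ℂ) ℂ)

theorem prL_apply {χ : ℕ} (hχ : χ ≤ m) (t : CS m) : prL hχ t = (fun i => t.1 (Fin.castLE hχ i), t.2) := rfl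

def TT (Θ : (Fin m → ℕ) → CS m → ℂ) (χ : ℕ) (x : (Fin m → ℂ) × CS χ) : ℂ := ThetaSum Θ x.1 (embedCS m χ x.2)

theorem TT_eq {Θ : (Fin m → ℕ) → CS m → ℂ} {χ : ℕ} (hχ : χ ≤ m) (hnf : NormalFormSeries χ Θ) (ζ : Fin m → ℂ) (t : CS m) :
    ThetaSum Θ ζ t = TT Θ χ (ζ, prL hχ t) := by
  unfold TT ThetaSum
  refine tsum_congr fun β => ?_
  rw [hnf.2 β t (embedCS m χ (prL hχ t)) ?_ rfl]
  intro i hi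
  simp [embedCS, hi, prL_apply]

theorem TT_hol {d : DefData m} {M' : Set (CS m)} (hd : d.IsDefiningSeriesOf M') (χ : ℕ) :
    DifferentiableOn ℂ (TT d.Θ χ) (ball 0 d.r) := by
  obtain ⟨hr, hC, hΘ, hb, h0, -⟩ := hd
  have hmem : ∀ x ∈ ball (0 : (Fin m → ℂ) × CS χ) d.r, ‖x.1‖ ≤ d.r ∧ embedCS m χ x.2 ∈ ball (0 : CS m) (2 * d.r) := by
    intro x hx
    have hx1 := mem_ball_zero_iff.1 hx
    refine ⟨(norm_fst_le x).trans hx1.le, mem_ball_zero_iff.2 ?_⟩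
    have := (norm_embedCS_le (m := m) x.2).trans (norm_snd_le x)
    linarith
  refine hol_tsum isOpen_ball (u := fun β => d.C * ((1:ℝ)/2) ^ mdeg β) (summable_half_mdeg.mul_left _) (fun β => ?_) (fun β x hx => ?_)
  · refine DifferentiableOn.mul ((mpow_hol β).comp differentiable_fst).differentiableOn ?_
    refine (hΘ β).comp (((embL m χ).differentiable.comp differentiable_snd).differentiableOn) ?_
    intro x hx
    exact (hmem x hx).2
  · obtain ⟨h1, h2⟩ := hmem x hx
    rw [norm_mul]
    refine (mul_le_mul (norm_mpow_le h1 β) (hb β _ h2) (norm_nonneg _) (by positivity)).trans (le_of_eq ?_)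
    rw [mul_pow, div_pow, one_pow]
    have := pow_pos hr (mdeg β)
    field_simp

theorem ThetaSum_zero {d : DefData m} {M' : Set (CS m)} (hd : d.IsDefiningSeriesOf M') : ThetaSum d.Θ 0 0 = 0 := by
  unfold ThetaSum
  have : ∀ β : Fin m → ℕ, mpow 0 β * d.Θ β 0 = 0 := by
    intro β
    by_cases h : β = 0
    · subst h; rw [hd.2.2.2.2.1, mul_zero]
    · obtain ⟨i, hi⟩ := Function.ne_iff.1 h
      have : mpow (0 : Fin m → ℂ) β = 0 := Finset.prod_eq_zero (Finset.mem_univ i) (by simpa using hi)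
      rw [this, zero_mul]
  simp [this]

theorem TT_zero {d : DefData m} {M' : Set (CS m)} (hd : d.IsDefiningSeriesOf M') (χ : ℕ) : TT d.Θ χ 0 = 0 := by
  have : embedCS m χ 0 = 0 := map_zero (embL m χ)
  simp only [TT, Prod.fst_zero, Prod.snd_zero, this]
  exact ThetaSum_zero hd

theorem ThetaBar_eq (Θ : (Fin m → ℕ) → CS m → ℂ) (w : Fin m → ℂ) (τ : CS m) :
    ThetaBar Θ w τ = (starRingEnd ℂ) (ThetaSum Θ (conjW w) (conjCS τ)) := by
  unfold ThetaBar ThetaSum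
  rw [Complex.conj_tsum]
  refine tsum_congr fun β => ?_
  rw [map_mul]
  congr 1
  simp [mpow, conjW]

theorem pderivList_conj {V : Type*} [NormedAddCommGroup V] [NormedSpace ℂ V] [FiniteDimensional ℂ V]
    {T : (Fin m → ℂ) × V → ℂ} {ρ : ℝ} (hT : DifferentiableOn ℂ T (ball 0 ρ)) {t : V} (ht : ‖t‖ < ρ) (L : List (Fin m)) :
    ∀ s : CS m, ‖s.1‖ < ρ → pderivList L (fun s : CS m => s.2 - (starRingEnd ℂ) (T (conjW s.1, t))) s =
      (if L = [] then s.2 else 0) - (starRingEnd ℂ) (thL T L (conjW s.1, t)) := by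
  induction L with
  | nil => intro s hs; simp [pderivList, thL]
  | cons i L ih =>
    intro s hs
    have hop : IsOpen {s : CS m | ‖s.1‖ < ρ} := isOpen_lt (by fun_prop) continuous_const
    have hmem : (conjW s.1, t) ∈ ball (0 : (Fin m → ℂ) × V) ρ := by
      rw [mem_ball_zero_iff, Prod.norm_def, norm_conjW]; exact max_lt hs ht
    have hθ : DifferentiableAt ℂ (thL T L) (conjW s.1, t) := (thL_hol hT L).differentiableAt (isOpen_ball.mem_nhds hmem)
    set c : CS m →L[ℝ] (Fin m → ℂ) × V := ((cW m).comp (ContinuousLinearMap.fst ℝ _ _)).prod 0 with hc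
    have h1 : HasFDerivAt (fun s : CS m => ((conjW s.1, t) : (Fin m → ℂ) × V)) c s := by
      have := c.hasFDerivAt (x := s) |>.add_const ((0 : Fin m → ℂ), t)
      refine this.congr_of_eventuallyEq (Eventually.of_forall fun x => ?_)
      simp [hc, cW_apply]
    have h2 : HasFDerivAt (fun s : CS m => (starRingEnd ℂ) (thL T L (conjW s.1, t)))
        (cC ∘L (((fderiv ℂ (thL T L) (conjW s.1, t)).restrictScalars ℝ) ∘L c)) s :=
      HasFDerivAt.comp (g := fun z : ℂ => (starRingEnd ℂ) z) s cC.hasFDerivAt (HasFDerivAt.comp (g := thL T L) s (hθ.hasFDerivAt.restrictScalars ℝ) h1)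
    have h3 : DifferentiableAt ℂ (fun s : CS m => (starRingEnd ℂ) (thL T L (conjW s.1, t))) s := by
      refine differentiableAt_complex_of_real h2.differentiableAt fun v => ?_
      rw [h2.fderiv]
      have : c (I • v) = (-I) • c v := by
        simp [hc, cW_I]
      simp [this, cC_apply]
    have h4 : fderiv ℂ (fun s : CS m => (starRingEnd ℂ) (thL T L (conjW s.1, t))) s (Pi.single i 1, 0) =
        (starRingEnd ℂ) (thL T (i :: L) (conjW s.1, t)) := by
      have e := (h3.hasFDerivAt.restrictScalars ℝ).unique h2
      have e2 := DFunLike.congr_fun e (Pi.single i 1, 0)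
      refine e2.trans ?_
      have : conjW (Pi.single i 1 : Fin m → ℂ) = Pi.single i 1 := by
        ext j; by_cases hj : j = i
        · subst hj; simp [conjW]
        · simp [conjW, hj]
      simp [hc, cW_apply, this, cC_apply, thL]
    have h5 : HasFDerivAt (fun s : CS m => (if L = [] then s.2 else 0 : ℂ)) (if L = [] then ContinuousLinearMap.snd ℂ _ _ else 0 : CS m →L[ℂ] ℂ) s := by
      by_cases hL : L = []
      · simp only [hL, if_true]; exact hasFDerivAt_snd
      · simp only [hL, if_false]; exact hasFDerivAt_const _ _
    have h6 : pderivList L (fun s : CS m => s.2 - (starRingEnd ℂ) (T (conjW s.1, t))) =ᶠ[𝓝 s]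
        fun s => (if L = [] then s.2 else 0) - (starRingEnd ℂ) (thL T L (conjW s.1, t)) := by
      filter_upwards [hop.mem_nhds hs] with x hx using ih x hx
    simp only [pderivList, pderivW]
    rw [h6.fderiv_eq, (h5.fun_sub h3.hasFDerivAt).fderiv, ContinuousLinearMap.sub_apply, h4]
    by_cases hL : L = [] <;> simp [hL]
end

section
variable {m : ℕ}

theorem ThetaSum_indep {Θ : (Fin m → ℕ) → CS m → ℂ} {χ : ℕ} (hnf : NormalFormSeries χ Θ) {ζ ζ' : Fin m → ℂ}
    (h : ∀ i : Fin m, (i : ℕ) < χ → ζ i = ζ' i) (t : CS m) : ThetaSum Θ ζ t = ThetaSum Θ ζ' t := by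
  unfold ThetaSum
  refine tsum_congr fun β => ?_
  by_cases hβ : ∃ i : Fin m, χ ≤ (i : ℕ) ∧ β i ≠ 0
  · rw [hnf.1 β hβ]; simp
  · push Not at hβ
    congr 1
    unfold mpow
    refine Finset.prod_congr rfl fun i _ => ?_
    by_cases hi : (i : ℕ) < χ
    · rw [h i hi]
    · rw [hβ i (not_lt.1 hi)]; simp

theorem ThetaBar_indep {Θ : (Fin m → ℕ) → CS m → ℂ} {χ : ℕ} (hnf : NormalFormSeries χ Θ) (w : Fin m → ℂ) {τ τ' : CS m}
    (h : ∀ i : Fin m, (i : ℕ) < χ → τ.1 i = τ'.1 i) (h2 : τ.2 = τ'.2) : ThetaBar Θ w τ = ThetaBar Θ w τ' := by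
  unfold ThetaBar
  refine tsum_congr fun β => ?_
  rw [hnf.2 β (conjCS τ) (conjCS τ') (fun i hi => by simp [conjCS, h i hi]) (by simp [conjCS, h2])]

/-- linear algebra: rank count -/
theorem rank_ker {χ : ℕ} (hχ : χ ≤ m) {Y : Type*} [AddCommGroup Y] [Module ℂ Y] [FiniteDimensional ℂ Y]
    (A : CS m × (Fin m → ℂ) →ₗ[ℂ] Y) (hr : Module.finrank ℂ (LinearMap.range A) = m + 1 + χ)
    (hk : ∀ ζ : Fin m → ℂ, (∀ i : Fin m, (i : ℕ) < χ → ζ i = 0) → A (0, ζ) = 0)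
    {ζ : Fin m → ℂ} (hz : A (0, ζ) = 0) : ∀ i : Fin m, (i : ℕ) < χ → ζ i = 0 := by
  let e : (Fin χ → ℂ) →ₗ[ℂ] (Fin m → ℂ) :=
    { toFun := fun x i => if h : (i : ℕ) < χ then x ⟨i, h⟩ else 0
      map_add' := fun x y => by
        ext i; by_cases h : (i : ℕ) < χ <;> simp [h]
      map_smul' := fun c x => by
        ext i; by_cases h : (i : ℕ) < χ <;> simp [h] }
  let E : CS m × (Fin χ → ℂ) →ₗ[ℂ] CS m × (Fin m → ℂ) := LinearMap.prodMap LinearMap.id e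
  have hfac : ∀ x : CS m × (Fin m → ℂ), A x = (A ∘ₗ E) (x.1, fun i => x.2 (Fin.castLE hχ i)) := by
    intro x
    have h1 := hk (x.2 - e (fun i => x.2 (Fin.castLE hχ i))) (fun i hi => by simp [e, hi])
    have h2 : x = E (x.1, fun i => x.2 (Fin.castLE hχ i)) + (0, x.2 - e (fun i => x.2 (Fin.castLE hχ i))) := by
      simp [E]
    conv_lhs => rw [h2, map_add, h1, add_zero]
    rfl
  have hle : LinearMap.range A ≤ LinearMap.range (A ∘ₗ E) := by
    rintro _ ⟨x, rfl⟩
    exact ⟨_, (hfac x).symm⟩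
  have h1 := Submodule.finrank_mono hle
  have h2 := LinearMap.finrank_range_add_finrank_ker (A ∘ₗ E)
  have h3 : Module.finrank ℂ (CS m × (Fin χ → ℂ)) = m + 1 + χ := by simp
  have h4 : Module.finrank ℂ (LinearMap.ker (A ∘ₗ E)) = 0 := by omega
  have h5 := Submodule.finrank_eq_zero.1 h4
  rw [hfac] at hz
  have h6 := LinearMap.ker_eq_bot'.1 h5 _ hz
  intro i hi
  have := congrFun (congrArg Prod.snd h6) ⟨i, hi⟩
  exact this

theorem segre_ker {d : DefData m} {M' : Set (CS m)} (hd : d.IsDefiningSeriesOf M') {χ : ℕ} (hχ : χ ≤ m)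
    (hnf : NormalFormSeries χ d.Θ) {k : ℕ} (hrk : mapRankAt (segreJetMap d.Θ k) 0 = m + 1 + χ) {w : Fin m → ℂ}
    (hw : ∀ β : Fin m → Fin (k + 1), mdeg (fun i => (β i : ℕ)) ≤ k →
      fderiv ℂ (thL (TT d.Θ χ) (indexList fun i => (β i : ℕ))) 0
        (0, prL hχ (w, (starRingEnd ℂ) (fderiv ℂ (TT d.Θ χ) 0 (conjW w, 0)))) = 0) :
    ∀ i : Fin m, (i : ℕ) < χ → w i = 0 := by
  have hrp : 0 < d.r := hd.1
  set S := segreJetMap d.Θ k with hS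
  have hSd : DifferentiableAt ℂ S 0 := by
    by_contra hn
    rw [mapRankAt, fderiv_zero_of_not_differentiableAt hn] at hrk
    have e : LinearMap.range ((0 : CS m × (Fin m → ℂ) →L[ℂ] CS m × ((Fin m → Fin (k + 1)) → ℂ)).toLinearMap) = ⊥ :=
      LinearMap.range_zero
    rw [e, finrank_bot] at hrk
    omega
  have hline : ∀ ζ : Fin m → ℂ, HasDerivAt (fun s : ℝ => S (0, (s : ℂ) • ζ)) (fderiv ℂ S 0 (0, ζ)) 0 := by
    intro ζ
    have h1 : HasDerivAt (fun s : ℝ => ((0, (s : ℂ) • ζ) : CS m × (Fin m → ℂ))) (0, ζ) 0 := by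
      have : HasDerivAt (fun s : ℝ => (s : ℂ) • ζ) ζ 0 := by
        simpa using (Complex.ofRealCLM.hasDerivAt (x := (0:ℝ))).smul_const ζ
      exact (hasDerivAt_const (0:ℝ) (0 : CS m)).prodMk this
    have h2 : HasFDerivAt S ((fderiv ℂ S 0).restrictScalars ℝ) ((fun s : ℝ => ((0, (s : ℂ) • ζ) : CS m × (Fin m → ℂ))) 0) := by
      have e : (fun s : ℝ => ((0, (s : ℂ) • ζ) : CS m × (Fin m → ℂ))) 0 = 0 := by
        simp only [Complex.ofReal_zero, zero_smul]; rfl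
      rw [e]
      exact hSd.hasFDerivAt.restrictScalars ℝ
    exact h2.comp_hasDerivAt (0:ℝ) h1
  have hk0 : ∀ ζ : Fin m → ℂ, (∀ i : Fin m, (i : ℕ) < χ → ζ i = 0) → (fderiv ℂ S 0).toLinearMap (0, ζ) = 0 := by
    intro ζ hζ
    have hc : (fun s : ℝ => S (0, (s : ℂ) • ζ)) = fun _ => S (0, 0) := by
      ext1 s
      have hz : ∀ i : Fin m, (i : ℕ) < χ → ((s : ℂ) • ζ) i = (0 : Fin m → ℂ) i := fun i hi => by simp [hζ i hi]
      simp only [hS, segreJetMap]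
      refine Prod.ext rfl (funext fun β => ?_)
      have e : ∀ x : Fin m → ℂ, ThetaBar d.Θ x ((s : ℂ) • ζ, ThetaSum d.Θ ((s : ℂ) • ζ) 0) = ThetaBar d.Θ x (0, ThetaSum d.Θ 0 0) :=
        fun x => ThetaBar_indep hnf x (fun i hi => hz i hi) (ThetaSum_indep hnf hz 0)
      simp only [e]
    have h1 := hline ζ
    rw [hc] at h1
    exact h1.unique (hasDerivAt_const _ _)
  have hzero : (fderiv ℂ S 0).toLinearMap (0, conjW w) = 0 := by
    set DS := fderiv ℂ S 0 (0, conjW w) with hDS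
    have h1 := hline (conjW w)
    change DS = 0
    refine Prod.ext ?_ (funext fun β => ?_)
    · have h2 : HasDerivAt (fun s : ℝ => (S (0, (s : ℂ) • conjW w)).1) DS.1 0 := h1.fst
      have h3 : (fun s : ℝ => (S (0, (s : ℂ) • conjW w)).1) = fun _ => 0 := rfl
      rw [h3] at h2
      exact h2.unique (hasDerivAt_const _ _)
    · have h2 : HasDerivAt (fun s : ℝ => (S (0, (s : ℂ) • conjW w)).2 β) (DS.2 β) 0 := hasDerivAt_pi.1 h1.snd β
      by_cases hβ : mdeg (fun i => (β i : ℕ)) ≤ k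
      swap
      · have h3 : (fun s : ℝ => (S (0, (s : ℂ) • conjW w)).2 β) = fun _ => 0 := by
          ext1 s; simp [hS, segreJetMap, hβ]
        rw [h3] at h2
        exact h2.unique (hasDerivAt_const _ _)
      have hT := TT_hol hd χ
      set L := indexList fun i => (β i : ℕ) with hL
      -- the curve
      set c : ℝ → CS χ := fun s => prL hχ (conjCS ((s : ℂ) • conjW w, TT d.Θ χ ((s : ℂ) • conjW w, 0))) with hc
      have hmem0 : ball (0 : (Fin m → ℂ) × CS χ) d.r ∈ 𝓝 (0 : (Fin m → ℂ) × CS χ) := ball_mem_nhds _ hrp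
      have hT0 : HasFDerivAt (TT d.Θ χ) (fderiv ℂ (TT d.Θ χ) 0) 0 := (hT.differentiableAt hmem0).hasFDerivAt
      have hsm : HasDerivAt (fun s : ℝ => (s : ℂ) • conjW w) (conjW w) 0 := by
        simpa using (Complex.ofRealCLM.hasDerivAt (x := (0:ℝ))).smul_const (conjW w)
      have hTl : HasDerivAt (fun s : ℝ => TT d.Θ χ ((s : ℂ) • conjW w, 0)) (fderiv ℂ (TT d.Θ χ) 0 (conjW w, 0)) 0 := by
        have a1 : HasDerivAt (fun s : ℝ => (((s : ℂ) • conjW w, 0) : (Fin m → ℂ) × CS χ)) (conjW w, 0) 0 :=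
          hsm.prodMk (hasDerivAt_const _ _)
        have a2 : HasFDerivAt (TT d.Θ χ) ((fderiv ℂ (TT d.Θ χ) 0).restrictScalars ℝ)
            ((fun s : ℝ => (((s : ℂ) • conjW w, 0) : (Fin m → ℂ) × CS χ)) 0) := by
          have e : (fun s : ℝ => (((s : ℂ) • conjW w, 0) : (Fin m → ℂ) × CS χ)) 0 = 0 := by
            simp only [Complex.ofReal_zero, zero_smul]; rfl
          rw [e]
          exact hT0.restrictScalars ℝ
        exact a2.comp_hasDerivAt (0:ℝ) a1
      have hcd : HasDerivAt c (prL hχ (w, (starRingEnd ℂ) (fderiv ℂ (TT d.Θ χ) 0 (conjW w, 0)))) 0 := by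
        have a1 := hsm.prodMk hTl
        have a2 := (((prL hχ).restrictScalars ℝ) ∘L (cCS m)).hasFDerivAt.comp_hasDerivAt (0:ℝ) a1
        simpa [cCS_apply, conjCS, Function.comp_def, hc] using a2
      have hc0 : c 0 = 0 := by
        have := TT_zero hd χ
        simp only [hc, Complex.ofReal_zero, zero_smul, show ((0 : Fin m → ℂ), (0 : CS χ)) = 0 from rfl, this,
          show ((0 : Fin m → ℂ), (0 : ℂ)) = 0 from rfl, conjCS_zero, map_zero]
      have hθ : HasDerivAt (fun s : ℝ => thL (TT d.Θ χ) L (0, c s)) 0 0 := by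
        have a1 : HasDerivAt (fun s : ℝ => (((0 : Fin m → ℂ), c s) : (Fin m → ℂ) × CS χ)) _ 0 :=
          (hasDerivAt_const (0:ℝ) (0 : Fin m → ℂ)).prodMk hcd
        have a2 : HasFDerivAt (thL (TT d.Θ χ) L) ((fderiv ℂ (thL (TT d.Θ χ) L) 0).restrictScalars ℝ)
            ((fun s : ℝ => (((0 : Fin m → ℂ), c s) : (Fin m → ℂ) × CS χ)) 0) := by
          have := ((thL_hol hT L).differentiableAt hmem0).hasFDerivAt.restrictScalars ℝ
          have e : (fun s : ℝ => (((0 : Fin m → ℂ), c s) : (Fin m → ℂ) × CS χ)) 0 = 0 := by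
            simp only [hc0]; rfl
          rw [e]
          exact this
        have a3 := a2.comp_hasDerivAt (0:ℝ) a1
        have a4 := hw β hβ
        rw [ContinuousLinearMap.coe_restrictScalars', a4] at a3
        exact a3
      have hθ2 : HasDerivAt (fun s : ℝ => - (starRingEnd ℂ) (thL (TT d.Θ χ) L (0, c s))) 0 0 := by
        have := (cC.hasFDerivAt.comp_hasDerivAt (0:ℝ) hθ).fun_neg
        simpa [cC_apply, Function.comp_def] using this
      refine h2.unique (hθ2.congr_of_eventuallyEq ?_)
      have hcc : ∀ᶠ s in 𝓝 (0:ℝ), ‖c s‖ < d.r := by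
        have := hcd.continuousAt.norm
        refine this.eventually_lt continuousAt_const ?_
        rw [hc0]; simpa using hrp
      filter_upwards [hcc] with s hs
      have e1 : ∀ x : CS m, ThetaBar d.Θ x.1 ((s : ℂ) • conjW w, ThetaSum d.Θ ((s : ℂ) • conjW w) 0) =
          (starRingEnd ℂ) (TT d.Θ χ (conjW x.1, c s)) := by
        intro x
        rw [ThetaBar_eq, TT_eq hχ hnf, TT_eq hχ hnf _ 0, map_zero]
      have e2 := pderivList_conj hT hs L 0 (by simpa using hrp)
      simp only [hS, segreJetMap, hβ, if_true, pderivMulti, e1]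
      rw [e2]
      simp
  intro i hi
  have := rank_ker hχ (fderiv ℂ S 0).toLinearMap hrk hk0 hzero i hi
  simpa using this
end

section
variable {m : ℕ} {M M' : Set (CS m)} {q : CS m} {Φ : (Fin m → ℂ) × (Fin m → ℂ) × ℂ → ℂ} {κ σ : CS m → CS m} {r R : ℝ}

/-- abstract linear algebra at the reference point -/
theorem linalg_at0 (D : (Fin m → ℂ) × ℝ →L[ℝ] CS m) (hinj : ∀ X, D X = 0 → X = 0)
    (hI : ∀ v, D (I • v, 0) = I • D (v, 0)) (B : (Fin m → ℂ) →L[ℂ] ℂ) (A : CS m →L[ℂ] ℂ)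
    (hrel : ∀ X, (starRingEnd ℂ) (D X).2 = B (conjW (D X).1) + A (D X)) :
    (∀ v, (D (v, 0)).1 = 0 → v = 0) ∧ (∀ y : CS m, A y = 0 → y.2 = (starRingEnd ℂ) (B (conjW y.1))) := by
  have hC : ∀ v, (starRingEnd ℂ) (D (v, 0)).2 = B (conjW (D (v, 0)).1) ∧ A (D (v, 0)) = 0 := by
    intro v
    have h1 := hrel (v, 0)
    have h2 := hrel (I • v, 0)
    rw [hI] at h2
    simp only [Prod.smul_fst, Prod.smul_snd, conjW_smul, map_smul, smul_eq_mul, map_mul, Complex.conj_I] at h2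
    have h3 : A (D (v, 0)) = 0 := by
      have : (2 * I) * A (D (v, 0)) = 0 := by linear_combination (-I) * h1 - h2
      simpa using this
    exact ⟨by rw [h1, h3, add_zero], h3⟩
  have h1 : ∀ v, (D (v, 0)).1 = 0 → v = 0 := by
    intro v hv
    have h2 := (hC v).1
    rw [hv, conjW_zero, map_zero] at h2
    have h3 : D (v, 0) = 0 := Prod.ext hv (by simpa using h2)
    exact congrArg Prod.fst (hinj _ h3)
  refine ⟨h1, ?_⟩
  let Q : (Fin m → ℂ) →ₗ[ℝ] (Fin m → ℂ) :=
    (LinearMap.fst ℝ (Fin m → ℂ) ℂ) ∘ₗ D.toLinearMap ∘ₗ (LinearMap.inl ℝ (Fin m → ℂ) ℝ)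
  have hQ : ∀ v, Q v = (D (v, 0)).1 := fun v => rfl
  have hQs : Function.Surjective Q := by
    rw [← LinearMap.injective_iff_surjective, injective_iff_map_eq_zero]
    exact fun v hv => h1 v hv
  have hA : ∀ y : CS m, ∃ v, (D (v, 0)).1 = y.1 ∧ (D (v, 0)).2 = (starRingEnd ℂ) (B (conjW y.1)) ∧
      A y = (y.2 - (D (v, 0)).2) * A (0, 1) := by
    intro y
    obtain ⟨v, hv⟩ := hQs y.1
    rw [hQ] at hv
    refine ⟨v, hv, ?_, ?_⟩
    · have := (hC v).1
      rw [hv] at this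
      rw [← this, Complex.conj_conj]
    · have e : y = D (v, 0) + (y.2 - (D (v, 0)).2) • ((0 : Fin m → ℂ), (1 : ℂ)) := by
        refine Prod.ext ?_ ?_
        · simp [hv]
        · simp
      conv_lhs => rw [e, map_add, (hC v).2, map_smul, zero_add, smul_eq_mul]
  have hc : A (0, 1) ≠ 0 := by
    intro hc
    obtain ⟨v, e1, e2, e3⟩ := hA (D (0, 1))
    rw [hc, mul_zero] at e3
    have h2 := hrel (0, 1)
    rw [e3, add_zero] at h2
    have h3 : D (v, 0) = D (0, 1) := by
      refine Prod.ext e1 ?_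
      rw [e2, ← h2, Complex.conj_conj]
    have h4 : D ((v, 0) - (0, 1)) = 0 := by rw [map_sub, h3, sub_self]
    have h5 := congrArg Prod.snd (hinj _ h4)
    simp at h5
  intro y hy
  obtain ⟨v, e1, e2, e3⟩ := hA y
  rw [hy] at e3
  have := (mul_eq_zero.1 e3.symm).resolve_right hc
  rw [← e2]; exact sub_eq_zero.1 this

theorem IsModel.hasZ0 (H : IsModel M q Φ κ σ r) :
    HasFDerivAt (gZ (mphi Φ)) (Complex.ofRealCLM ∘L (ContinuousLinearMap.snd ℝ (Fin m → ℂ) ℝ)) 0 := by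
  have h1 : HasFDerivAt Φ ((fderiv ℂ Φ 0).restrictScalars ℝ) (iotaR m 0) := by
    rw [map_zero]
    exact (H.hol.differentiableAt (ball_mem_nhds _ H.rpos)).hasFDerivAt.restrictScalars ℝ
  have h2 : HasFDerivAt (fun p => Φ (iotaR m p)) _ 0 := HasFDerivAt.comp (g := Φ) 0 h1 (iotaR m).hasFDerivAt
  have h3 : HasFDerivAt (fun p => (Φ (iotaR m p)).re) _ 0 := HasFDerivAt.comp (g := fun z : ℂ => z.re) 0 Complex.reCLM.hasFDerivAt h2
  rw [H.dzero] at h3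
  have h4 : HasFDerivAt (mphi Φ) (0 : (Fin m → ℂ) × ℝ →L[ℝ] ℝ) 0 := by
    have e : (fun p => (Φ (iotaR m p)).re) = mphi Φ := by ext p; simp [mphi, iotaR_apply]
    rw [e] at h3
    refine h3.congr_fderiv ?_
    ext <;> simp
  have h5 : HasFDerivAt (fun p => (mphi Φ p : ℂ)) (Complex.ofRealCLM ∘L (0 : (Fin m → ℂ) × ℝ →L[ℝ] ℝ)) 0 :=
    HasFDerivAt.comp (g := fun x : ℝ => (x : ℂ)) 0 Complex.ofRealCLM.hasFDerivAt h4
  have h6 := (Complex.ofRealCLM ∘L (ContinuousLinearMap.snd ℝ (Fin m → ℂ) ℝ)).hasFDerivAt (x := 0) |>.fun_add (h5.const_mul I)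
  refine HasFDerivAt.congr_fderiv (f := gZ (mphi Φ)) h6 ?_
  ext <;> simp

theorem IsModel.Lb0 {E : Type*} [NormedAddCommGroup E] [NormedSpace ℂ E] (H : IsModel M q Φ κ σ r) (v) (Q : (Fin m → ℂ) × ℝ → E) :
    Lb (mphi Φ) v Q 0 = (2 : ℂ)⁻¹ • (fderiv ℝ Q 0 (v, 0) + I • fderiv ℝ Q 0 (I • v, 0)) := by
  have : dbarW (gZ (mphi Φ)) 0 v = 0 := by
    simp [dbarW, H.hasZ0.fderiv]
  simp [Lb, this]

theorem IsModel.gam0 (H : IsModel M q Φ κ σ r) : gam (mphi Φ) 0 = 0 := by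
  have : gZ (mphi Φ) 0 = 0 := by simp [gZ, H.graph.zero]
  refine Prod.ext rfl this

/-- local CR components of the map in graph coordinates -/
theorem IsModel.comp_cr (H : IsModel M q Φ κ σ r) (hq : q ∈ M) {f : CS m → ℂ} (hf : IsCRFunctionOn (1 : ℕ∞) M f) :
    ∃ R > 0, IsCRg (mphi Φ) R (fun p => f (κ (gam (mphi Φ) p))) := by
  obtain ⟨U, g, hU, hqU, hg, hgf, hcr⟩ := hf q hq
  have hr := H.rpos
  have h0 : (0 : (Fin m → ℂ) × ℝ) ∈ ball (0 : (Fin m → ℂ) × ℝ) (r / 2) := mem_ball_self (by linarith)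
  have hc : ContinuousAt (fun p => κ (gam (mphi Φ) p)) 0 := (H.hasκg h0).continuousAt
  have hUn : U ∈ 𝓝 (κ (gam (mphi Φ) 0)) := by rw [H.gam0, H.κ0]; exact hU.mem_nhds hqU
  obtain ⟨R, hR, hRs⟩ := Metric.mem_nhds_iff.1 (Filter.inter_mem (hc hUn) (isOpen_ball.mem_nhds h0))
  have hRU : ∀ p ∈ ball (0 : (Fin m → ℂ) × ℝ) (min R (r/2)), κ (gam (mphi Φ) p) ∈ U := fun p hp =>
    (hRs (ball_subset_ball (min_le_left _ _) hp)).1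
  have hcg := H.isCRg hU (by exact_mod_cast hg) hcr (min_le_right R (r/2)) hRU
  have heq : ∀ p ∈ ball (0 : (Fin m → ℂ) × ℝ) (min R (r/2)), f (κ (gam (mphi Φ) p)) = g (κ (gam (mphi Φ) p)) := fun p hp =>
    (hgf _ ⟨H.gam_in (ball_subset_ball (min_le_right _ _) hp), hRU p hp⟩).symm
  refine ⟨min R (r/2), lt_min hR (by linarith), hcg.smooth.congr heq, fun p hp v => ?_⟩
  have he : (fun p => f (κ (gam (mphi Φ) p))) =ᶠ[𝓝 p] fun p => g (κ (gam (mphi Φ) p)) := by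
    filter_upwards [isOpen_ball.mem_nhds hp] with x hx using heq x hx
  have := hcg.cr p hp v
  simp only [dbarW] at this ⊢
  rw [he.fderiv_eq]; exact this

theorem cr_of_comp {φ : (Fin m → ℂ) × ℝ → ℝ} (G : GraphData φ R) {k : (Fin m → ℂ) × ℝ → CS m}
    (h1 : ∀ i, IsCRg φ R (fun p => (k p).1 i)) (h2 : IsCRg φ R (fun p => (k p).2)) :
    ContDiffOn ℝ 1 k (ball 0 R) ∧ ∀ p ∈ ball 0 R, ∀ v, Lb φ v k p = 0 := by
  have hs : ContDiffOn ℝ 1 k (ball 0 R) := by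
    have e1 : ContDiffOn ℝ 1 (fun p => (k p).1) (ball 0 R) := contDiffOn_pi.2 fun i => (h1 i).smooth
    exact e1.prodMk h2.smooth
  refine ⟨hs, fun p hp v => ?_⟩
  have hd := (hasFDerivAt_of_C1 hs isOpen_ball hp).differentiableAt
  have e1 : ∀ i, (Lb φ v k p).1 i = 0 := by
    intro i
    let ℓ : CS m →L[ℂ] ℂ := (ContinuousLinearMap.proj i) ∘L (ContinuousLinearMap.fst ℂ (Fin m → ℂ) ℂ)
    have e := Lb_clm (φ := φ) (v := v) ℓ hd
    have e' : ℓ (Lb φ v k p) = (Lb φ v k p).1 i := rfl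
    have e'' : (fun x => ℓ (k x)) = fun x => (k x).1 i := rfl
    rw [← e', ← e, e'']
    exact (h1 i).Lb_zero G hp v
  have e2 : (Lb φ v k p).2 = 0 := by
    let ℓ : CS m →L[ℂ] ℂ := ContinuousLinearMap.snd ℂ (Fin m → ℂ) ℂ
    have e := Lb_clm (φ := φ) (v := v) ℓ hd
    have e' : ℓ (Lb φ v k p) = (Lb φ v k p).2 := rfl
    have e'' : (fun x => ℓ (k x)) = fun x => (k x).2 := rfl
    rw [← e', ← e, e'']
    exact h2.Lb_zero G hp v
  exact Prod.ext (funext e1) e2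

theorem IsModel.map_cr (H : IsModel M q Φ κ σ r) (hq : q ∈ M) {h : CS m → CS m} (hh : IsCRMapOn (1 : ℕ∞) M M' h) :
    ∃ R > 0, R ≤ r / 2 ∧ (∀ i, IsCRg (mphi Φ) R (fun p => (h (κ (gam (mphi Φ) p))).1 i)) ∧
      IsCRg (mphi Φ) R (fun p => (h (κ (gam (mphi Φ) p))).2) := by
  have hr := H.rpos
  choose a ha hac using fun i : Fin m => H.comp_cr hq (hh.2 ((ContinuousLinearMap.proj i) ∘L (ContinuousLinearMap.fst ℂ (Fin m → ℂ) ℂ)))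
  obtain ⟨b, hb, hbc⟩ := H.comp_cr hq (hh.2 (ContinuousLinearMap.snd ℂ (Fin m → ℂ) ℂ))
  have hev : ∀ᶠ R in 𝓝[>] (0:ℝ), (∀ i, R ≤ a i) ∧ R ≤ b ∧ R ≤ r / 2 ∧ 0 < R := by
    have aux : ∀ c > (0:ℝ), ∀ᶠ R in 𝓝[>] (0:ℝ), R ≤ c := fun c hc =>
      Filter.mem_of_superset (Ioc_mem_nhdsGT hc) (fun x hx => hx.2)
    refine (Filter.eventually_all.2 fun i => aux _ (ha i)).and ((aux _ hb).and ((aux _ (by linarith)).and ?_))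
    exact self_mem_nhdsWithin
  obtain ⟨R, h1, h2, h3, h4⟩ := hev.exists
  exact ⟨R, h4, h3, fun i => (hac i).mono (h1 i), hbc.mono h2⟩

theorem IsModel.D_inj (H : IsModel M q Φ κ σ r) (hq : q ∈ M) {h g : CS m → CS m} (hg : IsCRMapOn (1 : ℕ∞) M' M g)
    (hh : MapsTo h M M') (hgh : ∀ z ∈ M, g (h z) = z) (hq' : h q = 0) {D : (Fin m → ℂ) × ℝ →L[ℝ] CS m}
    (hD : HasFDerivAt (fun p => h (κ (gam (mphi Φ) p))) D 0) {X} (hX : D X = 0) : X = 0 := by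
  have hr := H.rpos
  have h0 : (0 : (Fin m → ℂ) × ℝ) ∈ ball (0 : (Fin m → ℂ) × ℝ) (r / 2) := mem_ball_self (by linarith)
  have hM'0 : (0 : CS m) ∈ M' := hq' ▸ hh hq
  have hk0 : h (κ (gam (mphi Φ) 0)) = 0 := by rw [H.gam0, H.κ0, hq']
  have hkg := H.hasκg h0
  rw [H.hasZ0.fderiv, H.gam0] at hkg
  have key : ∀ ℓ : CS m →L[ℂ] ℂ, ℓ (fderiv ℂ κ 0 (X.1, (X.2 : ℂ))) = 0 := by
    intro ℓ
    obtain ⟨U, G, hU, h0U, hG, hGe, -⟩ := hg.2 ℓ 0 hM'0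
    have hG1 : ContDiffOn ℝ 1 G U := by exact_mod_cast hG
    have hG0 : HasFDerivAt G (fderiv ℝ G 0) (h (κ (gam (mphi Φ) 0))) := by
      rw [hk0]; exact hasFDerivAt_of_C1 hG1 hU h0U
    have a1 : HasFDerivAt (fun p => G (h (κ (gam (mphi Φ) p)))) _ 0 := HasFDerivAt.comp (g := G) 0 hG0 hD
    have a2 : HasFDerivAt (fun p => ℓ (κ (gam (mphi Φ) p))) _ 0 :=
      HasFDerivAt.comp (g := ℓ) 0 (ℓ.hasFDerivAt.restrictScalars ℝ) hkg
    have a3 : (fun p => G (h (κ (gam (mphi Φ) p)))) =ᶠ[𝓝 0] fun p => ℓ (κ (gam (mphi Φ) p)) := by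
      have hUn : U ∈ 𝓝 (h (κ (gam (mphi Φ) 0))) := by rw [hk0]; exact hU.mem_nhds h0U
      filter_upwards [hD.continuousAt hUn, isOpen_ball.mem_nhds h0] with p hp hp2
      have hin := H.gam_in hp2
      rw [hGe _ ⟨hh hin, hp⟩]
      exact congrArg ℓ (hgh _ hin)
    have a4 := DFunLike.congr_fun (a1.unique (a2.congr_of_eventuallyEq a3)) X
    simp only [ContinuousLinearMap.comp_apply, hX, map_zero] at a4
    exact a4.symm
  have hk : fderiv ℂ κ 0 (X.1, (X.2 : ℂ)) = 0 := by
    refine Prod.ext (funext fun i => ?_) ?_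
    · exact key ((ContinuousLinearMap.proj i) ∘L (ContinuousLinearMap.fst ℂ (Fin m → ℂ) ℂ))
    · exact key (ContinuousLinearMap.snd ℂ (Fin m → ℂ) ℂ)
  have hσ : HasFDerivAt σ (fderiv ℂ σ q) (κ 0) := by
    rw [H.κ0]; exact H.σdiff.self_of_nhds.hasFDerivAt
  have b1 : HasFDerivAt (fun p => σ (κ p)) _ 0 :=
    HasFDerivAt.comp (g := σ) 0 hσ (H.κdiff.differentiableAt (ball_mem_nhds _ hr)).hasFDerivAt
  have e : (fun p => σ (κ p)) = id := by ext1 p; exact H.σκ p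
  rw [e] at b1
  have b2 := DFunLike.congr_fun (b1.unique (hasFDerivAt_id 0)) (X.1, (X.2 : ℂ))
  rw [ContinuousLinearMap.comp_apply, hk, map_zero] at b2
  have c1 := congrArg Prod.fst b2
  have c2 := congrArg Prod.snd b2
  refine Prod.ext c1.symm ?_
  have : (X.2 : ℂ) = 0 := c2.symm
  exact_mod_cast this
end

section
variable {m : ℕ} {M M' : Set (CS m)} {q : CS m} {Φ : (Fin m → ℂ) × (Fin m → ℂ) × ℂ → ℂ} {κ σ : CS m → CS m} {r R : ℝ}

theorem IsModel.transport (H : IsModel M q Φ κ σ r) {ε : ℝ} (hε : 0 < ε) {F : CS m → ℂ} (hF : DifferentiableOn ℂ F (ball 0 ε))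
    {g : CS m → ℂ} (hFg : ∀ w u, ‖((w, gZ (mphi Φ) (w, u)) : CS m)‖ < ε →
      F (w, gZ (mphi Φ) (w, u)) = g (κ (gam (mphi Φ) (w, u)))) :
    ∃ G : CS m → ℂ, ∀ᶠ x in 𝓝 q, DifferentiableAt ℂ G x ∧ (x ∈ M → G x = g x) := by
  have hr := H.rpos
  have hσq : σ q = 0 := by rw [← H.κ0, H.σκ]
  have hc : ContinuousAt σ q := H.σdiff.self_of_nhds.continuousAt
  have hb : ∀ᶠ x in 𝓝 q, σ x ∈ ball (0 : CS m) (min ε r) := by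
    refine hc.eventually ?_
    rw [hσq]; exact ball_mem_nhds _ (lt_min hε hr)
  refine ⟨fun x => F (σ x), ?_⟩
  filter_upwards [H.σdiff, hb] with x hx hxb
  have h1 := ball_subset_ball (min_le_left ε r) hxb
  have h2 := ball_subset_ball (min_le_right ε r) hxb
  refine ⟨DifferentiableAt.comp (g := F) x (hF.differentiableAt (isOpen_ball.mem_nhds h1)) hx, fun hxM => ?_⟩
  have h3 := (H.mem _ h2).1 (by rw [H.κσ]; exact hxM)
  have h4 : σ x = ((σ x).1, gZ (mphi Φ) ((σ x).1, (σ x).2.re)) := by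
    refine Prod.ext rfl (Complex.ext ?_ ?_)
    · simp only [gZ_re]
    · simp only [gZ_im, mphi]; exact h3
  have h5 := hFg (σ x).1 (σ x).2.re (by rw [← h4]; exact mem_ball_zero_iff.1 h1)
  have h6 : gam (mphi Φ) ((σ x).1, (σ x).2.re) = σ x := h4.symm
  rw [h6, H.κσ, ← h4] at h5
  exact h5

theorem norm_prL_le {χ : ℕ} (hχ : χ ≤ m) (t : CS m) : ‖prL hχ t‖ ≤ ‖t‖ := by
  rw [prL_apply, Prod.norm_def]
  refine max_le ?_ (norm_snd_le t)
  exact (pi_norm_le_iff_of_nonneg (norm_nonneg _)).2 fun i => (norm_le_pi_norm t.1 _).trans (norm_fst_le t)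

theorem prL_embedCS {χ : ℕ} (hχ : χ ≤ m) (t : CS χ) : prL hχ (embedCS m χ t) = t := by
  rw [prL_apply]
  refine Prod.ext (funext fun i => ?_) rfl
  simp [embedCS]

theorem indexList_zero : indexList (fun _ : Fin m => 0) = [] := by
  simp [indexList]

/-- injectivity needed for the implicit function theorem -/
theorem segre_inj {d : DefData m} (hd : d.IsDefiningSeriesOf M') {χ : ℕ} (hχ : χ ≤ m)
    (hnf : NormalFormSeries χ d.Θ) {k : ℕ} (hrk : mapRankAt (segreJetMap d.Θ k) 0 = m + 1 + χ)
    (h2 : ∀ y : CS m, fderiv ℂ (TT d.Θ χ) 0 (0, prL hχ y) = 0 →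
      y.2 = (starRingEnd ℂ) (fderiv ℂ (TT d.Θ χ) 0 (conjW y.1, 0))) (t : CS χ)
    (ht : ∀ β : {β : Fin m → Fin (k + 1) // mdeg (fun i => (β i : ℕ)) ≤ k},
      fderiv ℂ (thL (TT d.Θ χ) (indexList fun i => (β.1 i : ℕ))) 0 (0, t) = 0) : t = 0 := by
  have hpr := prL_embedCS hχ t
  set y := embedCS m χ t with hy
  have h0 := ht ⟨fun _ => 0, by simp [mdeg]⟩
  have h1 : fderiv ℂ (TT d.Θ χ) 0 (0, t) = 0 := by
    have e : (indexList fun i : Fin m => (((fun _ => 0 : Fin m → Fin (k + 1)) i : Fin (k+1)) : ℕ)) = [] := by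
      simpa using indexList_zero
    rw [e] at h0
    exact h0
  have h3 := h2 y (by rw [hpr]; exact h1)
  have h4 : prL hχ (y.1, (starRingEnd ℂ) (fderiv ℂ (TT d.Θ χ) 0 (conjW y.1, 0))) = t := by
    rw [← h3]; exact hpr
  have h5 := segre_ker hd hχ hnf hrk (w := y.1) (fun β hβ => by rw [h4]; exact ht ⟨β, hβ⟩)
  have h6 : y.1 = 0 := by
    ext i
    by_cases hi : (i : ℕ) < χ
    · exact h5 i hi
    · simp [hy, embedCS, hi]
  rw [h6, conjW_zero, show ((0 : Fin m → ℂ), (0 : CS χ)) = 0 from rfl, map_zero, map_zero] at h3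
  have h7 : y = 0 := Prod.ext h6 h3
  rw [← hpr, h7, map_zero]

theorem det_ne_of_inj (D : (Fin m → ℂ) × ℝ →L[ℝ] CS m) (hI : ∀ v, D (I • v, 0) = I • D (v, 0))
    (hinj : ∀ v, (D (v, 0)).1 = 0 → v = 0) :
    (Matrix.of fun j i : Fin m => (starRingEnd ℂ) ((D (Pi.single j 1, 0)).1 i)).det ≠ 0 := by
  intro h0
  obtain ⟨v, hv, hv0⟩ := Matrix.exists_vecMul_eq_zero_iff.2 h0
  have hsm : ∀ (c : ℂ) (w : Fin m → ℂ), D (c • w, 0) = c • D (w, 0) := by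
    intro c w
    have e : ((c • w, 0) : (Fin m → ℂ) × ℝ) = c.re • (w, 0) + c.im • (I • w, 0) := by
      refine Prod.ext ?_ (by simp)
      ext i
      have := Complex.re_add_im c
      simp only [Prod.fst_add, Prod.smul_fst, Pi.add_apply, Pi.smul_apply, smul_eq_mul, Complex.real_smul]
      conv_lhs => rw [← this]
      ring
    rw [e, map_add, map_smul, map_smul, hI]
    refine Prod.ext (funext fun i => ?_) ?_
    · have := Complex.re_add_im c
      simp only [Prod.fst_add, Prod.smul_fst, Pi.add_apply, Pi.smul_apply, smul_eq_mul, Complex.real_smul]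
      conv_rhs => rw [← this]
      ring
    · have := Complex.re_add_im c
      simp only [Prod.snd_add, Prod.smul_snd, smul_eq_mul, Complex.real_smul]
      conv_rhs => rw [← this]
      ring
  have hs : conjW v = 0 := by
    refine hinj _ ?_
    have e : ((conjW v, 0) : (Fin m → ℂ) × ℝ) = ∑ j, ((conjW v j • (Pi.single j 1 : Fin m → ℂ), 0) : (Fin m → ℂ) × ℝ) := by
      refine Prod.ext ?_ ?_
      · rw [Prod.fst_sum]
        ext i; simp [Finset.sum_apply, Pi.single_apply]
      · rw [Prod.snd_sum]; simp
    rw [e, map_sum, Prod.fst_sum]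
    ext i
    rw [Finset.sum_apply]
    have h1 := congrArg (starRingEnd ℂ) (congrFun hv0 i)
    simp only [Matrix.vecMul, dotProduct, Matrix.of_apply, map_sum, map_mul, Complex.conj_conj, Pi.zero_apply, map_zero] at h1
    simp only [hsm, Prod.smul_fst, Pi.smul_apply, smul_eq_mul, conjW_apply]
    exact h1
  exact hv (by rw [← conjW_conjW v, hs, conjW_zero])
end

section P7
variable {m : ℕ} {M M' : Set (CS m)} {q : CS m} {Φ : (Fin m → ℂ) × (Fin m → ℂ) × ℂ → ℂ} {κ σ : CS m → CS m} {r : ℝ}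

theorem rel_at0 {χ : ℕ} (P : CS m →L[ℂ] CS χ) {T : (Fin m → ℂ) × CS χ → ℂ} (hT : DifferentiableAt ℂ T 0)
    {k : (Fin m → ℂ) × ℝ → CS m} {D : (Fin m → ℂ) × ℝ →L[ℝ] CS m} (hD : HasFDerivAt k D 0) (hk0 : k 0 = 0)
    (heq : ∀ᶠ p in 𝓝 (0 : (Fin m → ℂ) × ℝ), (starRingEnd ℂ) (k p).2 = T (conjW (k p).1, P (k p)))
    (X : (Fin m → ℂ) × ℝ) :
    (starRingEnd ℂ) (D X).2 = fderiv ℂ T 0 (conjW (D X).1, P (D X)) := by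
  let ℓ : CS m →L[ℝ] (Fin m → ℂ) × CS χ :=
    ((cW m).comp (ContinuousLinearMap.fst ℝ (Fin m → ℂ) ℂ)).prod (P.restrictScalars ℝ)
  have hℓ : ∀ y, ℓ y = (conjW y.1, P y) := fun y => by
    show (cW m y.1, P y) = _
    rw [cW_apply]
  let c : CS m →L[ℝ] ℂ := cC.comp (ContinuousLinearMap.snd ℝ (Fin m → ℂ) ℂ)
  have hc : ∀ y, c y = (starRingEnd ℂ) y.2 := fun y => cC_apply y.2
  have e0 : ℓ (k 0) = 0 := by rw [hk0, map_zero]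
  have h1 : HasFDerivAt (fun p => ℓ (k p)) (ℓ.comp D) 0 := ℓ.hasFDerivAt.comp 0 hD
  have h2 : HasFDerivAt T ((fderiv ℂ T 0).restrictScalars ℝ) (ℓ (k 0)) := by
    rw [e0]; exact hT.hasFDerivAt.restrictScalars ℝ
  have h3 := HasFDerivAt.comp (g := T) (0 : (Fin m → ℂ) × ℝ) h2 h1
  have h4 : HasFDerivAt (fun p => c (k p)) (c.comp D) 0 := c.hasFDerivAt.comp 0 hD
  have h5 := h3.congr_of_eventuallyEq (f₁ := fun p => c (k p)) (by
    filter_upwards [heq] with p hp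
    show c (k p) = T (ℓ (k p))
    rw [hc, hℓ, hp])
  have h6 := congrArg (fun A => A X) (h4.unique h5)
  have h7 : c (D X) = fderiv ℂ T 0 (ℓ (D X)) := h6
  rw [hc, hℓ] at h7
  exact h7

theorem smul_I_of_half {E : Type*} [AddCommGroup E] [Module ℂ E] {a b : E}
    (h : (2⁻¹ : ℂ) • (a + I • b) = 0) : b = I • a := by
  have h1 : a + I • b = 0 := by
    rcases smul_eq_zero.1 h with h | h
    · norm_num at h
    · exact h
  have h2 : I • (a + I • b) = 0 := by rw [h1, smul_zero]
  rw [smul_add, smul_smul, I_mul_I, neg_smul, one_smul, add_neg_eq_zero] at h2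
  exact h2.symm

theorem IsModel.main (H : IsModel M q Φ κ σ r) (hDi : HasDiscs Φ)
    (h : CS m → CS m) (hdiffeo : IsCRDiffeoOn (1 : ℕ∞) M M' h)
    (hq : q ∈ M) (hq' : h q = 0)
    (d : DefData m) (hd : d.IsDefiningSeriesOf M')
    (χ : ℕ) (hχ : χ ≤ m) (hnf : NormalFormSeries χ d.Θ)
    (k₀ : ℕ) (hrk : mapRankAt (segreJetMap d.Θ k₀) 0 = m + 1 + χ) :
    ∃ R > 0, R ≤ r ∧ (∀ i, IsCRg (mphi Φ) R (fun p => (h (κ (gam (mphi Φ) p))).1 i)) ∧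
      IsCRg (mphi Φ) R (fun p => (h (κ (gam (mphi Φ) p))).2) ∧
      InA (fun p => prL hχ (h (κ (gam (mphi Φ) p)))) := by
  obtain ⟨R₀, hR₀, hR₀r, hc1, hc2⟩ := H.map_cr hq hdiffeo.1
  have hr := H.rpos
  set k : (Fin m → ℂ) × ℝ → CS m := fun p => h (κ (gam (mphi Φ) p)) with hk
  have hk0 : k 0 = 0 := by simp only [hk]; rw [H.gam0, H.κ0, hq']
  have G0 : GraphData (mphi Φ) R₀ := H.graph.mono hR₀ (by linarith)
  obtain ⟨hC0, hL0⟩ := cr_of_comp (k := k) G0 hc1 hc2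
  have hkc : ContinuousAt k 0 := (hasFDerivAt_of_C1 hC0 isOpen_ball (mem_ball_self hR₀)).continuousAt
  have hdr := hd.1
  have hsm : ∀ᶠ p in 𝓝 (0 : (Fin m → ℂ) × ℝ), ‖k p‖ < d.r := by
    have h1 : Tendsto (fun p => ‖k p‖) (𝓝 0) (𝓝 ‖k 0‖) := hkc.norm
    rw [hk0, norm_zero] at h1
    exact h1.eventually (gt_mem_nhds hdr)
  obtain ⟨ε, hε, hεk⟩ := Metric.eventually_nhds_iff_ball.1 hsm
  obtain ⟨R, hR, hRR, hRε⟩ : ∃ R > 0, R ≤ R₀ ∧ R ≤ ε := ⟨min R₀ ε, lt_min hR₀ hε, min_le_left _ _, min_le_right _ _⟩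
  have hRr : R ≤ r := by linarith
  have hkR : ∀ p ∈ ball (0 : (Fin m → ℂ) × ℝ) R, ‖k p‖ < d.r := fun p hp => hεk p (ball_subset_ball hRε hp)
  have hc1' := fun i => (hc1 i).mono hRR
  have hc2' := hc2.mono hRR
  have hsub : ball (0 : (Fin m → ℂ) × ℝ) R ⊆ ball 0 R₀ := ball_subset_ball hRR
  have h0R : (0 : (Fin m → ℂ) × ℝ) ∈ ball (0 : (Fin m → ℂ) × ℝ) R := mem_ball_self hR
  have hC := hC0.mono hsub
  have hkd : ∀ p ∈ ball (0 : (Fin m → ℂ) × ℝ) R, DifferentiableAt ℝ k p := fun p hp =>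
    (hasFDerivAt_of_C1 hC isOpen_ball hp).differentiableAt
  have hkM : ∀ p ∈ ball (0 : (Fin m → ℂ) × ℝ) R, k p ∈ M' := fun p hp =>
    hdiffeo.1.1 (H.gam_in (ball_subset_ball (by linarith) hp))
  have heq : ∀ p ∈ ball (0 : (Fin m → ℂ) × ℝ) R,
      (starRingEnd ℂ) (k p).2 = TT d.Θ χ (conjW (k p).1, prL hχ (k p)) := by
    intro p hp
    rw [← TT_eq hχ hnf]
    exact (hd.2.2.2.2.2 (k p) (mem_ball_zero_iff.2 (hkR p hp))).1 (hkM p hp)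
  have hmem : ∀ p ∈ ball (0 : (Fin m → ℂ) × ℝ) R,
      ((conjW (k p).1, prL hχ (k p)) : (Fin m → ℂ) × CS χ) ∈ ball (0 : (Fin m → ℂ) × CS χ) d.r := by
    intro p hp
    rw [mem_ball_zero_iff, Prod.norm_def]
    refine max_lt ?_ ((norm_prL_le hχ _).trans_lt (hkR p hp))
    show ‖conjW (k p).1‖ < d.r
    rw [norm_conjW]
    exact (norm_fst_le _).trans_lt (hkR p hp)
  have hTd := TT_hol hd χ
  have hT0 : DifferentiableAt ℂ (TT d.Θ χ) 0 := hTd.differentiableAt (ball_mem_nhds _ hdr)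
  obtain ⟨D, hDk⟩ : ∃ D, HasFDerivAt k D 0 := ⟨_, hasFDerivAt_of_C1 hC isOpen_ball h0R⟩
  obtain ⟨g, hg, hgh⟩ := hdiffeo.2.2
  have hinj : ∀ X, D X = 0 → X = 0 := fun X hX => H.D_inj hq hg hdiffeo.1.1 hgh hq' hDk hX
  have hI : ∀ v : Fin m → ℂ, D (I • v, 0) = I • D (v, 0) := by
    intro v
    have h1 := hL0 0 (mem_ball_self hR₀) v
    rw [H.Lb0, hDk.fderiv] at h1
    exact smul_I_of_half h1
  have hrel := fun X => rel_at0 (prL hχ) hT0 hDk hk0 (by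
    filter_upwards [ball_mem_nhds _ hR] with p hp using heq p hp) X
  obtain ⟨hv, hy⟩ := linalg_at0 D hinj hI
    ((fderiv ℂ (TT d.Θ χ) 0).comp (ContinuousLinearMap.inl ℂ (Fin m → ℂ) (CS χ)))
    (((fderiv ℂ (TT d.Θ χ) 0).comp (ContinuousLinearMap.inr ℂ (Fin m → ℂ) (CS χ))).comp (prL hχ)) (by
      intro X
      rw [hrel X]
      simp only [ContinuousLinearMap.comp_apply, ContinuousLinearMap.inl_apply, ContinuousLinearMap.inr_apply]
      rw [← map_add, Prod.mk_add_mk, add_zero, zero_add])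
  have hJ : (Matrix.of fun j i : Fin m =>
      Lb (mphi Φ) (Pi.single j 1) (fun p => (starRingEnd ℂ) ((k p).1 i)) 0).det ≠ 0 := by
    have h1 := det_ne_of_inj D hI hv
    convert h1 using 3
    ext j i
    rw [H.Lb0]
    let c : CS m →L[ℝ] ℂ := cC.comp ((ContinuousLinearMap.proj (R := ℝ) (φ := fun _ : Fin m => ℂ) i).comp
      (ContinuousLinearMap.fst ℝ (Fin m → ℂ) ℂ))
    have hc : ∀ y, c y = (starRingEnd ℂ) (y.1 i) := fun y => cC_apply (y.1 i)
    have h4 : HasFDerivAt (fun p => c (k p)) (c.comp D) 0 := c.hasFDerivAt.comp 0 hDk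
    have h5 : HasFDerivAt (fun p => (starRingEnd ℂ) ((k p).1 i)) (c.comp D) 0 := h4
    have h6 : ∀ X, (c.comp D) X = (starRingEnd ℂ) ((D X).1 i) := fun X => hc (D X)
    rw [h5.fderiv, h6, h6, hI]
    simp only [Prod.smul_fst, Pi.smul_apply, smul_eq_mul, map_mul, conj_I]
    linear_combination (-(1/2 : ℂ) * (starRingEnd ℂ) ((D (Pi.single j 1, 0)).1 i)) * I_sq
  have hPc : ContDiffOn ℝ 1 (fun p => prL hχ (k p)) (ball 0 R) :=
    ((prL hχ).restrictScalars ℝ).contDiff.comp_contDiffOn hC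
  have hPL : ∀ p ∈ ball (0 : (Fin m → ℂ) × ℝ) R, ∀ v : Fin m → ℂ,
      Lb (mphi Φ) v (fun p => prL hχ (k p)) p = 0 := by
    intro p hp v
    have e := Lb_clm (φ := mphi Φ) (v := v) (prL hχ) (hkd p hp)
    rw [e, hL0 p (hsub hp) v, map_zero]
  have hQ := H.reflect hDi hR hRr (hw := fun p => (k p).1) hc1' hPc hPL hc2' hTd hmem heq hJ
  have hinj2 := segre_inj hd hχ hnf hrk hy
  have hA : InA (fun p => conjW (k p).1) :=
    InA.pi (Q := fun i p => (starRingEnd ℂ) ((k p).1 i)) fun i => H.inA_conj hDi hR hRr (hc1' i)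
  refine ⟨R, hR, hRr, hc1', hc2', ?_⟩
  refine ift_inA hdr hTd (fun β : {β : Fin m → Fin (k₀ + 1) // mdeg (fun i => (β i : ℕ)) ≤ k₀} =>
    indexList fun i => (β.1 i : ℕ)) hinj2 hA ?_ ?_ ?_ ?_ (fun β => hQ _)
  · show conjW (k 0).1 = 0
    rw [hk0]; exact conjW_zero
  · show prL hχ (k 0) = 0
    rw [hk0, map_zero]
  · have h1 : ContinuousAt (fun p => cW m (k p).1) 0 := (cW m).continuous.continuousAt.comp hkc.fst
    simpa only [cW_apply] using h1
  · exact (prL hχ).continuous.continuousAt.comp hkc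

theorem common_nhd {ι : Type*} [Finite ι] {g : ι → CS m → ℂ}
    (hG : ∀ i, ∃ G : CS m → ℂ, ∀ᶠ x in 𝓝 q, DifferentiableAt ℂ G x ∧ (x ∈ M → G x = g i x)) :
    ∃ U : Set (CS m), IsOpen U ∧ q ∈ U ∧ ∀ i, ∃ G : CS m → ℂ, DifferentiableOn ℂ G U ∧ ∀ z ∈ M ∩ U, G z = g i z := by
  choose G hG using hG
  obtain ⟨U, hU, hUo, hqU⟩ := _root_.eventually_nhds_iff.1 (eventually_all.2 hG)
  exact ⟨U, hUo, hqU, fun i => ⟨G i, fun x hx => (hU x hx i).1.differentiableWithinAt,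
    fun z hz => (hU z hz.2 i).2 hz.1⟩⟩

theorem final_statement
    (m : ℕ) (M M' : Set (CS m))
    (hM : IsRealAnalyticHypersurface M)
    (h : CS m → CS m) (hdiffeo : IsCRDiffeoOn (1 : ℕ∞) M M' h)
    (q : CS m) (hq : q ∈ M) (hq' : h q = 0)
    (hmin : MinimalAt M q)
    (d : DefData m) (hd : d.IsDefiningSeriesOf M')
    (χ : ℕ) (hχ : χ ≤ m)
    (hnf : NormalFormSeries χ d.Θ)
    (k₀ : ℕ) (hrk : mapRankAt (segreJetMap d.Θ k₀) 0 = m + 1 + χ) :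
    ∃ U : Set (CS m), IsOpen U ∧ q ∈ U ∧
      (∀ i : Fin m, (i : ℕ) < χ → ∃ g : CS m → ℂ,
        DifferentiableOn ℂ g U ∧ ∀ z ∈ M ∩ U, g z = (h z).1 i) ∧
      ∃ f : CS m → ℂ, DifferentiableOn ℂ f U ∧ ∀ z ∈ M ∩ U, f z = (h z).2 := by
  obtain ⟨Φ, κ, σ, r, H, hDi⟩ := exists_model_discs hM hq hmin
  obtain ⟨R, hR, hRr, hc1, hc2, hA⟩ := H.main hDi h hdiffeo hq hq' d hd χ hχ hnf k₀ hrk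
  have key : ∀ g : CS m → ℂ, IsCRg (mphi Φ) R (fun p => g (κ (gam (mphi Φ) p))) →
      InA (fun p => g (κ (gam (mphi Φ) p))) →
      ∃ G : CS m → ℂ, ∀ᶠ x in 𝓝 q, DifferentiableAt ℂ G x ∧ (x ∈ M → G x = g x) := by
    intro g h1 h2
    obtain ⟨ε, hε, F, hF, hFg⟩ := H.two_sided hDi hR hRr h1 h2
    exact H.transport hε hF hFg
  have hz := key (fun x => (h x).2) hc2 (by
    have := hA.clm (ContinuousLinearMap.snd ℂ (Fin χ → ℂ) ℂ)
    simp only [prL_apply] at this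
    exact this)
  have hw : ∀ i : Fin χ, _ := fun i => key (fun x => (h x).1 (Fin.castLE hχ i)) (hc1 _) (by
    have := hA.clm ((ContinuousLinearMap.proj (R := ℂ) (φ := fun _ : Fin χ => ℂ) i).comp
      (ContinuousLinearMap.fst ℂ (Fin χ → ℂ) ℂ))
    simp only [prL_apply] at this
    exact this)
  obtain ⟨U, hU, hqU, hUi⟩ := common_nhd (M := M) (q := q) (ι := Option (Fin χ))
    (g := fun o => o.elim (fun x => (h x).2) (fun i x => (h x).1 (Fin.castLE hχ i))) (by
      rintro (_ | i)
      · exact hz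
      · exact hw i)
  exact ⟨U, hU, hqU, fun i hi => hUi (some ⟨i, hi⟩), hUi none⟩
end P7

/-!
STATEMENT 8 (Lemma 3.3). Let `h : (M, q) → (M', q')` be a `C¹`-smooth CR
diffeomorphism between real analytic hypersurfaces in `ℂⁿ` (`n = m+1 ≥ 2`),
with `M` minimal in the sense of Tumanov at `q`; suppose the morphism of
`k`-jets of Segre varieties of `M'` is of locally constant maximal rank
`n + χ` near `(q', q̄') = (0, 0̄)`, and that coordinates
`(w', v', z') ∈ ℂ^χ × ℂ^κ × ℂ` (`κ = m - χ`) vanishing at `q'` have been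
chosen in which the defining series `d` of `M'` is of the normal form
`z̄' = Θ'(w̄', w', z')`, independent of `(v', v̄')`.  Split `h = (g, l, f)`
accordingly, `h̲ = (g, f)`.  Then the components of `h̲ = (g, f)` (that is,
the first `χ` components `(h ·).1 i`, `i < χ`, and the last component
`(h ·).2`) extend holomorphically at `q`.
-/
theorem partial_components_extend_holomorphically
    (m : ℕ) (hm : 1 ≤ m) (M M' : Set (CS m))
    (hM : IsRealAnalyticHypersurface M) (hM' : IsRealAnalyticHypersurface M')
    (h : CS m → CS m) (hdiffeo : IsCRDiffeoOn (1 : ℕ∞) M M' h)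
    (q : CS m) (hq : q ∈ M) (hq' : h q = 0)
    (hmin : MinimalAt M q)
    (d : DefData m) (hd : d.IsDefiningSeriesOf M')
    (χ : ℕ) (hχ : χ ≤ m)
    (hnf : NormalFormSeries χ d.Θ)
    (k₀ : ℕ) (hgen : ∀ k ≥ k₀, SegreGenericRank d.Θ d.r k (m + 1 + χ))
    (hconst : ∀ k ≥ k₀, SegreConstRankNear d.Θ k (m + 1 + χ) (0 : CS m)) :
    ∃ U : Set (CS m), IsOpen U ∧ q ∈ U ∧
      (∀ i : Fin m, (i : ℕ) < χ → ∃ g : CS m → ℂ,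
        DifferentiableOn ℂ g U ∧ ∀ z ∈ M ∩ U, g z = (h z).1 i) ∧
      ∃ f : CS m → ℂ, DifferentiableOn ℂ f U ∧ ∀ z ∈ M ∩ U, f z = (h z).2 := by
  have hrk : mapRankAt (segreJetMap d.Θ k₀) 0 = m + 1 + χ := by
    have h1 := (hconst k₀ le_rfl).self_of_nhds
    have e : ((0 : CS m), conjW (0 : CS m).1) = 0 := by
      rw [Prod.fst_zero, conjW_zero]; rfl
    rw [e] at h1
    exact h1
  exact final_statement m M M' hM h hdiffeo q hq hq' hmin d hd χ hχ hnf k₀ hrk
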